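/- For every ε > 0 there exist positive constants c₁ and C₂(ε) such that for all sufficiently large real x: c₁ x ≤ Σ_{n ≤ x} r₃(n)² ≤ C₂(ε) x^{7/6} (log x)^{ε − 5/2}. -/

import Mathlib

open Classical Finset

/-- `r₃(n) = #{(l₁,l₂,l₃) ∈ ℕ³, l_i ≥ 1 : l₁³ + l₂³ + l₃³ = n}`. -/
noncomputable def rthree (n : ℕ) : ℕ :=
  Nat.card {t : ℕ × ℕ × ℕ //
    1 ≤ t.1 ∧ 1 ≤ t.2.1 ∧ 1 ≤ t.2.2 ∧ t.1 ^ 3 + t.2.1 ^ 3 + t.2.2 ^ 3 = n}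

namespace ThreeCubes

/-- The additive character `t ↦ exp (2 π i t)`. -/
noncomputable def ee (t : ℝ) : ℂ := Complex.exp ((2 * Real.pi * t : ℝ) * Complex.I)

lemma ee_add (s t : ℝ) : ee (s + t) = ee s * ee t := by
  unfold ee
  rw [← Complex.exp_add]
  congr 1
  push_cast
  ring

lemma norm_ee (t : ℝ) : ‖ee t‖ = 1 := by
  unfold ee
  exact Complex.norm_exp_ofReal_mul_I _

lemma ee_int (n : ℤ) : ee n = 1 := by
  unfold ee
  rw [Complex.exp_eq_one_iff]
  exact ⟨n, by push_cast; ring⟩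

lemma conj_ee (t : ℝ) : (starRingEnd ℂ) (ee t) = ee (-t) := by
  unfold ee
  rw [← Complex.exp_conj]
  congr 1
  rw [map_mul, Complex.conj_I, Complex.conj_ofReal]
  push_cast
  ring

lemma ee_add_int (t : ℝ) (n : ℤ) : ee (t + n) = ee t := by
  rw [ee_add, ee_int, mul_one]

lemma ee_nat_mul (n : ℕ) (t : ℝ) : ee (n * t) = ee t ^ n := by
  unfold ee
  rw [← Complex.exp_nat_mul]
  congr 1
  push_cast
  ring

lemma ee_eq_one_iff (t : ℝ) : ee t = 1 ↔ ∃ n : ℤ, t = n := by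
  constructor
  · intro h
    unfold ee at h
    rw [Complex.exp_eq_one_iff] at h
    obtain ⟨n, hn⟩ := h
    refine ⟨n, ?_⟩
    have hpi : (2 * Real.pi * Complex.I : ℂ) ≠ 0 := by
      simp [Real.pi_ne_zero]
    have h2 : (t : ℂ) * (2 * Real.pi * Complex.I) = n * (2 * Real.pi * Complex.I) := by
      rw [← hn]; push_cast; ring
    have h3 := mul_right_cancel₀ hpi h2
    exact_mod_cast h3
  · rintro ⟨n, rfl⟩
    exact ee_int n

/-- Orthogonality of additive characters modulo `N`. -/
lemma sum_ee_range (N : ℕ) (hN : 0 < N) (n : ℤ) :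
    ∑ b ∈ range N, ee ((b : ℝ) / N * n) = if (N : ℤ) ∣ n then (N : ℂ) else 0 := by
  have hN' : (N : ℝ) ≠ 0 := by positivity
  have h1 : ∀ b ∈ range N, ee ((b : ℝ) / N * n) = ee ((n : ℝ) / N) ^ b := by
    intro b _
    rw [← ee_nat_mul]
    congr 1
    ring
  rw [sum_congr rfl h1]
  split_ifs with h
  · obtain ⟨k, rfl⟩ := h
    have : ee (((N * k : ℤ) : ℝ) / N) = 1 := by
      rw [ee_eq_one_iff]
      exact ⟨k, by push_cast; field_simp⟩
    rw [this]
    simp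
  · have hne : ee ((n : ℝ) / N) ≠ 1 := by
      intro hh
      rw [ee_eq_one_iff] at hh
      obtain ⟨k, hk⟩ := hh
      apply h
      refine ⟨k, ?_⟩
      rw [div_eq_iff hN'] at hk
      have : (n : ℝ) = ((N * k : ℤ) : ℝ) := by rw [hk]; push_cast; ring
      exact_mod_cast this
    rw [geom_sum_eq hne, ← ee_nat_mul]
    have : ee ((N : ℝ) * ((n : ℝ) / N)) = 1 := by
      rw [ee_eq_one_iff]
      exact ⟨n, by field_simp⟩
    rw [this]
    simp

/-- The weighted exponential sum `∑ c(s) e(t φ(s))`. -/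
noncomputable def esum {ι : Type*} (S : Finset ι) (c : ι → ℝ) (φ : ι → ℤ) (t : ℝ) : ℂ :=
  ∑ s ∈ S, (c s : ℂ) * ee (t * φ s)

lemma esum_mul {ι κ : Type*} (S : Finset ι) (T : Finset κ) (c : ι → ℝ) (d : κ → ℝ)
    (φ : ι → ℤ) (ψ : κ → ℤ) (t : ℝ) :
    esum S c φ t * esum T d ψ t =
      esum (S ×ˢ T) (fun x => c x.1 * d x.2) (fun x => φ x.1 + ψ x.2) t := by
  unfold esum
  rw [Finset.sum_mul_sum, ← Finset.sum_product']
  refine sum_congr rfl fun x _ => ?_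
  have : t * ((φ x.1 + ψ x.2 : ℤ) : ℝ) = t * φ x.1 + t * ψ x.2 := by push_cast; ring
  rw [this, ee_add]
  push_cast
  ring

lemma esum_conj {ι : Type*} (S : Finset ι) (c : ι → ℝ) (φ : ι → ℤ) (t : ℝ) :
    (starRingEnd ℂ) (esum S c φ t) = esum S c (fun s => -φ s) t := by
  unfold esum
  rw [map_sum]
  refine sum_congr rfl fun x _ => ?_
  rw [map_mul, conj_ee, Complex.conj_ofReal]
  congr 2
  push_cast
  ring

lemma sum_esum_range {ι : Type*} (S : Finset ι) (c : ι → ℝ) (φ : ι → ℤ) (N : ℕ) (hN : 0 < N) :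
    ∑ b ∈ range N, esum S c φ ((b : ℝ) / N) =
      ((N * ∑ s ∈ S with (N : ℤ) ∣ φ s, c s : ℝ) : ℂ) := by
  unfold esum
  rw [sum_comm]
  simp_rw [← mul_sum, sum_ee_range N hN]
  rw [sum_filter]
  push_cast
  rw [mul_sum]
  refine sum_congr rfl fun x _ => ?_
  split_ifs <;> simp [mul_comm]

lemma norm_esum_sq {ι : Type*} (S : Finset ι) (c : ι → ℝ) (φ : ι → ℤ) (t : ℝ) :
    ((‖esum S c φ t‖ ^ 2 : ℝ) : ℂ) =
      esum (S ×ˢ S) (fun x => c x.1 * c x.2) (fun x => φ x.1 - φ x.2) t := by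
  have h := esum_mul S S c c φ (fun s => -φ s) t
  rw [← esum_conj, Complex.mul_conj, Complex.normSq_eq_norm_sq] at h
  simpa [sub_eq_add_neg] using h

/-- Parseval: the mean of `|esum|²` over fractions with denominator `N`. -/
lemma sum_norm_esum_sq {ι : Type*} (S : Finset ι) (c : ι → ℝ) (φ : ι → ℤ) (N : ℕ) (hN : 0 < N) :
    ∑ b ∈ range N, ‖esum S c φ ((b : ℝ) / N)‖ ^ 2 =
      N * ∑ x ∈ S ×ˢ S with (N : ℤ) ∣ φ x.1 - φ x.2, c x.1 * c x.2 := by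
  have h := sum_esum_range (S ×ˢ S) (fun x => c x.1 * c x.2) (fun x => φ x.1 - φ x.2) N hN
  simp_rw [← norm_esum_sq] at h
  exact_mod_cast h

lemma sum_le_sum_of_injOn {ι κ : Type*} {s : Finset ι} {t : Finset κ} {f : ι → ℝ} {g : κ → ℝ}
    (i : ι → κ) (hg : ∀ x ∈ t, 0 ≤ g x) (hi : ∀ x ∈ s, i x ∈ t) (hinj : Set.InjOn i s)
    (hfg : ∀ x ∈ s, f x ≤ g (i x)) : ∑ x ∈ s, f x ≤ ∑ y ∈ t, g y := by
  calc ∑ x ∈ s, f x ≤ ∑ x ∈ s, g (i x) := sum_le_sum hfg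
    _ = ∑ y ∈ s.image i, g y := (sum_image hinj).symm
    _ ≤ ∑ y ∈ t, g y := sum_le_sum_of_subset_of_nonneg
        (image_subset_iff.mpr hi) fun y hy _ => hg y hy

/-- The number of divisors. -/
def tau (n : ℕ) : ℕ := n.divisors.card

/-- The product of the distinct prime factors. -/
def rad (n : ℕ) : ℕ := ∏ p ∈ n.primeFactors, p

lemma tau_pos {n : ℕ} (hn : n ≠ 0) : 1 ≤ tau n :=
  Finset.card_pos.mpr ⟨1, by simp [hn]⟩

lemma tau_mul_le (m n : ℕ) : tau (m * n) ≤ tau m * tau n := by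
  unfold tau
  rw [Nat.divisors_mul]
  exact Finset.card_mul_le

lemma tau_le_of_dvd {m n : ℕ} (h : m ∣ n) (hn : n ≠ 0) : tau m ≤ tau n :=
  Finset.card_le_card (Nat.divisors_subset_of_dvd hn h)

lemma tau_eq_prod {n : ℕ} (hn : n ≠ 0) :
    tau n = ∏ p ∈ n.primeFactors, (n.factorization p + 1) := Nat.card_divisors hn

lemma two_pow_card_primeFactors_le_tau {n : ℕ} (hn : n ≠ 0) :
    2 ^ n.primeFactors.card ≤ tau n := by
  rw [tau_eq_prod hn, ← prod_const]
  refine prod_le_prod' fun p hp => ?_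
  have := (Nat.prime_of_mem_primeFactors hp).factorization_pos_of_dvd hn
    (Nat.dvd_of_mem_primeFactors hp)
  omega

lemma rad_dvd (n : ℕ) : rad n ∣ n := Nat.prod_primeFactors_dvd n

lemma rad_pos (n : ℕ) : 0 < rad n :=
  prod_pos fun _ hp => (Nat.prime_of_mem_primeFactors hp).pos

lemma tau_le_rpow (η : ℝ) (hη : 0 < η) :
    ∃ C : ℝ, 1 ≤ C ∧ ∀ n : ℕ, n ≠ 0 → (tau n : ℝ) ≤ C * (n : ℝ) ^ η := by
  -- large primes satisfy `2 ≤ p ^ η`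
  obtain ⟨P, hP⟩ : ∃ P : ℕ, (2 : ℝ) ^ (1 / η) ≤ P := exists_nat_ge _
  -- `k + 1 ≤ A * 2 ^ (η k)`
  have hA : ∃ A : ℝ, 1 ≤ A ∧ ∀ k : ℕ, (k : ℝ) + 1 ≤ A * ((2 : ℝ) ^ η) ^ k := by
    set t : ℝ := (2 : ℝ) ^ η - 1 with ht
    have ht0 : 0 < t := by
      have := Real.one_lt_rpow (by norm_num : (1 : ℝ) < 2) hη
      linarith
    refine ⟨1 + 1 / t, by have : 0 < 1 / t := by positivity
                          linarith, fun k => ?_⟩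
    have h1 : 1 + (k : ℝ) * t ≤ (1 + t) ^ k := by
      have := one_add_mul_le_pow (a := t) (by linarith) k
      simpa using this
    have h2 : (2 : ℝ) ^ η = 1 + t := by rw [ht]; ring
    rw [h2]
    calc (k : ℝ) + 1 ≤ (1 + 1 / t) * (1 + k * t) := by
          have h3 : (1 + 1 / t) * (1 + k * t) = k + 1 + (k * t + 1 / t) := by
            field_simp; ring
          rw [h3]
          have : 0 < 1 / t := by positivity
          have : 0 ≤ (k : ℝ) * t := by positivity
          linarith
      _ ≤ _ := by
          apply mul_le_mul_of_nonneg_left h1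
          positivity
  obtain ⟨A, hA1, hA⟩ := hA
  refine ⟨A ^ P, one_le_pow₀ hA1, fun n hn => ?_⟩
  have hn' : (n : ℝ) ^ η = ∏ p ∈ n.primeFactors, ((p : ℝ) ^ η) ^ n.factorization p := by
    conv_lhs => rw [← Nat.prod_factorization_pow_eq_self hn]
    rw [Finsupp.prod, Nat.support_factorization]
    push_cast
    rw [← Real.finsetProd_rpow _ _ (fun i _ => by positivity)]
    refine prod_congr rfl fun p _ => ?_
    rw [← Real.rpow_natCast, ← Real.rpow_mul (by positivity), mul_comm,
      Real.rpow_mul (by positivity), Real.rpow_natCast]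
  rw [tau_eq_prod hn, hn']
  push_cast
  have key : ∀ p ∈ n.primeFactors, ((n.factorization p : ℝ) + 1) ≤
      (if p < P then A else 1) * ((p : ℝ) ^ η) ^ n.factorization p := by
    intro p hp
    have hp2 : (2 : ℝ) ≤ p := by exact_mod_cast (Nat.prime_of_mem_primeFactors hp).two_le
    split_ifs with h
    · refine (hA _).trans ?_
      gcongr
    · push Not at h
      rw [one_mul]
      have h2 : (2 : ℝ) ≤ (p : ℝ) ^ η := by
        have : (2 : ℝ) = ((2 : ℝ) ^ (1 / η)) ^ η := by
          rw [← Real.rpow_mul (by norm_num)]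
          field_simp
          simp
        rw [this]
        apply Real.rpow_le_rpow (by positivity) _ hη.le
        exact hP.trans (by exact_mod_cast h)
      calc ((n.factorization p : ℝ) + 1) ≤ 2 ^ n.factorization p := by
            exact_mod_cast Nat.lt_two_pow_self
        _ ≤ _ := by gcongr
  refine (prod_le_prod (fun i _ => by positivity) key).trans ?_
  rw [prod_mul_distrib]
  gcongr
  rw [← prod_filter, prod_const]
  refine pow_le_pow_right₀ hA1 ?_
  calc _ ≤ (range P).card := card_le_card fun p hp => by
        simp only [mem_filter] at hp; simpa using hp.2
    _ = P := card_range P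

lemma sum_gcd_le (d M : ℕ) (hd : d ≠ 0) :
    ∑ h ∈ Icc 1 M, Nat.gcd d h ≤ M * tau d := by
  calc ∑ h ∈ Icc 1 M, Nat.gcd d h ≤ ∑ h ∈ Icc 1 M, ∑ e ∈ d.divisors, if e ∣ h then e else 0 := by
        refine sum_le_sum fun h _ => ?_
        have := single_le_sum (f := fun e => if e ∣ h then e else 0) (fun _ _ => Nat.zero_le _)
          (Nat.mem_divisors.mpr ⟨Nat.gcd_dvd_left d h, hd⟩)
        simpa [Nat.gcd_dvd_right] using this
    _ = ∑ e ∈ d.divisors, ∑ h ∈ Icc 1 M, if e ∣ h then e else 0 := sum_comm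
    _ ≤ ∑ e ∈ d.divisors, M := by
        refine sum_le_sum fun e _ => ?_
        rw [← sum_filter, sum_const, smul_eq_mul]
        have : ((Icc 1 M).filter (e ∣ ·)).card = M / e := by
          rw [← Nat.Ioc_filter_dvd_card_eq_div]; rfl
        rw [this]
        exact Nat.div_mul_le_self M e
    _ = M * tau d := by simp [tau, mul_comm]

lemma card_filter_dvd (M e : ℕ) : ((Icc 1 M).filter (e ∣ ·)).card = M / e := by
  rw [← Nat.Ioc_filter_dvd_card_eq_div]; rfl

lemma sum_inv_le_one_add_log (N : ℕ) : ∑ n ∈ Icc 1 N, (1 / (n : ℝ)) ≤ 1 + Real.log N := by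
  have := harmonic_le_one_add_log N
  rw [harmonic_eq_sum_Icc] at this
  push_cast at this
  simpa using this

/-- The primes up to `N`. -/
def primesUpTo (N : ℕ) : Finset ℕ := (Icc 1 N).filter Nat.Prime

lemma mem_primesUpTo {N p : ℕ} : p ∈ primesUpTo N ↔ p.Prime ∧ p ≤ N := by
  unfold primesUpTo
  simp only [mem_filter, mem_Icc]
  exact ⟨fun h => ⟨h.2, h.1.2⟩, fun h => ⟨⟨h.1.one_lt.le, h.2⟩, h.1⟩⟩

lemma primesUpTo_mono {M N : ℕ} (h : M ≤ N) : primesUpTo M ⊆ primesUpTo N := fun p hp => by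
  rw [mem_primesUpTo] at hp ⊢
  exact ⟨hp.1, hp.2.trans h⟩

lemma sum_log_primes_le (N : ℕ) : ∑ p ∈ primesUpTo N, Real.log p ≤ Real.log 4 * N := by
  have h := Chebyshev.theta_le_log4_mul_x (x := N) (by positivity)
  rw [Chebyshev.theta_eq_sum_Icc, Nat.floor_natCast] at h
  refine le_of_eq_of_le (sum_congr ?_ fun _ _ => rfl) h
  ext p
  simp only [mem_primesUpTo, mem_filter, mem_Icc]
  exact ⟨fun h => ⟨⟨Nat.zero_le _, h.2⟩, h.1⟩, fun h => ⟨h.2, h.1.2⟩⟩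

lemma log_four_le : Real.log 4 ≤ 1.4 := by
  have : (4 : ℝ) = 2 ^ 2 := by norm_num
  rw [this, Real.log_pow]
  have := Real.log_two_lt_d9
  push_cast
  linarith

lemma sum_block_log_div_le (k : ℕ) :
    ∑ p ∈ primesUpTo (2 ^ (k + 1)) \ primesUpTo (2 ^ k), Real.log p / p ≤ 2.8 := by
  calc ∑ p ∈ primesUpTo (2 ^ (k + 1)) \ primesUpTo (2 ^ k), Real.log p / p
      ≤ ∑ p ∈ primesUpTo (2 ^ (k + 1)) \ primesUpTo (2 ^ k), Real.log p / 2 ^ k := by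
        refine sum_le_sum fun p hp => ?_
        simp only [mem_sdiff, mem_primesUpTo, not_and, not_le] at hp
        have : (2 : ℝ) ^ k ≤ p := by exact_mod_cast (hp.2 hp.1.1).le
        have h0 : 0 ≤ Real.log p := Real.log_natCast_nonneg p
        gcongr
    _ ≤ ∑ p ∈ primesUpTo (2 ^ (k + 1)), Real.log p / 2 ^ k := by
        refine sum_le_sum_of_subset_of_nonneg sdiff_subset fun p _ _ => ?_
        have h0 : 0 ≤ Real.log p := Real.log_natCast_nonneg p
        positivity
    _ ≤ (Real.log 4 * (2 ^ (k + 1) : ℕ)) / 2 ^ k := by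
        rw [← sum_div]
        gcongr
        exact sum_log_primes_le _
    _ = 2 * Real.log 4 := by push_cast; rw [pow_succ]; field_simp
    _ ≤ _ := by have := log_four_le; linarith

lemma primesUpTo_zero_pow : primesUpTo (2 ^ 0) = ∅ := by
  ext p
  simp only [mem_primesUpTo, notMem_empty, iff_false, not_and, pow_zero]
  intro h
  have := h.two_le
  omega

lemma sum_log_div_two_pow_le (k : ℕ) :
    ∑ p ∈ primesUpTo (2 ^ k), Real.log p / p ≤ 2.8 * k := by
  induction k with
  | zero => rw [primesUpTo_zero_pow]; simp
  | succ k ih =>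
    rw [← sum_sdiff (primesUpTo_mono (Nat.pow_le_pow_right (by norm_num : 0 < 2) k.le_succ))]
    have := sum_block_log_div_le k
    push_cast
    linarith

lemma clog_le (N : ℕ) (hN : 1 ≤ N) : (Nat.clog 2 N : ℝ) ≤ 1 + 1.5 * Real.log N := by
  rcases Nat.lt_or_ge N 2 with h | h
  · have : N = 1 := by omega
    subst this
    simp
  have h1 : 2 ^ (Nat.clog 2 N - 1) < N := Nat.pow_pred_clog_lt_self (by norm_num) h
  have h2 : ((2 : ℝ) ^ (Nat.clog 2 N - 1)) ≤ N := by exact_mod_cast h1.le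
  have h3 := Real.log_le_log (by positivity) h2
  rw [Real.log_pow] at h3
  have h4 := Real.log_two_gt_d9
  have h5 : 0 < Nat.clog 2 N := Nat.clog_pos (by norm_num) h
  rw [Nat.cast_sub h5] at h3
  push_cast at h3
  have h6 : 0 ≤ (Nat.clog 2 N : ℝ) - 1 := by
    have : (1 : ℝ) ≤ Nat.clog 2 N := by exact_mod_cast h5
    linarith
  nlinarith

/-- An upper bound of Mertens type. -/
lemma sum_log_div_le (N : ℕ) (hN : 1 ≤ N) :
    ∑ p ∈ primesUpTo N, Real.log p / p ≤ 5 * (1 + Real.log N) := by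
  have h1 : ∑ p ∈ primesUpTo N, Real.log p / p ≤
      ∑ p ∈ primesUpTo (2 ^ Nat.clog 2 N), Real.log p / p := by
    refine sum_le_sum_of_subset_of_nonneg
      (primesUpTo_mono (Nat.le_pow_clog (by norm_num) N)) fun p _ _ => ?_
    have h0 : 0 ≤ Real.log p := Real.log_natCast_nonneg p
    positivity
  have h2 := sum_log_div_two_pow_le (Nat.clog 2 N)
  have h3 := clog_le N hN
  have h4 : 0 ≤ Real.log N := Real.log_natCast_nonneg N
  linarith

lemma sum_block_inv_le (k : ℕ) (hk : 1 ≤ k) :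
    ∑ p ∈ primesUpTo (2 ^ (k + 1)) \ primesUpTo (2 ^ k), (1 : ℝ) / p ≤ 5 * (1 / k) := by
  have hk' : (0 : ℝ) < k := by exact_mod_cast hk
  have hl := Real.log_two_gt_d9
  calc ∑ p ∈ primesUpTo (2 ^ (k + 1)) \ primesUpTo (2 ^ k), (1 : ℝ) / p
      ≤ ∑ p ∈ primesUpTo (2 ^ (k + 1)) \ primesUpTo (2 ^ k),
          (Real.log p / p) * (1 / (k * Real.log 2)) := by
        refine sum_le_sum fun p hp => ?_
        simp only [mem_sdiff, mem_primesUpTo, not_and, not_le] at hp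
        have h1 : (2 : ℝ) ^ k ≤ p := by exact_mod_cast (hp.2 hp.1.1).le
        have h2 := Real.log_le_log (by positivity) h1
        rw [Real.log_pow] at h2
        have h3 : (0 : ℝ) < p := by exact_mod_cast hp.1.1.pos
        have h4 : 0 < k * Real.log 2 := by positivity
        rw [div_mul_div_comm, div_le_div_iff₀ h3 (by positivity)]
        nlinarith
    _ = (∑ p ∈ primesUpTo (2 ^ (k + 1)) \ primesUpTo (2 ^ k), Real.log p / p) *
          (1 / (k * Real.log 2)) := by rw [sum_mul]
    _ ≤ 2.8 * (1 / (k * Real.log 2)) := by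
        have := sum_block_log_div_le k
        gcongr
    _ ≤ 5 * (1 / k) := by
        rw [mul_one_div, mul_one_div, div_le_div_iff₀ (by positivity) hk']
        nlinarith

lemma sum_inv_two_pow_le (k : ℕ) :
    ∑ p ∈ primesUpTo (2 ^ (k + 1)), (1 : ℝ) / p ≤ 3 + 5 * ∑ j ∈ Icc 1 k, (1 / (j : ℝ)) := by
  induction k with
  | zero =>
    have : primesUpTo (2 ^ (0 + 1)) = {2} := by
      ext p
      simp only [mem_primesUpTo, mem_singleton]
      constructor
      · rintro ⟨h1, h2⟩
        have := h1.two_le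
        omega
      · rintro rfl
        exact ⟨Nat.prime_two, by norm_num⟩
    rw [this]
    simp
    norm_num
  | succ k ih =>
    rw [← sum_sdiff (primesUpTo_mono (Nat.pow_le_pow_right (by norm_num : 0 < 2)
      (Nat.le_succ (k + 1)))), sum_Icc_succ_top (by omega)]
    have := sum_block_inv_le (k + 1) (by omega)
    linarith

/-- An upper bound for the sum of reciprocals of the primes. -/
lemma sum_inv_primes_le (N : ℕ) (hN : 1 ≤ N) :
    ∑ p ∈ primesUpTo N, (1 : ℝ) / p ≤ 13 + 5 * Real.log (1 + Real.log N) := by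
  have hl : 0 ≤ Real.log N := Real.log_natCast_nonneg N
  have h1 : ∑ p ∈ primesUpTo N, (1 : ℝ) / p ≤
      ∑ p ∈ primesUpTo (2 ^ (Nat.clog 2 N + 1)), (1 : ℝ) / p := by
    refine sum_le_sum_of_subset_of_nonneg
      (primesUpTo_mono ((Nat.le_pow_clog (by norm_num) N).trans
        (Nat.pow_le_pow_right (by norm_num) (Nat.le_succ _)))) fun p _ _ => by positivity
  have h2 := sum_inv_two_pow_le (Nat.clog 2 N)
  have h3 := sum_inv_le_one_add_log (Nat.clog 2 N)
  have h4 : Real.log (Nat.clog 2 N) ≤ 1 + Real.log (1 + Real.log N) := by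
    rcases Nat.eq_zero_or_pos (Nat.clog 2 N) with h | h
    · rw [h]
      have := Real.log_nonneg (by linarith : (1 : ℝ) ≤ 1 + Real.log N)
      simp only [CharP.cast_eq_zero, Real.log_zero]
      linarith
    · have h5 : (Nat.clog 2 N : ℝ) ≤ Real.exp 1 * (1 + Real.log N) := by
        have := clog_le N hN
        have he := Real.exp_one_gt_d9
        nlinarith
      have h6 := Real.log_le_log (by exact_mod_cast h) h5
      rwa [Real.log_mul (by positivity) (by positivity), Real.log_exp] at h6
  linarith

/-- An upper bound for sums of multiplicative functions over smooth numbers. -/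
lemma sum_smooth_le_exp (f : ℕ → ℝ) (hf0 : ∀ n, 0 ≤ f n) (hf1 : f 1 = 1)
    (hmul : ∀ {m n : ℕ}, Nat.Coprime m n → f (m * n) = f m * f n)
    (hsum : ∀ {p : ℕ}, p.Prime → Summable fun k : ℕ => f (p ^ k)) (N : ℕ) (b : ℕ → ℝ)
    (hb : ∀ p ∈ primesUpTo N, ∑' k : ℕ, f (p ^ k) ≤ 1 + b p)
    (S : Finset ℕ) (hS : ∀ n ∈ S, n ≠ 0 ∧ ∀ p ∈ n.primeFactors, p ≤ N) :
    ∑ n ∈ S, f n ≤ Real.exp (∑ p ∈ primesUpTo N, b p) := by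
  have h := EulerProduct.summable_and_hasSum_smoothNumbers_prod_primesBelow_tsum (f := f) hf1 hmul
    (fun hp => by simpa [Real.norm_eq_abs, abs_of_nonneg (hf0 _)] using hsum hp) (N + 1)
  have hpr : (N + 1).primesBelow = primesUpTo N := by
    ext p
    simp only [Nat.mem_primesBelow, mem_primesUpTo, Nat.lt_succ_iff]
    tauto
  rw [hpr] at h
  have hmem : ∀ n ∈ S, n ∈ (N + 1).smoothNumbers := fun n hn => by
    refine ⟨(hS n hn).1, fun p hp => ?_⟩
    have := (hS n hn).2 p (by
      rw [Nat.mem_primeFactorsList (hS n hn).1] at hp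
      exact Nat.mem_primeFactors.mpr ⟨hp.1, hp.2, (hS n hn).1⟩)
    omega
  have h1 : ∑ n ∈ S, f n = ∑ m ∈ S.subtype (· ∈ (N + 1).smoothNumbers),
      f (m : (N + 1).smoothNumbers) := by
    rw [sum_subtype_of_mem (f := f) hmem]
  rw [h1]
  calc _ ≤ ∏ p ∈ primesUpTo N, ∑' k : ℕ, f (p ^ k) := by
        exact sum_le_hasSum _ (fun i _ => hf0 _) h.2
    _ ≤ ∏ p ∈ primesUpTo N, Real.exp (b p) := by
        refine prod_le_prod (fun p _ => tsum_nonneg fun k => hf0 _) fun p hp => ?_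
        refine (hb p hp).trans ?_
        have := Real.add_one_le_exp (b p)
        linarith
    _ = _ := (Real.exp_sum _ _).symm

lemma log_le_prod_primes (N : ℕ) :
    Real.log (N + 1) ≤ ∏ p ∈ primesUpTo N, (1 - (p : ℝ)⁻¹)⁻¹ := by
  have h1 := log_add_one_le_harmonic N
  rw [harmonic_eq_sum_Icc] at h1
  push_cast at h1
  refine h1.trans ?_
  let f : ℕ →* ℝ :=
    { toFun := fun n => (n : ℝ)⁻¹
      map_one' := by simp
      map_mul' := fun a b => by push_cast; rw [mul_inv] }
  have h := EulerProduct.summable_and_hasSum_smoothNumbers_prod_primesBelow_geometric (f := f)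
    (fun {p} hp => by
      have : (1 : ℝ) < p := by exact_mod_cast hp.one_lt
      change ‖(p : ℝ)⁻¹‖ < 1
      rw [Real.norm_eq_abs, abs_of_nonneg (by positivity)]
      exact inv_lt_one_of_one_lt₀ this) (N + 1)
  have hpr : (N + 1).primesBelow = primesUpTo N := by
    ext p
    simp only [Nat.mem_primesBelow, mem_primesUpTo, Nat.lt_succ_iff]
    tauto
  rw [hpr] at h
  have hmem : ∀ n ∈ Icc 1 N, n ∈ (N + 1).smoothNumbers := fun n hn => by
    rw [mem_Icc] at hn
    refine ⟨by omega, fun p hp => ?_⟩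
    rw [Nat.mem_primeFactorsList (by omega)] at hp
    have := Nat.le_of_dvd (by omega) hp.2
    omega
  have h2 : ∑ n ∈ Icc 1 N, (n : ℝ)⁻¹ = ∑ m ∈ (Icc 1 N).subtype (· ∈ (N + 1).smoothNumbers),
      f (m : (N + 1).smoothNumbers) := by
    rw [sum_subtype_of_mem (f := fun n => f n) hmem]
    rfl
  rw [h2]
  exact sum_le_hasSum _ (fun i _ => by change (0 : ℝ) ≤ ((i : ℕ) : ℝ)⁻¹; positivity) h.2

lemma sum_Ico_int_telescope (F : ℤ → ℂ) (a : ℤ) (n : ℕ) :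
    ∑ x ∈ Ico a (a + n), (F (x + 1) - F x) = F (a + n) - F a := by
  induction n with
  | zero => simp
  | succ n ih =>
    have : Ico a (a + ((n + 1 : ℕ) : ℤ)) = insert (a + n) (Ico a (a + n)) := by
      ext x
      simp only [mem_Ico, mem_insert]
      push_cast
      omega
    rw [this, sum_insert (by simp), ih]
    push_cast
    rw [← add_assoc]
    ring

lemma norm_linear_sum_le (β γ : ℝ) (h : ee β ≠ 1) (a b : ℤ) :
    ‖∑ x ∈ Ico a b, ee (β * x + γ)‖ ≤ 2 / ‖ee β - 1‖ := by
  have hpos : 0 < ‖ee β - 1‖ := norm_pos_iff.mpr (sub_ne_zero.mpr h)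
  rcases le_or_gt b a with hab | hab
  · rw [Ico_eq_empty (by omega), sum_empty, norm_zero]
    positivity
  obtain ⟨n, rfl⟩ : ∃ n : ℕ, b = a + n := ⟨(b - a).toNat, by omega⟩
  rw [le_div_iff₀ hpos, ← norm_mul, sum_mul]
  have h1 : ∀ x ∈ Ico a (a + n), ee (β * x + γ) * (ee β - 1) =
      (fun y : ℤ => ee (β * y + γ)) (x + 1) - (fun y : ℤ => ee (β * y + γ)) x := by
    intro x _
    have : β * ((x + 1 : ℤ) : ℝ) + γ = (β * x + γ) + β := by push_cast; ring
    simp only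
    rw [this, ee_add _ β]
    ring
  rw [sum_congr rfl h1, sum_Ico_int_telescope (fun y : ℤ => ee (β * y + γ))]
  refine (norm_sub_le _ _).trans ?_
  simp only [norm_ee]
  norm_num

lemma norm_ee_sub_one (t : ℝ) : ‖ee t - 1‖ = 2 * |Real.sin (Real.pi * t)| := by
  unfold ee
  rw [mul_comm, Complex.norm_exp_I_mul_ofReal_sub_one]
  rw [Real.norm_eq_abs, abs_mul]
  congr 2
  · norm_num
  · congr 1; ring

/-- A bound for the geometric sums with frequency `r / q`. -/
noncomputable def geomBound (M q : ℕ) (r : ZMod q) : ℝ :=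
  if r = 0 then M else (q : ℝ) / 2 * (1 / (r.val : ℝ) + 1 / ((q : ℝ) - r.val))

lemma two_div_norm_ee_le (q r : ℕ) (hr : 0 < r) (hrq : r < q) :
    ee ((r : ℝ) / q) ≠ 1 ∧
    2 / ‖ee ((r : ℝ) / q) - 1‖ ≤ (q : ℝ) / 2 * (1 / (r : ℝ) + 1 / ((q : ℝ) - r)) := by
  have hr0 : (0 : ℝ) < r := by exact_mod_cast hr
  have hrq' : (r : ℝ) < q := by exact_mod_cast hrq
  have hq0 : (0 : ℝ) < q := hr0.trans hrq'
  have key : ∀ s : ℝ, 0 < s → s ≤ q / 2 → 2 / q * s ≤ Real.sin (Real.pi * (s / q)) := by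
    intro s hs hsq
    have h1 : Real.pi * (s / q) ≤ Real.pi / 2 := by
      have : s / q ≤ 1 / 2 := by rw [div_le_div_iff₀ hq0 (by norm_num)]; linarith
      nlinarith [Real.pi_pos]
    have := Real.mul_le_sin (x := Real.pi * (s / q)) (by positivity) h1
    refine le_trans (le_of_eq ?_) this
    field_simp
  have hmain : ∃ s : ℝ, 0 < s ∧ (s = r ∨ s = q - r) ∧ 4 / q * s ≤ ‖ee ((r : ℝ) / q) - 1‖ := by
    rcases le_or_gt (r : ℝ) (q / 2) with h | h
    · refine ⟨r, hr0, Or.inl rfl, ?_⟩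
      rw [norm_ee_sub_one]
      have := key r hr0 h
      have h2 := le_abs_self (Real.sin (Real.pi * ((r : ℝ) / q)))
      have : 4 / (q : ℝ) * r = 2 * (2 / q * r) := by ring
      linarith
    · refine ⟨q - r, by linarith, Or.inr rfl, ?_⟩
      rw [norm_ee_sub_one]
      have h1 := key (q - r) (by linarith) (by linarith)
      have h3 : Real.pi * (((q : ℝ) - r) / q) = Real.pi - Real.pi * ((r : ℝ) / q) := by
        field_simp
      rw [h3, Real.sin_pi_sub] at h1
      have h2 := le_abs_self (Real.sin (Real.pi * ((r : ℝ) / q)))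
      have : 4 / (q : ℝ) * (q - r) = 2 * (2 / q * (q - r)) := by ring
      linarith
  obtain ⟨s, hs, hs', hle⟩ := hmain
  have hpos : 0 < 4 / (q : ℝ) * s := by positivity
  refine ⟨fun h => ?_, ?_⟩
  · rw [h] at hle
    rw [sub_self, norm_zero] at hle
    linarith
  · have h1 : 2 / ‖ee ((r : ℝ) / q) - 1‖ ≤ 2 / (4 / q * s) := by gcongr
    refine h1.trans ?_
    have h2 : 2 / (4 / (q : ℝ) * s) = q / 2 * (1 / s) := by field_simp; norm_num
    rw [h2]
    have h3 : (0 : ℝ) < 1 / r := by positivity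
    have h4 : (0 : ℝ) < 1 / (q - r) := by
      have : (0 : ℝ) < q - r := by linarith
      positivity
    rcases hs' with rfl | rfl <;> gcongr <;> linarith

lemma norm_linear_sum_le_geomBound (M q : ℕ) (hq : 0 < q) (c : ℤ) (γ : ℝ) (a b : ℤ)
    (hab : b - a ≤ M) :
    ‖∑ x ∈ Ico a b, ee ((c : ℝ) / q * x + γ)‖ ≤ geomBound M q (c : ZMod q) := by
  have : NeZero q := ⟨hq.ne'⟩
  unfold geomBound
  split_ifs with h
  · refine (norm_sum_le _ _).trans ?_
    simp only [norm_ee, sum_const, Int.card_Ico, nsmul_eq_mul, mul_one]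
    have : (b - a).toNat ≤ M := by omega
    exact_mod_cast this
  · set r := (c : ZMod q).val with hr
    have hr0 : 0 < r := by
      rcases Nat.eq_zero_or_pos r with h0 | h0
      · exact absurd ((ZMod.val_eq_zero _).mp h0) h
      · exact h0
    have hrq : r < q := ZMod.val_lt _
    obtain ⟨hne, hle⟩ := two_div_norm_ee_le q r hr0 hrq
    have hcr : ∃ k : ℤ, c = r + q * k := by
      have : ((c - r : ℤ) : ZMod q) = 0 := by
        push_cast
        rw [hr, ZMod.natCast_zmod_val, sub_self]
      rw [ZMod.intCast_zmod_eq_zero_iff_dvd] at this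
      obtain ⟨k, hk⟩ := this
      exact ⟨k, by linarith⟩
    obtain ⟨k, hk⟩ := hcr
    have hee : ee ((c : ℝ) / q) = ee ((r : ℝ) / q) := by
      have : (c : ℝ) / q = (r : ℝ) / q + k := by
        rw [hk]
        have : (q : ℝ) ≠ 0 := by positivity
        push_cast
        field_simp
      rw [this, ee_add_int]
    refine (norm_linear_sum_le _ γ (by rw [hee]; exact hne) a b).trans ?_
    rw [hee]
    exact hle

lemma geomBound_nonneg (M q : ℕ) (hq : 0 < q) (r : ZMod q) : 0 ≤ geomBound M q r := by
  have : NeZero q := ⟨hq.ne'⟩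
  unfold geomBound
  split_ifs
  · positivity
  · have : (r.val : ℝ) < q := by exact_mod_cast ZMod.val_lt r
    have : 0 < (q : ℝ) - r.val := by linarith
    positivity

lemma sum_geomBound_le (M q : ℕ) (hq : 0 < q) :
    ∑ r ∈ range q, geomBound M q (r : ZMod q) ≤ M + q * (1 + Real.log q) := by
  obtain ⟨n, rfl⟩ : ∃ n, q = n + 1 := ⟨q - 1, by omega⟩
  rw [sum_range_succ']
  have h0 : geomBound M (n + 1) ((0 : ℕ) : ZMod (n + 1)) = M := by simp [geomBound]
  rw [h0, add_comm]
  gcongr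
  have h1 : ∀ i ∈ range n, geomBound M (n + 1) ((i + 1 : ℕ) : ZMod (n + 1)) =
      ((n + 1 : ℕ) : ℝ) / 2 * (1 / ((i + 1 : ℕ) : ℝ) + 1 / ((n - i : ℕ) : ℝ)) := by
    intro i hi
    rw [mem_range] at hi
    have hv : ((i + 1 : ℕ) : ZMod (n + 1)).val = i + 1 := ZMod.val_cast_of_lt (by omega)
    unfold geomBound
    rw [if_neg, hv]
    · congr 3
      push_cast [Nat.cast_sub hi.le]
      ring
    · intro h
      rw [← ZMod.val_eq_zero, hv] at h
      omega
  rw [sum_congr rfl h1, ← mul_sum, sum_add_distrib]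
  have h2 : ∑ i ∈ range n, 1 / ((i + 1 : ℕ) : ℝ) = ∑ i ∈ Icc 1 n, (1 / ((i : ℕ) : ℝ)) := by
    rw [range_eq_Ico, Finset.sum_Ico_add' (fun i : ℕ => 1 / (i : ℝ)) 0 n 1]
    rfl
  have h3 : ∑ i ∈ range n, 1 / ((n - i : ℕ) : ℝ) = ∑ i ∈ range n, 1 / ((i + 1 : ℕ) : ℝ) := by
    rw [← sum_range_reflect]
    refine sum_congr rfl fun i hi => ?_
    rw [mem_range] at hi
    congr 2
    omega
  rw [h3, h2]
  have h4 := sum_inv_le_one_add_log n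
  have h5 : Real.log n ≤ Real.log ((n + 1 : ℕ) : ℝ) := by
    rcases Nat.eq_zero_or_pos n with rfl | hn
    · simp
    · apply Real.log_le_log (by exact_mod_cast hn)
      push_cast
      linarith
  have : (0 : ℝ) < ((n + 1 : ℕ) : ℝ) := by positivity
  nlinarith

/-- The number of integers of a residue class in an interval. -/
lemma card_int_class_le (q : ℕ) (hq : 0 < q) (a b : ℤ) (r : ZMod q) :
    ((Ico a b).filter fun k : ℤ => (k : ZMod q) = r).card ≤ (b - a).toNat / q + 1 := by
  have : NeZero q := ⟨hq.ne'⟩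
  have hr : ∀ k : ℤ, (k : ZMod q) = r ↔ k ≡ (r.val : ℤ) [ZMOD q] := by
    intro k
    rw [← ZMod.intCast_eq_intCast_iff]
    simp
  simp only [hr]
  rcases le_or_gt b a with h | h
  · rw [Ico_eq_empty (by omega)]
    simp
  have := Int.Ico_filter_modEq_card a b (r := (q : ℤ)) (by exact_mod_cast hq) (r.val : ℤ)
  have h2 : (((Ico a b).filter fun k : ℤ => k ≡ (r.val : ℤ) [ZMOD q]).card : ℤ) ≤
      (b - a) / q + 1 := by
    rw [this]
    apply max_le
    · set v : ℤ := (r.val : ℤ)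
      have hq' : (0 : ℚ) < q := by exact_mod_cast hq
      have h5 : ⌈((b : ℚ) - v) / q⌉ - ⌈((a : ℚ) - v) / q⌉ < (b - a) / q + 2 := by
        have e1 := Int.ceil_lt_add_one (((b : ℚ) - v) / q)
        have e2 := Int.le_ceil (((a : ℚ) - v) / q)
        have e3 : (((b - a : ℤ) : ℚ) / (q : ℚ)) < ((b - a) / q : ℤ) + 1 := by
          rw [← Rat.floor_intCast_div_natCast]
          exact Int.lt_floor_add_one _
        have : (⌈((b : ℚ) - v) / q⌉ : ℚ) - ⌈((a : ℚ) - v) / q⌉ < ((b - a) / q : ℤ) + 2 := by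
          push_cast at e3 ⊢
          have e4 : ((b : ℚ) - v) / q - ((a : ℚ) - v) / q = ((b : ℚ) - a) / q := by ring
          linarith
        exact_mod_cast this
      push_cast at h5 ⊢
      linarith
    · have : 0 ≤ (b - a) / q := Int.ediv_nonneg (by omega) (by positivity)
      omega
  have h3 : (((b - a).toNat / q + 1 : ℕ) : ℤ) = (b - a) / q + 1 := by
    push_cast
    rw [Int.toNat_of_nonneg (by omega)]
  exact_mod_cast h3 ▸ h2

lemma sum_zmod_eq_sum_range (q : ℕ) [NeZero q] (F : ZMod q → ℝ) :
    ∑ r : ZMod q, F r = ∑ r ∈ range q, F (r : ZMod q) := by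
  refine Finset.sum_nbij' (fun r => r.val) (fun r => (r : ZMod q)) ?_ ?_ ?_ ?_ ?_
  · intro r _; exact mem_range.mpr (ZMod.val_lt r)
  · intro r _; exact mem_univ _
  · intro r _; exact ZMod.natCast_zmod_val r
  · intro r hr; exact ZMod.val_cast_of_lt (mem_range.mp hr)
  · intro r _; rw [ZMod.natCast_zmod_val]

/-- Van der Corput differencing with unrestricted shifts. -/
lemma norm_sq_exp_sum_le (φ : ℤ → ℝ) (M : ℕ) (a b : ℤ) (hab : b - a ≤ M) :
    ‖∑ x ∈ Ico a b, ee (φ x)‖ ^ 2 ≤ ∑ h ∈ Ico (1 - M : ℤ) M,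
      ‖∑ x ∈ Ico (max a (a - h)) (min b (b - h)), ee (φ (x + h) - φ x)‖ := by
  have h1 : (((‖∑ x ∈ Ico a b, ee (φ x)‖ ^ 2 : ℝ)) : ℂ) =
      ∑ h ∈ Ico (1 - M : ℤ) M,
        ∑ x ∈ Ico (max a (a - h)) (min b (b - h)), ee (φ (x + h) - φ x) := by
    rw [← Complex.normSq_eq_norm_sq, ← Complex.mul_conj, map_sum, Finset.sum_mul_sum,
      ← sum_product', Finset.sum_sigma']
    refine Finset.sum_nbij' (fun z => ⟨z.1 - z.2, z.2⟩) (fun z => (z.2 + z.1, z.2)) ?_ ?_ ?_ ?_ ?_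
    · intro z hz
      simp only [mem_product, mem_Ico, mem_sigma] at hz ⊢
      omega
    · intro z hz
      simp only [mem_product, mem_Ico, mem_sigma] at hz ⊢
      omega
    · intro z hz
      simp
    · intro z hz
      simp
    · intro z hz
      rw [conj_ee, ← ee_add]
      congr 1
      simp [sub_eq_add_neg]
  have h2 : ‖∑ x ∈ Ico a b, ee (φ x)‖ ^ 2 =
      ‖∑ h ∈ Ico (1 - M : ℤ) M,
        ∑ x ∈ Ico (max a (a - h)) (min b (b - h)), ee (φ (x + h) - φ x)‖ := by
    rw [← h1, Complex.norm_real, Real.norm_of_nonneg (by positivity)]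
  rw [h2]
  exact norm_sum_le _ _

lemma sum_geomBound_linear_le (M q : ℕ) (hq : 0 < q) (c : ℤ) (hc : IsUnit (c : ZMod q)) :
    ∑ k ∈ Ico (1 - M : ℤ) M, geomBound M q ((c * k : ℤ) : ZMod q) ≤
      ((2 * M / q : ℕ) + 1) * (M + q * (1 + Real.log q)) := by
  have : NeZero q := ⟨hq.ne'⟩
  calc ∑ k ∈ Ico (1 - M : ℤ) M, geomBound M q ((c * k : ℤ) : ZMod q)
      = ∑ r : ZMod q, ∑ k ∈ (Ico (1 - M : ℤ) M).filter (fun k : ℤ => (k : ZMod q) = r),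
          geomBound M q ((c * k : ℤ) : ZMod q) :=
        (sum_fiberwise (Ico (1 - M : ℤ) M) (fun k : ℤ => (k : ZMod q))
          (fun k : ℤ => geomBound M q ((c * k : ℤ) : ZMod q))).symm
    _ = ∑ r : ZMod q, (((Ico (1 - M : ℤ) M).filter fun k : ℤ => (k : ZMod q) = r).card : ℝ) *
          geomBound M q ((c : ZMod q) * r : ZMod q) := by
        refine sum_congr rfl fun r _ => ?_
        rw [← nsmul_eq_mul, ← sum_const]
        refine sum_congr rfl fun k hk => ?_
        rw [mem_filter] at hk
        push_cast
        rw [hk.2]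
    _ ≤ ∑ r : ZMod q, (((2 * M / q : ℕ) : ℝ) + 1) * geomBound M q ((c : ZMod q) * r) := by
        refine sum_le_sum fun r _ => ?_
        apply mul_le_mul_of_nonneg_right _ (geomBound_nonneg M q hq _)
        have h1 := card_int_class_le q hq (1 - M) M r
        have h2 : ((M : ℤ) - (1 - M)).toNat / q ≤ 2 * M / q :=
          Nat.div_le_div_right (by omega)
        exact_mod_cast h1.trans (Nat.add_le_add_right h2 1)
    _ = (((2 * M / q : ℕ) : ℝ) + 1) * ∑ r : ZMod q, geomBound M q r := by
        rw [mul_sum]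
        obtain ⟨u, hu⟩ := hc
        refine Fintype.sum_equiv u.mulLeft _ _ fun r => ?_
        simp [hu]
    _ ≤ _ := by
        rw [sum_zmod_eq_sum_range]
        have := sum_geomBound_le M q hq
        gcongr

lemma sum_norm_cubic_diff_le (M d : ℕ) (hd : 0 < d) (a : ℤ) (ha : IsUnit (a : ZMod d))
    (h : ℤ) (u v : ℤ) (huv : v - u ≤ M) :
    ‖∑ x ∈ Ico u v, ee ((a : ℝ) / d * (3 * h * x ^ 2 + 3 * h ^ 2 * x + h ^ 3))‖ ^ 2 ≤
      2 * M ^ 2 * (Nat.gcd d (6 * h.natAbs)) / d +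
        (3 * M + d) * (1 + Real.log d) := by
  set g : ℕ := Nat.gcd d (6 * h.natAbs) with hg
  have hg0 : 0 < g := Nat.gcd_pos_of_pos_left _ hd
  obtain ⟨q, hq⟩ : g ∣ d := Nat.gcd_dvd_left _ _
  have hq0 : 0 < q := by
    rcases Nat.eq_zero_or_pos q with h0 | h0
    · rw [h0] at hq; omega
    · exact h0
  obtain ⟨m, hm⟩ : (g : ℤ) ∣ 6 * h := by
    have : g ∣ 6 * h.natAbs := Nat.gcd_dvd_right _ _
    rw [← Int.natCast_dvd_natCast] at this
    push_cast at this
    rcases Int.natAbs_eq h with h' | h'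
    · rw [h']; simpa using this
    · rw [h', mul_neg, dvd_neg]; simpa using this
  have hcop : Nat.Coprime m.natAbs q := by
    have h1 : Nat.gcd (g * q) (g * m.natAbs) = g := by
      rw [← hq]
      have : g * m.natAbs = 6 * h.natAbs := by
        have := congrArg Int.natAbs hm
        rw [Int.natAbs_mul, Int.natAbs_mul] at this
        simpa using this.symm
      rw [this]
    rw [Nat.gcd_mul_left] at h1
    have h2 : q.gcd m.natAbs = 1 := Nat.eq_of_mul_eq_mul_left hg0 (by omega)
    rw [Nat.coprime_comm]
    exact h2
  have hunit : IsUnit ((a * m : ℤ) : ZMod q) := by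
    push_cast
    apply IsUnit.mul
    · have := ha.map (ZMod.castHom (hq ▸ Dvd.intro_left g rfl : q ∣ d) (ZMod q))
      simpa using this
    · rcases Int.natAbs_eq m with h' | h'
      · rw [h']
        simpa using (ZMod.isUnit_iff_coprime _ _).mpr hcop
      · rw [h']
        simpa using (ZMod.isUnit_iff_coprime _ _).mpr hcop
  have hdR : (0 : ℝ) < d := by exact_mod_cast hd
  have hqR : (0 : ℝ) < q := by exact_mod_cast hq0
  have hgR : (0 : ℝ) < g := by exact_mod_cast hg0
  have hdq : (d : ℝ) = g * q := by exact_mod_cast hq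
  refine (norm_sq_exp_sum_le (fun x : ℤ => (a : ℝ) / d * (3 * h * x ^ 2 + 3 * h ^ 2 * x + h ^ 3))
    M u v huv).trans ?_
  have hle : ∀ k ∈ Ico (1 - M : ℤ) M,
      ‖∑ x ∈ Ico (max u (u - k)) (min v (v - k)),
        ee ((a : ℝ) / d * (3 * h * ((x + k : ℤ) : ℝ) ^ 2 + 3 * h ^ 2 * ((x + k : ℤ) : ℝ) + h ^ 3) -
          (a : ℝ) / d * (3 * h * x ^ 2 + 3 * h ^ 2 * x + h ^ 3))‖ ≤
      geomBound M q (((a * m) * k : ℤ) : ZMod q) := by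
    intro k _
    have := norm_linear_sum_le_geomBound M q hq0 ((a * m) * k)
      ((a : ℝ) / d * (3 * h * k ^ 2 + 3 * h ^ 2 * k)) (max u (u - k)) (min v (v - k)) (by omega)
    refine le_trans (le_of_eq ?_) this
    congr 1
    refine sum_congr rfl fun x _ => ?_
    congr 1
    have hm' : (6 : ℝ) * h = g * m := by exact_mod_cast hm
    have h6 : (a : ℝ) / d * (6 * h * k * x) = ((((a * m) * k : ℤ) : ℝ)) / q * x := by
      rw [hm', hdq]
      push_cast
      field_simp
    rw [← h6]
    push_cast
    ring
  refine (sum_le_sum hle).trans ((sum_geomBound_linear_le M q hq0 (a * m) hunit).trans ?_)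
  have h1 : (((2 * M / q : ℕ) : ℝ)) ≤ 2 * M / q := by
    have := @Nat.cast_div_le ℝ _ _ _ (2 * M) q
    push_cast at this
    exact this
  have hlog : Real.log q ≤ Real.log d := by
    apply Real.log_le_log hqR
    exact_mod_cast Nat.le_of_dvd hd (hq ▸ Dvd.intro_left g rfl)
  have hq1 : (1 : ℝ) ≤ q := by exact_mod_cast hq0
  have hlog0 : 0 ≤ Real.log q := Real.log_nonneg hq1
  have hqd : (q : ℝ) ≤ d := by exact_mod_cast Nat.le_of_dvd hd (hq ▸ Dvd.intro_left g rfl)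
  have hM : (0 : ℝ) ≤ M := by positivity
  calc (((2 * M / q : ℕ) : ℝ) + 1) * (M + q * (1 + Real.log q))
      ≤ (2 * M / q + 1) * (M + q * (1 + Real.log q)) := by gcongr
    _ = 2 * M ^ 2 / q + 2 * M * (1 + Real.log q) + M + q * (1 + Real.log q) := by
        field_simp
        ring
    _ ≤ 2 * M ^ 2 / q + 2 * M * (1 + Real.log d) + M * (1 + Real.log d) +
          d * (1 + Real.log d) := by
        gcongr
        nlinarith
    _ = _ := by rw [hdq]; field_simp; ring

/-- Weyl's inequality for cubic sums at a rational point. -/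
lemma weyl_cube (M d : ℕ) (hd : 0 < d) (a : ℤ) (ha : IsUnit (a : ZMod d)) (u v : ℤ)
    (huv : v - u ≤ M) :
    ‖∑ x ∈ Ico u v, ee ((a : ℝ) / d * (x : ℝ) ^ 3)‖ ^ 4 ≤
      48 * (1 + Real.log d) * (M ^ 4 * tau d / d + M ^ 3 + M ^ 2 * d) := by
  rcases Nat.eq_zero_or_pos M with hM | hM
  · subst hM
    rw [Ico_eq_empty (by push_cast at huv; omega), sum_empty, norm_zero]
    simp
  have hM1 : (1 : ℝ) ≤ M := by exact_mod_cast hM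
  have hdR : (1 : ℝ) ≤ d := by exact_mod_cast hd
  have hlog : 0 ≤ Real.log d := Real.log_nonneg hdR
  set D : ℤ → ℝ := fun h => ‖∑ x ∈ Ico (max u (u - h)) (min v (v - h)),
    ee ((a : ℝ) / d * (3 * h * x ^ 2 + 3 * h ^ 2 * x + h ^ 3))‖ with hD
  have h1 : ‖∑ x ∈ Ico u v, ee ((a : ℝ) / d * (x : ℝ) ^ 3)‖ ^ 2 ≤
      ∑ h ∈ Ico (1 - M : ℤ) M, D h := by
    refine (norm_sq_exp_sum_le (fun x : ℤ => (a : ℝ) / d * (x : ℝ) ^ 3) M u v huv).trans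
      (le_of_eq ?_)
    refine sum_congr rfl fun h _ => ?_
    simp only [hD]
    congr 1
    refine sum_congr rfl fun x _ => ?_
    congr 1
    push_cast
    ring
  have hcard : ((Ico (1 - M : ℤ) M).card : ℝ) ≤ 2 * M := by
    rw [Int.card_Ico]
    have : ((M : ℤ) - (1 - M)).toNat ≤ 2 * M := by omega
    exact_mod_cast this
  have h2 : (∑ h ∈ Ico (1 - M : ℤ) M, D h) ^ 2 ≤ 2 * M * ∑ h ∈ Ico (1 - M : ℤ) M, D h ^ 2 := by
    refine sq_sum_le_card_mul_sum_sq.trans ?_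
    gcongr
  set B : ℕ → ℝ := fun h => 2 * (M : ℝ) ^ 2 * (Nat.gcd d (6 * h)) / d +
    (3 * M + d) * (1 + Real.log d) with hB
  have hB0 : ∀ h, 0 ≤ B h := fun h => by simp only [hB]; positivity
  have h3 : ∀ h ∈ Ico (1 - M : ℤ) M, D h ^ 2 ≤ (if h = 0 then (M : ℝ) ^ 2 else 0) +
      (if 0 < h then B h.natAbs else 0) + (if h < 0 then B h.natAbs else 0) := by
    intro h _
    rcases lt_trichotomy h 0 with hneg | h0 | hpos
    · rw [if_neg hneg.ne, if_neg (by omega), if_pos hneg, zero_add, zero_add]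
      exact sum_norm_cubic_diff_le M d hd a ha h _ _ (by omega)
    · subst h0
      simp only [if_true, lt_irrefl, if_false, add_zero]
      have : D 0 ≤ M := by
        simp only [hD]
        refine (norm_sum_le _ _).trans ?_
        simp only [norm_ee, sum_const, nsmul_eq_mul, mul_one, Int.card_Ico]
        have : (min v (v - 0) - max u (u - 0)).toNat ≤ M := by omega
        exact_mod_cast this
      have h0 : 0 ≤ D 0 := norm_nonneg _
      gcongr
    · rw [if_neg hpos.ne', if_pos hpos, if_neg (by omega), zero_add, add_zero]
      exact sum_norm_cubic_diff_le M d hd a ha h _ _ (by omega)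
  have hpos_sum : ∑ h ∈ Ico (1 - M : ℤ) M, (if 0 < h then B h.natAbs else 0) ≤
      ∑ h ∈ Icc 1 M, B h := by
    rw [← sum_filter]
    refine sum_le_sum_of_injOn (fun h : ℤ => h.natAbs) ?_ ?_ ?_ ?_
    · intro h hh
      exact hB0 _
    · intro h hh
      simp only [mem_filter, mem_Ico, mem_Icc] at hh ⊢
      omega
    · intro h hh h' hh' e
      simp only [coe_filter, mem_Ico, Set.mem_ofPred_eq] at hh hh'
      simp only at e
      omega
    · intro h hh
      exact le_rfl
  have hneg_sum : ∑ h ∈ Ico (1 - M : ℤ) M, (if h < 0 then B h.natAbs else 0) ≤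
      ∑ h ∈ Icc 1 M, B h := by
    rw [← sum_filter]
    refine sum_le_sum_of_injOn (fun h : ℤ => h.natAbs) ?_ ?_ ?_ ?_
    · intro h hh
      exact hB0 _
    · intro h hh
      simp only [mem_filter, mem_Ico, mem_Icc] at hh ⊢
      omega
    · intro h hh h' hh' e
      simp only [coe_filter, mem_Ico, Set.mem_ofPred_eq] at hh hh'
      simp only at e
      omega
    · intro h hh
      exact le_rfl
  have hzero : ∑ h ∈ Ico (1 - M : ℤ) M, (if h = 0 then (M : ℝ) ^ 2 else 0) ≤ M ^ 2 := by
    rw [sum_ite_eq']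
    split_ifs
    · exact le_rfl
    · positivity
  have hBsum : ∑ h ∈ Icc 1 M, B h ≤ 12 * M ^ 3 * tau d / d +
      M * ((3 * M + d) * (1 + Real.log d)) := by
    simp only [hB]
    rw [sum_add_distrib, sum_const, Nat.card_Icc, nsmul_eq_mul]
    have hg : (∑ h ∈ Icc 1 M, (Nat.gcd d (6 * h) : ℝ)) ≤ 6 * (M * tau d) := by
      have e1 := sum_gcd_le d M hd.ne'
      have e2 : ∑ h ∈ Icc 1 M, Nat.gcd d (6 * h) ≤ 6 * ∑ h ∈ Icc 1 M, Nat.gcd d h := by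
        rw [mul_sum]
        refine sum_le_sum fun h hh => ?_
        calc Nat.gcd d (6 * h) ≤ Nat.gcd d 6 * Nat.gcd d h :=
              Nat.le_of_dvd (Nat.mul_pos (Nat.gcd_pos_of_pos_left _ hd)
                (Nat.gcd_pos_of_pos_left _ hd)) (Nat.gcd_mul_right_dvd_mul_gcd d 6 h)
          _ ≤ 6 * Nat.gcd d h := Nat.mul_le_mul_right _ (Nat.gcd_le_right d (by norm_num))
      have e3 := e2.trans (Nat.mul_le_mul_left 6 e1)
      exact_mod_cast e3
    have e4 : ∑ h ∈ Icc 1 M, 2 * (M : ℝ) ^ 2 * (Nat.gcd d (6 * h)) / d =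
        2 * (M : ℝ) ^ 2 / d * ∑ h ∈ Icc 1 M, (Nat.gcd d (6 * h) : ℝ) := by
      rw [mul_sum]
      refine sum_congr rfl fun h _ => by ring
    rw [e4]
    have e5 : 2 * (M : ℝ) ^ 2 / d * ∑ h ∈ Icc 1 M, (Nat.gcd d (6 * h) : ℝ) ≤
        2 * (M : ℝ) ^ 2 / d * (6 * (M * tau d)) := by gcongr
    have e6 : 2 * (M : ℝ) ^ 2 / d * (6 * (M * tau d)) = 12 * M ^ 3 * tau d / d := by ring
    have e7 : ((M + 1 - 1 : ℕ) : ℝ) = M := by simp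
    rw [e7]
    linarith
  have h4 : ∑ h ∈ Ico (1 - M : ℤ) M, D h ^ 2 ≤ M ^ 2 + 2 * (12 * M ^ 3 * tau d / d +
      M * ((3 * M + d) * (1 + Real.log d))) := by
    refine (sum_le_sum h3).trans ?_
    rw [sum_add_distrib, sum_add_distrib]
    linarith
  calc ‖∑ x ∈ Ico u v, ee ((a : ℝ) / d * (x : ℝ) ^ 3)‖ ^ 4
      = (‖∑ x ∈ Ico u v, ee ((a : ℝ) / d * (x : ℝ) ^ 3)‖ ^ 2) ^ 2 := by ring
    _ ≤ (∑ h ∈ Ico (1 - M : ℤ) M, D h) ^ 2 := by gcongr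
    _ ≤ 2 * M * (M ^ 2 + 2 * (12 * M ^ 3 * tau d / d +
      M * ((3 * M + d) * (1 + Real.log d)))) := h2.trans (by gcongr)
    _ = 2 * M ^ 3 + 48 * (M ^ 4 * tau d / d) +
          (12 * M ^ 3 + 4 * M ^ 2 * d) * (1 + Real.log d) := by ring
    _ ≤ _ := by
        have p1 : (0 : ℝ) ≤ M ^ 4 * tau d / d := by positivity
        have p2 : (0 : ℝ) ≤ M ^ 3 := by positivity
        have p3 : (0 : ℝ) ≤ (M : ℝ) ^ 2 * d := by positivity
        have p4 := mul_nonneg p1 hlog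
        have p5 := mul_nonneg p2 hlog
        have p6 := mul_nonneg p3 hlog
        nlinarith

/-- The number of cube roots of a residue class modulo a prime. -/
lemma card_cube_roots_prime_le (p : ℕ) (hp : p.Prime) (x : ℤ) :
    ((range p).filter fun y : ℕ => (p : ℤ) ∣ x ^ 3 - (y : ℤ) ^ 3).card ≤ 3 := by
  have : Fact p.Prime := ⟨hp⟩
  calc ((range p).filter fun y : ℕ => (p : ℤ) ∣ x ^ 3 - (y : ℤ) ^ 3).card
      ≤ (Polynomial.nthRoots 3 ((x : ZMod p) ^ 3)).toFinset.card := by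
        refine card_le_card_of_injOn (fun y : ℕ => (y : ZMod p)) ?_ ?_
        · intro y hy
          simp only [coe_filter, mem_range, Set.mem_ofPred_eq] at hy
          rw [Finset.mem_coe, Multiset.mem_toFinset, Polynomial.mem_nthRoots (by norm_num)]
          have h := (ZMod.intCast_zmod_eq_zero_iff_dvd _ p).mpr hy.2
          push_cast at h
          exact (sub_eq_zero.mp h).symm
        · intro y hy z hz hyz
          simp only [coe_filter, mem_range, Set.mem_ofPred_eq] at hy hz
          have h := (ZMod.natCast_eq_natCast_iff' y z p).mp hyz
          rwa [Nat.mod_eq_of_lt hy.1, Nat.mod_eq_of_lt hz.1] at h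
    _ ≤ 3 := (Multiset.toFinset_card_le _).trans (Polynomial.card_nthRoots 3 _)

lemma card_filter_forall_mod_le (d M : ℕ) (c : ℕ → ℕ) :
    ((Icc 1 M).filter fun y => ∀ p ∈ d.primeFactors, y % p = c p).card ≤ M / rad d + 1 := by
  set S := (Icc 1 M).filter fun y => ∀ p ∈ d.primeFactors, y % p = c p with hS
  rcases S.eq_empty_or_nonempty with h | ⟨y₀, hy₀⟩
  · simp [h]
  have h1 : S.card ≤ ((Ico (1 : ℤ) (M + 1)).filter
      fun k : ℤ => (k : ZMod (rad d)) = (y₀ : ZMod (rad d))).card := by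
    refine card_le_card_of_injOn (fun y : ℕ => (y : ℤ)) ?_ (fun a _ b _ h => Nat.cast_injective h)
    intro y hy
    rw [hS] at hy hy₀
    simp only [coe_filter, mem_Icc, Set.mem_ofPred_eq] at hy
    simp only [mem_filter, mem_Icc] at hy₀
    simp only [coe_filter, mem_Ico, Set.mem_ofPred_eq]
    refine ⟨by omega, ?_⟩
    have h2 : ((rad d : ℕ) : ℤ) ∣ (y : ℤ) - y₀ := by
      unfold rad
      push_cast
      refine Finset.prod_dvd_of_coprime ?_ ?_
      · intro p hp q hq hpq
        rw [Function.onFun, Nat.isCoprime_iff_coprime]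
        exact (Nat.coprime_primes (Nat.prime_of_mem_primeFactors hp)
          (Nat.prime_of_mem_primeFactors hq)).mpr hpq
      · intro p hp
        have := (hy.2 p hp).trans (hy₀.2 p hp).symm
        exact (Nat.modEq_iff_dvd.mp (show y₀ ≡ y [MOD p] from this.symm))
    have h3 := (ZMod.intCast_zmod_eq_zero_iff_dvd _ (rad d)).mpr h2
    push_cast at h3
    simpa using sub_eq_zero.mp h3
  refine h1.trans ((card_int_class_le (rad d) (rad_pos d) _ _ _).trans ?_)
  simp

lemma card_cube_class_le (d M : ℕ) (hd : d ≠ 0) (x : ℤ) :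
    ((Icc 1 M).filter fun y : ℕ => (d : ℤ) ∣ x ^ 3 - (y : ℤ) ^ 3).card ≤
      tau d ^ 2 * (M / rad d + 1) := by
  set S := (Icc 1 M).filter fun y : ℕ => (d : ℤ) ∣ x ^ 3 - (y : ℤ) ^ 3 with hS
  let T : Finset ((p : ℕ) → p ∈ d.primeFactors → ℕ) := d.primeFactors.pi fun p =>
    (range p).filter fun y : ℕ => (p : ℤ) ∣ x ^ 3 - (y : ℤ) ^ 3
  have hT : T.card ≤ tau d ^ 2 := by
    rw [card_pi]
    calc _ ≤ ∏ p ∈ d.primeFactors, 4 := by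
          refine prod_le_prod' fun p hp => ?_
          exact (card_cube_roots_prime_le p (Nat.prime_of_mem_primeFactors hp) x).trans (by norm_num)
      _ = (2 ^ d.primeFactors.card) ^ 2 := by
          rw [prod_const, ← pow_mul, mul_comm, pow_mul]; norm_num
      _ ≤ _ := Nat.pow_le_pow_left (two_pow_card_primeFactors_le_tau hd) 2
  have hmaps : ∀ y ∈ S, (fun p (_ : p ∈ d.primeFactors) => y % p) ∈ T := by
    intro y hy
    rw [mem_pi]
    intro p hp
    have hpp := Nat.prime_of_mem_primeFactors hp
    rw [mem_filter, mem_range]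
    refine ⟨Nat.mod_lt _ hpp.pos, ?_⟩
    have h1 : (p : ℤ) ∣ x ^ 3 - (y : ℤ) ^ 3 :=
      (Int.natCast_dvd_natCast.mpr (Nat.dvd_of_mem_primeFactors hp)).trans (mem_filter.mp hy).2
    have h2 := (ZMod.intCast_zmod_eq_zero_iff_dvd _ p).mpr h1
    apply (ZMod.intCast_zmod_eq_zero_iff_dvd _ p).mp
    push_cast at h2 ⊢
    simpa using h2
  have := card_le_mul_card_image_of_maps_to hmaps (M / rad d + 1) (fun c _ => by
    refine le_trans (card_le_card ?_)
      (card_filter_forall_mod_le d M fun p => if h : p ∈ d.primeFactors then c p h else 0)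
    intro y hy
    rw [mem_filter, hS, mem_filter] at hy
    rw [mem_filter]
    refine ⟨hy.1.1, fun p hp => ?_⟩
    rw [dif_pos hp, ← hy.2])
  calc S.card ≤ (M / rad d + 1) * T.card := this
    _ ≤ _ := by
      rw [mul_comm]
      exact Nat.mul_le_mul_right _ hT

/-- The cubic exponential sum over `[1, M]`. -/
noncomputable def cubeSum (M : ℕ) (t : ℝ) : ℂ := ∑ x ∈ Icc 1 M, ee (t * (x : ℝ) ^ 3)

lemma cubeSum_eq_esum (M e : ℕ) (t : ℝ) :
    cubeSum M (e ^ 3 * t) = esum (Icc 1 M) (fun _ => 1) (fun x => (e * x : ℤ) ^ 3) t := by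
  unfold cubeSum esum
  refine sum_congr rfl fun x _ => ?_
  push_cast
  rw [one_mul]
  congr 1
  ring

lemma dvd_cube_mul_iff (d e : ℕ) (hd : d ≠ 0) (n : ℤ) :
    (d : ℤ) ∣ (e : ℤ) ^ 3 * n ↔ ((d / d.gcd (e ^ 3) : ℕ) : ℤ) ∣ n := by
  have hg : 0 < d.gcd (e ^ 3) := Nat.gcd_pos_of_pos_left _ (Nat.pos_of_ne_zero hd)
  have hcop := Nat.coprime_div_gcd_div_gcd hg
  set g := d.gcd (e ^ 3)
  obtain ⟨d', hd'⟩ : g ∣ d := Nat.gcd_dvd_left _ _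
  obtain ⟨e', he'⟩ : g ∣ e ^ 3 := Nat.gcd_dvd_right _ _
  have h1 : d / g = d' := by rw [hd', Nat.mul_div_cancel_left _ hg]
  have h2 : e ^ 3 / g = e' := by rw [he', Nat.mul_div_cancel_left _ hg]
  rw [h1, h2] at hcop
  rw [h1, hd']
  have h3 : (e : ℤ) ^ 3 = g * e' := by exact_mod_cast he'
  rw [h3]
  push_cast
  rw [mul_assoc, mul_dvd_mul_iff_left (by exact_mod_cast hg.ne')]
  exact ⟨fun h => (Nat.isCoprime_iff_coprime.mpr hcop).dvd_of_dvd_mul_left h,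
    fun h => h.mul_left _⟩

lemma sum_norm_cubeSum_sq_le (d e M : ℕ) (hd : d ≠ 0) :
    ∑ a ∈ range d, ‖cubeSum M (e ^ 3 * ((a : ℝ) / d))‖ ^ 2 ≤
      d * (M * (tau d ^ 2 * (M / rad (d / d.gcd (e ^ 3)) + 1))) := by
  have hg : 0 < d.gcd (e ^ 3) := Nat.gcd_pos_of_pos_left _ (Nat.pos_of_ne_zero hd)
  have hd' : d / d.gcd (e ^ 3) ≠ 0 := by
    have := Nat.div_pos (Nat.le_of_dvd (Nat.pos_of_ne_zero hd) (Nat.gcd_dvd_left d (e ^ 3))) hg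
    omega
  simp_rw [cubeSum_eq_esum]
  rw [sum_norm_esum_sq _ _ _ d (Nat.pos_of_ne_zero hd)]
  gcongr
  simp only [mul_one, sum_const, nsmul_eq_mul]
  have h1 : ((Icc 1 M ×ˢ Icc 1 M).filter fun x : ℕ × ℕ =>
      (d : ℤ) ∣ (e * x.1 : ℤ) ^ 3 - (e * x.2 : ℤ) ^ 3).card ≤
      M * (tau d ^ 2 * (M / rad (d / d.gcd (e ^ 3)) + 1)) := by
    rw [card_filter, sum_product]
    calc _ = ∑ x ∈ Icc 1 M, ((Icc 1 M).filter fun y : ℕ =>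
          (d : ℤ) ∣ (e * x : ℤ) ^ 3 - (e * y : ℤ) ^ 3).card := by
          simp_rw [card_filter]
      _ ≤ ∑ x ∈ Icc 1 M, (tau d ^ 2 * (M / rad (d / d.gcd (e ^ 3)) + 1)) := by
          refine sum_le_sum fun x _ => ?_
          have h2 : ∀ y : ℕ, (d : ℤ) ∣ (e * x : ℤ) ^ 3 - (e * y : ℤ) ^ 3 ↔
              ((d / d.gcd (e ^ 3) : ℕ) : ℤ) ∣ (x : ℤ) ^ 3 - (y : ℤ) ^ 3 := by
            intro y
            rw [← dvd_cube_mul_iff d e hd, mul_pow, mul_pow, mul_sub]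
          simp_rw [h2]
          refine (card_cube_class_le _ M hd' x).trans ?_
          gcongr
          exact tau_le_of_dvd (Nat.div_dvd_of_dvd (Nat.gcd_dvd_left _ _)) hd
      _ = _ := by simp
  calc ((((Icc 1 M ×ˢ Icc 1 M).filter fun x : ℕ × ℕ =>
      (d : ℤ) ∣ (e * x.1 : ℤ) ^ 3 - (e * x.2 : ℤ) ^ 3).card : ℕ) : ℝ)
      ≤ ((M * (tau d ^ 2 * (M / rad (d / d.gcd (e ^ 3)) + 1)) : ℕ) : ℝ) := by exact_mod_cast h1
    _ ≤ _ := by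
      push_cast
      gcongr
      exact Nat.cast_div_le

lemma norm_cubeSum_pow_four_le (d e M a : ℕ) (hd : d ≠ 0) (ha : a.Coprime d) :
    ‖cubeSum M (e ^ 3 * ((a : ℝ) / d))‖ ^ 4 ≤
      48 * (1 + Real.log d) * (M ^ 4 * tau d * (d.gcd (e ^ 3)) / d + M ^ 3 + M ^ 2 * d) := by
  have hg : 0 < d.gcd (e ^ 3) := Nat.gcd_pos_of_pos_left _ (Nat.pos_of_ne_zero hd)
  have hcop := Nat.coprime_div_gcd_div_gcd hg
  obtain ⟨d', hd'⟩ : d.gcd (e ^ 3) ∣ d := Nat.gcd_dvd_left _ _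
  obtain ⟨e', he'⟩ : d.gcd (e ^ 3) ∣ e ^ 3 := Nat.gcd_dvd_right _ _
  set g := d.gcd (e ^ 3)
  have h1 : d / g = d' := by rw [hd', Nat.mul_div_cancel_left _ hg]
  have h2 : e ^ 3 / g = e' := by rw [he', Nat.mul_div_cancel_left _ hg]
  rw [h1, h2] at hcop
  have hd'0 : 0 < d' := by
    rcases Nat.eq_zero_or_pos d' with h | h
    · rw [h] at hd'; omega
    · exact h
  have hdd : d' ∣ d := ⟨g, by rw [hd']; ring⟩
  have hcop' : (e' * a).Coprime d' :=
    Nat.Coprime.mul_left hcop.symm (ha.coprime_dvd_right hdd)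
  have hw := weyl_cube M d' hd'0 (e' * a : ℕ)
    (by rw [Int.cast_natCast]; exact (ZMod.isUnit_iff_coprime _ _).mpr hcop') 1 (M + 1) (by simp)
  have heq : ∑ x ∈ Ico (1 : ℤ) (M + 1), ee ((((e' * a : ℕ) : ℤ) : ℝ) / d' * (x : ℝ) ^ 3) =
      cubeSum M (e ^ 3 * ((a : ℝ) / d)) := by
    unfold cubeSum
    symm
    refine sum_bij (fun (x : ℕ) _ => (x : ℤ)) ?_ ?_ ?_ ?_
    · intro x hx
      simp only [mem_Icc, mem_Ico] at hx ⊢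
      omega
    · intro x _ y _ h
      exact_mod_cast h
    · intro y hy
      simp only [mem_Ico] at hy
      refine ⟨y.toNat, ?_, ?_⟩
      · simp only [mem_Icc]; omega
      · omega
    · intro x _
      congr 1
      have hgr : (g : ℝ) ≠ 0 := by exact_mod_cast hg.ne'
      have hdr : (d' : ℝ) ≠ 0 := by exact_mod_cast hd'0.ne'
      have h3 : (e : ℝ) ^ 3 = g * e' := by exact_mod_cast he'
      have h4 : (d : ℝ) = g * d' := by exact_mod_cast hd'
      rw [h3, h4]
      push_cast
      field_simp
  rw [heq] at hw
  refine hw.trans ?_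
  have hgr : (0 : ℝ) < g := by exact_mod_cast hg
  have hdr : (0 : ℝ) < d' := by exact_mod_cast hd'0
  have h4 : (d : ℝ) = g * d' := by exact_mod_cast hd'
  have hlog : Real.log d' ≤ Real.log d := by
    apply Real.log_le_log hdr
    exact_mod_cast Nat.le_of_dvd (Nat.pos_of_ne_zero hd) hdd
  have hlog0 : 0 ≤ Real.log d' := Real.log_natCast_nonneg _
  have htau : (tau d' : ℝ) ≤ tau d := by exact_mod_cast tau_le_of_dvd hdd hd
  have hdle : (d' : ℝ) ≤ d := by exact_mod_cast Nat.le_of_dvd (Nat.pos_of_ne_zero hd) hdd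
  have h5 : (M : ℝ) ^ 4 * tau d * g / d = M ^ 4 * tau d / d' := by
    rw [h4]; field_simp
  rw [h5]
  gcongr

lemma rad_le_rad_div_mul (d e : ℕ) (hd : d ≠ 0) :
    rad d ≤ rad (d / d.gcd (e ^ 3)) * d.gcd e := by
  have hg : 0 < d.gcd (e ^ 3) := Nat.gcd_pos_of_pos_left _ (Nat.pos_of_ne_zero hd)
  have hge : 0 < d.gcd e := Nat.gcd_pos_of_pos_left _ (Nat.pos_of_ne_zero hd)
  have hd'0 : d / d.gcd (e ^ 3) ≠ 0 := by
    have := Nat.div_pos (Nat.le_of_dvd (Nat.pos_of_ne_zero hd) (Nat.gcd_dvd_left d (e ^ 3))) hg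
    omega
  refine Nat.le_of_dvd (Nat.mul_pos (rad_pos _) hge) ?_
  refine Finset.prod_primes_dvd _ (fun p hp => (Nat.prime_of_mem_primeFactors hp).prime) ?_
  intro p hp
  have hpp := Nat.prime_of_mem_primeFactors hp
  have hpd := Nat.dvd_of_mem_primeFactors hp
  by_cases h : p ∣ d / d.gcd (e ^ 3)
  · exact (Finset.dvd_prod_of_mem _ (Nat.mem_primeFactors.mpr ⟨hpp, h, hd'0⟩)).mul_right _
  · have h1 : p ∣ d / d.gcd (e ^ 3) * d.gcd (e ^ 3) := by
      rwa [Nat.div_mul_cancel (Nat.gcd_dvd_left _ _)]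
    have h2 := (hpp.dvd_mul.mp h1).resolve_left h
    have h3 := hpp.dvd_of_dvd_pow (h2.trans (Nat.gcd_dvd_right _ _))
    exact (Nat.dvd_gcd hpd h3).mul_left _

lemma sum_gcd_div_le (d U : ℕ) (hd : d ≠ 0) :
    ∑ e ∈ Icc 1 U, (d.gcd e : ℝ) / e ≤ tau d * (1 + Real.log U) := by
  calc ∑ e ∈ Icc 1 U, (d.gcd e : ℝ) / e
      ≤ ∑ e ∈ Icc 1 U, ∑ k ∈ d.divisors, if k ∣ e then (k : ℝ) / e else 0 := by
        refine sum_le_sum fun e _ => ?_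
        have := single_le_sum (f := fun k : ℕ => if k ∣ e then (k : ℝ) / e else 0)
          (fun _ _ => by positivity) (Nat.mem_divisors.mpr ⟨Nat.gcd_dvd_left d e, hd⟩)
        simpa [Nat.gcd_dvd_right] using this
    _ = ∑ k ∈ d.divisors, ∑ e ∈ Icc 1 U, if k ∣ e then (k : ℝ) / e else 0 := sum_comm
    _ ≤ ∑ k ∈ d.divisors, (1 + Real.log U) := by
        refine sum_le_sum fun k hk => ?_
        have hk0 : 0 < k := Nat.pos_of_mem_divisors hk
        refine le_trans ?_ (sum_inv_le_one_add_log U)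
        rw [← sum_filter]
        refine sum_le_sum_of_injOn (fun e => e / k) (fun _ _ => by positivity) ?_ ?_ ?_
        · intro e he
          rw [mem_filter, mem_Icc] at he
          rw [mem_Icc]
          exact ⟨Nat.div_pos (Nat.le_of_dvd (by omega) he.2) hk0, (Nat.div_le_self _ _).trans he.1.2⟩
        · intro a ha b hb hab
          rw [mem_coe, mem_filter] at ha hb
          have h1 := Nat.div_mul_cancel ha.2
          have h2 := Nat.div_mul_cancel hb.2
          simp only at hab
          rw [← h1, ← h2, hab]
        · intro e he
          rw [mem_filter] at he
          obtain ⟨m, rfl⟩ := he.2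
          rw [Nat.mul_div_cancel_left _ hk0]
          have : (k : ℝ) ≠ 0 := by exact_mod_cast hk0.ne'
          push_cast
          rw [div_mul_eq_div_div, div_self this]
    _ = _ := by simp [tau, mul_add]

/-- The exponential sum over cubes of `[1, U]` weighted by a sieve of support `I` and
coefficients `c`. -/
noncomputable def sieveSum (I : Finset ℕ) (c : ℕ → ℝ) (U : ℕ) (t : ℝ) : ℂ :=
  ∑ e ∈ I, (c e : ℂ) * cubeSum (U / e) (e ^ 3 * t)

/-- A set of sieve moduli up to `U ^ 0.01`. -/
structure IsSieve (I : Finset ℕ) (c : ℕ → ℝ) (U : ℕ) : Prop where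
  pos : ∀ e ∈ I, 1 ≤ e
  le : ∀ e ∈ I, (e : ℝ) ≤ (U : ℝ) ^ (0.01 : ℝ)
  abs_le : ∀ e ∈ I, |c e| ≤ 1

lemma IsSieve.mem_Icc {I : Finset ℕ} {c : ℕ → ℝ} {U : ℕ} (h : IsSieve I c U) (hU : 1 ≤ U)
    {e : ℕ} (he : e ∈ I) : e ∈ Icc 1 U := by
  rw [Finset.mem_Icc]
  refine ⟨h.pos e he, ?_⟩
  have h1 : (1 : ℝ) ≤ U := by exact_mod_cast hU
  have h2 : (e : ℝ) ≤ U := (h.le e he).trans (by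
    simpa using Real.rpow_le_rpow_of_exponent_le h1 (show (0.01 : ℝ) ≤ 1 by norm_num))
  exact_mod_cast h2

lemma IsSieve.rpow_le_div {I : Finset ℕ} {c : ℕ → ℝ} {U : ℕ} (h : IsSieve I c U) (hU : 1 ≤ U)
    {e : ℕ} (he : e ∈ I) : (U : ℝ) ^ (0.99 : ℝ) ≤ U / e := by
  have h1 : (0 : ℝ) < U := by exact_mod_cast hU
  have h2 : (0 : ℝ) < e := by exact_mod_cast h.pos e he
  rw [le_div_iff₀ h2]
  calc (U : ℝ) ^ (0.99 : ℝ) * e ≤ (U : ℝ) ^ (0.99 : ℝ) * (U : ℝ) ^ (0.01 : ℝ) := by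
        gcongr; exact h.le e he
    _ = U := by rw [← Real.rpow_add h1]; norm_num

lemma IsSieve.sum_gcd_le {I : Finset ℕ} {c : ℕ → ℝ} {U : ℕ} (h : IsSieve I c U) (hU : 1 ≤ U)
    (d : ℕ) (hd : d ≠ 0) : ∑ e ∈ I, (d.gcd e : ℝ) / e ≤ tau d * (1 + Real.log U) :=
  (sum_le_sum_of_subset_of_nonneg (fun e he => h.mem_Icc hU he)
    (fun _ _ _ => by positivity)).trans (sum_gcd_div_le d U hd)

lemma IsSieve.norm_sieveSum_le {I : Finset ℕ} {c : ℕ → ℝ} {U : ℕ} (h : IsSieve I c U)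
    (hU : 1 ≤ U) (d a : ℕ) (hd : d ≠ 0) (ha : a.Coprime d)
    (hdU : (d : ℝ) ≤ (U : ℝ) ^ (1.1 : ℝ)) :
    ‖sieveSum I c U ((a : ℝ) / d)‖ ^ 2 ≤
      12 * (1 + Real.log d) * tau d ^ 3 * (1 + Real.log U) ^ 2 * U ^ 2 *
        (d : ℝ) ^ (-0.4 : ℝ) := by
  have hU0 : (1 : ℝ) ≤ U := by exact_mod_cast hU
  have hd1 : (1 : ℝ) ≤ d := by exact_mod_cast Nat.one_le_iff_ne_zero.mpr hd
  have hdp : (0 : ℝ) < d := by linarith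
  have hlogd : 0 ≤ Real.log d := Real.log_natCast_nonneg _
  have hlogU : 0 ≤ Real.log U := Real.log_natCast_nonneg _
  have htau : (1 : ℝ) ≤ tau d := by exact_mod_cast tau_pos hd
  set b : ℝ := 12 * (1 + Real.log d) * tau d * (d : ℝ) ^ (-0.4 : ℝ) with hb
  have hb0 : 0 ≤ b := by positivity
  have hdpow : (d : ℝ) ^ (0.9 : ℝ) ≤ (U : ℝ) ^ (0.99 : ℝ) := by
    calc (d : ℝ) ^ (0.9 : ℝ) ≤ ((U : ℝ) ^ (1.1 : ℝ)) ^ (0.9 : ℝ) := by gcongr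
      _ = _ := by rw [← Real.rpow_mul (by linarith)]; norm_num
  have key : ∀ e ∈ I, ‖cubeSum (U / e) (e ^ 3 * ((a : ℝ) / d))‖ ≤
      Real.sqrt b * U * ((d.gcd e : ℝ) / e) := by
    intro e he
    have he0 : (0 : ℝ) < e := by exact_mod_cast h.pos e he
    have hg1 : (1 : ℝ) ≤ d.gcd e := by
      exact_mod_cast Nat.gcd_pos_of_pos_left _ (Nat.pos_of_ne_zero hd)
    have hX := hdpow.trans (h.rpow_le_div hU he)
    set X : ℝ := U / e with hXd
    have hX0 : 0 < X := by positivity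
    have hMX : ((U / e : ℕ) : ℝ) ≤ X := Nat.cast_div_le
    have hgg : ((d.gcd (e ^ 3) : ℕ) : ℝ) ≤ (d.gcd e : ℝ) ^ 4 := by
      have h1 : d.gcd (e ^ 3) ∣ d.gcd e ^ 3 := by
        have h2 := Nat.gcd_mul_right_dvd_mul_gcd d (e * e) e
        have h3 := Nat.gcd_mul_right_dvd_mul_gcd d e e
        have h4 : e ^ 3 = e * e * e := by ring
        rw [h4, pow_three']
        exact h2.trans (mul_dvd_mul_right h3 _)
      have h5 := Nat.le_of_dvd (pow_pos (Nat.gcd_pos_of_pos_left _ (Nat.pos_of_ne_zero hd)) 3) h1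
      calc ((d.gcd (e ^ 3) : ℕ) : ℝ) ≤ (d.gcd e : ℝ) ^ 3 := by exact_mod_cast h5
        _ ≤ _ := pow_le_pow_right₀ hg1 (by norm_num)
    have hg4 : (1 : ℝ) ≤ (d.gcd e : ℝ) ^ 4 := one_le_pow₀ hg1
    refine le_of_pow_le_pow_left₀ (n := 4) (by norm_num) (by positivity) ?_
    refine (norm_cubeSum_pow_four_le d e (U / e) a hd ha).trans ?_
    have hE : (d : ℝ) ^ (-0.8 : ℝ) = ((d : ℝ) ^ (-0.4 : ℝ)) ^ 2 := by
      rw [← Real.rpow_natCast, ← Real.rpow_mul hdp.le]; norm_num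
    have hq1 : 1 / (d : ℝ) ≤ (d : ℝ) ^ (-0.8 : ℝ) := by
      rw [one_div, ← Real.rpow_neg_one]
      exact Real.rpow_le_rpow_of_exponent_le hd1 (by norm_num)
    have hq2 : 1 ≤ X * (d : ℝ) ^ (-0.8 : ℝ) := by
      calc (1 : ℝ) = (d : ℝ) ^ (0.8 : ℝ) * (d : ℝ) ^ (-0.8 : ℝ) := by
            rw [← Real.rpow_add hdp]; norm_num
        _ ≤ X * (d : ℝ) ^ (-0.8 : ℝ) := by
            gcongr
            exact (Real.rpow_le_rpow_of_exponent_le hd1 (by norm_num)).trans hX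
    have hq3 : (d : ℝ) ≤ X ^ 2 * (d : ℝ) ^ (-0.8 : ℝ) := by
      calc (d : ℝ) = ((d : ℝ) ^ (0.9 : ℝ)) ^ 2 * (d : ℝ) ^ (-0.8 : ℝ) := by
            rw [← Real.rpow_natCast, ← Real.rpow_mul hdp.le, ← Real.rpow_add hdp]; norm_num
        _ ≤ X ^ 2 * (d : ℝ) ^ (-0.8 : ℝ) := by gcongr
    set δ : ℝ := (d : ℝ) ^ (-0.8 : ℝ) with hδ
    have hδ0 : 0 ≤ δ := by positivity
    set γ : ℝ := (d.gcd e : ℝ) ^ 4 with hγ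
    have hT1 : ((U / e : ℕ) : ℝ) ^ 4 * tau d * (d.gcd (e ^ 3) : ℕ) / d ≤ X ^ 4 * tau d * γ * δ := by
      rw [div_eq_mul_one_div]
      gcongr
    have hT2 : ((U / e : ℕ) : ℝ) ^ 3 ≤ X ^ 4 * tau d * γ * δ := by
      calc ((U / e : ℕ) : ℝ) ^ 3 ≤ X ^ 3 := by gcongr
        _ ≤ X ^ 3 * (X * δ) * (tau d * γ) := by
          have h1 : X ^ 3 * 1 ≤ X ^ 3 * (X * δ) := by gcongr
          have h2 : X ^ 3 * (X * δ) * (1 * 1) ≤ X ^ 3 * (X * δ) * (tau d * γ) := by gcongr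
          linarith
        _ = _ := by ring
    have hT3 : ((U / e : ℕ) : ℝ) ^ 2 * d ≤ X ^ 4 * tau d * γ * δ := by
      calc ((U / e : ℕ) : ℝ) ^ 2 * d ≤ X ^ 2 * (X ^ 2 * δ) := by gcongr
        _ ≤ X ^ 2 * (X ^ 2 * δ) * (tau d * γ) := by
          have h2 : X ^ 2 * (X ^ 2 * δ) * (1 * 1) ≤ X ^ 2 * (X ^ 2 * δ) * (tau d * γ) := by gcongr
          linarith
        _ = _ := by ring
    calc _ ≤ 48 * (1 + Real.log d) * (X ^ 4 * tau d * γ * δ + X ^ 4 * tau d * γ * δ +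
          X ^ 4 * tau d * γ * δ) := by gcongr
      _ = 144 * ((1 + Real.log d) * tau d) * δ * (X ^ 4 * γ) := by ring
      _ ≤ 144 * ((1 + Real.log d) * tau d) ^ 2 * δ * (X ^ 4 * γ) := by
          gcongr
          have : (1 : ℝ) ≤ (1 + Real.log d) * tau d := by nlinarith
          nlinarith
      _ = (Real.sqrt b ^ 2) ^ 2 * (X ^ 4 * γ) := by
          rw [Real.sq_sqrt hb0, hb, hE]; ring
      _ = _ := by rw [hXd, hγ]; ring
  have hnorm : ‖sieveSum I c U ((a : ℝ) / d)‖ ≤ Real.sqrt b * U * (tau d * (1 + Real.log U)) := by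
    unfold sieveSum
    calc _ ≤ ∑ e ∈ I, ‖cubeSum (U / e) (e ^ 3 * ((a : ℝ) / d))‖ := by
          refine (norm_sum_le _ _).trans (sum_le_sum fun e he => ?_)
          rw [norm_mul, Complex.norm_real, Real.norm_eq_abs]
          exact mul_le_of_le_one_left (norm_nonneg _) (h.abs_le e he)
      _ ≤ ∑ e ∈ I, Real.sqrt b * U * ((d.gcd e : ℝ) / e) := sum_le_sum key
      _ = Real.sqrt b * U * ∑ e ∈ I, (d.gcd e : ℝ) / e := by rw [mul_sum]
      _ ≤ _ := by gcongr; exact h.sum_gcd_le hU d hd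
  calc _ ≤ (Real.sqrt b * U * (tau d * (1 + Real.log U))) ^ 2 := by gcongr
    _ = Real.sqrt b ^ 2 * U ^ 2 * (tau d * (1 + Real.log U)) ^ 2 := by ring
    _ = _ := by rw [Real.sq_sqrt hb0, hb]; ring

lemma IsSieve.sum_norm_sieveSum_sq_le {I : Finset ℕ} {c : ℕ → ℝ} {U : ℕ} (h : IsSieve I c U)
    (hU : 1 ≤ U) (d : ℕ) (hd : d ≠ 0) (hdU : (d : ℝ) ≤ (U : ℝ) ^ (1.1 : ℝ)) :
    ∑ a ∈ range d, ‖sieveSum I c U ((a : ℝ) / d)‖ ^ 2 ≤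
      2 * (1 + Real.log U) ^ 2 * tau d ^ 3 * U ^ 2 * (d : ℝ) ^ (1.12 : ℝ) / rad d := by
  have hU0 : (1 : ℝ) ≤ U := by exact_mod_cast hU
  have hd1 : (1 : ℝ) ≤ d := by exact_mod_cast Nat.one_le_iff_ne_zero.mpr hd
  have hdp : (0 : ℝ) < d := by linarith
  have hlogU : 0 ≤ Real.log U := Real.log_natCast_nonneg _
  have hrad : (0 : ℝ) < rad d := by exact_mod_cast rad_pos d
  have hdpow : (d : ℝ) ^ (0.88 : ℝ) ≤ (U : ℝ) ^ (0.99 : ℝ) := by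
    calc (d : ℝ) ^ (0.88 : ℝ) ≤ ((U : ℝ) ^ (1.1 : ℝ)) ^ (0.88 : ℝ) := by gcongr
      _ = (U : ℝ) ^ (0.968 : ℝ) := by rw [← Real.rpow_mul (by linarith)]; norm_num
      _ ≤ _ := Real.rpow_le_rpow_of_exponent_le hU0 (by norm_num)
  have hcs : ∀ t : ℝ, ‖sieveSum I c U t‖ ^ 2 ≤
      (1 + Real.log U) * ∑ e ∈ I, e * ‖cubeSum (U / e) (e ^ 3 * t)‖ ^ 2 := by
    intro t
    have h1 : ‖sieveSum I c U t‖ ≤ ∑ e ∈ I, ‖cubeSum (U / e) (e ^ 3 * t)‖ := by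
      refine (norm_sum_le _ _).trans (sum_le_sum fun e he => ?_)
      rw [norm_mul, Complex.norm_real, Real.norm_eq_abs]
      exact mul_le_of_le_one_left (norm_nonneg _) (h.abs_le e he)
    calc _ ≤ (∑ e ∈ I, ‖cubeSum (U / e) (e ^ 3 * t)‖) ^ 2 := by gcongr
      _ ≤ (∑ e ∈ I, 1 / (e : ℝ)) * ∑ e ∈ I, e * ‖cubeSum (U / e) (e ^ 3 * t)‖ ^ 2 := by
          refine sum_sq_le_sum_mul_sum_of_sq_le_mul _ (fun _ _ => by positivity)
            (fun _ _ => by positivity) fun e he => ?_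
          have he0 : (0 : ℝ) < e := by exact_mod_cast h.pos e he
          apply le_of_eq
          field_simp
      _ ≤ _ := by
          gcongr
          exact (sum_le_sum_of_subset_of_nonneg (fun e he => h.mem_Icc hU he)
            (fun _ _ _ => by positivity)).trans (sum_inv_le_one_add_log U)
  calc _ ≤ ∑ a ∈ range d, (1 + Real.log U) *
        ∑ e ∈ I, e * ‖cubeSum (U / e) (e ^ 3 * ((a : ℝ) / d))‖ ^ 2 :=
        sum_le_sum fun a _ => hcs _
    _ = (1 + Real.log U) * ∑ e ∈ I, e * ∑ a ∈ range d,
        ‖cubeSum (U / e) (e ^ 3 * ((a : ℝ) / d))‖ ^ 2 := by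
        rw [← mul_sum, sum_comm]
        simp_rw [mul_sum]
    _ ≤ (1 + Real.log U) * ∑ e ∈ I, (2 * tau d ^ 2 * U ^ 2 * (d : ℝ) ^ (1.12 : ℝ) / rad d) *
        ((d.gcd e : ℝ) / e) := by
        refine mul_le_mul_of_nonneg_left (sum_le_sum fun e he => ?_) (by positivity)
        have he0 : (0 : ℝ) < e := by exact_mod_cast h.pos e he
        have hg1 : (1 : ℝ) ≤ d.gcd e := by
          exact_mod_cast Nat.gcd_pos_of_pos_left _ (Nat.pos_of_ne_zero hd)
        have hX := hdpow.trans (h.rpow_le_div hU he)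
        set X : ℝ := U / e with hXd
        have hX0 : 0 < X := by positivity
        have hMX : ((U / e : ℕ) : ℝ) ≤ X := Nat.cast_div_le
        have hr' : (0 : ℝ) < rad (d / d.gcd (e ^ 3)) := by exact_mod_cast rad_pos _
        have hrr : (rad d : ℝ) ≤ rad (d / d.gcd (e ^ 3)) * d.gcd e := by
          exact_mod_cast rad_le_rad_div_mul d e hd
        have hrd : (rad d : ℝ) ≤ d := by
          exact_mod_cast Nat.le_of_dvd (Nat.pos_of_ne_zero hd) (rad_dvd d)
        have hd12 : (1 : ℝ) ≤ (d : ℝ) ^ (0.12 : ℝ) := Real.one_le_rpow hd1 (by norm_num)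
        have hA : X / rad (d / d.gcd (e ^ 3)) ≤ X * (d.gcd e) * (d : ℝ) ^ (0.12 : ℝ) / rad d := by
          rw [div_le_div_iff₀ hr' hrad]
          calc X * rad d ≤ X * (rad (d / d.gcd (e ^ 3)) * d.gcd e) * 1 := by
                rw [mul_one]; gcongr
            _ ≤ X * (rad (d / d.gcd (e ^ 3)) * d.gcd e) * (d : ℝ) ^ (0.12 : ℝ) := by gcongr
            _ = _ := by ring
        have hB : 1 ≤ X * (d.gcd e) * (d : ℝ) ^ (0.12 : ℝ) / rad d := by
          rw [le_div_iff₀ hrad, one_mul]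
          calc (rad d : ℝ) ≤ (d : ℝ) ^ (0.88 : ℝ) * 1 * (d : ℝ) ^ (0.12 : ℝ) := by
                rw [mul_one, ← Real.rpow_add hdp]; norm_num; exact_mod_cast hrd
            _ ≤ _ := by gcongr
        calc (e : ℝ) * ∑ a ∈ range d, ‖cubeSum (U / e) (e ^ 3 * ((a : ℝ) / d))‖ ^ 2
            ≤ e * (d * ((U / e : ℕ) * (tau d ^ 2 *
              ((U / e : ℕ) / rad (d / d.gcd (e ^ 3)) + 1)))) := by
              gcongr
              exact sum_norm_cubeSum_sq_le d e (U / e) hd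
          _ ≤ e * (d * (X * (tau d ^ 2 * (X / rad (d / d.gcd (e ^ 3)) + 1)))) := by gcongr
          _ ≤ e * (d * (X * (tau d ^ 2 * (X * (d.gcd e) * (d : ℝ) ^ (0.12 : ℝ) / rad d +
              X * (d.gcd e) * (d : ℝ) ^ (0.12 : ℝ) / rad d)))) := by gcongr
          _ = _ := by
              have : (d : ℝ) ^ (1.12 : ℝ) = d * (d : ℝ) ^ (0.12 : ℝ) := by
                rw [← Real.rpow_one_add' (by linarith) (by norm_num)]; norm_num
              rw [this, hXd]
              field_simp
              ring
    _ = (1 + Real.log U) * ((2 * tau d ^ 2 * U ^ 2 * (d : ℝ) ^ (1.12 : ℝ) / rad d) *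
        ∑ e ∈ I, (d.gcd e : ℝ) / e) := by
        congr 1; rw [mul_sum]
    _ ≤ (1 + Real.log U) * ((2 * tau d ^ 2 * U ^ 2 * (d : ℝ) ^ (1.12 : ℝ) / rad d) *
        (tau d * (1 + Real.log U))) := by
        gcongr
        exact h.sum_gcd_le hU d hd
    _ = _ := by ring

lemma tau_pow_mul_log_le : ∃ C : ℝ, 1 ≤ C ∧ ∀ d : ℕ, d ≠ 0 →
    (1 + Real.log d) * (tau d : ℝ) ^ 6 ≤ C * (d : ℝ) ^ (0.03 : ℝ) := by
  obtain ⟨C, hC, h⟩ := tau_le_rpow 0.003 (by norm_num)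
  refine ⟨101 * C ^ 6, by nlinarith [one_le_pow₀ hC (n := 6)], fun d hd => ?_⟩
  have hd1 : (1 : ℝ) ≤ d := by exact_mod_cast Nat.one_le_iff_ne_zero.mpr hd
  have hdp : (0 : ℝ) < d := by linarith
  have h1 : 1 + Real.log d ≤ 101 * (d : ℝ) ^ (0.01 : ℝ) := by
    have h2 := Real.log_le_rpow_div hdp.le (show (0 : ℝ) < 0.01 by norm_num)
    have h3 : (1 : ℝ) ≤ (d : ℝ) ^ (0.01 : ℝ) := Real.one_le_rpow hd1 (by norm_num)
    have h4 : (d : ℝ) ^ (0.01 : ℝ) / 0.01 = 100 * (d : ℝ) ^ (0.01 : ℝ) := by ring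
    linarith
  have h5 : (tau d : ℝ) ^ 6 ≤ C ^ 6 * (d : ℝ) ^ (0.018 : ℝ) := by
    calc (tau d : ℝ) ^ 6 ≤ (C * (d : ℝ) ^ (0.003 : ℝ)) ^ 6 := by gcongr; exact h d hd
      _ = C ^ 6 * (d : ℝ) ^ (0.018 : ℝ) := by
        rw [mul_pow, ← Real.rpow_natCast, ← Real.rpow_natCast, ← Real.rpow_mul hdp.le]; norm_num
  calc _ ≤ 101 * (d : ℝ) ^ (0.01 : ℝ) * (C ^ 6 * (d : ℝ) ^ (0.018 : ℝ)) := by gcongr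
    _ = 101 * C ^ 6 * ((d : ℝ) ^ (0.01 : ℝ) * (d : ℝ) ^ (0.018 : ℝ)) := by ring
    _ = 101 * C ^ 6 * (d : ℝ) ^ (0.028 : ℝ) := by rw [← Real.rpow_add hdp]; norm_num
    _ ≤ _ := by
      exact mul_le_mul_of_nonneg_left
        (Real.rpow_le_rpow_of_exponent_le hd1 (by norm_num)) (by positivity)

/-- Fourth moments of sieve sums over the reduced fractions of denominator `d`. -/
lemma exists_sum_norm_sieveSum_pow_four_le : ∃ C : ℝ, 1 ≤ C ∧ ∀ (I : Finset ℕ) (c : ℕ → ℝ) (U : ℕ),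
    IsSieve I c U → 1 ≤ U → ∀ d : ℕ, d ≠ 0 → (d : ℝ) ≤ (U : ℝ) ^ (1.1 : ℝ) →
    ∑ a ∈ range d with a.Coprime d, ‖sieveSum I c U ((a : ℝ) / d)‖ ^ 4 ≤
      C * (1 + Real.log U) ^ 4 * U ^ 4 * (d : ℝ) ^ (0.75 : ℝ) / rad d := by
  obtain ⟨C, hC, hCd⟩ := tau_pow_mul_log_le
  refine ⟨24 * C, by linarith, fun I c U h hU d hd hdU => ?_⟩
  have hd1 : (1 : ℝ) ≤ d := by exact_mod_cast Nat.one_le_iff_ne_zero.mpr hd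
  have hdp : (0 : ℝ) < d := by linarith
  have hlogd : 0 ≤ Real.log d := Real.log_natCast_nonneg _
  have hlogU : 0 ≤ Real.log U := Real.log_natCast_nonneg _
  have hrad : (0 : ℝ) < rad d := by exact_mod_cast rad_pos d
  set A := 12 * (1 + Real.log d) * tau d ^ 3 * (1 + Real.log U) ^ 2 * U ^ 2 *
        (d : ℝ) ^ (-0.4 : ℝ) with hA
  have hA0 : 0 ≤ A := by positivity
  calc _ ≤ ∑ a ∈ range d with a.Coprime d, A * ‖sieveSum I c U ((a : ℝ) / d)‖ ^ 2 := by
        refine sum_le_sum fun a ha => ?_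
        have := h.norm_sieveSum_le hU d a hd (mem_filter.mp ha).2 hdU
        calc ‖sieveSum I c U ((a : ℝ) / d)‖ ^ 4 = ‖sieveSum I c U ((a : ℝ) / d)‖ ^ 2 *
              ‖sieveSum I c U ((a : ℝ) / d)‖ ^ 2 := by ring
          _ ≤ _ := by gcongr
    _ ≤ ∑ a ∈ range d, A * ‖sieveSum I c U ((a : ℝ) / d)‖ ^ 2 :=
        sum_le_sum_of_subset_of_nonneg (filter_subset _ _) fun _ _ _ => by positivity
    _ = A * ∑ a ∈ range d, ‖sieveSum I c U ((a : ℝ) / d)‖ ^ 2 := by rw [mul_sum]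
    _ ≤ A * (2 * (1 + Real.log U) ^ 2 * tau d ^ 3 * U ^ 2 * (d : ℝ) ^ (1.12 : ℝ) / rad d) := by
        gcongr
        exact h.sum_norm_sieveSum_sq_le hU d hd hdU
    _ = 24 * ((1 + Real.log d) * tau d ^ 6) * ((1 + Real.log U) ^ 4 * U ^ 4) *
        ((d : ℝ) ^ (-0.4 : ℝ) * (d : ℝ) ^ (1.12 : ℝ)) / rad d := by rw [hA]; ring
    _ = 24 * ((1 + Real.log d) * tau d ^ 6) * ((1 + Real.log U) ^ 4 * U ^ 4) *
        (d : ℝ) ^ (0.72 : ℝ) / rad d := by rw [← Real.rpow_add hdp]; norm_num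
    _ ≤ 24 * (C * (d : ℝ) ^ (0.03 : ℝ)) * ((1 + Real.log U) ^ 4 * U ^ 4) *
        (d : ℝ) ^ (0.72 : ℝ) / rad d := by
        have := hCd d hd
        refine div_le_div_of_nonneg_right ?_ hrad.le
        refine mul_le_mul_of_nonneg_right ?_ (by positivity)
        refine mul_le_mul_of_nonneg_right ?_ (by positivity)
        linarith
    _ = 24 * C * ((1 + Real.log U) ^ 4 * U ^ 4) *
        ((d : ℝ) ^ (0.03 : ℝ) * (d : ℝ) ^ (0.72 : ℝ)) / rad d := by ring
    _ = _ := by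
        rw [← Real.rpow_add hdp]
        norm_num
        ring

/-- Quadruples from a set of natural numbers. -/
def quad (A : Finset ℕ) : Finset ((ℕ × ℕ) × ℕ × ℕ) := (A ×ˢ A) ×ˢ A ×ˢ A

/-- The form `z₁³ + z₂³ - z₃³ - z₄³`. -/
def Phi (z : (ℕ × ℕ) × ℕ × ℕ) : ℤ :=
  ((z.1.1 : ℤ) ^ 3 + (z.1.2 : ℤ) ^ 3) - ((z.2.1 : ℤ) ^ 3 + (z.2.2 : ℤ) ^ 3)

lemma mem_quad {A : Finset ℕ} {z : (ℕ × ℕ) × ℕ × ℕ} :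
    z ∈ quad A ↔ (z.1.1 ∈ A ∧ z.1.2 ∈ A) ∧ z.2.1 ∈ A ∧ z.2.2 ∈ A := by
  simp only [quad, mem_product]

lemma sum_norm_esum_pow_four (S : Finset ℕ) (c : ℕ → ℝ) (N : ℕ) (hN : 0 < N) :
    ∑ b ∈ range N, ‖esum S c (fun x => (x : ℤ) ^ 3) ((b : ℝ) / N)‖ ^ 4 =
      N * ∑ z ∈ quad S with (N : ℤ) ∣ Phi z, c z.1.1 * c z.1.2 * (c z.2.1 * c z.2.2) := by
  have h := sum_norm_esum_sq (S ×ˢ S) (fun x : ℕ × ℕ => c x.1 * c x.2)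
    (fun x : ℕ × ℕ => (x.1 : ℤ) ^ 3 + (x.2 : ℤ) ^ 3) N hN
  simp_rw [← esum_mul S S c c (fun x => (x : ℤ) ^ 3) (fun x => (x : ℤ) ^ 3)] at h
  have h2 : ∀ t : ℝ, ‖esum S c (fun x => (x : ℤ) ^ 3) t * esum S c (fun x => (x : ℤ) ^ 3) t‖ ^ 2 =
      ‖esum S c (fun x => (x : ℤ) ^ 3) t‖ ^ 4 := by
    intro t
    rw [norm_mul]; ring
  simp_rw [h2] at h
  exact h

lemma sum_range_le_sum_divisors (F : ℝ → ℝ) (hF : ∀ t, 0 ≤ F t) (r : ℕ) (hr : r ≠ 0) :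
    ∑ b ∈ range r, F ((b : ℝ) / r) ≤
      ∑ d ∈ r.divisors, ∑ a ∈ range d with a.Coprime d, F ((a : ℝ) / d) := by
  rw [← sum_sigma (s := r.divisors) (t := fun d => (range d).filter fun a => a.Coprime d)
    (f := fun x : (_ : ℕ) × ℕ => F ((x.2 : ℝ) / x.1))]
  have hr0 : 0 < r := Nat.pos_of_ne_zero hr
  have hgp : ∀ b : ℕ, 0 < b.gcd r := fun b => Nat.gcd_pos_of_pos_right _ hr0
  have hdiv : ∀ b : ℕ, (b : ℝ) / r = ((b / b.gcd r : ℕ) : ℝ) / ((r / b.gcd r : ℕ) : ℝ) := by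
    intro b
    have hne : ((b.gcd r : ℕ) : ℝ) ≠ 0 := by exact_mod_cast (hgp b).ne'
    rw [Nat.cast_div (Nat.gcd_dvd_left _ _) hne, Nat.cast_div (Nat.gcd_dvd_right _ _) hne]
    rw [div_div_div_cancel_right₀ hne]
  refine sum_le_sum_of_injOn (fun b => ⟨r / b.gcd r, b / b.gcd r⟩) (fun _ _ => hF _) ?_ ?_ ?_
  · intro b hb
    rw [mem_range] at hb
    rw [mem_sigma, mem_filter, mem_range, Nat.mem_divisors]
    refine ⟨⟨Nat.div_dvd_of_dvd (Nat.gcd_dvd_right _ _), hr⟩, ?_,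
      Nat.coprime_div_gcd_div_gcd (hgp b)⟩
    exact Nat.div_lt_div_of_lt_of_dvd (Nat.gcd_dvd_right _ _) hb
  · intro b _ b' _ hbb
    simp only [Sigma.mk.injEq, heq_eq_eq] at hbb
    have h1 := hdiv b
    rw [hbb.1, hbb.2, ← hdiv b'] at h1
    have hrr : (r : ℝ) ≠ 0 := by exact_mod_cast hr
    field_simp at h1
    exact_mod_cast h1
  · intro b _
    exact (congrArg F (hdiv b)).le

lemma norm_sum_periodic_sub_le (f : ℕ → ℂ) (d M : ℕ) (hd : 0 < d) (hf : ∀ n, ‖f n‖ ≤ 1)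
    (hper : ∀ n, f (n + d) = f n) :
    ‖∑ x ∈ Icc 1 M, f x - (M : ℂ) / d * ∑ x ∈ Icc 1 d, f x‖ ≤ 2 * d := by
  have hI : ∀ K : ℕ, ∑ x ∈ Icc 1 K, f x = ∑ i ∈ range K, f (i + 1) := by
    intro K
    induction K with
    | zero => simp
    | succ K ih => rw [sum_Icc_succ_top (by omega), sum_range_succ, ih]
  have hper' : ∀ m n, f (n + d * m) = f n := by
    intro m
    induction m with
    | zero => simp
    | succ m ih => intro n; rw [Nat.mul_succ, ← add_assoc, hper, ih]
  have hfull : ∀ m : ℕ, ∑ i ∈ range (d * m), f (i + 1) = m * ∑ i ∈ range d, f (i + 1) := by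
    intro m
    induction m with
    | zero => simp
    | succ m ih =>
      rw [Nat.mul_succ, sum_range_add, ih]
      have : ∀ x, f (d * m + x + 1) = f (x + 1) := fun x => by
        rw [← hper' m (x + 1)]; congr 1; ring
      simp_rw [this]
      push_cast; ring
  have hb : ∀ K : ℕ, ‖∑ i ∈ range K, f (i + 1)‖ ≤ K := by
    intro K
    refine (norm_sum_le _ _).trans ((sum_le_sum fun i _ => hf (i + 1)).trans ?_)
    simp
  rw [hI, hI]
  set A := ∑ i ∈ range d, f (i + 1) with hA
  have hM : M = d * (M / d) + M % d := (Nat.div_add_mod M d).symm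
  have h1 : ∑ i ∈ range M, f (i + 1) =
      (M / d : ℕ) * A + ∑ i ∈ range (M % d), f (i + 1) := by
    conv_lhs => rw [hM]
    rw [sum_range_add, hfull]
    congr 1
    refine sum_congr rfl fun x _ => ?_
    rw [← hper' (M / d) (x + 1)]; congr 1; ring
  have hdr : (0 : ℝ) < d := by exact_mod_cast hd
  have hlt : ((M % d : ℕ) : ℝ) < d := by exact_mod_cast Nat.mod_lt _ hd
  have h2 : (M : ℂ) / d = (M / d : ℕ) + ((M % d : ℕ) : ℂ) / d := by
    have hdc : (d : ℂ) ≠ 0 := by exact_mod_cast hd.ne'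
    field_simp
    exact_mod_cast hM
  have h3 : ∑ i ∈ range M, f (i + 1) - (M : ℂ) / d * A =
      ∑ i ∈ range (M % d), f (i + 1) - ((M % d : ℕ) : ℂ) / d * A := by
    rw [h1, h2]; ring
  rw [h3]
  refine (norm_sub_le _ _).trans ?_
  rw [norm_mul, norm_div, Complex.norm_natCast, Complex.norm_natCast]
  have h4 := hb (M % d)
  have h5 : ((M % d : ℕ) : ℝ) / d * ‖A‖ ≤ 1 * d := by
    gcongr
    · exact (div_le_one hdr).mpr hlt.le
    · exact hb d
  linarith

lemma ee_cube_periodic (d : ℕ) (hd : 0 < d) (b : ℤ) (n : ℕ) :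
    ee ((b : ℝ) / d * ((n + d : ℕ) : ℝ) ^ 3) = ee ((b : ℝ) / d * (n : ℝ) ^ 3) := by
  rw [← ee_add_int ((b : ℝ) / d * (n : ℝ) ^ 3) (b * (3 * n ^ 2 + 3 * n * d + d ^ 2))]
  congr 1
  have : (d : ℝ) ≠ 0 := by exact_mod_cast hd.ne'
  push_cast
  field_simp
  ring

lemma cubeSum_dilate (d e a : ℕ) (hd : 0 < d) (he : e.Coprime d) :
    cubeSum d (e ^ 3 * ((a : ℝ) / d)) = cubeSum d ((a : ℝ) / d) := by
  have hper : ∀ m n : ℕ, ee ((a : ℝ) / d * ((n + d * m : ℕ) : ℝ) ^ 3) =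
      ee ((a : ℝ) / d * (n : ℝ) ^ 3) := by
    intro m
    induction m with
    | zero => simp
    | succ m ih =>
      intro n
      have := ee_cube_periodic d hd a (n + d * m)
      rw [Nat.mul_succ, ← add_assoc]
      rw [Int.cast_natCast] at this
      rw [this, ih]
  have hI : ∀ f : ℕ → ℂ, f d = f 0 → ∑ x ∈ Icc 1 d, f x = ∑ i ∈ range d, f i := by
    intro f hf
    have h1 : ∑ x ∈ Icc 1 d, f x = ∑ i ∈ range d, f (i + 1) := by
      rw [range_eq_Ico, sum_Ico_add' f 0 d 1]
      rfl
    have h2 := sum_range_succ f d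
    rw [sum_range_succ'] at h2
    rw [h1]
    rw [hf] at h2
    exact add_right_cancel h2
  unfold cubeSum
  have hper0 := hper 1 0
  rw [Nat.mul_one, Nat.zero_add] at hper0
  have hmod : ∀ n : ℕ, ee ((a : ℝ) / d * ((n % d : ℕ) : ℝ) ^ 3) =
      ee ((a : ℝ) / d * (n : ℝ) ^ 3) := by
    intro n
    conv_rhs => rw [← Nat.mod_add_div n d]
    exact (hper _ _).symm
  have hdil : ∀ x : ℕ, ee ((e : ℝ) ^ 3 * ((a : ℝ) / d) * (x : ℝ) ^ 3) =
      ee ((a : ℝ) / d * ((e * x % d : ℕ) : ℝ) ^ 3) := by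
    intro x
    rw [hmod]
    congr 1
    push_cast; ring
  simp only [hdil]
  rw [hI (fun x => ee ((a : ℝ) / d * (x : ℝ) ^ 3)) hper0]
  rw [hI (fun x => ee ((a : ℝ) / d * ((e * x % d : ℕ) : ℝ) ^ 3)) (by simp)]
  have hinj : Set.InjOn (fun x => e * x % d) (range d) := by
    intro x hx y hy hxy
    rw [mem_coe, mem_range] at hx hy
    have h1 : x ≡ y [MOD d] := Nat.ModEq.cancel_left_of_coprime he.symm hxy
    rwa [Nat.ModEq, Nat.mod_eq_of_lt hx, Nat.mod_eq_of_lt hy] at h1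
  have himg : (range d).image (fun x => e * x % d) = range d := by
    refine eq_of_subset_of_card_le ?_ (by rw [card_image_of_injOn hinj])
    intro y hy
    obtain ⟨x, -, rfl⟩ := mem_image.mp hy
    exact mem_range.mpr (Nat.mod_lt _ hd)
  rw [← sum_image (f := fun y : ℕ => ee ((a : ℝ) / d * (y : ℝ) ^ 3)) hinj, himg]

lemma norm_cubeSum_le (M : ℕ) (t : ℝ) : ‖cubeSum M t‖ ≤ M := by
  unfold cubeSum
  refine (norm_sum_le _ _).trans ?_
  simp [norm_ee]

/-- The density of a sieve. -/
noncomputable def sieveDensity (I : Finset ℕ) (c : ℕ → ℝ) : ℝ := ∑ e ∈ I, c e / e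

lemma IsSieve.norm_sieveSum_sub_le {I : Finset ℕ} {c : ℕ → ℝ} {U : ℕ} (h : IsSieve I c U)
    (d a : ℕ) (hd : 0 < d) (hcop : ∀ e ∈ I, e.Coprime d) :
    ‖sieveSum I c U ((a : ℝ) / d) -
      (U * sieveDensity I c : ℝ) * (cubeSum d ((a : ℝ) / d) / d)‖ ≤ I.card * (3 * d) := by
  have hdr : (0 : ℝ) < d := by exact_mod_cast hd
  have hd1 : (1 : ℝ) ≤ d := by exact_mod_cast hd
  have h1 : sieveSum I c U ((a : ℝ) / d) -
      (U * sieveDensity I c : ℝ) * (cubeSum d ((a : ℝ) / d) / d) =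
      ∑ e ∈ I, (c e : ℂ) * (cubeSum (U / e) (e ^ 3 * ((a : ℝ) / d)) -
        (U : ℂ) / e * (cubeSum d ((a : ℝ) / d) / d)) := by
    unfold sieveSum sieveDensity
    simp_rw [mul_sub]
    rw [sum_sub_distrib]
    congr 1
    push_cast
    rw [mul_sum, sum_mul]
    refine sum_congr rfl fun e _ => ?_
    ring
  rw [h1]
  refine (norm_sum_le _ _).trans ?_
  rw [← nsmul_eq_mul, ← sum_const]
  refine sum_le_sum fun e he => ?_
  rw [norm_mul, Complex.norm_real, Real.norm_eq_abs]
  refine (mul_le_of_le_one_left (norm_nonneg _) (h.abs_le e he)).trans ?_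
  have he0 : 0 < e := h.pos e he
  have her : (0 : ℝ) < e := by exact_mod_cast he0
  have h2 := norm_sum_periodic_sub_le
    (fun n => ee (((e ^ 3 * a : ℕ) : ℤ) / d * (n : ℝ) ^ 3)) d (U / e) hd
    (fun n => (norm_ee _).le) (fun n => ee_cube_periodic d hd _ n)
  have h3 : ∀ K : ℕ, ∑ x ∈ Icc 1 K, ee (((e ^ 3 * a : ℕ) : ℤ) / d * (x : ℝ) ^ 3) =
      cubeSum K (e ^ 3 * ((a : ℝ) / d)) := by
    intro K
    unfold cubeSum
    refine sum_congr rfl fun x _ => ?_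
    congr 1
    push_cast; ring
  simp only [h3] at h2
  rw [cubeSum_dilate d e a hd (hcop e he)] at h2
  set A := cubeSum d ((a : ℝ) / d)
  have hA : ‖A‖ ≤ d := norm_cubeSum_le _ _
  have h4 : cubeSum (U / e) (e ^ 3 * ((a : ℝ) / d)) - (U : ℂ) / e * (A / d) =
      (cubeSum (U / e) (e ^ 3 * ((a : ℝ) / d)) - ((U / e : ℕ) : ℂ) / d * A) -
        ((((U : ℝ) / e - (U / e : ℕ) : ℝ) : ℂ) * (A / d)) := by
    push_cast; ring
  have h5 : ‖((((U : ℝ) / e - (U / e : ℕ) : ℝ) : ℂ) * (A / d))‖ ≤ 1 := by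
    rw [norm_mul, Complex.norm_real, Real.norm_eq_abs, norm_div, Complex.norm_natCast]
    have h6 : ((U / e : ℕ) : ℝ) ≤ U / e := Nat.cast_div_le
    have h7 : (U : ℝ) / e < (U / e : ℕ) + 1 := by
      rw [div_lt_iff₀ her]
      have := Nat.lt_mul_div_succ U he0
      rw [mul_comm] at this
      exact_mod_cast this
    rw [abs_of_nonneg (by linarith)]
    have h8 : ‖A‖ / d ≤ 1 := (div_le_one hdr).mpr hA
    have h9 : 0 ≤ ‖A‖ / d := by positivity
    nlinarith
  rw [h4]
  refine (norm_sub_le _ _).trans ?_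
  linarith

/-- The weight of an integer in a sieve. -/
noncomputable def sieveWeight (I : Finset ℕ) (c : ℕ → ℝ) (n : ℕ) : ℝ := ∑ e ∈ I with e ∣ n, c e

/-- A local weight bounding complete fourth moments of cubic sums. -/
noncomputable def localWeight (d : ℕ) : ℝ := (d : ℝ) ^ (0.8 : ℝ) / rad d

/-- The divisor sum of `localWeight`. -/
noncomputable def localSum (r : ℕ) : ℝ := ∑ d ∈ r.divisors, localWeight d

lemma localWeight_nonneg (d : ℕ) : 0 ≤ localWeight d := by unfold localWeight; positivity

lemma localSum_nonneg (r : ℕ) : 0 ≤ localSum r := sum_nonneg fun _ _ => localWeight_nonneg _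

lemma esum_sieveWeight (I : Finset ℕ) (c : ℕ → ℝ) (U : ℕ) (hI : ∀ e ∈ I, 1 ≤ e) (t : ℝ) :
    esum (Icc 1 U) (sieveWeight I c) (fun x => (x : ℤ) ^ 3) t = sieveSum I c U t := by
  unfold esum sieveWeight sieveSum cubeSum
  simp_rw [sum_filter, Complex.ofReal_sum, sum_mul]
  rw [sum_comm]
  refine sum_congr rfl fun e he => ?_
  have he0 : 0 < e := hI e he
  rw [mul_sum]
  symm
  have h1 : ∑ x ∈ Icc 1 U, ((if e ∣ x then c e else 0 : ℝ) : ℂ) * ee (t * ((x : ℤ) ^ 3 : ℤ)) =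
      ∑ x ∈ (Icc 1 U).filter (e ∣ ·), (c e : ℂ) * ee (t * (x : ℝ) ^ 3) := by
    rw [sum_filter]
    refine sum_congr rfl fun x _ => ?_
    split_ifs <;> simp
  rw [h1]
  refine sum_bij (fun m _ => e * m) ?_ ?_ ?_ ?_
  · intro m hm
    rw [mem_Icc] at hm
    rw [mem_filter, mem_Icc]
    refine ⟨⟨Nat.mul_pos he0 hm.1, ?_⟩, dvd_mul_right _ _⟩
    exact (Nat.mul_le_mul_left e hm.2).trans (Nat.mul_div_le U e)
  · intro a _ b _ h
    exact Nat.eq_of_mul_eq_mul_left he0 h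
  · intro x hx
    rw [mem_filter, mem_Icc] at hx
    obtain ⟨⟨h2, h3⟩, m, rfl⟩ := hx
    refine ⟨m, ?_, rfl⟩
    rw [mem_Icc]
    exact ⟨Nat.pos_of_mul_pos_left h2, (Nat.le_div_iff_mul_le he0).mpr (by rwa [mul_comm])⟩
  · intro m _
    congr 2
    push_cast; ring

lemma mul_card_dvd_le (A : Finset ℕ) (θ : ℕ → ℝ) (U : ℕ) (hA : A ⊆ Icc 1 U)
    (h0 : ∀ n ∈ Icc 1 U, 0 ≤ θ n) (h1 : ∀ n ∈ A, 1 ≤ θ n) (r : ℕ) (hr : 0 < r) :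
    (r : ℝ) * ((quad A).filter fun z => (r : ℤ) ∣ Phi z).card ≤
      ∑ b ∈ range r, ‖esum (Icc 1 U) θ (fun x => (x : ℤ) ^ 3) ((b : ℝ) / r)‖ ^ 4 := by
  rw [sum_norm_esum_pow_four _ _ _ hr]
  gcongr
  rw [card_eq_sum_ones, Nat.cast_sum]
  refine (sum_le_sum (g := fun z => θ z.1.1 * θ z.1.2 * (θ z.2.1 * θ z.2.2)) fun z hz => ?_).trans
    (sum_le_sum_of_subset_of_nonneg ?_ fun z hz _ => ?_)
  · have hz := mem_quad.mp (mem_filter.mp hz).1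
    have e1 := one_le_mul_of_one_le_of_one_le (h1 _ hz.1.1) (h1 _ hz.1.2)
    have e2 := one_le_mul_of_one_le_of_one_le (h1 _ hz.2.1) (h1 _ hz.2.2)
    simpa using one_le_mul_of_one_le_of_one_le e1 e2
  · refine filter_subset_filter _ fun z hz => ?_
    have hz := mem_quad.mp hz
    exact mem_quad.mpr ⟨⟨hA hz.1.1, hA hz.1.2⟩, hA hz.2.1, hA hz.2.2⟩
  · have hz := mem_quad.mp (mem_filter.mp hz).1
    exact mul_nonneg (mul_nonneg (h0 _ hz.1.1) (h0 _ hz.1.2))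
      (mul_nonneg (h0 _ hz.2.1) (h0 _ hz.2.2))

lemma log_pow_le_rpow (k : ℕ) (η : ℝ) (hη : 0 < η) : ∃ C : ℝ, 1 ≤ C ∧ ∀ x : ℝ, 1 ≤ x →
    (1 + Real.log x) ^ k ≤ C * x ^ η := by
  rcases Nat.eq_zero_or_pos k with rfl | hk
  · refine ⟨1, le_rfl, fun x hx => ?_⟩
    simpa using Real.one_le_rpow hx hη.le
  have hkr : (0 : ℝ) < k := by exact_mod_cast hk
  refine ⟨(1 + k / η) ^ k, one_le_pow₀ (by linarith [div_pos hkr hη]), fun x hx => ?_⟩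
  have hx0 : (0 : ℝ) < x := by linarith
  have h1 := Real.log_le_rpow_div hx0.le (div_pos hη hkr)
  have h3 : (1 : ℝ) ≤ x ^ (η / k) := Real.one_le_rpow hx (div_pos hη hkr).le
  have h2 : 1 + Real.log x ≤ (1 + k / η) * x ^ (η / k) := by
    have : x ^ (η / k) / (η / k) = k / η * x ^ (η / k) := by field_simp
    linarith
  have h4 : 0 ≤ Real.log x := Real.log_nonneg hx
  calc (1 + Real.log x) ^ k ≤ ((1 + k / η) * x ^ (η / k)) ^ k := by gcongr
    _ = (1 + k / η) ^ k * x ^ η := by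
      rw [mul_pow, ← Real.rpow_natCast (x ^ (η / k)), ← Real.rpow_mul hx0.le]
      congr 2
      field_simp

lemma sum_norm_cubeSum_div_pow_four_le : ∃ C : ℝ, 1 ≤ C ∧ ∀ d : ℕ, d ≠ 0 →
    ∑ a ∈ range d with a.Coprime d, ‖cubeSum d ((a : ℝ) / d) / d‖ ^ 4 ≤ C * localWeight d := by
  obtain ⟨C₁, hC₁, h1⟩ := exists_sum_norm_sieveSum_pow_four_le
  obtain ⟨C₂, hC₂, h2⟩ := log_pow_le_rpow 4 0.05 (by norm_num)
  refine ⟨C₁ * C₂, by nlinarith, fun d hd => ?_⟩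
  have hd1 : (1 : ℝ) ≤ d := by exact_mod_cast Nat.one_le_iff_ne_zero.mpr hd
  have hdp : (0 : ℝ) < d := by linarith
  have hrad : (0 : ℝ) < rad d := by exact_mod_cast rad_pos d
  have hs : IsSieve {1} (fun _ => 1) d :=
    ⟨by simp, by simpa using Real.one_le_rpow hd1 (by norm_num), by simp⟩
  have h3 := h1 {1} (fun _ => 1) d hs (Nat.one_le_iff_ne_zero.mpr hd) d hd (by
    simpa using Real.rpow_le_rpow_of_exponent_le hd1 (show (1 : ℝ) ≤ 1.1 by norm_num))
  have h4 : ∀ t, sieveSum {1} (fun _ => 1) d t = cubeSum d t := by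
    intro t; simp [sieveSum]
  simp_rw [h4] at h3
  simp_rw [norm_div, Complex.norm_natCast, div_pow]
  rw [← sum_div, div_le_iff₀ (by positivity)]
  refine h3.trans ?_
  have h5 := h2 d hd1
  unfold localWeight
  calc C₁ * (1 + Real.log d) ^ 4 * d ^ 4 * (d : ℝ) ^ (0.75 : ℝ) / rad d
      ≤ C₁ * (C₂ * (d : ℝ) ^ (0.05 : ℝ)) * d ^ 4 * (d : ℝ) ^ (0.75 : ℝ) / rad d := by gcongr
    _ = C₁ * C₂ * (((d : ℝ) ^ (0.05 : ℝ) * (d : ℝ) ^ (0.75 : ℝ)) / rad d) * d ^ 4 := by ring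
    _ = _ := by rw [← Real.rpow_add hdp]; norm_num

lemma norm_add_pow_four_le (x y : ℂ) : ‖x‖ ^ 4 ≤ 8 * (‖y‖ ^ 4 + ‖x - y‖ ^ 4) := by
  have h1 : ‖x‖ ≤ ‖y‖ + ‖x - y‖ := by
    have := norm_add_le y (x - y)
    simpa using this
  have h2 := add_pow_le (norm_nonneg y) (norm_nonneg (x - y)) 4
  calc ‖x‖ ^ 4 ≤ (‖y‖ + ‖x - y‖) ^ 4 := by gcongr
    _ ≤ _ := by norm_num at h2; linarith

/-- Quadruples of sifted integers with `z₁³ + z₂³ - z₃³ - z₄³` in the zero class. -/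
lemma exists_card_dvd_le : ∃ C : ℝ, 1 ≤ C ∧ ∀ (I : Finset ℕ) (c : ℕ → ℝ) (U : ℕ) (Y : ℝ)
    (A : Finset ℕ), IsSieve I c U → 1 ≤ U → 1 ≤ Y → Y ≤ (U : ℝ) ^ (0.01 : ℝ) →
    (∀ e ∈ I, ∀ d : ℕ, 1 ≤ d → (d : ℝ) < Y → e.Coprime d) → A ⊆ Icc 1 U →
    (∀ n ∈ Icc 1 U, 0 ≤ sieveWeight I c n) → (∀ n ∈ A, 1 ≤ sieveWeight I c n) →
    ∀ r : ℕ, 1 ≤ r → (r : ℝ) ≤ (U : ℝ) ^ (1.1 : ℝ) →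
    (((quad A).filter fun z => (r : ℤ) ∣ Phi z).card : ℝ) ≤
      C * (sieveDensity I c ^ 4 + (U : ℝ) ^ (-3.8 : ℝ) + (1 + Real.log U) ^ 4 * Y ^ (-0.05 : ℝ)) *
        (U ^ 4 / r * localSum r) := by
  obtain ⟨C₁, hC₁, h1⟩ := exists_sum_norm_sieveSum_pow_four_le
  obtain ⟨C₂, hC₂, h2⟩ := sum_norm_cubeSum_div_pow_four_le
  refine ⟨C₁ + 8 * C₂ + 8 * 81, by linarith, ?_⟩
  intro I c U Y A hI hU hY hYU hcop hA h0 h1A r hr hrU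
  set D := sieveDensity I c with hD
  have hU1 : (1 : ℝ) ≤ U := by exact_mod_cast hU
  have hUp : (0 : ℝ) < U := by linarith
  have hrp : (0 : ℝ) < r := by exact_mod_cast hr
  have hYp : (0 : ℝ) < Y := by linarith
  have hlogU : 0 ≤ Real.log U := Real.log_natCast_nonneg _
  set C := C₁ + 8 * C₂ + 8 * 81 with hC
  set K := D ^ 4 + (U : ℝ) ^ (-3.8 : ℝ) + (1 + Real.log U) ^ 4 * Y ^ (-0.05 : ℝ) with hK
  have hQ : ∀ d ∈ r.divisors,
      ∑ a ∈ range d with a.Coprime d, ‖sieveSum I c U ((a : ℝ) / d)‖ ^ 4 ≤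
        C * K * U ^ 4 * localWeight d := by
    intro d hd
    have hd0 : d ≠ 0 := (Nat.pos_of_mem_divisors hd).ne'
    have hd1 : (1 : ℝ) ≤ d := by exact_mod_cast Nat.one_le_iff_ne_zero.mpr hd0
    have hdp : (0 : ℝ) < d := by linarith
    have hrad : (0 : ℝ) < rad d := by exact_mod_cast rad_pos d
    have hw := localWeight_nonneg d
    have hdr : (d : ℝ) ≤ r := by exact_mod_cast Nat.divisor_le hd
    have hD4 : 0 ≤ D ^ 4 := by positivity
    have hU39 : 0 ≤ (U : ℝ) ^ (-3.8 : ℝ) := by positivity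
    have hY05 : 0 ≤ (1 + Real.log U) ^ 4 * Y ^ (-0.05 : ℝ) := by positivity
    rcases le_or_gt Y d with hdY | hdY
    · refine (h1 I c U hI hU d hd0 (hdr.trans hrU)).trans ?_
      have e1 : (d : ℝ) ^ (0.75 : ℝ) ≤ Y ^ (-0.05 : ℝ) * (d : ℝ) ^ (0.8 : ℝ) := by
        have : (d : ℝ) ^ (0.75 : ℝ) = (d : ℝ) ^ (-0.05 : ℝ) * (d : ℝ) ^ (0.8 : ℝ) := by
          rw [← Real.rpow_add hdp]; norm_num
        rw [this]
        exact mul_le_mul_of_nonneg_right (Real.rpow_le_rpow_of_nonpos hYp hdY (by norm_num))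
          (by positivity)
      calc C₁ * (1 + Real.log U) ^ 4 * U ^ 4 * (d : ℝ) ^ (0.75 : ℝ) / rad d
          ≤ C₁ * (1 + Real.log U) ^ 4 * U ^ 4 * (Y ^ (-0.05 : ℝ) * (d : ℝ) ^ (0.8 : ℝ)) / rad d := by
            gcongr
        _ = C₁ * ((1 + Real.log U) ^ 4 * Y ^ (-0.05 : ℝ)) * U ^ 4 * localWeight d := by
            unfold localWeight; ring
        _ ≤ _ := by
            gcongr
            · rw [hC]; linarith
            · rw [hK]; linarith
    · have hcd : ∀ e ∈ I, e.Coprime d := fun e he =>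
        hcop e he d (Nat.one_le_iff_ne_zero.mpr hd0) hdY
      have hcard : (I.card : ℝ) ≤ (U : ℝ) ^ (0.01 : ℝ) := by
        have hsub : I ⊆ Icc 1 ⌊(U : ℝ) ^ (0.01 : ℝ)⌋₊ := by
          intro e he
          rw [mem_Icc]
          exact ⟨hI.pos e he, Nat.le_floor (hI.le e he)⟩
        have := card_le_card hsub
        rw [Nat.card_Icc, Nat.add_sub_cancel] at this
        calc (I.card : ℝ) ≤ (⌊(U : ℝ) ^ (0.01 : ℝ)⌋₊ : ℝ) := by exact_mod_cast this
          _ ≤ _ := Nat.floor_le (by positivity)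
      have hdU : (d : ℝ) ≤ (U : ℝ) ^ (0.01 : ℝ) := hdY.le.trans hYU
      set u := (U : ℝ) ^ (0.01 : ℝ) with hu
      have hu0 : 0 < u := by positivity
      calc _ ≤ ∑ a ∈ range d with a.Coprime d, 8 * ((U * D) ^ 4 *
            ‖cubeSum d ((a : ℝ) / d) / d‖ ^ 4 + (3 * u ^ 2) ^ 4) := by
            refine sum_le_sum fun a _ => ?_
            refine (norm_add_pow_four_le _
              ((U * D : ℝ) * (cubeSum d ((a : ℝ) / d) / d))).trans ?_
            rw [norm_mul _ (cubeSum d ((a : ℝ) / d) / d), mul_pow ‖((U * D : ℝ) : ℂ)‖,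
              Complex.norm_real, Real.norm_eq_abs]
            have e1 : |(U * D : ℝ)| ^ 4 = (U * D) ^ 4 := Even.pow_abs (by decide) _
            rw [e1]
            have e2 := hI.norm_sieveSum_sub_le d a (Nat.pos_of_ne_zero hd0) hcd
            have e3 : (I.card : ℝ) * (3 * d) ≤ 3 * u ^ 2 := by
              calc (I.card : ℝ) * (3 * d) ≤ u * (3 * u) := by gcongr
                _ = _ := by ring
            gcongr
            exact e2.trans e3
        _ ≤ 8 * (U * D) ^ 4 * ∑ a ∈ range d with a.Coprime d, ‖cubeSum d ((a : ℝ) / d) / d‖ ^ 4 +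
              8 * 81 * u ^ 9 := by
            have e1 : ((range d).filter fun a => a.Coprime d).card * (8 * 81 * u ^ 8) ≤
                8 * 81 * u ^ 9 := by
              have : (((range d).filter fun a => a.Coprime d).card : ℝ) ≤ u := by
                refine le_trans ?_ hdU
                exact_mod_cast (card_filter_le _ _).trans (by simp)
              calc _ ≤ u * (8 * 81 * u ^ 8) := by gcongr
                _ = _ := by ring
            refine le_trans (le_of_eq ?_) (add_le_add_right e1 _)
            simp_rw [mul_add, sum_add_distrib, sum_const, nsmul_eq_mul, mul_sum]
            congr 1
            · exact sum_congr rfl fun a _ => by ring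
            · ring
        _ ≤ 8 * (U * D) ^ 4 * (C₂ * localWeight d) +
              8 * 81 * ((U : ℝ) ^ (-3.8 : ℝ) * U ^ 4 * localWeight d) := by
            have e1 : u ^ 9 ≤ (U : ℝ) ^ (-3.8 : ℝ) * U ^ 4 * localWeight d := by
              have e2 : (U : ℝ) ^ (-0.01 : ℝ) ≤ localWeight d := by
                unfold localWeight
                rw [le_div_iff₀ hrad]
                have hrd : (rad d : ℝ) ≤ d := by
                  exact_mod_cast Nat.le_of_dvd (Nat.pos_of_ne_zero hd0) (rad_dvd d)
                calc (U : ℝ) ^ (-0.01 : ℝ) * rad d ≤ (U : ℝ) ^ (-0.01 : ℝ) * u := by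
                      gcongr; exact hrd.trans hdU
                  _ = 1 := by rw [hu, ← Real.rpow_add hUp]; norm_num
                  _ ≤ _ := Real.one_le_rpow hd1 (by norm_num)
              calc u ^ 9 = (U : ℝ) ^ (0.09 : ℝ) := by
                    rw [hu, ← Real.rpow_natCast, ← Real.rpow_mul hUp.le]; norm_num
                _ ≤ (U : ℝ) ^ (0.19 : ℝ) := Real.rpow_le_rpow_of_exponent_le hU1 (by norm_num)
                _ = (U : ℝ) ^ (-3.8 : ℝ) * U ^ 4 * (U : ℝ) ^ (-0.01 : ℝ) := by
                    rw [← Real.rpow_natCast, ← Real.rpow_add hUp, ← Real.rpow_add hUp]; norm_num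
                _ ≤ _ := by gcongr
            have e3 := h2 d hd0
            have e4 : 0 ≤ 8 * (U * D) ^ 4 := by positivity
            exact add_le_add (mul_le_mul_of_nonneg_left e3 e4) (by linarith)
        _ = (8 * C₂ * D ^ 4 + 8 * 81 * (U : ℝ) ^ (-3.8 : ℝ)) * U ^ 4 * localWeight d := by ring
        _ ≤ _ := by
            gcongr
            rw [hC, hK]
            nlinarith
  have h3 := mul_card_dvd_le A (sieveWeight I c) U hA h0 h1A r hr
  simp_rw [esum_sieveWeight I c U hI.pos] at h3
  have h4 := sum_range_le_sum_divisors (fun t => ‖sieveSum I c U t‖ ^ 4) (fun _ => by positivity) r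
    (by omega)
  have h5 := (h3.trans h4).trans (sum_le_sum hQ)
  rw [← mul_sum] at h5
  rw [← localSum] at h5
  rw [mul_comm, ← le_div_iff₀ hrp] at h5
  refine h5.trans (le_of_eq ?_)
  ring

/-- `n` is nonzero and its prime factors are at most `N`. -/
def Smooth (N n : ℕ) : Prop := n ≠ 0 ∧ ∀ p ∈ n.primeFactors, p ≤ N

lemma Smooth.of_dvd {N m n : ℕ} (h : Smooth N n) (hd : m ∣ n) : Smooth N m :=
  ⟨ne_zero_of_dvd_ne_zero h.1 hd, fun p hp => h.2 p (Nat.primeFactors_mono hd h.1 hp)⟩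

lemma Smooth.exists_dvd {N n D : ℕ} (h : Smooth N n) (hD : 1 ≤ D) (hn : D < n) :
    ∃ e, e ∣ n ∧ D < e ∧ e ≤ D * N := by
  have hex : ∃ e, e ∣ n ∧ D < e := ⟨n, dvd_rfl, hn⟩
  obtain ⟨h1, h2⟩ := Nat.find_spec hex
  set e := Nat.find hex with he
  refine ⟨e, h1, h2, ?_⟩
  have hp := Nat.minFac_prime (show e ≠ 1 by omega)
  have hpe := Nat.minFac_dvd e
  have h3 : e / e.minFac ≤ D := by
    by_contra! hcon
    have h4 := Nat.find_min hex (m := e / e.minFac) (Nat.div_lt_self (by omega) hp.one_lt)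
    exact h4 ⟨(Nat.div_dvd_of_dvd hpe).trans h1, hcon⟩
  have h4 : e.minFac ≤ N := h.2 _ (Nat.mem_primeFactors.mpr ⟨hp, hpe.trans h1, h.1⟩)
  calc e = e / e.minFac * e.minFac := (Nat.div_mul_cancel hpe).symm
    _ ≤ _ := Nat.mul_le_mul h3 h4

/-- A smooth number has a divisor of controlled size carrying many divisors. -/
lemma Smooth.exists_dvd_tau_le {N D : ℕ} (hN : 1 ≤ N) (hD : 1 ≤ D) (J : ℕ) : ∀ {n : ℕ},
    Smooth N n → D < n → n ≤ D ^ (J + 2) →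
    ∃ e, e ∣ n ∧ D < e ∧ e ≤ D ^ 2 * N ∧ tau n ≤ tau e ^ (J + 1) := by
  induction J with
  | zero =>
    intro n hs h1 h2
    refine ⟨n, dvd_rfl, h1, ?_, by simp⟩
    calc n ≤ D ^ 2 * 1 := by simpa using h2
      _ ≤ _ := Nat.mul_le_mul_left _ hN
  | succ J ih =>
    intro n hs h1 h2
    obtain ⟨e, he, h3, h4⟩ := hs.exists_dvd hD h1
    have he0 : e ≠ 0 := by omega
    have h5 : n / e ≤ D ^ (J + 2) := by
      refine Nat.div_le_of_le_mul ?_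
      calc n ≤ D * D ^ (J + 2) := by rw [← pow_succ']; exact h2
        _ ≤ _ := Nat.mul_le_mul_right _ h3.le
    have hne : n = e * (n / e) := (Nat.mul_div_cancel' he).symm
    rcases le_or_gt (n / e) D with h6 | h6
    · refine ⟨n, dvd_rfl, h1, ?_, Nat.le_self_pow (by omega) _⟩
      calc n = e * (n / e) := hne
        _ ≤ D * N * D := Nat.mul_le_mul h4 h6
        _ = _ := by ring
    · obtain ⟨k, hk, h7, h8, h9⟩ := ih (hs.of_dvd (Nat.div_dvd_of_dvd he)) h6 h5
      have h10 : tau n ≤ tau e * tau k ^ (J + 1) := by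
        calc tau n = tau (e * (n / e)) := by rw [← hne]
          _ ≤ _ := (tau_mul_le _ _).trans (Nat.mul_le_mul_left _ h9)
      rcases le_total (tau e) (tau k) with h11 | h11
      · refine ⟨k, hk.trans (Nat.div_dvd_of_dvd he), h7, h8, h10.trans ?_⟩
        rw [pow_succ' _ (J + 1)]
        exact Nat.mul_le_mul_right _ h11
      · refine ⟨e, he, h3, h4.trans ?_, h10.trans ?_⟩
        · rw [sq]; exact Nat.mul_le_mul_right _ (Nat.le_mul_of_pos_left _ hD)
        · rw [pow_succ' _ (J + 1)]
          exact Nat.mul_le_mul_left _ (Nat.pow_le_pow_left h11 _)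

/-- Splitting off the rough part of an integer. -/
lemma exists_smooth_mul (N : ℕ) (n : ℕ) : n ≠ 0 →
    ∃ a b k, n = a * b ∧ Smooth N a ∧ N ^ k ≤ b ∧ tau b ≤ 2 ^ k := by
  induction n using induction_on_primes with
  | zero => intro h; exact absurd rfl h
  | one => exact fun _ => ⟨1, 1, 0, rfl, ⟨one_ne_zero, by simp⟩, by simp, by simp [tau]⟩
  | prime_mul p n hp ih =>
    intro h
    have hn : n ≠ 0 := fun h0 => h (by simp [h0])
    obtain ⟨a, b, k, rfl, ha, hb, hk⟩ := ih hn
    rcases le_or_gt p N with h1 | h1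
    · refine ⟨p * a, b, k, (mul_assoc _ _ _).symm, ⟨mul_ne_zero hp.ne_zero ha.1, ?_⟩, hb, hk⟩
      intro q hq
      rw [Nat.primeFactors_mul hp.ne_zero ha.1, mem_union, hp.primeFactors, mem_singleton] at hq
      rcases hq with rfl | hq
      · exact h1
      · exact ha.2 q hq
    · refine ⟨a, p * b, k + 1, by ring, ha, ?_, ?_⟩
      · rw [pow_succ']; exact Nat.mul_le_mul h1.le hb
      · have : tau p = 2 := by unfold tau; rw [hp.divisors, card_pair hp.one_lt.ne]
        rw [pow_succ']
        exact (tau_mul_le _ _).trans (Nat.mul_le_mul this.le hk)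

lemma tau_prime_pow {p : ℕ} (hp : p.Prime) (k : ℕ) : tau (p ^ k) = k + 1 := by
  unfold tau
  rw [Nat.divisors_prime_pow hp, card_map, card_range]

lemma tau_mul {m n : ℕ} (h : m.Coprime n) : tau (m * n) = tau m * tau n :=
  Nat.Coprime.card_divisors_mul h

lemma rad_mul {m n : ℕ} (h : m.Coprime n) : rad (m * n) = rad m * rad n := by
  unfold rad
  rw [h.primeFactors_mul, prod_union h.disjoint_primeFactors]

lemma rad_prime_pow {p : ℕ} (hp : p.Prime) (k : ℕ) : rad (p ^ (k + 1)) = p := by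
  unfold rad
  rw [Nat.primeFactors_prime_pow (by omega) hp, prod_singleton]

lemma sum_primesUpTo_rpow_le (s : ℝ) (hs : s < -1) :
    ∃ C : ℝ, 0 ≤ C ∧ ∀ N, ∑ p ∈ primesUpTo N, (p : ℝ) ^ s ≤ C := by
  refine ⟨∑' n : ℕ, (n : ℝ) ^ s, tsum_nonneg fun _ => by positivity, fun N => ?_⟩
  exact (Real.summable_nat_rpow.mpr hs).sum_le_tsum _ fun _ _ => by positivity

/-- Convergence of `∑ n ^ (-δ) / rad n`. -/
lemma sum_rpow_div_rad_le (δ : ℝ) (hδ : 0 < δ) :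
    ∃ C : ℝ, 1 ≤ C ∧ ∀ M : ℕ, ∑ n ∈ Icc 1 M, (n : ℝ) ^ (-δ) / rad n ≤ C := by
  obtain ⟨C, hC, h1⟩ := sum_primesUpTo_rpow_le (-1 - δ) (by linarith)
  set q : ℝ := (2 : ℝ) ^ (-δ) with hq
  have hq0 : 0 < q := by positivity
  have hq1 : q < 1 := Real.rpow_lt_one_of_one_lt_of_neg (by norm_num) (by linarith)
  refine ⟨Real.exp (C / (1 - q)), Real.one_le_exp (div_nonneg hC (by linarith)), fun M => ?_⟩
  have hpow : ∀ {p : ℕ}, p.Prime → ∀ k : ℕ, ((p ^ (k + 1) : ℕ) : ℝ) ^ (-δ) / rad (p ^ (k + 1)) ≤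
      (p : ℝ) ^ (-1 - δ) * q ^ k := by
    intro p hp k
    have hp0 : (0 : ℝ) < p := by exact_mod_cast hp.pos
    have hp2 : (2 : ℝ) ≤ p := by exact_mod_cast hp.two_le
    have h2 : ((p : ℝ) ^ (-δ)) ^ k ≤ q ^ k := by
      refine pow_le_pow_left₀ (by positivity) ?_ _
      exact Real.rpow_le_rpow_of_nonpos (by norm_num) hp2 (by linarith)
    rw [rad_prime_pow hp, Nat.cast_pow, ← Real.rpow_natCast, ← Real.rpow_mul hp0.le,
      mul_comm ((k + 1 : ℕ) : ℝ), Real.rpow_mul hp0.le, Real.rpow_natCast, pow_succ]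
    calc ((p : ℝ) ^ (-δ)) ^ k * (p : ℝ) ^ (-δ) / p = (p : ℝ) ^ (-1 - δ) * ((p : ℝ) ^ (-δ)) ^ k := by
          rw [show (-1 - δ) = -δ - 1 by ring, Real.rpow_sub_one hp0.ne']; ring
      _ ≤ _ := by gcongr
  have hgeo := summable_geometric_of_lt_one hq0.le hq1
  have hsumm : ∀ {p : ℕ}, p.Prime → Summable fun k : ℕ =>
      (((p ^ k : ℕ) : ℝ) ^ (-δ) / rad (p ^ k)) := by
    intro p hp
    rw [← summable_nat_add_iff 1]
    exact Summable.of_nonneg_of_le (fun _ => by positivity) (hpow hp) (hgeo.mul_left _)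
  refine (sum_smooth_le_exp (fun n => (n : ℝ) ^ (-δ) / rad n) (fun n => by positivity)
    (by simp [rad]) ?_ hsumm M (fun p => (p : ℝ) ^ (-1 - δ) * (1 - q)⁻¹) ?_ _ ?_).trans ?_
  · intro m n h
    rw [rad_mul h]
    push_cast
    rw [Real.mul_rpow (by positivity) (by positivity)]
    ring
  · intro p hp
    have hp := (mem_primesUpTo.mp hp).1
    rw [(hsumm hp).tsum_eq_zero_add]
    simp only [pow_zero, Nat.cast_one, Real.one_rpow]
    have h3 : ((rad 1 : ℕ) : ℝ) = 1 := by simp [rad]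
    rw [h3, div_one]
    gcongr
    rw [← tsum_geometric_of_lt_one hq0.le hq1, ← tsum_mul_left]
    exact Summable.tsum_le_tsum (hpow hp) ((summable_nat_add_iff 1).mpr (hsumm hp))
      (hgeo.mul_left _)
  · intro n hn
    rw [mem_Icc] at hn
    exact ⟨by omega, fun p hp => (Nat.le_of_mem_primeFactors hp).trans hn.2⟩
  · rw [← sum_mul, ← div_eq_mul_inv]
    have : 0 < 1 - q := by linarith
    gcongr
    exact h1 M

/-- Rankin's bound for sums of powers of the divisor function over smooth numbers. -/
lemma sum_smooth_tau_pow_le (J : ℕ) (B : ℝ) (hB : 0 ≤ B) : ∃ C : ℝ, 1 ≤ C ∧ ∀ N : ℕ, 1 ≤ N →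
    ∀ σ : ℝ, 0 ≤ σ → σ ≤ 1 / 4 → σ * Real.log N ≤ B → ∀ S : Finset ℕ, (∀ n ∈ S, Smooth N n) →
    ∑ n ∈ S, (tau n : ℝ) ^ J * (n : ℝ) ^ (σ - 1) ≤ C * (1 + Real.log N) ^ (5 * 2 ^ J) := by
  obtain ⟨C₁, hC₁, h1⟩ := sum_primesUpTo_rpow_le (-3 / 2) (by norm_num)
  set q : ℝ := (2 : ℝ) ^ (-3 / 4 : ℝ) with hq
  have hq0 : 0 < q := by positivity
  have hq1 : q < 1 := Real.rpow_lt_one_of_one_lt_of_neg (by norm_num) (by norm_num)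
  have hgeo : Summable fun k : ℕ => ((k + 3 : ℕ) : ℝ) ^ J * q ^ (k + 3) :=
    (summable_nat_add_iff 3).mpr
      (summable_pow_mul_geometric_of_norm_lt_one (R := ℝ) J (r := q)
        (by rw [Real.norm_eq_abs, abs_of_pos hq0]; exact hq1))
  have hgeo2 : Summable fun k : ℕ => ((k : ℝ) + 3) ^ J * q ^ k := by
    refine (hgeo.mul_left (q ^ 3)⁻¹).congr fun k => ?_
    push_cast
    field_simp
    ring
  set A := ∑' k : ℕ, ((k : ℝ) + 3) ^ J * q ^ k with hA
  have hA0 : 0 ≤ A := tsum_nonneg fun _ => by positivity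
  set E := 2 ^ J * 13 + 2 ^ J * (Real.exp B * (5 * (1 + B))) + C₁ * A with hE
  refine ⟨Real.exp E, Real.one_le_exp (by positivity), ?_⟩
  intro N hN σ hσ0 hσ hσB S hS
  have hN1 : (1 : ℝ) ≤ N := by exact_mod_cast hN
  have hlN : 0 ≤ Real.log N := Real.log_natCast_nonneg N
  set f : ℕ → ℝ := fun n => (tau n : ℝ) ^ J * (n : ℝ) ^ (σ - 1) with hf
  have hfpow : ∀ {p : ℕ}, p.Prime → ∀ k : ℕ,
      f (p ^ k) = ((k : ℝ) + 1) ^ J * ((p : ℝ) ^ (σ - 1)) ^ k := by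
    intro p hp k
    simp only [hf]
    rw [tau_prime_pow hp, Nat.cast_pow, ← Real.rpow_natCast (p : ℝ), ← Real.rpow_mul (by positivity),
      mul_comm (k : ℝ) (σ - 1), Real.rpow_mul (by positivity), Real.rpow_natCast]
    push_cast
    rfl
  have hx : ∀ {p : ℕ}, p.Prime → (p : ℝ) ^ (σ - 1) ≤ (p : ℝ) ^ (-3 / 4 : ℝ) ∧
      (p : ℝ) ^ (-3 / 4 : ℝ) ≤ q := by
    intro p hp
    have hp2 : (2 : ℝ) ≤ p := by exact_mod_cast hp.two_le
    exact ⟨Real.rpow_le_rpow_of_exponent_le (by linarith) (by linarith),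
      Real.rpow_le_rpow_of_nonpos (by norm_num) hp2 (by norm_num)⟩
  have hf2 : ∀ {p : ℕ}, p.Prime → ∀ k : ℕ,
      f (p ^ (k + 2)) ≤ (p : ℝ) ^ (-3 / 2 : ℝ) * (((k : ℝ) + 3) ^ J * q ^ k) := by
    intro p hp k
    have hp0 : (0 : ℝ) < p := by exact_mod_cast hp.pos
    obtain ⟨h2, h3⟩ := hx hp
    have h4 : ((p : ℝ) ^ (σ - 1)) ^ 2 ≤ (p : ℝ) ^ (-3 / 2 : ℝ) := by
      calc _ ≤ ((p : ℝ) ^ (-3 / 4 : ℝ)) ^ 2 := by gcongr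
        _ = _ := by rw [← Real.rpow_natCast, ← Real.rpow_mul hp0.le]; norm_num
    have h5 : ((p : ℝ) ^ (σ - 1)) ^ k ≤ q ^ k := by gcongr; exact h2.trans h3
    rw [hfpow hp]
    calc _ = ((p : ℝ) ^ (σ - 1)) ^ 2 * (((k : ℝ) + 3) ^ J * ((p : ℝ) ^ (σ - 1)) ^ k) := by
          push_cast; ring
      _ ≤ _ := by gcongr
  have hsumm : ∀ {p : ℕ}, p.Prime → Summable fun k : ℕ => f (p ^ k) := by
    intro p hp
    rw [← summable_nat_add_iff 2]
    refine Summable.of_nonneg_of_le (fun _ => by simp only [hf]; positivity) (hf2 hp)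
      (hgeo2.mul_left _)
  refine (sum_smooth_le_exp f (fun n => by simp only [hf]; positivity) (by simp [hf, tau]) ?_
    hsumm N (fun p => 2 ^ J * (1 / p + Real.exp B * σ * (Real.log p / p)) +
      (p : ℝ) ^ (-3 / 2 : ℝ) * A) ?_ S hS).trans ?_
  · intro m n h
    simp only [hf]
    rw [tau_mul h]
    push_cast
    rw [Real.mul_rpow (by positivity) (by positivity)]
    ring
  · intro p hp
    obtain ⟨hp, hpN⟩ := mem_primesUpTo.mp hp
    have hp0 : (0 : ℝ) < p := by exact_mod_cast hp.pos
    have hlp : 0 ≤ Real.log p := Real.log_natCast_nonneg p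
    rw [← (hsumm hp).sum_add_tsum_nat_add 2]
    have h2 : ∑' k : ℕ, f (p ^ (k + 2)) ≤ (p : ℝ) ^ (-3 / 2 : ℝ) * A := by
      rw [hA, ← tsum_mul_left]
      exact Summable.tsum_le_tsum (hf2 hp) ((summable_nat_add_iff 2).mpr (hsumm hp))
        (hgeo2.mul_left _)
    have h3 : (p : ℝ) ^ σ ≤ 1 + Real.exp B * σ * Real.log p := by
      have h4 : σ * Real.log p ≤ B := by
        refine le_trans ?_ hσB
        gcongr
      have h5 : (p : ℝ) ^ σ = Real.exp (σ * Real.log p) := by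
        rw [Real.rpow_def_of_pos hp0, mul_comm]
      have h6 := Real.add_one_le_exp (-(σ * Real.log p))
      rw [Real.exp_neg] at h6
      have h7 := Real.exp_pos (σ * Real.log p)
      have h8 : Real.exp (σ * Real.log p) ≤ 1 + σ * Real.log p * Real.exp (σ * Real.log p) := by
        have := mul_le_mul_of_nonneg_right h6 h7.le
        rw [inv_mul_cancel₀ h7.ne'] at this
        linarith
      have h9 : Real.exp (σ * Real.log p) ≤ Real.exp B := Real.exp_le_exp.mpr h4
      have h10 : σ * Real.log p * Real.exp (σ * Real.log p) ≤ σ * Real.log p * Real.exp B := by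
        gcongr
      rw [h5]; linarith
    have h4 : f (p ^ 1) ≤ 2 ^ J * (1 / p + Real.exp B * σ * (Real.log p / p)) := by
      rw [hfpow hp, Real.rpow_sub_one hp0.ne']
      have : (((1 : ℕ) : ℝ) + 1) ^ J = 2 ^ J := by norm_num
      rw [this, pow_one]
      gcongr
      calc (p : ℝ) ^ σ / p ≤ (1 + Real.exp B * σ * Real.log p) / p := by gcongr
        _ = _ := by ring
    have h5 : f (p ^ 0) = 1 := by simp [hf, tau]
    rw [sum_range_succ, sum_range_one, h5]
    linarith
  · rw [sum_add_distrib, ← mul_sum, ← sum_mul, sum_add_distrib, ← mul_sum]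
    have h2 := sum_inv_primes_le N hN
    have h3 := sum_log_div_le N hN
    have h4 : Real.exp B * σ * ∑ p ∈ primesUpTo N, Real.log p / p ≤
        Real.exp B * (5 * (1 + B)) := by
      calc _ ≤ Real.exp B * σ * (5 * (1 + Real.log N)) := by gcongr
        _ = Real.exp B * (5 * (σ + σ * Real.log N)) := by ring
        _ ≤ _ := by gcongr; linarith
    have h5 : (∑ p ∈ primesUpTo N, (p : ℝ) ^ (-3 / 2 : ℝ)) * A ≤ C₁ * A := by
      gcongr; exact h1 N
    calc _ ≤ Real.exp (2 ^ J * (13 + 5 * Real.log (1 + Real.log N) + Real.exp B * (5 * (1 + B))) +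
          C₁ * A) := by gcongr
      _ = Real.exp (E + Real.log ((1 + Real.log N) ^ (5 * 2 ^ J))) := by
          rw [Real.log_pow, hE]; push_cast; congr 1; ring
      _ = _ := by rw [Real.exp_add, Real.exp_log (by positivity)]

/-- Upper bounds for the number of quadruples in residue classes. -/
def ClassBound (A : Finset ℕ) (U : ℕ) (K : ℝ) : Prop :=
  ∀ r : ℕ, 1 ≤ r → (r : ℝ) ≤ (U : ℝ) ^ (1.1 : ℝ) →
    (((quad A).filter fun z => (r : ℤ) ∣ Phi z).card : ℝ) ≤ K * (U ^ 4 / r * localSum r)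

/-- A majorant for divisor sums: small divisors together with smooth divisors. -/
noncomputable def divMajorant (N D J e : ℕ) : ℝ :=
  (if e ≤ D then 1 else 0) + if D < e ∧ Smooth N e then (tau e : ℝ) ^ J else 0

lemma divMajorant_nonneg (N D J e : ℕ) : 0 ≤ divMajorant N D J e := by
  unfold divMajorant
  split_ifs <;> positivity

lemma tau_le_sum_divMajorant {N D J m : ℕ} {R : ℝ} (hN : 1 ≤ N) (hD : 1 ≤ D) (hm : m ≠ 0)
    (hmD : m ≤ D ^ (J + 2)) (hR : ∀ k : ℕ, N ^ k ≤ m → (2 : ℝ) ^ k ≤ R) :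
    (tau m : ℝ) ≤ R * ∑ e ∈ Icc 1 (D ^ 2 * N) with e ∣ m, divMajorant N D (J + 1) e := by
  obtain ⟨a, b, k, rfl, ha, hb, hk⟩ := exists_smooth_mul N m hm
  have ha0 := ha.1
  have hb0 : b ≠ 0 := right_ne_zero_of_mul hm
  have h1 : (2 : ℝ) ^ k ≤ R := hR k (hb.trans (Nat.le_mul_of_pos_left _ (Nat.pos_of_ne_zero ha0)))
  have h2 : (tau (a * b) : ℝ) ≤ R * tau a := by
    calc (tau (a * b) : ℝ) ≤ (tau a * tau b : ℕ) := by exact_mod_cast tau_mul_le a b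
      _ ≤ (tau a * 2 ^ k : ℕ) := by exact_mod_cast Nat.mul_le_mul_left _ hk
      _ = 2 ^ k * tau a := by push_cast; ring
      _ ≤ _ := by gcongr
  refine h2.trans (mul_le_mul_of_nonneg_left ?_ ((by positivity : (0 : ℝ) ≤ 2 ^ k).trans h1))
  have hDD : D ≤ D ^ 2 * N := by
    calc D ≤ D ^ 2 := Nat.le_self_pow (by norm_num) D
      _ ≤ _ := Nat.le_mul_of_pos_right _ hN
  rcases le_or_gt a D with h3 | h3
  · unfold tau
    rw [card_eq_sum_ones, Nat.cast_sum]
    refine (sum_le_sum (g := fun e => divMajorant N D (J + 1) e) fun e he => ?_).trans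
      (sum_le_sum_of_subset_of_nonneg ?_ fun _ _ _ => divMajorant_nonneg _ _ _ _)
    · have : e ≤ D := (Nat.divisor_le he).trans h3
      unfold divMajorant
      rw [if_pos this]
      split_ifs <;> simp
    · intro e he
      rw [mem_filter, mem_Icc]
      exact ⟨⟨Nat.pos_of_mem_divisors he, ((Nat.divisor_le he).trans h3).trans hDD⟩,
        (Nat.dvd_of_mem_divisors he).mul_right _⟩
  · obtain ⟨e, he, h4, h5, h6⟩ := ha.exists_dvd_tau_le hN hD J h3
      ((Nat.le_mul_of_pos_right a (Nat.pos_of_ne_zero hb0)).trans hmD)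
    have h7 : (tau a : ℝ) ≤ divMajorant N D (J + 1) e := by
      unfold divMajorant
      rw [if_neg (by omega), if_pos ⟨h4, ha.of_dvd he⟩, zero_add]
      exact_mod_cast h6
    refine h7.trans (single_le_sum (f := fun e => divMajorant N D (J + 1) e)
      (fun _ _ => divMajorant_nonneg _ _ _ _) ?_)
    rw [mem_filter, mem_Icc]
    exact ⟨⟨by omega, h5⟩, he.mul_right _⟩

lemma localSum_mul_le {h e : ℕ} (hh : h ≠ 0) (he : e ≠ 0) :
    localSum (h * e) ≤ ∑ x ∈ h.divisors ×ˢ e.divisors, localWeight (x.1 * x.2) := by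
  unfold localSum
  have key : ∀ d ∈ (h * e).divisors, d.gcd h * (d / d.gcd h) = d := fun d _ =>
    Nat.mul_div_cancel' (Nat.gcd_dvd_left d h)
  refine sum_le_sum_of_injOn (fun d => (d.gcd h, d / d.gcd h)) (fun _ _ => localWeight_nonneg _)
    ?_ ?_ ?_
  · intro d hd
    have hd1 := Nat.dvd_of_mem_divisors hd
    have hd0 := Nat.pos_of_mem_divisors hd
    rw [mem_product]
    refine ⟨Nat.mem_divisors.mpr ⟨Nat.gcd_dvd_right _ _, hh⟩, Nat.mem_divisors.mpr ⟨?_, he⟩⟩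
    have hg : 0 < d.gcd h := Nat.gcd_pos_of_pos_left _ hd0
    have hc : (d / d.gcd h).Coprime (h / d.gcd h) := Nat.coprime_div_gcd_div_gcd hg
    refine hc.dvd_of_dvd_mul_left ?_
    refine Nat.dvd_of_mul_dvd_mul_left hg ?_
    rw [Nat.mul_div_cancel' (Nat.gcd_dvd_left d h), ← mul_assoc,
      Nat.mul_div_cancel' (Nat.gcd_dvd_right d h)]
    exact hd1
  · intro d hd d' hd' hdd
    simp only [Prod.mk.injEq] at hdd
    calc d = d.gcd h * (d / d.gcd h) := (key d hd).symm
      _ = d' := by rw [hdd.2, hdd.1]; exact key d' hd'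
  · intro d hd
    rw [key d hd]

lemma sum_filter_dvd_Icc {α : Type*} [AddCommMonoid α] (F : ℕ → α) (M d : ℕ) (hd : 0 < d) :
    ∑ n ∈ Icc 1 M with d ∣ n, F n = ∑ k ∈ Icc 1 (M / d), F (d * k) := by
  symm
  refine sum_bij (fun m _ => d * m) ?_ ?_ ?_ fun _ _ => rfl
  · intro m hm
    rw [mem_Icc] at hm
    rw [mem_filter, mem_Icc]
    exact ⟨⟨Nat.mul_pos hd hm.1, (Nat.mul_le_mul_left d hm.2).trans (Nat.mul_div_le M d)⟩,
      dvd_mul_right _ _⟩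
  · intro a _ b _ h
    exact Nat.eq_of_mul_eq_mul_left hd h
  · intro x hx
    rw [mem_filter, mem_Icc] at hx
    obtain ⟨⟨h2, h3⟩, m, rfl⟩ := hx
    refine ⟨m, ?_, rfl⟩
    rw [mem_Icc]
    exact ⟨Nat.pos_of_mul_pos_left h2, (Nat.le_div_iff_mul_le hd).mpr (by rwa [mul_comm])⟩

lemma sum_inv_sqrt_le (n : ℕ) : ∑ k ∈ Icc 1 n, 1 / √(k : ℝ) ≤ 2 * √(n : ℝ) := by
  induction n with
  | zero => simp
  | succ n ih =>
    rw [sum_Icc_succ_top (by omega)]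
    have h1 : 0 < √((n + 1 : ℕ) : ℝ) := Real.sqrt_pos.mpr (by positivity)
    have h2 : √(n : ℝ) ≤ √((n + 1 : ℕ) : ℝ) := Real.sqrt_le_sqrt (by push_cast; linarith)
    have h3 : √((n + 1 : ℕ) : ℝ) ^ 2 = n + 1 := by rw [Real.sq_sqrt (by positivity)]; push_cast; rfl
    have h4 : √(n : ℝ) ^ 2 = n := Real.sq_sqrt (by positivity)
    have h5 : 1 / √((n + 1 : ℕ) : ℝ) ≤ 2 * (√((n + 1 : ℕ) : ℝ) - √(n : ℝ)) := by
      rw [div_le_iff₀ h1]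
      nlinarith [sq_nonneg (√((n + 1 : ℕ) : ℝ) - √(n : ℝ))]
    linarith

lemma sum_dvd_inv_sqrt_le (H d : ℕ) (hd : 0 < d) :
    ∑ h ∈ Icc 1 H with d ∣ h, 1 / √(h : ℝ) ≤ 2 * √(H : ℝ) / d := by
  have hdr : (0 : ℝ) < d := by exact_mod_cast hd
  rw [sum_filter_dvd_Icc _ _ _ hd]
  have h1 : ∀ k : ℕ, 1 / √((d * k : ℕ) : ℝ) = 1 / √(d : ℝ) * (1 / √(k : ℝ)) := by
    intro k
    rw [Nat.cast_mul, Real.sqrt_mul hdr.le]; ring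
  simp_rw [h1]
  rw [← mul_sum]
  calc _ ≤ 1 / √(d : ℝ) * (2 * √((H / d : ℕ) : ℝ)) := by gcongr; exact sum_inv_sqrt_le _
    _ ≤ 1 / √(d : ℝ) * (2 * √((H : ℝ) / d)) := by gcongr; exact Nat.cast_div_le
    _ = 2 * √(H : ℝ) / (√(d : ℝ) * √(d : ℝ)) := by
      rw [Real.sqrt_div (by positivity)]; field_simp
    _ = _ := by rw [Real.mul_self_sqrt hdr.le]

lemma sum_dvd_divMajorant_le {N D J d : ℕ} (M : ℕ) {σ G : ℝ} (hD : 1 ≤ D) (hσ : 0 ≤ σ)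
    (hd : 0 < d)
    (hG : ∀ S : Finset ℕ, (∀ n ∈ S, Smooth N n) → ∑ n ∈ S, (tau n : ℝ) ^ J * (n : ℝ) ^ (σ - 1) ≤ G) :
    ∑ e ∈ Icc 1 M with d ∣ e, divMajorant N D J e / e ≤
      (tau d : ℝ) ^ J * (d : ℝ) ^ σ / d * (1 + Real.log D + (D : ℝ) ^ (-σ) * G) := by
  have hdr : (0 : ℝ) < d := by exact_mod_cast hd
  have hd1 : (1 : ℝ) ≤ d := by exact_mod_cast hd
  have hDr : (0 : ℝ) < D := by exact_mod_cast hD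
  have ht : (1 : ℝ) ≤ (tau d : ℝ) ^ J := one_le_pow₀ (by exact_mod_cast tau_pos hd.ne')
  have hds : (1 : ℝ) ≤ (d : ℝ) ^ σ := Real.one_le_rpow hd1 hσ
  rw [sum_filter_dvd_Icc _ _ _ hd]
  have h1 : ∑ k ∈ Icc 1 (M / d), (if d * k ≤ D then (1 : ℝ) else 0) / ((d * k : ℕ) : ℝ) ≤
      1 / d * (1 + Real.log D) := by
    calc _ ≤ ∑ k ∈ Icc 1 (M / d), if d * k ≤ D then 1 / (d : ℝ) * (1 / (k : ℝ)) else 0 := by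
          refine sum_le_sum fun k _ => ?_
          split_ifs
          · rw [Nat.cast_mul]; exact le_of_eq (by field_simp)
          · simp
      _ = ∑ k ∈ (Icc 1 (M / d)).filter (fun k => d * k ≤ D), 1 / (d : ℝ) * (1 / (k : ℝ)) := by
          rw [sum_filter]
      _ ≤ ∑ k ∈ Icc 1 D, 1 / (d : ℝ) * (1 / (k : ℝ)) := by
          refine sum_le_sum_of_subset_of_nonneg ?_ fun _ _ _ => by positivity
          intro k hk
          rw [mem_filter, mem_Icc] at hk
          rw [mem_Icc]
          exact ⟨hk.1.1, (Nat.le_mul_of_pos_left k hd).trans hk.2⟩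
      _ ≤ _ := by
          rw [← mul_sum]
          gcongr
          exact sum_inv_le_one_add_log D
  have h2 : ∑ k ∈ Icc 1 (M / d), (if D < d * k ∧ Smooth N (d * k) then (tau (d * k) : ℝ) ^ J else 0) /
      ((d * k : ℕ) : ℝ) ≤ (tau d : ℝ) ^ J * (d : ℝ) ^ σ / d * ((D : ℝ) ^ (-σ) * G) := by
    calc _ ≤ ∑ k ∈ Icc 1 (M / d), if Smooth N k then (tau d : ℝ) ^ J * (d : ℝ) ^ σ / d *
          ((D : ℝ) ^ (-σ) * ((tau k : ℝ) ^ J * (k : ℝ) ^ (σ - 1))) else 0 := by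
          refine sum_le_sum fun k hk => ?_
          have hk0 : 0 < k := (mem_Icc.mp hk).1
          have hkr : (0 : ℝ) < k := by exact_mod_cast hk0
          by_cases h : D < d * k ∧ Smooth N (d * k)
          · rw [if_pos h, if_pos (h.2.of_dvd (dvd_mul_left _ _))]
            have h3 : (1 : ℝ) ≤ (d : ℝ) ^ σ * (k : ℝ) ^ σ * (D : ℝ) ^ (-σ) := by
              rw [← Real.mul_rpow hdr.le hkr.le, Real.rpow_neg hDr.le, ← div_eq_mul_inv,
                one_le_div (by positivity)]
              refine Real.rpow_le_rpow hDr.le ?_ hσ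
              exact_mod_cast h.1.le
            have h4 : (tau (d * k) : ℝ) ^ J ≤ (tau d : ℝ) ^ J * (tau k : ℝ) ^ J := by
              rw [← mul_pow]
              gcongr
              exact_mod_cast tau_mul_le d k
            rw [Real.rpow_sub_one hkr.ne', Nat.cast_mul]
            calc (tau (d * k) : ℝ) ^ J / (d * k) ≤ (tau d : ℝ) ^ J * (tau k : ℝ) ^ J / (d * k) := by
                  gcongr
              _ ≤ (tau d : ℝ) ^ J * (tau k : ℝ) ^ J / (d * k) *
                  ((d : ℝ) ^ σ * (k : ℝ) ^ σ * (D : ℝ) ^ (-σ)) :=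
                  le_mul_of_one_le_right (by positivity) h3
              _ = _ := by ring
          · rw [if_neg h, zero_div]
            split_ifs <;> positivity
      _ = (tau d : ℝ) ^ J * (d : ℝ) ^ σ / d * ((D : ℝ) ^ (-σ) *
          ∑ k ∈ (Icc 1 (M / d)).filter (Smooth N), (tau k : ℝ) ^ J * (k : ℝ) ^ (σ - 1)) := by
          rw [sum_filter, mul_sum, mul_sum]
          refine sum_congr rfl fun k _ => ?_
          split_ifs <;> simp
      _ ≤ _ := by
          gcongr
          exact hG _ fun n hn => (mem_filter.mp hn).2
  have h3 : ∑ k ∈ Icc 1 (M / d), divMajorant N D J (d * k) / ((d * k : ℕ) : ℝ) ≤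
      1 / d * (1 + Real.log D) + (tau d : ℝ) ^ J * (d : ℝ) ^ σ / d * ((D : ℝ) ^ (-σ) * G) := by
    refine le_trans (le_of_eq ?_) (add_le_add h1 h2)
    rw [← sum_add_distrib]
    refine sum_congr rfl fun k _ => ?_
    unfold divMajorant
    rw [add_div]
  refine h3.trans ?_
  have h4 : 0 ≤ Real.log D := Real.log_natCast_nonneg D
  have h5 : (1 : ℝ) / d ≤ (tau d : ℝ) ^ J * (d : ℝ) ^ σ / d := by
    gcongr
    exact one_le_mul_of_one_le_of_one_le ht hds
  rw [mul_add _ (1 + Real.log (D : ℝ))]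
  exact add_le_add_left (mul_le_mul_of_nonneg_right h5 (by linarith)) _

lemma sum_pairs_le (g : ℕ → ℝ) (hg : ∀ n, 0 ≤ g n) (H M : ℕ) :
    ∑ x ∈ Icc 1 H ×ˢ Icc 1 M, g (x.1 * x.2) ≤ ∑ n ∈ Icc 1 (H * M), (tau n : ℝ) * g n := by
  have h1 : ∀ x ∈ Icc 1 H ×ˢ Icc 1 M, x.1 * x.2 ∈ Icc 1 (H * M) := by
    intro x hx
    simp only [mem_product, mem_Icc] at hx ⊢
    exact ⟨Nat.mul_pos hx.1.1 hx.2.1, Nat.mul_le_mul hx.1.2 hx.2.2⟩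
  rw [← sum_fiberwise_of_maps_to h1]
  refine sum_le_sum fun n hn => ?_
  have h2 : ∑ x ∈ Icc 1 H ×ˢ Icc 1 M with x.1 * x.2 = n, g (x.1 * x.2) =
      ((Icc 1 H ×ˢ Icc 1 M).filter fun x => x.1 * x.2 = n).card * g n := by
    rw [← nsmul_eq_mul, ← sum_const]
    exact sum_congr rfl fun x hx => by rw [(mem_filter.mp hx).2]
  rw [h2]
  refine mul_le_mul_of_nonneg_right ?_ (hg n)
  norm_cast
  unfold tau
  refine card_le_card_of_injOn Prod.fst ?_ ?_
  · intro x hx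
    have hx := (mem_filter.mp hx).2
    have hn0 : n ≠ 0 := by have := (mem_Icc.mp hn).1; omega
    exact Nat.mem_divisors.mpr ⟨⟨x.2, hx.symm⟩, hn0⟩
  · intro x hx y hy hxy
    have hx := mem_filter.mp hx
    have hy := mem_filter.mp hy
    simp only [mem_product, mem_Icc] at hx hy
    refine Prod.ext hxy (Nat.eq_of_mul_eq_mul_left (show 0 < x.1 from hx.1.1.1) ?_)
    rw [hx.2, hxy, hy.2]

/-- The weighted double sum attached to the local densities. -/
lemma exists_sum_localSum_le (J : ℕ) : ∃ C : ℝ, 1 ≤ C ∧ ∀ (N D M H : ℕ) (σ G : ℝ), 1 ≤ D → 0 ≤ σ →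
    σ ≤ 0.03 →
    (∀ S : Finset ℕ, (∀ n ∈ S, Smooth N n) → ∑ n ∈ S, (tau n : ℝ) ^ J * (n : ℝ) ^ (σ - 1) ≤ G) →
    ∑ h ∈ Icc 1 H, ∑ e ∈ Icc 1 M, √(h : ℝ) * (divMajorant N D J e * (1 / ((h * e : ℕ) : ℝ) *
      localSum (h * e))) ≤ C * √(H : ℝ) * (1 + Real.log D + (D : ℝ) ^ (-σ) * G) := by
  obtain ⟨C₁, hC₁, h1⟩ := tau_le_rpow (0.07 / (J + 1)) (by positivity)
  obtain ⟨C₂, hC₂, h2⟩ := sum_rpow_div_rad_le 0.1 (by norm_num)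
  have hC₁p : 1 ≤ C₁ ^ (J + 1) := one_le_pow₀ hC₁
  refine ⟨2 * (C₁ ^ (J + 1) * C₂), by nlinarith, ?_⟩
  intro N D M H σ G hD hσ hσ3 hG
  set W := 1 + Real.log D + (D : ℝ) ^ (-σ) * G with hW
  have hG0 : 0 ≤ G := by simpa using hG ∅ (by simp)
  have hW0 : 0 ≤ W := by
    have := Real.log_natCast_nonneg D
    positivity
  set g : ℕ → ℝ := fun n => localWeight n * ((tau n : ℝ) ^ J * (n : ℝ) ^ σ / n) with hg
  have hg0 : ∀ n, 0 ≤ g n := fun n => mul_nonneg (localWeight_nonneg n) (by positivity)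
  have step1 : ∑ h ∈ Icc 1 H, ∑ e ∈ Icc 1 M, √(h : ℝ) * (divMajorant N D J e *
      (1 / ((h * e : ℕ) : ℝ) * localSum (h * e))) ≤
      ∑ h ∈ Icc 1 H, ∑ e ∈ Icc 1 M, ∑ x ∈ Icc 1 H ×ˢ Icc 1 M,
        if x.1 ∣ h ∧ x.2 ∣ e then localWeight (x.1 * x.2) * (1 / √(h : ℝ) * (divMajorant N D J e / e))
          else 0 := by
    refine sum_le_sum fun h hh => sum_le_sum fun e he => ?_
    rw [mem_Icc] at hh he
    have hh0 : (0 : ℝ) < h := by exact_mod_cast hh.1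
    have he0 : (0 : ℝ) < e := by exact_mod_cast he.1
    have hdm := divMajorant_nonneg N D J e
    rw [← sum_filter, ← sum_mul]
    have h3 : localSum (h * e) ≤ ∑ x ∈ (Icc 1 H ×ˢ Icc 1 M).filter (fun x => x.1 ∣ h ∧ x.2 ∣ e),
        localWeight (x.1 * x.2) := by
      refine (localSum_mul_le (by omega) (by omega)).trans
        (sum_le_sum_of_subset_of_nonneg ?_ fun _ _ _ => localWeight_nonneg _)
      intro x hx
      rw [mem_product] at hx
      rw [mem_filter, mem_product, mem_Icc, mem_Icc]
      exact ⟨⟨⟨Nat.pos_of_mem_divisors hx.1, (Nat.divisor_le hx.1).trans hh.2⟩,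
        Nat.pos_of_mem_divisors hx.2, (Nat.divisor_le hx.2).trans he.2⟩,
        Nat.dvd_of_mem_divisors hx.1, Nat.dvd_of_mem_divisors hx.2⟩
    have h4 : √(h : ℝ) * (divMajorant N D J e * (1 / ((h * e : ℕ) : ℝ) * localSum (h * e))) =
        localSum (h * e) * (1 / √(h : ℝ) * (divMajorant N D J e / e)) := by
      have hs : √(h : ℝ) * √(h : ℝ) = h := Real.mul_self_sqrt hh0.le
      have hs0 : 0 < √(h : ℝ) := Real.sqrt_pos.mpr hh0
      rw [Nat.cast_mul]
      field_simp
      rw [sq, hs]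
      ring
    rw [h4]
    gcongr
  refine step1.trans ?_
  have step2 : ∀ x ∈ Icc 1 H ×ˢ Icc 1 M, ∑ h ∈ Icc 1 H, ∑ e ∈ Icc 1 M,
      (if x.1 ∣ h ∧ x.2 ∣ e then localWeight (x.1 * x.2) * (1 / √(h : ℝ) * (divMajorant N D J e / e))
          else 0) ≤ 2 * √(H : ℝ) * W * g (x.1 * x.2) := by
    intro x hx
    rw [mem_product, mem_Icc, mem_Icc] at hx
    have hx1 : (0 : ℝ) < x.1 := by exact_mod_cast hx.1.1
    have hx2 : (0 : ℝ) < x.2 := by exact_mod_cast hx.2.1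
    have e1 : ∑ h ∈ Icc 1 H, ∑ e ∈ Icc 1 M,
      (if x.1 ∣ h ∧ x.2 ∣ e then localWeight (x.1 * x.2) * (1 / √(h : ℝ) * (divMajorant N D J e / e))
          else 0) = localWeight (x.1 * x.2) * ((∑ h ∈ Icc 1 H with x.1 ∣ h, 1 / √(h : ℝ)) *
          ∑ e ∈ Icc 1 M with x.2 ∣ e, divMajorant N D J e / e) := by
      rw [sum_mul_sum, mul_sum, sum_filter]
      refine sum_congr rfl fun h _ => ?_
      by_cases hh : x.1 ∣ h
      · rw [if_pos hh, mul_sum, sum_filter]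
        refine sum_congr rfl fun e _ => ?_
        by_cases he : x.2 ∣ e <;> simp [hh, he]
      · simp [hh]
    rw [e1]
    have e2 := sum_dvd_inv_sqrt_le H x.1 hx.1.1
    have e3 := sum_dvd_divMajorant_le M hD hσ hx.2.1 hG
    have hlw := localWeight_nonneg (x.1 * x.2)
    have htau : (tau x.2 : ℝ) ^ J ≤ (tau (x.1 * x.2) : ℝ) ^ J := by
      gcongr
      exact_mod_cast tau_le_of_dvd (dvd_mul_left _ _) (Nat.mul_pos hx.1.1 hx.2.1).ne'
    have hpow : (x.2 : ℝ) ^ σ ≤ ((x.1 * x.2 : ℕ) : ℝ) ^ σ := by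
      refine Real.rpow_le_rpow hx2.le ?_ hσ
      exact_mod_cast Nat.le_mul_of_pos_left _ hx.1.1
    calc _ ≤ localWeight (x.1 * x.2) * ((2 * √(H : ℝ) / x.1) *
          ((tau x.2 : ℝ) ^ J * (x.2 : ℝ) ^ σ / x.2 * W)) := by
          refine mul_le_mul_of_nonneg_left ?_ hlw
          exact mul_le_mul e2 e3 (sum_nonneg fun e _ =>
            div_nonneg (divMajorant_nonneg _ _ _ _) (by positivity)) (by positivity)
      _ ≤ localWeight (x.1 * x.2) * ((2 * √(H : ℝ) / x.1) *
          ((tau (x.1 * x.2) : ℝ) ^ J * ((x.1 * x.2 : ℕ) : ℝ) ^ σ / x.2 * W)) := by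
          gcongr
      _ = _ := by simp only [hg]; push_cast; field_simp
  have step3 : ∑ x ∈ Icc 1 H ×ˢ Icc 1 M, g (x.1 * x.2) ≤ C₁ ^ (J + 1) * C₂ := by
    refine (sum_pairs_le g hg0 H M).trans ?_
    calc _ ≤ ∑ n ∈ Icc 1 (H * M), C₁ ^ (J + 1) * ((n : ℝ) ^ (-0.1 : ℝ) / rad n) := by
          refine sum_le_sum fun n hn => ?_
          have hn0 : 0 < n := (mem_Icc.mp hn).1
          have hnr : (0 : ℝ) < n := by exact_mod_cast hn0
          have hn1 : (1 : ℝ) ≤ n := by exact_mod_cast hn0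
          have hrad : (0 : ℝ) < rad n := by exact_mod_cast rad_pos n
          have h3 : (tau n : ℝ) ^ (J + 1) ≤ C₁ ^ (J + 1) * (n : ℝ) ^ (0.07 : ℝ) := by
            calc (tau n : ℝ) ^ (J + 1) ≤ (C₁ * (n : ℝ) ^ (0.07 / ((J : ℝ) + 1))) ^ (J + 1) := by
                  gcongr; exact h1 n hn0.ne'
              _ = _ := by
                  rw [mul_pow, ← Real.rpow_natCast (_ ^ _), ← Real.rpow_mul hnr.le]
                  congr 2
                  push_cast
                  field_simp
          have h4 : (n : ℝ) ^ (0.07 : ℝ) * (n : ℝ) ^ (0.8 : ℝ) * (n : ℝ) ^ σ / n ≤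
              (n : ℝ) ^ (-0.1 : ℝ) := by
            rw [← Real.rpow_add hnr, ← Real.rpow_add hnr, ← Real.rpow_sub_one hnr.ne']
            exact Real.rpow_le_rpow_of_exponent_le hn1 (by linarith)
          simp only [hg, localWeight]
          calc (tau n : ℝ) * ((n : ℝ) ^ (0.8 : ℝ) / rad n * ((tau n : ℝ) ^ J * (n : ℝ) ^ σ / n))
              = (tau n : ℝ) ^ (J + 1) * ((n : ℝ) ^ (0.8 : ℝ) * (n : ℝ) ^ σ / n / rad n) := by ring
            _ ≤ C₁ ^ (J + 1) * (n : ℝ) ^ (0.07 : ℝ) *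
                ((n : ℝ) ^ (0.8 : ℝ) * (n : ℝ) ^ σ / n / rad n) := by gcongr
            _ = C₁ ^ (J + 1) * ((n : ℝ) ^ (0.07 : ℝ) * (n : ℝ) ^ (0.8 : ℝ) * (n : ℝ) ^ σ / n / rad n)
                := by ring
            _ ≤ _ := by gcongr
      _ ≤ _ := by rw [← mul_sum]; gcongr; exact h2 _
  calc _ = ∑ x ∈ Icc 1 H ×ˢ Icc 1 M, ∑ h ∈ Icc 1 H, ∑ e ∈ Icc 1 M,
      (if x.1 ∣ h ∧ x.2 ∣ e then localWeight (x.1 * x.2) * (1 / √(h : ℝ) * (divMajorant N D J e / e))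
          else 0) := by
        simp_rw [sum_comm (s := Icc 1 M) (t := Icc 1 H ×ˢ Icc 1 M)]
        rw [sum_comm]
    _ ≤ ∑ x ∈ Icc 1 H ×ˢ Icc 1 M, 2 * √(H : ℝ) * W * g (x.1 * x.2) := sum_le_sum step2
    _ = 2 * √(H : ℝ) * W * ∑ x ∈ Icc 1 H ×ˢ Icc 1 M, g (x.1 * x.2) := by rw [mul_sum]
    _ ≤ 2 * √(H : ℝ) * W * (C₁ ^ (J + 1) * C₂) := by gcongr
    _ = _ := by ring

lemma ceil_exp_le (x : ℝ) (hx : 0 ≤ x) : (⌈Real.exp x⌉₊ : ℝ) ≤ Real.exp (x + 1) := by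
  have h1 := (Nat.ceil_lt_add_one (Real.exp_pos x).le).le
  have h2 := Real.one_le_exp hx
  have h3 := Real.add_one_le_exp (1 : ℝ)
  rw [Real.exp_add]
  nlinarith

/-- Choice of parameters for divisor sums. -/
lemma exists_divisor_params (ε : ℝ) (hε : 0 < ε) (E : ℕ) : ∃ B : ℝ, 0 ≤ B ∧ ∃ U₀ : ℕ, 1 ≤ U₀ ∧
    ∀ U : ℕ, U₀ ≤ U → ∃ (N D : ℕ) (σ : ℝ), 1 ≤ N ∧ 1 ≤ D ∧ 0 ≤ σ ∧ σ ≤ 0.03 ∧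
      σ * Real.log N ≤ B ∧ ((D ^ 2 * N : ℕ) : ℝ) ≤ (U : ℝ) ^ (0.09 : ℝ) ∧ 2 * U ^ 3 ≤ D ^ 200 ∧
      (∀ k : ℕ, N ^ k ≤ 2 * U ^ 3 → (2 : ℝ) ^ k ≤ Real.log U ^ ε) ∧
      1 + Real.log D ≤ Real.log U ∧ (D : ℝ) ^ (-σ) * (1 + Real.log N) ^ E ≤ 1 ∧
      1 ≤ Real.log U := by
  set δ := ε / 4 with hδ
  have hδ0 : 0 < δ := by positivity
  set b : ℝ := 50 * E with hb
  have hb0 : 0 ≤ b := by positivity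
  refine ⟨b / δ + 1, by positivity, ?_⟩
  have hev : ∀ᶠ U : ℕ in Filter.atTop, 1000 ≤ Real.log U ∧ 1000 / δ ≤ Real.log (Real.log U) ∧
      1 ≤ Real.log (Real.log U) ∧ b * Real.log (Real.log U) ≤ 0.03 * Real.log U := by
    have t1 : Filter.Tendsto (fun U : ℕ => Real.log (U : ℝ)) Filter.atTop Filter.atTop :=
      Real.tendsto_log_atTop.comp tendsto_natCast_atTop_atTop
    have t2 := Real.tendsto_log_atTop.comp t1
    have t3 : ∀ᶠ x : ℝ in Filter.atTop, b * Real.log x ≤ 0.03 * x := by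
      have h := Real.isLittleO_log_id_atTop.bound (c := 0.03 / (b + 1)) (by positivity)
      filter_upwards [h, Filter.eventually_ge_atTop 1] with x hx hx1
      have hl := Real.log_nonneg hx1
      rw [Real.norm_eq_abs, Real.norm_eq_abs, abs_of_nonneg hl, id,
        abs_of_nonneg (by linarith)] at hx
      calc b * Real.log x ≤ (b + 1) * Real.log x := by gcongr; linarith
        _ ≤ (b + 1) * (0.03 / (b + 1) * x) := by gcongr
        _ = _ := by field_simp
    filter_upwards [t1.eventually_ge_atTop 1000, t2.eventually_ge_atTop (1000 / δ),
      t2.eventually_ge_atTop 1, t1.eventually t3] with U h1 h2 h3 h4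
    exact ⟨h1, h2, h3, h4⟩
  obtain ⟨U₀, hU₀⟩ := Filter.eventually_atTop.mp hev
  refine ⟨max U₀ 1, le_max_right _ _, fun U hU => ?_⟩
  obtain ⟨hL, hl, hl1, hbl⟩ := hU₀ U ((le_max_left _ _).trans hU)
  have hU1 : 1 ≤ U := (le_max_right _ _).trans hU
  have hUp : (0 : ℝ) < U := by exact_mod_cast hU1
  set L := Real.log U with hLdef
  set l := Real.log L with hldef
  have hL0 : 0 < L := by linarith
  have hl0 : 0 < l := by linarith
  have hUexp : (U : ℝ) = Real.exp L := (Real.exp_log hUp).symm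
  have hδl : L / (δ * l) ≤ 0.001 * L := by
    rw [div_le_iff₀ (by positivity)]
    rw [div_le_iff₀ hδ0] at hl
    nlinarith
  have hLdl0 : 0 ≤ L / (δ * l) := by positivity
  set N := ⌈Real.exp (L / (δ * l))⌉₊ with hN
  set D := ⌈Real.exp (0.02 * L)⌉₊ with hD
  have hN1 : 1 ≤ N := Nat.one_le_iff_ne_zero.mpr (Nat.ceil_pos.mpr (Real.exp_pos _)).ne'
  have hD1 : 1 ≤ D := Nat.one_le_iff_ne_zero.mpr (Nat.ceil_pos.mpr (Real.exp_pos _)).ne'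
  have hNr : (0 : ℝ) < N := by exact_mod_cast hN1
  have hDr : (0 : ℝ) < D := by exact_mod_cast hD1
  have hNle : (N : ℝ) ≤ Real.exp (L / (δ * l) + 1) := ceil_exp_le _ hLdl0
  have hDle : (D : ℝ) ≤ Real.exp (0.02 * L + 1) := ceil_exp_le _ (by positivity)
  have hNge : Real.exp (L / (δ * l)) ≤ N := Nat.le_ceil _
  have hDge : Real.exp (0.02 * L) ≤ D := Nat.le_ceil _
  have hlogN : Real.log N ≤ L / (δ * l) + 1 := (Real.log_le_iff_le_exp hNr).mpr hNle
  have hlogD : Real.log D ≤ 0.02 * L + 1 := (Real.log_le_iff_le_exp hDr).mpr hDle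
  have hlogN0 : 0 ≤ Real.log N := Real.log_natCast_nonneg N
  have h2U : (2 * U ^ 3 : ℝ) ≤ Real.exp (4 * L) := by
    have h3 : (2 : ℝ) ≤ U := by
      rw [hUexp]; have := Real.add_one_le_exp L; linarith
    rw [show (4 * L) = L + 3 * L by ring, Real.exp_add, ← hUexp]
    have : Real.exp (3 * L) = (U : ℝ) ^ 3 := by
      rw [hUexp, ← Real.exp_nat_mul]; norm_num
    rw [this]
    gcongr
  refine ⟨N, D, b * l / L, hN1, hD1, by positivity, ?_, ?_, ?_, ?_, ?_, ?_, ?_, by linarith⟩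
  · rw [div_le_iff₀ hL0]; exact hbl
  · calc b * l / L * Real.log N ≤ b * l / L * (L / (δ * l) + 1) := by gcongr
      _ = b / δ + b * l / L := by field_simp
      _ ≤ _ := by
        gcongr
        rw [div_le_one hL0]; linarith
  · push_cast
    rw [Real.rpow_def_of_pos hUp]
    calc (D : ℝ) ^ 2 * N ≤ Real.exp (0.02 * L + 1) ^ 2 * Real.exp (L / (δ * l) + 1) := by gcongr
      _ = Real.exp (2 * (0.02 * L + 1) + (L / (δ * l) + 1)) := by
        rw [← Real.exp_nat_mul, ← Real.exp_add]; norm_num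
      _ ≤ _ := by
        rw [Real.exp_le_exp, ← hLdef]; linarith
  · have : (2 * U ^ 3 : ℝ) ≤ (D : ℝ) ^ 200 := by
      refine h2U.trans ?_
      calc Real.exp (4 * L) = Real.exp (0.02 * L) ^ 200 := by
            rw [← Real.exp_nat_mul]; congr 1; norm_num; ring
        _ ≤ _ := by gcongr
    exact_mod_cast this
  · intro k hk
    have h3 : Real.exp (k * (L / (δ * l))) ≤ Real.exp (4 * L) := by
      rw [Real.exp_nat_mul]
      calc _ ≤ (N : ℝ) ^ k := by gcongr
        _ ≤ 2 * U ^ 3 := by exact_mod_cast hk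
        _ ≤ _ := h2U
    rw [Real.exp_le_exp] at h3
    have h4 : (k : ℝ) ≤ ε * l := by
      have : (k : ℝ) * (L / (δ * l)) = k / (δ * l) * L := by ring
      rw [this] at h3
      have h5 := le_of_mul_le_mul_right h3 hL0
      rw [div_le_iff₀ (by positivity)] at h5
      calc (k : ℝ) ≤ 4 * (δ * l) := h5
        _ = _ := by rw [hδ]; ring
    rw [Real.rpow_def_of_pos hL0, mul_comm]
    have h5 : (2 : ℝ) ^ k ≤ Real.exp k := by
      calc (2 : ℝ) ^ k ≤ Real.exp 1 ^ k := by
            gcongr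
            have := Real.add_one_le_exp (1 : ℝ)
            linarith
        _ = _ := by rw [← Real.exp_nat_mul]; simp
    exact h5.trans (Real.exp_le_exp.mpr h4)
  · linarith
  · have h3 : (D : ℝ) ^ (-(b * l / L)) ≤ (L ^ E)⁻¹ := by
      have h5 : (L ^ E)⁻¹ = Real.exp (0.02 * L) ^ (-(b * l / L)) := by
        rw [← Real.exp_mul]
        have : 0.02 * L * -(b * l / L) = -((E : ℝ) * l) := by
          rw [hb]; field_simp; norm_num
        rw [this, Real.exp_neg, Real.exp_nat_mul, hldef, Real.exp_log hL0]
      rw [h5]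
      refine Real.rpow_le_rpow_of_nonpos (Real.exp_pos _) hDge ?_
      rw [neg_nonpos]; positivity
    have h4 : (1 + Real.log N) ^ E ≤ L ^ E := by
      gcongr
      linarith
    calc _ ≤ (L ^ E)⁻¹ * L ^ E := by gcongr
      _ = 1 := inv_mul_cancel₀ (by positivity)

lemma natAbs_Phi_le {A : Finset ℕ} {U : ℕ} (hA : A ⊆ Icc 1 U) {z : (ℕ × ℕ) × ℕ × ℕ}
    (hz : z ∈ quad A) : (Phi z).natAbs ≤ 2 * U ^ 3 := by
  have hz := mem_quad.mp hz
  have hb : ∀ a ∈ A, a ^ 3 ≤ U ^ 3 := fun a ha => Nat.pow_le_pow_left (mem_Icc.mp (hA ha)).2 3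
  have h1 := hb _ hz.1.1
  have h2 := hb _ hz.1.2
  have h3 := hb _ hz.2.1
  have h4 := hb _ hz.2.2
  unfold Phi
  zify at h1 h2 h3 h4 ⊢
  rw [abs_le]
  constructor <;> linarith [show (0 : ℤ) ≤ (z.1.1 : ℤ) ^ 3 by positivity,
    show (0 : ℤ) ≤ (z.1.2 : ℤ) ^ 3 by positivity, show (0 : ℤ) ≤ (z.2.1 : ℤ) ^ 3 by positivity,
    show (0 : ℤ) ≤ (z.2.2 : ℤ) ^ 3 by positivity]

/-- Weighted sums of divisor functions of the values `Phi z / h`. -/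
noncomputable def divisorMean (A : Finset ℕ) (H : ℕ) : ℝ :=
  ∑ h ∈ Icc 1 H, √(h : ℝ) * ∑ z ∈ quad A with Phi z ≠ 0 ∧ (h : ℤ) ∣ Phi z,
    (tau ((Phi z).natAbs / h) : ℝ)

/-- The mean of the divisor function over the values of `Phi`. -/
lemma exists_divisorMean_le (ε : ℝ) (hε : 0 < ε) : ∃ C : ℝ, 1 ≤ C ∧ ∃ U₀ : ℕ, ∀ U : ℕ, U₀ ≤ U →
    ∀ (K : ℝ) (A : Finset ℕ), 0 ≤ K → A ⊆ Icc 1 U → ClassBound A U K → ∀ H ≤ U,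
    divisorMean A H ≤ C * K * U ^ 4 * √(H : ℝ) * Real.log U ^ (1 + ε) := by
  obtain ⟨C₁, hC₁, h1⟩ := exists_sum_localSum_le 199
  obtain ⟨E, hE⟩ : ∃ E : ℕ, E = 5 * 2 ^ 199 := ⟨_, rfl⟩
  obtain ⟨B, hB, U₀, hU₀, h2⟩ := exists_divisor_params ε hε E
  obtain ⟨C₃, hC₃, h3⟩ := sum_smooth_tau_pow_le 199 B hB
  rw [← hE] at h3
  refine ⟨C₁ * (1 + C₃), by nlinarith, U₀, ?_⟩
  intro U hU K A hK hA hcl H hH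
  obtain ⟨N, D, σ, hN, hD, hσ0, hσ, hσB, hDN, hUD, hR, hlD, hDσ, hL⟩ := h2 U hU
  have hU1 : 1 ≤ U := hU₀.trans hU
  have hUr : (1 : ℝ) ≤ U := by exact_mod_cast hU1
  have hUp : (0 : ℝ) < U := by linarith
  set L := Real.log U with hLdef
  set M := D ^ 2 * N with hM
  set R := L ^ ε with hRdef
  have hR0 : 0 ≤ R := by positivity
  have hg := h1 N D M H σ _ hD hσ0 hσ (h3 N hN σ hσ0 (by linarith) hσB)
  have e1 : ∀ h ∈ Icc 1 H, ∑ z ∈ quad A with Phi z ≠ 0 ∧ (h : ℤ) ∣ Phi z,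
      (tau ((Phi z).natAbs / h) : ℝ) ≤ R * ∑ e ∈ Icc 1 M, divMajorant N D 199 e *
        (K * U ^ 4 * (1 / ((h * e : ℕ) : ℝ) * localSum (h * e))) := by
    intro h hh
    rw [mem_Icc] at hh
    have e2 : ∀ z ∈ (quad A).filter fun z => Phi z ≠ 0 ∧ (h : ℤ) ∣ Phi z,
        (tau ((Phi z).natAbs / h) : ℝ) ≤ R * ∑ e ∈ Icc 1 M,
          if ((h * e : ℕ) : ℤ) ∣ Phi z then divMajorant N D 199 e else 0 := by
      intro z hz
      obtain ⟨hz, hz0, hzh⟩ := mem_filter.mp hz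
      have hdvd : h ∣ (Phi z).natAbs := Int.natCast_dvd.mp hzh
      have habs : (Phi z).natAbs ≠ 0 := Int.natAbs_ne_zero.mpr hz0
      have hm0 : (Phi z).natAbs / h ≠ 0 :=
        (Nat.div_pos (Nat.le_of_dvd (Nat.pos_of_ne_zero habs) hdvd) hh.1).ne'
      have hmle : (Phi z).natAbs / h ≤ 2 * U ^ 3 := (Nat.div_le_self _ _).trans (natAbs_Phi_le hA hz)
      refine (tau_le_sum_divMajorant (J := 198) hN hD hm0 (hmle.trans hUD)
        (fun k hk => hR k (hk.trans hmle))).trans ?_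
      rw [sum_filter]
      refine mul_le_mul_of_nonneg_left (le_of_eq (sum_congr rfl fun e _ => ?_)) hR0
      have : e ∣ (Phi z).natAbs / h ↔ ((h * e : ℕ) : ℤ) ∣ Phi z := by
        rw [Int.natCast_dvd, Nat.dvd_div_iff_mul_dvd hdvd]
      simp only [this]
    refine (sum_le_sum e2).trans ?_
    rw [← mul_sum, sum_comm]
    refine mul_le_mul_of_nonneg_left (sum_le_sum fun e he => ?_) hR0
    rw [mem_Icc] at he
    rw [← sum_filter, sum_const, nsmul_eq_mul, mul_comm]
    refine mul_le_mul_of_nonneg_left ?_ (divMajorant_nonneg _ _ _ _)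
    have hhe : ((h * e : ℕ) : ℝ) ≤ (U : ℝ) ^ (1.1 : ℝ) := by
      have h4 : (h : ℝ) ≤ U := by exact_mod_cast hh.2.trans hH
      have h5 : (e : ℝ) ≤ (U : ℝ) ^ (0.09 : ℝ) := le_trans (by exact_mod_cast he.2) hDN
      calc ((h * e : ℕ) : ℝ) ≤ (U : ℝ) * (U : ℝ) ^ (0.09 : ℝ) := by push_cast; gcongr
        _ = (U : ℝ) ^ (1.09 : ℝ) := by rw [← Real.rpow_one_add' hUp.le (by norm_num)]; norm_num
        _ ≤ _ := Real.rpow_le_rpow_of_exponent_le hUr (by norm_num)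
    have h6 := hcl (h * e) (Nat.mul_pos hh.1 he.1) hhe
    calc _ ≤ (((quad A).filter fun z => ((h * e : ℕ) : ℤ) ∣ Phi z).card : ℝ) := by
          norm_cast
          refine card_le_card fun z hz => ?_
          simp only [mem_filter] at hz ⊢
          exact ⟨hz.1.1, hz.2⟩
      _ ≤ _ := h6
      _ = _ := by ring
  calc divisorMean A H ≤ ∑ h ∈ Icc 1 H, √(h : ℝ) * (R * ∑ e ∈ Icc 1 M, divMajorant N D 199 e *
        (K * U ^ 4 * (1 / ((h * e : ℕ) : ℝ) * localSum (h * e)))) :=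
        sum_le_sum fun h hh => mul_le_mul_of_nonneg_left (e1 h hh) (Real.sqrt_nonneg _)
    _ = R * K * U ^ 4 * ∑ h ∈ Icc 1 H, ∑ e ∈ Icc 1 M, √(h : ℝ) * (divMajorant N D 199 e *
          (1 / ((h * e : ℕ) : ℝ) * localSum (h * e))) := by
        simp_rw [mul_sum]
        refine sum_congr rfl fun h _ => sum_congr rfl fun e _ => ?_
        ring
    _ ≤ R * K * U ^ 4 * (C₁ * √(H : ℝ) * (1 + Real.log D + (D : ℝ) ^ (-σ) *
          (C₃ * (1 + Real.log N) ^ E))) := by gcongr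
    _ ≤ R * K * U ^ 4 * (C₁ * √(H : ℝ) * ((1 + C₃) * L)) := by
        gcongr
        have : (D : ℝ) ^ (-σ) * (C₃ * (1 + Real.log N) ^ E) ≤ C₃ := by
          calc _ = C₃ * ((D : ℝ) ^ (-σ) * (1 + Real.log N) ^ E) := by ring
            _ ≤ C₃ * 1 := by gcongr
            _ = _ := mul_one _
        nlinarith
    _ = _ := by
        rw [Real.rpow_add (by linarith), Real.rpow_one]
        ring

lemma abs_lt_of_conic {m l k A B : ℤ} (hm : 0 < m) (hml : m < l) (hk : 0 < k) (hA : 0 < A)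
    (h : m * A ^ 2 - l * B ^ 2 = k) : |B| < A := by
  have h1 : m * B ^ 2 ≤ l * B ^ 2 := mul_le_mul_of_nonneg_right hml.le (sq_nonneg B)
  have h2 : B ^ 2 < A ^ 2 := lt_of_mul_lt_mul_left (by linarith) hm.le
  exact abs_lt_of_sq_lt_sq h2 hA.le

/-- The difference of two congruent points on a hyperbola. -/
lemma conic_difference {m l k A₀ B₀ A B : ℤ} (hm : 0 < m) (hml : m < l) (hk : 0 < k) (hA₀ : 0 < A₀)
    (hA : 0 < A) (h₀ : m * A₀ ^ 2 - l * B₀ ^ 2 = k) (h : m * A ^ 2 - l * B ^ 2 = k)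
    (hl : l ∣ A₀ - A) (hmB : m ∣ B₀ - B) (hne : (A, B) ≠ (A₀, B₀)) :
    ∃ a b : ℤ, A = A₀ - l * a ∧ B = B₀ - m * b ∧ b ≠ 0 ∧ |a| ≤ |b| ∧
      2 * A₀ * a - l * a ^ 2 = 2 * B₀ * b - m * b ^ 2 := by
  obtain ⟨a, ha⟩ := hl
  obtain ⟨b, hb⟩ := hmB
  have hA' : A = A₀ - l * a := by linarith
  have hB' : B = B₀ - m * b := by linarith
  have hl0 : 0 < l := hm.trans hml
  have key : 2 * A₀ * a - l * a ^ 2 = 2 * B₀ * b - m * b ^ 2 := by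
    have : (m * l) * (2 * A₀ * a - l * a ^ 2) = (m * l) * (2 * B₀ * b - m * b ^ 2) := by
      rw [hA', hB'] at h
      linear_combination h₀ - h
    exact mul_left_cancel₀ (mul_pos hm hl0).ne' this
  have key2 : a * (A + A₀) = b * (B + B₀) := by
    rw [hA', hB']; linear_combination key
  have hB1 := abs_lt_of_conic hm hml hk hA h
  have hB2 := abs_lt_of_conic hm hml hk hA₀ h₀
  have hS : 0 < A + A₀ := by linarith
  have hb0 : b ≠ 0 := by
    rintro rfl
    rw [zero_mul] at key2
    rcases mul_eq_zero.mp key2 with h1 | h1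
    · subst h1; exact hne (by rw [hA', hB']; simp)
    · linarith
  refine ⟨a, b, hA', hB', hb0, ?_, key⟩
  have h1 : |a| * (A + A₀) = |b| * |B + B₀| := by
    have h0 := congrArg abs key2
    rwa [abs_mul, abs_mul, abs_of_pos hS] at h0
  have h2 : |B + B₀| ≤ A + A₀ := (abs_add_le _ _).trans (by linarith)
  refine le_of_mul_le_mul_right ?_ hS
  rw [h1]
  exact mul_le_mul_of_nonneg_left h2 (abs_nonneg b)

/-- Congruent points on a short arc of a hyperbola: at most two of them. -/
lemma eq_of_conic_window {m l k X A₀ B₀ A B A' B' : ℤ} (hm : 0 < m) (hml : m < l) (hk : 0 < k)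
    (hA₀ : 0 < A₀) (hA : 0 < A) (hA' : 0 < A') (h₀ : m * A₀ ^ 2 - l * B₀ ^ 2 = k)
    (h : m * A ^ 2 - l * B ^ 2 = k) (h' : m * A' ^ 2 - l * B' ^ 2 = k)
    (hl : l ∣ A₀ - A) (hl' : l ∣ A₀ - A') (hmB : m ∣ B₀ - B) (hmB' : m ∣ B₀ - B')
    (hX : l * X ^ 3 < A₀) (hBX : |B₀ - B| ≤ m * X) (hBX' : |B₀ - B'| ≤ m * X)
    (hne : (A, B) ≠ (A₀, B₀)) (hne' : (A', B') ≠ (A₀, B₀)) : (A, B) = (A', B') := by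
  obtain ⟨a, b, rfl, rfl, hb, hab, e1⟩ := conic_difference hm hml hk hA₀ hA h₀ h hl hmB hne
  obtain ⟨a', b', rfl, rfl, hb', hab', e2⟩ := conic_difference hm hml hk hA₀ hA' h₀ h' hl' hmB' hne'
  have hl0 : 0 < l := hm.trans hml
  have hbX : |b| ≤ X := by
    rw [sub_sub_cancel, abs_mul, abs_of_pos hm] at hBX
    exact le_of_mul_le_mul_left hBX hm
  have hbX' : |b'| ≤ X := by
    rw [sub_sub_cancel, abs_mul, abs_of_pos hm] at hBX'
    exact le_of_mul_le_mul_left hBX' hm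
  have hX0 : 0 ≤ X := (abs_nonneg b).trans hbX
  have key : 2 * A₀ * (a * b' - a' * b) =
      b' * (l * a ^ 2 - m * b ^ 2) - b * (l * a' ^ 2 - m * b' ^ 2) := by
    linear_combination b' * e1 - b * e2
  have hbound : ∀ x y : ℤ, |x| ≤ |y| → |y| ≤ X → |l * x ^ 2 - m * y ^ 2| ≤ l * X ^ 2 := by
    intro x y hxy hy
    have h1 : x ^ 2 ≤ y ^ 2 := sq_le_sq.mpr hxy
    have h2 : y ^ 2 ≤ X ^ 2 := sq_le_sq.mpr (by rwa [abs_of_nonneg hX0])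
    have h3 : l * x ^ 2 ≤ l * X ^ 2 := mul_le_mul_of_nonneg_left (h1.trans h2) hl0.le
    have h4 : m * y ^ 2 ≤ l * X ^ 2 := mul_le_mul hml.le h2 (sq_nonneg y) hl0.le
    rw [abs_le]
    constructor <;> linarith [mul_nonneg hl0.le (sq_nonneg x), mul_nonneg hm.le (sq_nonneg y)]
  have hsmall : |2 * A₀ * (a * b' - a' * b)| < 2 * A₀ := by
    rw [key]
    calc _ ≤ |b' * (l * a ^ 2 - m * b ^ 2)| + |b * (l * a' ^ 2 - m * b' ^ 2)| := abs_sub _ _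
      _ = |b'| * |l * a ^ 2 - m * b ^ 2| + |b| * |l * a' ^ 2 - m * b' ^ 2| := by
        rw [abs_mul, abs_mul]
      _ ≤ X * (l * X ^ 2) + X * (l * X ^ 2) := by
        refine add_le_add ?_ ?_
        · exact mul_le_mul hbX' (hbound a b hab hbX) (abs_nonneg _) hX0
        · exact mul_le_mul hbX (hbound a' b' hab' hbX') (abs_nonneg _) hX0
      _ = 2 * (l * X ^ 3) := by ring
      _ < _ := by linarith
  have hz : a * b' - a' * b = 0 := by
    rw [abs_mul, abs_of_pos (by linarith : 0 < 2 * A₀)] at hsmall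
    have : |a * b' - a' * b| < 1 := lt_of_mul_lt_mul_left (by linarith) (by linarith : 0 ≤ 2 * A₀)
    exact Int.abs_lt_one_iff.mp this
  have hprod : a * b' = a' * b := by linarith
  rw [hz, mul_zero] at key
  have hfac : b' * (b - b') * (l * a ^ 2 - m * b ^ 2) = 0 := by
    have : b * (b' * (b - b') * (l * a ^ 2 - m * b ^ 2)) = 0 := by
      linear_combination (-b ^ 2) * key + (-l) * b * (a * b' + a' * b) * hprod
    exact (mul_eq_zero.mp this).resolve_left hb
  rcases mul_eq_zero.mp hfac with h1 | h1
  · have hbb : b = b' := by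
      rcases mul_eq_zero.mp h1 with h2 | h2
      · exact absurd h2 hb'
      · linarith
    subst hbb
    have : a = a' := mul_right_cancel₀ hb hprod
    rw [this]
  · exfalso
    have h2 : A₀ * a = B₀ * b := by linarith
    have h3 : b ^ 2 * (m * A₀ ^ 2 - l * B₀ ^ 2) = 0 := by
      linear_combination (-A₀ ^ 2) * h1 + l * (A₀ * a + B₀ * b) * h2
    rw [h₀] at h3
    rcases mul_eq_zero.mp h3 with h4 | h4
    · exact hb (pow_eq_zero_iff (by norm_num) |>.mp h4)
    · linarith

/-- A bound for the number of square root classes modulo `n`. -/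
noncomputable def rootBound (n : ℕ) : ℕ := 4 * ∑ d ∈ n.divisors, d.gcd (n / d)

lemma card_root_classes_le (n : ℕ) (hn : 0 < n) (T : Finset ℤ)
    (hT : ∀ a ∈ T, ∀ b ∈ T, (n : ℤ) ∣ 3 * ((a - b) * (a + b))) :
    (T.image fun a : ℤ => a % (n : ℤ)).card ≤ rootBound n := by
  rcases T.eq_empty_or_nonempty with rfl | ⟨A₀, hA₀⟩
  · simp
  have hn0 : (n : ℤ) ≠ 0 := by exact_mod_cast hn.ne'
  have hsub : (T.image fun a : ℤ => a % (n : ℤ)) ⊆ n.divisors.biUnion fun d =>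
      (Ico (0 : ℤ) (n : ℤ)).filter fun r : ℤ => (d : ℤ) ∣ r - A₀ ∧ ((n / d : ℕ) : ℤ) ∣ 3 * (r + A₀) := by
    intro r hr
    obtain ⟨a, ha, rfl⟩ := mem_image.mp hr
    have h1 := hT a ha A₀ hA₀
    have hmod : (n : ℤ) ∣ a - a % n := Int.dvd_self_sub_emod
    have h2 : (n : ℤ) ∣ 3 * ((a % n - A₀) * (a % n + A₀)) := by
      have : 3 * ((a % n - A₀) * (a % n + A₀)) =
          3 * ((a - A₀) * (a + A₀)) - (a - a % n) * (3 * (a + a % n)) := by ring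
      rw [this]
      exact dvd_sub h1 (hmod.mul_right _)
    rw [mem_biUnion]
    set r := a % (n : ℤ) with hr
    set d := Int.gcd n (r - A₀) with hd
    have hdn : d ∣ n := by
      have : (d : ℤ) ∣ n := Int.gcd_dvd_left _ _
      exact_mod_cast this
    have hd0 : 0 < d := Nat.pos_of_dvd_of_pos hdn hn
    refine ⟨d, Nat.mem_divisors.mpr ⟨hdn, hn.ne'⟩, ?_⟩
    rw [mem_filter, mem_Ico]
    refine ⟨⟨Int.emod_nonneg _ hn0, Int.emod_lt_of_pos _ (by exact_mod_cast hn)⟩,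
      Int.gcd_dvd_right _ _, ?_⟩
    obtain ⟨t, ht⟩ : (d : ℤ) ∣ r - A₀ := Int.gcd_dvd_right _ _
    obtain ⟨e, he⟩ := hdn
    have hed : n / d = e := by rw [he]; exact Nat.mul_div_cancel_left e hd0
    rw [hed]
    have hcop : IsCoprime (e : ℤ) t := by
      rw [Int.isCoprime_iff_gcd_eq_one]
      have h3 : d = d * Int.gcd e t := by
        conv_lhs => rw [hd, ht, he]
        push_cast
        rw [Int.gcd_mul_left, Int.natAbs_natCast]
      exact Nat.eq_of_mul_eq_mul_left hd0 (by rw [← h3, mul_one])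
    have h4 : (e : ℤ) ∣ t * (3 * (r + A₀)) := by
      rw [ht, he] at h2
      push_cast at h2
      have hdz : (d : ℤ) ≠ 0 := by exact_mod_cast hd0.ne'
      refine Int.dvd_of_mul_dvd_mul_left hdz ?_
      convert h2 using 1
      ring
    exact hcop.dvd_of_dvd_mul_left h4
  refine (card_le_card hsub).trans (card_biUnion_le.trans ?_)
  unfold rootBound
  rw [mul_sum]
  refine sum_le_sum fun d hd => ?_
  have hdn := Nat.dvd_of_mem_divisors hd
  have hd0 := Nat.pos_of_mem_divisors hd
  set e := n / d with he
  have hde : d * e = n := Nat.mul_div_cancel' hdn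
  have he0 : 0 < e := Nat.pos_of_ne_zero fun h => by rw [h] at hde; omega
  have hl0 : 0 < d.lcm e := Nat.lcm_pos hd0 he0
  have hg0 : 0 < d.gcd e := Nat.gcd_pos_of_pos_left _ hd0
  set S := (Ico (0 : ℤ) (n : ℤ)).filter fun r : ℤ => (d : ℤ) ∣ r - A₀ ∧ (e : ℤ) ∣ 3 * (r + A₀) with hS
  rcases S.eq_empty_or_nonempty with hSe | ⟨r₀, hr₀⟩
  · rw [hSe]; simp
  have h1 : S.card ≤ ((Ico (0 : ℤ) (3 * n)).filter
      fun k => ((k : ℤ) : ZMod (d.lcm e)) = ((3 * r₀ : ℤ) : ZMod (d.lcm e))).card := by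
    refine card_le_card_of_injOn (fun r => 3 * r) ?_ ?_
    · intro r hr
      have hr := mem_filter.mp hr
      have hr₀ := mem_filter.mp hr₀
      rw [mem_Ico] at hr
      simp only [coe_filter, mem_Ico, Set.mem_ofPred_eq]
      refine ⟨⟨by linarith [hr.1.1], by linarith [hr.1.2]⟩, ?_⟩
      rw [ZMod.intCast_eq_intCast_iff_dvd_sub]
      have h2 : (d : ℤ) ∣ 3 * r₀ - 3 * r := by
        have := dvd_sub hr₀.2.1 hr.2.1
        have h3 : 3 * r₀ - 3 * r = 3 * ((r₀ - A₀) - (r - A₀)) := by ring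
        rw [h3]; exact this.mul_left 3
      have h3 : (e : ℤ) ∣ 3 * r₀ - 3 * r := by
        have := dvd_sub hr₀.2.2 hr.2.2
        have h3 : 3 * r₀ - 3 * r = 3 * (r₀ + A₀) - 3 * (r + A₀) := by ring
        rw [h3]; exact this
      rw [Int.natCast_dvd] at h2 h3 ⊢
      exact Nat.lcm_dvd h2 h3
    · intro a _ b _ hab
      have : (3 : ℤ) * a = 3 * b := hab
      linarith
  have : NeZero (d.lcm e) := ⟨hl0.ne'⟩
  refine h1.trans ((card_int_class_le _ hl0 0 (3 * n) _).trans ?_)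
  have h2 : (3 * (n : ℤ) - 0).toNat = 3 * n := by omega
  have h3 : 3 * n / d.lcm e = 3 * d.gcd e := by
    rw [← hde, ← Nat.gcd_mul_lcm d e, ← mul_assoc, Nat.mul_div_cancel _ hl0]
  rw [h2, h3]
  omega

lemma sum_sum_divisors_eq (N : ℕ) (f : ℕ → ℕ → ℝ) :
    ∑ n ∈ Icc 1 N, ∑ d ∈ n.divisors, f d (n / d) =
      ∑ d ∈ Icc 1 N, ∑ e ∈ Icc 1 (N / d), f d e := by
  rw [sum_sigma', sum_sigma']
  refine sum_nbij' (fun x => ⟨x.2, x.1 / x.2⟩) (fun x => ⟨x.1 * x.2, x.1⟩) ?_ ?_ ?_ ?_ ?_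
  · rintro ⟨n, d⟩ h
    simp only [mem_sigma, mem_Icc, Nat.mem_divisors] at h ⊢
    have hd := Nat.pos_of_dvd_of_pos h.2.1 h.1.1
    exact ⟨⟨hd, (Nat.le_of_dvd h.1.1 h.2.1).trans h.1.2⟩,
      Nat.div_pos (Nat.le_of_dvd h.1.1 h.2.1) hd, Nat.div_le_div_right h.1.2⟩
  · rintro ⟨d, e⟩ h
    simp only [mem_sigma, mem_Icc, Nat.mem_divisors] at h ⊢
    have := Nat.mul_pos h.1.1 h.2.1
    refine ⟨⟨this, ?_⟩, dvd_mul_right _ _, this.ne'⟩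
    have := (Nat.le_div_iff_mul_le h.1.1).mp h.2.2
    rwa [mul_comm]
  · rintro ⟨n, d⟩ h
    simp only [mem_sigma, mem_Icc, Nat.mem_divisors] at h
    simp [Nat.mul_div_cancel' h.2.1]
  · rintro ⟨d, e⟩ h
    simp only [mem_sigma, mem_Icc] at h
    simp [Nat.mul_div_cancel_left e h.1.1]
  · rintro ⟨n, d⟩ h
    rfl

lemma sum_rootBound_le (N M : ℕ) (hM : 1 ≤ M) (hNM : N ≤ M) (T : ℝ)
    (hT : ∀ n ∈ Icc 1 M, (tau n : ℝ) ≤ T) :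
    ∑ n ∈ Icc 1 N, (rootBound n : ℝ) ≤ 4 * N * T * (1 + Real.log M) := by
  have hT0 : 0 ≤ T := (Nat.cast_nonneg _).trans (hT 1 (mem_Icc.mpr ⟨le_rfl, hM⟩))
  have h1 : ∑ n ∈ Icc 1 N, (rootBound n : ℝ) =
      4 * ∑ d ∈ Icc 1 N, ∑ e ∈ Icc 1 (N / d), (d.gcd e : ℝ) := by
    rw [← sum_sum_divisors_eq N fun d e => (d.gcd e : ℝ), mul_sum]
    refine sum_congr rfl fun n _ => ?_
    rw [rootBound]
    push_cast
    rfl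
  rw [h1]
  have h2 : ∑ d ∈ Icc 1 N, ∑ e ∈ Icc 1 (N / d), (d.gcd e : ℝ) ≤
      ∑ d ∈ Icc 1 M, (N : ℝ) * T * (1 / d) := by
    refine (sum_le_sum (g := fun d : ℕ => (N : ℝ) * T * (1 / d)) fun d hd => ?_).trans
      (sum_le_sum_of_subset_of_nonneg (Icc_subset_Icc le_rfl hNM) fun d _ _ => by positivity)
    rw [mem_Icc] at hd
    have h3 : ∑ e ∈ Icc 1 (N / d), (d.gcd e : ℝ) ≤ ((N / d : ℕ) : ℝ) * tau d := by
      exact_mod_cast sum_gcd_le d (N / d) (Nat.pos_iff_ne_zero.mp hd.1)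
    have hd0 : (0 : ℝ) < d := by exact_mod_cast hd.1
    calc _ ≤ _ := h3
      _ ≤ (N / d : ℝ) * T := mul_le_mul Nat.cast_div_le
          (hT d (mem_Icc.mpr ⟨hd.1, hd.2.trans hNM⟩)) (Nat.cast_nonneg _) (by positivity)
      _ = _ := by ring
  rw [← mul_sum] at h2
  have h4 := sum_inv_le_one_add_log M
  have h5 : (N : ℝ) * T * ∑ d ∈ Icc 1 M, (1 / d : ℝ) ≤ N * T * (1 + Real.log M) :=
    mul_le_mul_of_nonneg_left (by simpa using h4) (by positivity)
  calc _ ≤ 4 * ((N : ℝ) * T * (1 + Real.log M)) := by linarith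
    _ = _ := by ring

lemma sum_rootBound_div_le (N M : ℕ) (hM : 1 ≤ M) (hNM : N ≤ M) (T : ℝ)
    (hT : ∀ n ∈ Icc 1 M, (tau n : ℝ) ≤ T) :
    ∑ n ∈ Icc 1 N, (rootBound n : ℝ) / n ≤ 4 * T * (1 + Real.log M) ^ 2 := by
  have hT0 : 0 ≤ T := (Nat.cast_nonneg _).trans (hT 1 (mem_Icc.mpr ⟨le_rfl, hM⟩))
  have hM1 : (1 : ℝ) ≤ M := by exact_mod_cast hM
  have hL : 0 ≤ Real.log M := Real.log_nonneg hM1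
  have h1 : ∑ n ∈ Icc 1 N, (rootBound n : ℝ) / n =
      4 * ∑ d ∈ Icc 1 N, ∑ e ∈ Icc 1 (N / d), (d.gcd e : ℝ) / (d * e) := by
    rw [← sum_sum_divisors_eq N fun d e => (d.gcd e : ℝ) / (d * e), mul_sum]
    refine sum_congr rfl fun n _ => ?_
    rw [rootBound]
    push_cast
    rw [mul_div_assoc, sum_div]
    congr 1
    refine sum_congr rfl fun d hd => ?_
    congr 1
    exact_mod_cast (Nat.mul_div_cancel' (Nat.dvd_of_mem_divisors hd)).symm
  rw [h1]
  have h2 : ∑ d ∈ Icc 1 N, ∑ e ∈ Icc 1 (N / d), (d.gcd e : ℝ) / (d * e) ≤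
      ∑ d ∈ Icc 1 M, T * (1 + Real.log M) * (1 / d) := by
    refine (sum_le_sum (g := fun d : ℕ => T * (1 + Real.log M) * (1 / d)) fun d hd => ?_).trans
      (sum_le_sum_of_subset_of_nonneg (Icc_subset_Icc le_rfl hNM) fun d _ _ => by positivity)
    rw [mem_Icc] at hd
    have h3 := sum_gcd_div_le d M (Nat.pos_iff_ne_zero.mp hd.1)
    have hd0 : (0 : ℝ) < d := by exact_mod_cast hd.1
    calc ∑ e ∈ Icc 1 (N / d), (d.gcd e : ℝ) / (d * e)
        = (1 / d) * ∑ e ∈ Icc 1 (N / d), (d.gcd e : ℝ) / e := by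
          rw [mul_sum]
          refine sum_congr rfl fun e _ => ?_
          rw [div_mul_div_comm, one_mul]
      _ ≤ (1 / d) * ∑ e ∈ Icc 1 M, (d.gcd e : ℝ) / e := by
          refine mul_le_mul_of_nonneg_left ?_ (by positivity)
          exact sum_le_sum_of_subset_of_nonneg
            (Icc_subset_Icc le_rfl ((Nat.div_le_self _ _).trans hNM)) fun d _ _ => by positivity
      _ ≤ (1 / d) * (tau d * (1 + Real.log M)) := mul_le_mul_of_nonneg_left h3 (by positivity)
      _ ≤ (1 / d) * (T * (1 + Real.log M)) := by
          refine mul_le_mul_of_nonneg_left ?_ (by positivity)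
          exact mul_le_mul_of_nonneg_right (hT d (mem_Icc.mpr ⟨hd.1, hd.2.trans hNM⟩))
            (by positivity)
      _ = _ := by ring
  rw [← mul_sum] at h2
  have h4 := sum_inv_le_one_add_log M
  have h5 : T * (1 + Real.log M) * ∑ d ∈ Icc 1 M, (1 / d : ℝ) ≤
      T * (1 + Real.log M) * (1 + Real.log M) :=
    mul_le_mul_of_nonneg_left (by simpa using h4) (by positivity)
  calc _ ≤ 4 * (T * (1 + Real.log M) * (1 + Real.log M)) := by linarith
    _ = _ := by ring

/-- Counting points on one hyperbola. -/
lemma card_conic_le {W X g μ l : ℕ} (hg : 0 < g) (hμ : 0 < μ) (hml : μ < l) (hX : 0 < X)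
    (hcop : IsCoprime (μ : ℤ) l) (F : Finset (ℤ × ℤ))
    (hF : ∀ t ∈ F, 0 < t.1 ∧ 0 ≤ t.2 ∧ t.2 ≤ W ∧ (l : ℤ) * X ^ 3 < t.1 ∧
      3 * ((μ : ℤ) * t.1 ^ 2 - l * t.2 ^ 2) = (g : ℤ) ^ 2 * (l ^ 3 - μ ^ 3)) :
    F.card ≤ 2 * (rootBound l * rootBound μ * (W / (μ * X) + 1)) := by
  set key : ℤ × ℤ → ℤ × ℤ × ℤ := fun t => (t.1 % (l : ℤ), t.2 % (μ : ℤ), t.2 / ((μ : ℤ) * X))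
    with hkey
  have hμz : (0 : ℤ) < μ := by exact_mod_cast hμ
  have hmlz : (μ : ℤ) < l := by exact_mod_cast hml
  have hXz : (0 : ℤ) < X := by exact_mod_cast hX
  have hμX : (0 : ℤ) < (μ : ℤ) * X := mul_pos hμz hXz
  have hR : 0 < (g : ℤ) ^ 2 * ((l : ℤ) ^ 3 - μ ^ 3) := by
    have : (0 : ℤ) < g := by exact_mod_cast hg
    have h3 : (μ : ℤ) ^ 3 < l ^ 3 := pow_lt_pow_left₀ hmlz hμz.le (by norm_num)
    have : 0 < (l : ℤ) ^ 3 - μ ^ 3 := by linarith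
    positivity
  have h1 : F.card ≤ 2 * (F.image key).card := by
    refine card_le_mul_card_image F 2 fun b _ => ?_
    by_contra hlt
    obtain ⟨t₀, h₀, t₁, h₁, t₂, h₂, n01, n02, n12⟩ := two_lt_card.mp (not_le.mp hlt)
    rw [mem_filter] at h₀ h₁ h₂
    obtain ⟨a₀, b₀, -, w₀, e₀⟩ := hF _ h₀.1
    obtain ⟨a₁, b₁, -, w₁, e₁⟩ := hF _ h₁.1
    obtain ⟨a₂, b₂, -, w₂, e₂⟩ := hF _ h₂.1
    have hk : ∀ t, key t = b → key t₀ = b → (l : ℤ) ∣ t₀.1 - t.1 ∧ (μ : ℤ) ∣ t₀.2 - t.2 ∧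
        |t₀.2 - t.2| ≤ (μ : ℤ) * X := by
      intro t ht ht₀
      have h := ht₀.trans ht.symm
      simp only [hkey, Prod.mk.injEq] at h
      refine ⟨Int.ModEq.dvd h.1.symm, Int.ModEq.dvd h.2.1.symm, ?_⟩
      have c1 := Int.emod_add_mul_ediv t₀.2 ((μ : ℤ) * X)
      have c2 := Int.emod_add_mul_ediv t.2 ((μ : ℤ) * X)
      have c3 := Int.emod_nonneg t₀.2 hμX.ne'
      have c4 := Int.emod_nonneg t.2 hμX.ne'
      have c5 := Int.emod_lt_of_pos t₀.2 hμX
      have c6 := Int.emod_lt_of_pos t.2 hμX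
      rw [h.2.2] at c1
      rw [abs_le]
      constructor <;> linarith
    obtain ⟨d1, d2, d3⟩ := hk t₁ h₁.2 h₀.2
    obtain ⟨f1, f2, f3⟩ := hk t₂ h₂.2 h₀.2
    refine n12 (eq_of_conic_window (m := μ) (l := l)
      (k := (μ : ℤ) * t₀.1 ^ 2 - l * t₀.2 ^ 2) (X := X) (A₀ := t₀.1) (B₀ := t₀.2)
      hμz hmlz (by linarith) a₀ a₁ a₂ rfl (by linarith) (by linarith) d1 f1 d2 f2 w₀ d3 f3
      n01.symm n02.symm)
  refine h1.trans (Nat.mul_le_mul_left 2 ?_)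
  have h2 : F.image key ⊆ ((F.image Prod.fst).image fun a : ℤ => a % (l : ℤ)) ×ˢ
      (((F.image Prod.snd).image fun a : ℤ => a % (μ : ℤ)) ×ˢ
        Icc (0 : ℤ) ((W / (μ * X) : ℕ) : ℤ)) := by
    intro k hk
    obtain ⟨t, ht, rfl⟩ := mem_image.mp hk
    obtain ⟨-, b, c, -, -⟩ := hF t ht
    simp only [hkey, mem_product]
    refine ⟨mem_image_of_mem _ (mem_image_of_mem _ ht),
      mem_image_of_mem _ (mem_image_of_mem _ ht), mem_Icc.mpr ⟨Int.ediv_nonneg b hμX.le, ?_⟩⟩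
    push_cast
    exact Int.ediv_le_ediv hμX c
  refine (card_le_card h2).trans ?_
  rw [card_product, card_product, Int.card_Icc, mul_assoc]
  have c1 := card_root_classes_le l (hμ.trans hml) (F.image Prod.fst) (by
    intro a ha b hb
    obtain ⟨t, ht, rfl⟩ := mem_image.mp ha
    obtain ⟨t', ht', rfl⟩ := mem_image.mp hb
    obtain ⟨-, -, -, -, e⟩ := hF t ht
    obtain ⟨-, -, -, -, e'⟩ := hF t' ht'
    refine hcop.symm.dvd_of_dvd_mul_left (z := 3 * ((t.1 - t'.1) * (t.1 + t'.1))) ?_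
    exact ⟨3 * (t.2 ^ 2 - t'.2 ^ 2), by linear_combination e - e'⟩)
  have c2 := card_root_classes_le μ hμ (F.image Prod.snd) (by
    intro a ha b hb
    obtain ⟨t, ht, rfl⟩ := mem_image.mp ha
    obtain ⟨t', ht', rfl⟩ := mem_image.mp hb
    obtain ⟨-, -, -, -, e⟩ := hF t ht
    obtain ⟨-, -, -, -, e'⟩ := hF t' ht'
    refine hcop.dvd_of_dvd_mul_left (z := 3 * ((t.2 - t'.2) * (t.2 + t'.2))) ?_
    exact ⟨3 * (t.1 ^ 2 - t'.1 ^ 2), by linear_combination e' - e⟩)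
  refine Nat.mul_le_mul c1 (Nat.mul_le_mul c2 ?_)
  rw [sub_zero, ← Nat.cast_succ, Int.toNat_natCast]

/-- Points `((p, q), (A, B))` with `p (3 A² + p²) = q (3 B² + q²)`, `q - p` large and
`p, q` having a large common factor. -/
noncomputable def conicSet (W U₀ G : ℕ) : Finset ((ℕ × ℕ) × (ℕ × ℕ)) :=
  ((Icc 1 W ×ˢ Icc 1 W) ×ˢ (Icc 1 W ×ˢ Icc 0 W)).filter fun t =>
    t.1.1 + U₀ < t.1.2 ∧ G ≤ t.1.1.gcd t.1.2 ∧
      t.1.1 * (3 * t.2.1 ^ 2 + t.1.1 ^ 2) = t.1.2 * (3 * t.2.2 ^ 2 + t.1.2 ^ 2)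

lemma mem_conicSet {W U₀ G p q A B : ℕ} : ((p, q), (A, B)) ∈ conicSet W U₀ G ↔
    ((1 ≤ p ∧ p ≤ W) ∧ (1 ≤ q ∧ q ≤ W)) ∧ ((1 ≤ A ∧ A ≤ W) ∧ B ≤ W) ∧
    p + U₀ < q ∧ G ≤ p.gcd q ∧ p * (3 * A ^ 2 + p ^ 2) = q * (3 * B ^ 2 + q ^ 2) := by
  simp [conicSet, and_assoc]

lemma card_conicSet_fiber_le {W U₀ G X g l μ : ℕ} (hG : 1 ≤ G) (hX : 0 < X)
    (hW : 2 * W * X ^ 3 < G * U₀) :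
    ((conicSet W U₀ G).filter fun t => t.1.1.gcd t.1.2 = g ∧ t.1.2 / g = l ∧ t.1.1 / g = μ).card ≤
      2 * (rootBound l * rootBound μ * (W / (μ * X) + 1)) := by
  set S := (conicSet W U₀ G).filter
    fun t => t.1.1.gcd t.1.2 = g ∧ t.1.2 / g = l ∧ t.1.1 / g = μ with hS
  rcases S.eq_empty_or_nonempty with h0 | ⟨⟨⟨p₀, q₀⟩, A₀, B₀⟩, h0⟩
  · rw [h0]; simp
  have hpq : ∀ t ∈ S, t.1.1 = g * μ ∧ t.1.2 = g * l := by
    intro t ht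
    obtain ⟨-, e1, e2, e3⟩ := mem_filter.mp ht
    have d1 : g ∣ t.1.1 := e1 ▸ Nat.gcd_dvd_left _ _
    have d2 : g ∣ t.1.2 := e1 ▸ Nat.gcd_dvd_right _ _
    rw [← e2, ← e3]
    exact ⟨(Nat.mul_div_cancel' d1).symm, (Nat.mul_div_cancel' d2).symm⟩
  have h1 := hpq _ h0
  obtain ⟨h2, e1, -, -⟩ := mem_filter.mp h0
  obtain ⟨h3, -, h4, h5, -⟩ := mem_conicSet.mp h2
  simp only at h1 e1
  obtain ⟨rfl, rfl⟩ := h1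
  have hg : 0 < g := by omega
  have hμ : 0 < μ := Nat.pos_of_ne_zero fun h => by simp [h] at h3
  have hml : μ < l := Nat.lt_of_mul_lt_mul_left (a := g) (by omega)
  have hcop : Nat.Coprime μ l := by
    rw [Nat.gcd_mul_left] at e1
    exact Nat.eq_of_mul_eq_mul_left hg (by rw [e1, mul_one])
  have hcard : S.card ≤ (S.image fun t => ((t.2.1 : ℤ), (t.2.2 : ℤ))).card := by
    rw [card_image_of_injOn]
    intro t ht t' ht' h
    simp only [Prod.mk.injEq, Nat.cast_inj] at h
    obtain ⟨a1, a2⟩ := hpq t ht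
    obtain ⟨b1, b2⟩ := hpq t' ht'
    exact Prod.ext (Prod.ext (a1.trans b1.symm) (a2.trans b2.symm)) (Prod.ext h.1 h.2)
  refine hcard.trans (card_conic_le hg hμ hml hX (Nat.isCoprime_iff_coprime.mpr hcop) _ ?_)
  intro t ht
  obtain ⟨⟨⟨p, q⟩, A, B⟩, hs, rfl⟩ := mem_image.mp ht
  obtain ⟨rfl, rfl⟩ := hpq _ hs
  obtain ⟨-, ⟨⟨c1, -⟩, c2⟩, c3, c4, c5⟩ := mem_conicSet.mp (mem_filter.mp hs).1
  have hGg : G ≤ g := by rw [e1] at h5; exact h5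
  have c5z : (g * μ : ℤ) * (3 * A ^ 2 + (g * μ : ℤ) ^ 2) = (g * l) * (3 * B ^ 2 + (g * l : ℤ) ^ 2) := by
    exact_mod_cast c5
  have hgz : (0 : ℤ) < g := by exact_mod_cast hg
  have e : 3 * ((μ : ℤ) * A ^ 2 - l * B ^ 2) = (g : ℤ) ^ 2 * (l ^ 3 - μ ^ 3) := by
    refine mul_left_cancel₀ hgz.ne' ?_
    linear_combination c5z
  refine ⟨Int.natCast_pos.mpr c1, Int.natCast_nonneg _, Int.ofNat_le.mpr c2, ?_, e⟩
  simp only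
  have hμz : (0 : ℤ) < μ := by exact_mod_cast hμ
  have hmlz : (μ : ℤ) < l := by exact_mod_cast hml
  have c3z : (g * μ : ℤ) + U₀ < g * l := by exact_mod_cast c3
  have hAz : (0 : ℤ) < A := by exact_mod_cast c1
  have hU0 : (0 : ℤ) ≤ U₀ := by positivity
  have k1 : (g : ℤ) ^ 2 * (l - μ) ^ 2 ≤ 3 * A ^ 2 := by
    refine le_of_mul_le_mul_left ?_ hμz
    have k2 : μ * (l - μ) ^ 2 ≤ (l : ℤ) ^ 3 - μ ^ 3 := by
      have : (l : ℤ) ^ 3 - μ ^ 3 - μ * (l - μ) ^ 2 = (l - μ) * (l ^ 2 + 2 * μ ^ 2) := by ring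
      have h6 : 0 ≤ ((l : ℤ) - μ) * (l ^ 2 + 2 * μ ^ 2) :=
        mul_nonneg (by linarith) (by positivity)
      linarith
    have k3 := mul_le_mul_of_nonneg_left k2 (sq_nonneg (g : ℤ))
    have k4 : 0 ≤ (l : ℤ) * B ^ 2 := by positivity
    linarith
  have k2 : (U₀ : ℤ) ≤ 2 * A := by
    refine abs_le_of_sq_le_sq' ?_ (by linarith) |>.2
    have : (U₀ : ℤ) ^ 2 ≤ (g * (l - μ)) ^ 2 := pow_le_pow_left₀ hU0 (by linarith) 2
    nlinarith
  have hGz : (0 : ℤ) < G := by exact_mod_cast hG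
  have hWz : 2 * (W : ℤ) * X ^ 3 < G * U₀ := by exact_mod_cast hW
  have k5 : (G : ℤ) * l ≤ W := by
    have : G * l ≤ W := (Nat.mul_le_mul_right l hGg).trans h3.2.2
    exact_mod_cast this
  have k6 : (G : ℤ) * l * X ^ 3 ≤ W * X ^ 3 := mul_le_mul_of_nonneg_right k5 (by positivity)
  have k7 : (G : ℤ) * U₀ ≤ G * (2 * A) := mul_le_mul_of_nonneg_left k2 hGz.le
  refine lt_of_mul_lt_mul_left ?_ hGz.le
  linarith

lemma card_conicSet_le {W U₀ G X : ℕ} (hG : 1 ≤ G) (hX : 0 < X) (hW1 : 1 ≤ W)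
    (hW : 2 * W * X ^ 3 < G * U₀) (T : ℝ) (hT : ∀ n ∈ Icc 1 W, (tau n : ℝ) ≤ T) :
    ((conicSet W U₀ G).card : ℝ) ≤
      32 * T ^ 2 * (1 + Real.log W) ^ 4 * (W : ℝ) ^ 2 * (1 / X + 1 / G) := by
  have hT0 : 0 ≤ T := (Nat.cast_nonneg _).trans (hT 1 (mem_Icc.mpr ⟨le_rfl, hW1⟩))
  have hW1' : (1 : ℝ) ≤ W := by exact_mod_cast hW1
  have hlog : 0 ≤ Real.log W := Real.log_nonneg hW1'
  set L := 1 + Real.log W with hL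
  have hL1 : 1 ≤ L := by linarith
  have hX' : (0 : ℝ) < X := by exact_mod_cast hX
  have hG' : (0 : ℝ) < G := by exact_mod_cast hG
  have step : ∀ g ∈ Icc G W, (((conicSet W U₀ G).filter fun t => t.1.1.gcd t.1.2 = g).card : ℝ) ≤
      32 * T ^ 2 * L ^ 3 * ((W : ℝ) ^ 2 / X + (W : ℝ) ^ 2 / G) * (1 / g) := by
    intro g hg
    rw [mem_Icc] at hg
    have hg0 : 0 < g := by omega
    have hg' : (0 : ℝ) < g := by exact_mod_cast hg0
    have hGg : (G : ℝ) ≤ g := by exact_mod_cast hg.1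
    set N := W / g with hN
    have hNW : N ≤ W := Nat.div_le_self _ _
    have hNr : (N : ℝ) ≤ W / g := Nat.cast_div_le
    set S := (conicSet W U₀ G).filter fun t => t.1.1.gcd t.1.2 = g with hS
    have h1 : S.card = ∑ w ∈ Icc 1 N ×ˢ Icc 1 N, (S.filter fun t =>
        (t.1.2 / g, t.1.1 / g) = w).card := by
      refine card_eq_sum_card_fiberwise ?_
      intro t ht
      obtain ⟨ht, hgt⟩ := mem_filter.mp ht
      obtain ⟨⟨p, q⟩, A, B⟩ := t
      obtain ⟨h3, -⟩ := mem_conicSet.mp ht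
      simp only at hgt
      have d1 : g ∣ p := hgt ▸ Nat.gcd_dvd_left _ _
      have d2 : g ∣ q := hgt ▸ Nat.gcd_dvd_right _ _
      simp only [coe_product, Set.mem_prod, coe_Icc, Set.mem_Icc]
      exact ⟨⟨Nat.div_pos (Nat.le_of_dvd h3.2.1 d2) hg0, Nat.div_le_div_right h3.2.2⟩,
        ⟨Nat.div_pos (Nat.le_of_dvd h3.1.1 d1) hg0, Nat.div_le_div_right h3.1.2⟩⟩
    have h2 : (S.card : ℝ) ≤ ∑ w ∈ Icc 1 N ×ˢ Icc 1 N,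
        2 * ((rootBound w.1 : ℝ) * (W / X * (rootBound w.2 / w.2) + rootBound w.2)) := by
      rw [h1]
      push_cast
      refine sum_le_sum fun w hw => ?_
      have hw2 : 1 ≤ w.2 := (mem_Icc.mp (mem_product.mp hw).2).1
      have h3 := card_conicSet_fiber_le (g := g) (l := w.1) (μ := w.2) hG hX hW
      have h4 : (S.filter fun t => (t.1.2 / g, t.1.1 / g) = w) = (conicSet W U₀ G).filter
          fun t => t.1.1.gcd t.1.2 = g ∧ t.1.2 / g = w.1 ∧ t.1.1 / g = w.2 := by
        rw [hS, filter_filter]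
        refine filter_congr fun t _ => ?_
        rw [Prod.ext_iff]
      rw [h4]
      have h5 : ((((conicSet W U₀ G).filter
          fun t => t.1.1.gcd t.1.2 = g ∧ t.1.2 / g = w.1 ∧ t.1.1 / g = w.2).card : ℕ) : ℝ) ≤
          2 * ((rootBound w.1 : ℝ) * rootBound w.2 * ((W / (w.2 * X) : ℕ) + 1)) := by
        exact_mod_cast h3
      refine h5.trans ?_
      have hw2' : (0 : ℝ) < w.2 := by exact_mod_cast hw2
      have h6 : ((W / (w.2 * X) : ℕ) : ℝ) ≤ W / (w.2 * X) := by
        have := Nat.cast_div_le (α := ℝ) (m := W) (n := w.2 * X)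
        push_cast at this
        exact this
      calc _ ≤ 2 * ((rootBound w.1 : ℝ) * rootBound w.2 * (W / (w.2 * X) + 1)) := by
            gcongr
        _ = _ := by field_simp
    have hs1 := sum_rootBound_le N W hW1 hNW T hT
    have hs2 := sum_rootBound_div_le N W hW1 hNW T hT
    rw [← hL] at hs1 hs2
    have hT4 : 0 ≤ 4 * (W / g) * T * L := by positivity
    have hs1' : ∑ n ∈ Icc 1 N, (rootBound n : ℝ) ≤ 4 * (W / g) * T * L := by
      refine hs1.trans ?_
      gcongr
    have h7 : ∑ w ∈ Icc 1 N ×ˢ Icc 1 N,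
        2 * ((rootBound w.1 : ℝ) * (W / X * (rootBound w.2 / w.2) + rootBound w.2)) =
        2 * ((∑ n ∈ Icc 1 N, (rootBound n : ℝ)) *
          (W / X * ∑ n ∈ Icc 1 N, (rootBound n : ℝ) / n + ∑ n ∈ Icc 1 N, (rootBound n : ℝ))) := by
      rw [← mul_sum, mul_sum (Icc 1 N) (fun n => (rootBound n : ℝ) / n), ← sum_add_distrib,
        sum_mul_sum, ← sum_product']
    rw [h7] at h2
    have hr0 : 0 ≤ ∑ n ∈ Icc 1 N, (rootBound n : ℝ) := sum_nonneg fun n _ => by positivity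
    have hr1 : 0 ≤ ∑ n ∈ Icc 1 N, (rootBound n : ℝ) / n := sum_nonneg fun n _ => by positivity
    calc (S.card : ℝ) ≤ _ := h2
      _ ≤ 2 * ((4 * (W / g) * T * L) * (W / X * (4 * T * L ^ 2) + 4 * (W / g) * T * L)) := by
        refine mul_le_mul_of_nonneg_left ?_ (by norm_num)
        refine mul_le_mul hs1' (add_le_add ?_ hs1') (by positivity) hT4
        exact mul_le_mul_of_nonneg_left hs2 (by positivity)
      _ ≤ 2 * ((4 * (W / g) * T * L) * (W / X * (4 * T * L ^ 2) + 4 * (W / G) * T * L ^ 2)) := by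
        have : L ≤ L ^ 2 := by nlinarith
        gcongr
      _ = _ := by field_simp; ring
  have h1 : (conicSet W U₀ G).card = ∑ g ∈ Icc G W,
      ((conicSet W U₀ G).filter fun t => t.1.1.gcd t.1.2 = g).card := by
    refine card_eq_sum_card_fiberwise ?_
    rintro ⟨⟨p, q⟩, A, B⟩ ht
    obtain ⟨h3, -, -, h5, -⟩ := mem_conicSet.mp ht
    rw [coe_Icc]
    exact ⟨h5, (Nat.le_of_dvd h3.1.1 (Nat.gcd_dvd_left _ _)).trans h3.1.2⟩
  rw [h1]
  push_cast
  refine (sum_le_sum step).trans ?_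
  rw [← mul_sum]
  have h4 : ∑ g ∈ Icc G W, (1 / g : ℝ) ≤ L := by
    refine le_trans (sum_le_sum_of_subset_of_nonneg (Icc_subset_Icc hG le_rfl)
      fun d _ _ => by positivity) ?_
    simpa using sum_inv_le_one_add_log W
  calc _ ≤ 32 * T ^ 2 * L ^ 3 * ((W : ℝ) ^ 2 / X + (W : ℝ) ^ 2 / G) * L :=
        mul_le_mul_of_nonneg_left h4 (by positivity)
    _ = _ := by ring

lemma card_trivial_le (A : Finset ℕ) :
    ((quad A).filter fun z => Phi z = 0 ∧ (z.1.1 : ℤ) + z.1.2 - z.2.1 - z.2.2 = 0).card ≤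
      2 * A.card ^ 2 := by
  have h : (((A ×ˢ A) ×ˢ (univ : Finset Bool))).card = 2 * A.card ^ 2 := by
    simp [card_product]; ring
  rw [← h]
  refine card_le_card_of_injOn (fun z => (z.1, decide (z.1.1 = z.2.1))) ?_ ?_
  · rintro z hz
    have hz := (mem_filter.mp hz).1
    simp only [quad, mem_product] at hz
    simp [hz.1, Classical.em]
  · have key : ∀ z : (ℕ × ℕ) × (ℕ × ℕ), z ∈ (quad A).filter (fun z => Phi z = 0 ∧
        (z.1.1 : ℤ) + z.1.2 - z.2.1 - z.2.2 = 0) → z.1.1 = z.2.1 ∧ z.1.2 = z.2.2 ∨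
          z.1.1 = z.2.2 ∧ z.1.2 = z.2.1 := by
      rintro ⟨⟨a, b⟩, c, d⟩ hz
      obtain ⟨-, h1, h2⟩ := mem_filter.mp hz
      simp only [Phi] at h1 h2 ⊢
      have hd : (d : ℤ) = a + b - c := by linarith
      have h3 : 3 * ((a : ℤ) + b) * ((a - c) * (b - c)) = 0 := by
        rw [hd] at h1
        linear_combination (-1) * h1
      rcases mul_eq_zero.mp h3 with h4 | h4
      · omega
      · rcases mul_eq_zero.mp h4 with h5 | h5
        · left; omega
        · right; omega
    rintro z hz w hw hzw
    obtain ⟨⟨a, b⟩, c, d⟩ := z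
    obtain ⟨⟨a', b'⟩, c', d'⟩ := w
    have h1 := key _ hz
    have h2 := key _ hw
    simp only [Prod.mk.injEq, decide_eq_decide] at h1 h2 hzw ⊢
    omega

lemma card_small_shift_le (U U₀ : ℕ) (T : ℝ) (hT : ∀ n ∈ Icc 1 (9 * U ^ 3), (tau n : ℝ) ≤ T) :
    (((quad (Icc 1 U)).filter fun z => Phi z = 0 ∧
      (z.1.1 : ℤ) + z.1.2 - z.2.1 - z.2.2 ≠ 0 ∧
      ((z.1.1 : ℤ) + z.1.2 - z.2.1 - z.2.2).natAbs ≤ U₀).card : ℝ) ≤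
      (2 * U₀ + 1) * U * (2 * T ^ 2) := by
  set S := (quad (Icc 1 U)).filter fun z => Phi z = 0 ∧
      (z.1.1 : ℤ) + z.1.2 - z.2.1 - z.2.2 ≠ 0 ∧
      ((z.1.1 : ℤ) + z.1.2 - z.2.1 - z.2.2).natAbs ≤ U₀ with hS
  have h1 : S.card = ∑ w ∈ Icc (-(U₀ : ℤ)) U₀ ×ˢ Icc 1 U, (S.filter fun z =>
      ((z.1.1 : ℤ) + z.1.2 - z.2.1 - z.2.2, z.2.2) = w).card := by
    refine card_eq_sum_card_fiberwise ?_
    intro z hz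
    obtain ⟨h, -, -, h3⟩ := mem_filter.mp hz
    rw [mem_quad] at h
    simp only [coe_product, Set.mem_prod, coe_Icc, Set.mem_Icc]
    exact ⟨⟨by omega, by omega⟩, mem_Icc.mp h.2.2⟩
  have h2 : ∀ w ∈ Icc (-(U₀ : ℤ)) U₀ ×ˢ Icc 1 U, ((S.filter fun z =>
      ((z.1.1 : ℤ) + z.1.2 - z.2.1 - z.2.2, z.2.2) = w).card : ℝ) ≤ 2 * T ^ 2 := by
    rintro ⟨u, x⟩ -
    set F := S.filter fun z => ((z.1.1 : ℤ) + z.1.2 - z.2.1 - z.2.2, z.2.2) = (u, x) with hF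
    have hT2 : (0 : ℝ) ≤ 2 * T ^ 2 := by positivity
    rcases F.eq_empty_or_nonempty with h0 | ⟨z₀, hz₀⟩
    · rw [h0]; simpa using hT2
    set n : ℕ := (((x : ℤ) + u) ^ 3 - (x : ℤ) ^ 3).natAbs with hn
    have key : ∀ a b c d : ℕ, ((a, b), (c, d)) ∈ F →
        (1 ≤ a ∧ a ≤ U) ∧ (1 ≤ b ∧ b ≤ U) ∧ (1 ≤ c ∧ c ≤ U) ∧ (1 ≤ d ∧ d ≤ U) ∧ d = x ∧
        (a : ℤ) + b - c - d = u ∧ u ≠ 0 ∧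
        ((x : ℤ) + u) ^ 3 - (x : ℤ) ^ 3 = 3 * (a + b) * ((a - c) * (b - c)) := by
      intro a b c d h
      obtain ⟨h, h'⟩ := mem_filter.mp h
      obtain ⟨h, h3, h4, h5⟩ := mem_filter.mp h
      simp only [mem_quad, mem_Icc] at h
      simp only [Prod.mk.injEq, Phi] at h' h3 h4
      refine ⟨h.1.1, h.1.2, h.2.1, h.2.2, h'.2, h'.1, h'.1 ▸ h4, ?_⟩
      rw [← h'.2, ← h'.1]
      linear_combination h3
    have hne : n ≠ 0 := by
      obtain ⟨⟨a, b⟩, c, d⟩ := z₀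
      obtain ⟨-, -, -, h4, rfl, -, h7, -⟩ := key _ _ _ _ hz₀
      rw [hn, Int.natAbs_ne_zero, sub_ne_zero]
      intro h
      have := (Odd.strictMono_pow (R := ℤ) (n := 3) (by decide)).injective h
      exact h7 (by linarith)
    have hnle : n ≤ 9 * U ^ 3 := by
      obtain ⟨⟨a, b⟩, c, d⟩ := z₀
      obtain ⟨h1, h2, h3, h4, rfl, h6, h7, -⟩ := key _ _ _ _ hz₀
      have e1 : |(d : ℤ) + u| ≤ 2 * U := by rw [abs_le]; omega
      have e2 : |(d : ℤ)| ≤ U := by rw [abs_le]; omega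
      have e3 : |((d : ℤ) + u) ^ 3 - (d : ℤ) ^ 3| ≤ 9 * U ^ 3 := by
        refine (abs_sub _ _).trans ?_
        rw [abs_pow, abs_pow]
        have := pow_le_pow_left₀ (abs_nonneg _) e1 3
        have := pow_le_pow_left₀ (abs_nonneg _) e2 3
        linarith
      rw [← Int.natCast_natAbs] at e3
      exact_mod_cast e3
    have hc : F.card ≤ (n.divisors ×ˢ (n.divisors ×ˢ (univ : Finset Bool))).card := by
      refine card_le_card_of_injOn (fun z => (z.1.1 + z.1.2, ((z.1.1 : ℤ) - z.2.1).natAbs,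
        decide (z.2.1 ≤ z.1.1))) ?_ ?_
      · rintro ⟨⟨a, b⟩, c, d⟩ hz
        obtain ⟨-, -, -, -, -, -, -, h⟩ := key _ _ _ _ hz
        simp only [coe_product, Set.mem_prod, mem_coe, Nat.mem_divisors, mem_univ, and_true]
        refine ⟨⟨?_, hne⟩, ?_, hne⟩
        · rw [hn, ← Int.natCast_dvd, h]
          exact ⟨3 * ((a - c) * (b - c)), by push_cast; ring⟩
        · rw [hn, Int.natAbs_dvd_natAbs, h]
          exact ⟨3 * (a + b) * (b - c), by ring⟩
      · rintro ⟨⟨a, b⟩, c, d⟩ hz ⟨⟨a', b'⟩, c', d'⟩ hz' h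
        obtain ⟨-, -, -, -, h5, h6, -⟩ := key _ _ _ _ hz
        obtain ⟨-, -, -, -, h5', h6', -⟩ := key _ _ _ _ hz'
        simp only [Prod.mk.injEq, decide_eq_decide] at h ⊢
        omega
    have hτ := hT n (mem_Icc.mpr ⟨Nat.pos_of_ne_zero hne, hnle⟩)
    have hc' : (F.card : ℝ) ≤ tau n * (tau n * 2) := by
      rw [card_product, card_product] at hc
      simp only [card_univ, Fintype.card_bool] at hc
      exact_mod_cast hc
    have h0 : (0 : ℝ) ≤ tau n := Nat.cast_nonneg _
    nlinarith
  rw [h1]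
  push_cast
  refine (sum_le_sum h2).trans ?_
  rw [sum_const, nsmul_eq_mul, card_product, Int.card_Icc, Nat.card_Icc]
  have : ((U₀ : ℤ) + 1 - -(U₀ : ℤ)).toNat = 2 * U₀ + 1 := by omega
  rw [this]
  push_cast
  simp

/-- Passing from signed quadruples to `conicSet`. -/
lemma card_le_conicSet {W U₀ G : ℕ} (N : Finset (ℤ × ℤ × ℤ × ℤ))
    (hN : ∀ t ∈ N, t.1.natAbs ≤ W ∧ t.2.1.natAbs ≤ W ∧ t.2.2.1.natAbs ≤ W ∧ t.2.2.2.natAbs ≤ W ∧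
      U₀ < (t.1 - t.2.1).natAbs ∧ G ≤ t.1.gcd t.2.1 ∧
      t.1 * (3 * t.2.2.1 ^ 2 + t.1 ^ 2) = t.2.1 * (3 * t.2.2.2 ^ 2 + t.2.1 ^ 2)) :
    N.card ≤ 16 * (conicSet W U₀ G).card := by
  have h16 : ((univ : Finset (Bool × Bool × Bool × Bool)) ×ˢ conicSet W U₀ G).card =
      16 * (conicSet W U₀ G).card := by
    rw [card_product]; rfl
  rw [← h16]
  have hsign : ∀ p q a b : ℤ, p ≠ q → p * (3 * a ^ 2 + p ^ 2) = q * (3 * b ^ 2 + q ^ 2) →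
      0 < p ∧ 0 < q ∨ p < 0 ∧ q < 0 := by
    intro p q a b hpq h
    have hP : ∀ x c : ℤ, x ≠ 0 → 0 < 3 * c ^ 2 + x ^ 2 := fun x c hx => by positivity
    rcases lt_trichotomy p 0 with hp | hp | hp <;> rcases lt_trichotomy q 0 with hq | hq | hq
    · exact Or.inr ⟨hp, hq⟩
    · have : p * (3 * a ^ 2 + p ^ 2) < 0 := mul_neg_of_neg_of_pos hp (hP _ _ hp.ne)
      rw [hq, zero_mul] at h; omega
    · have h1 : p * (3 * a ^ 2 + p ^ 2) < 0 := mul_neg_of_neg_of_pos hp (hP _ _ hp.ne)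
      have h2 : 0 < q * (3 * b ^ 2 + q ^ 2) := by positivity
      omega
    · have : q * (3 * b ^ 2 + q ^ 2) < 0 := mul_neg_of_neg_of_pos hq (hP _ _ hq.ne)
      rw [hp, zero_mul] at h; omega
    · exact absurd (hp.trans hq.symm) hpq
    · have : 0 < q * (3 * b ^ 2 + q ^ 2) := by positivity
      rw [hp, zero_mul] at h; omega
    · have h1 : q * (3 * b ^ 2 + q ^ 2) < 0 := mul_neg_of_neg_of_pos hq (hP _ _ hq.ne)
      have h2 : 0 < p * (3 * a ^ 2 + p ^ 2) := by positivity
      omega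
    · have : 0 < p * (3 * a ^ 2 + p ^ 2) := by positivity
      rw [hq, zero_mul] at h; omega
    · exact Or.inl ⟨hp, hq⟩
  have hmem : ∀ p q A B : ℕ, 0 < p → p ≤ W → q ≤ W → A ≤ W → B ≤ W → p + U₀ < q →
      G ≤ p.gcd q → p * (3 * A ^ 2 + p ^ 2) = q * (3 * B ^ 2 + q ^ 2) →
      ((p, q), (A, B)) ∈ conicSet W U₀ G := by
    intro p q A B h1 h2 h3 h4 h5 h6 h7 h8
    refine mem_conicSet.mpr ⟨⟨⟨h1, h2⟩, by omega, h3⟩, ⟨⟨?_, h4⟩, h5⟩, h6, h7, h8⟩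
    refine Nat.pos_of_ne_zero fun hA => ?_
    subst hA
    have h9 : p ^ 3 < q ^ 3 := Nat.pow_lt_pow_left (by omega) (by norm_num)
    have h10 : q * (3 * B ^ 2 + q ^ 2) = q * (3 * B ^ 2) + q ^ 3 := by ring
    have h11 : p * (3 * 0 ^ 2 + p ^ 2) = p ^ 3 := by ring
    rw [h10, h11] at h8
    omega
  refine card_le_card_of_injOn (fun t => ((decide (0 < t.1), decide (0 < t.2.2.1),
    decide (0 < t.2.2.2), decide (t.1.natAbs < t.2.1.natAbs)),
    if t.1.natAbs < t.2.1.natAbs then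
      ((t.1.natAbs, t.2.1.natAbs), (t.2.2.1.natAbs, t.2.2.2.natAbs)) else
      ((t.2.1.natAbs, t.1.natAbs), (t.2.2.2.natAbs, t.2.2.1.natAbs)))) ?_ ?_
  · rintro ⟨p, q, a, b⟩ ht
    obtain ⟨h1, h2, h3, h4, h5, h6, h7⟩ := hN _ ht
    simp only at h1 h2 h3 h4 h5 h6 h7
    have hpq : p ≠ q := by rintro rfl; simp at h5
    have hs := hsign p q a b hpq h7
    have h8 : p.natAbs * (3 * a.natAbs ^ 2 + p.natAbs ^ 2) =
        q.natAbs * (3 * b.natAbs ^ 2 + q.natAbs ^ 2) := by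
      zify
      rw [sq_abs, sq_abs, sq_abs, sq_abs]
      rcases hs with ⟨hp, hq⟩ | ⟨hp, hq⟩
      · rw [abs_of_pos hp, abs_of_pos hq, h7]
      · rw [abs_of_neg hp, abs_of_neg hq]; linarith
    rw [mem_coe, mem_product]
    refine ⟨mem_univ _, ?_⟩
    simp only
    split_ifs with hlt
    · exact hmem _ _ _ _ (by omega) h1 h2 h3 h4 (by omega) h6 h8
    · refine hmem _ _ _ _ (by omega) h2 h1 h4 h3 (by omega) ?_ h8.symm
      rw [Nat.gcd_comm]; exact h6
  · rintro ⟨p, q, a, b⟩ ht ⟨p', q', a', b'⟩ ht' h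
    obtain ⟨-, -, -, -, h5, -, h7⟩ := hN _ ht
    obtain ⟨-, -, -, -, h5', -, h7'⟩ := hN _ ht'
    simp only at h5 h7 h5' h7'
    have hpq : p ≠ q := by rintro rfl; simp at h5
    have hpq' : p' ≠ q' := by rintro rfl; simp at h5'
    have hs := hsign p q a b hpq h7
    have hs' := hsign p' q' a' b' hpq' h7'
    simp only [Prod.mk.injEq, decide_eq_decide] at h
    obtain ⟨⟨e1, e2, e3, e4⟩, h⟩ := h
    have hinj : ∀ x y : ℤ, x.natAbs = y.natAbs → (0 < x ↔ 0 < y) → x = y := by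
      intro x y; omega
    have eq : 0 < q ↔ 0 < q' := by
      clear h h5 h5' h7 h7' hsign hmem hN ht ht'
      omega
    by_cases hlt : p.natAbs < q.natAbs
    · rw [if_pos hlt, if_pos (e4.mp hlt)] at h
      simp only [Prod.mk.injEq] at h ⊢
      exact ⟨hinj _ _ h.1.1 e1, hinj _ _ h.1.2 eq, hinj _ _ h.2.1 e2, hinj _ _ h.2.2 e3⟩
    · rw [if_neg hlt, if_neg (fun h' => hlt (e4.mpr h'))] at h
      simp only [Prod.mk.injEq] at h ⊢
      exact ⟨hinj _ _ h.1.2 e1, hinj _ _ h.1.1 eq, hinj _ _ h.2.2 e2, hinj _ _ h.2.1 e3⟩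

lemma card_large_shift_le {U U₀ G : ℕ} (hG : 3 * G ^ 3 ≤ U₀) :
    ((quad (Icc 1 U)).filter fun z => Phi z = 0 ∧
      U₀ < ((z.1.1 : ℤ) + z.1.2 - z.2.1 - z.2.2).natAbs).card ≤
      48 * (conicSet (2 * U) U₀ G).card := by
  set S := (quad (Icc 1 U)).filter fun z => Phi z = 0 ∧
      U₀ < ((z.1.1 : ℤ) + z.1.2 - z.2.1 - z.2.2).natAbs with hS
  set u : (ℕ × ℕ) × (ℕ × ℕ) → ℤ := fun z => (z.1.1 : ℤ) + z.1.2 - z.2.1 - z.2.2 with hu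
  have hgcd : ∀ p q : ℤ, (p - q).gcd p = p.gcd q := by
    intro p q
    rw [Int.gcd_comm]; simp
  set S₁ := S.filter fun z => G ≤ (u z).gcd ((z.1.1 : ℤ) - z.2.1) with hS1
  set S₂ := S.filter fun z => G ≤ (u z).gcd ((z.1.2 : ℤ) - z.2.1) with hS2
  set S₃ := S.filter fun z => G ≤ (u z).gcd ((z.1.1 : ℤ) + z.1.2) with hS3
  have hmem : ∀ a b c d : ℕ, ((a, b), (c, d)) ∈ S → (1 ≤ a ∧ a ≤ U) ∧ (1 ≤ b ∧ b ≤ U) ∧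
      (1 ≤ c ∧ c ≤ U) ∧ (1 ≤ d ∧ d ≤ U) ∧ (a : ℤ) ^ 3 + b ^ 3 - (c ^ 3 + d ^ 3) = 0 ∧
      U₀ < ((a : ℤ) + b - c - d).natAbs := by
    intro a b c d h
    obtain ⟨h, h3, h4⟩ := mem_filter.mp h
    simp only [mem_quad, mem_Icc] at h
    exact ⟨h.1.1, h.1.2, h.2.1, h.2.2, h3, h4⟩
  have hcover : S ⊆ S₁ ∪ (S₂ ∪ S₃) := by
    rintro ⟨⟨a, b⟩, c, d⟩ hz
    obtain ⟨-, -, -, -, e, hlt⟩ := hmem _ _ _ _ hz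
    simp only [mem_union, hS1, hS2, hS3, mem_filter, hz, true_and, hu]
    by_contra hcon
    push Not at hcon
    obtain ⟨c1, c2, c3⟩ := hcon
    set v : ℤ := (a : ℤ) + b - c - d with hv
    have hdvd : v ∣ 3 * (((a : ℤ) - c) * ((b - c) * (a + b))) := by
      refine ⟨(d + v) ^ 2 + (d + v) * d + d ^ 2, ?_⟩
      have hd : (d : ℤ) = a + b - c - v := by rw [hv]; ring
      rw [hd] at e ⊢
      linear_combination (-1) * e
    have h1 : v.natAbs ∣ v.gcd 3 * (v.gcd (a - c) * (v.gcd (b - c) * v.gcd (a + b))) := by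
      have h2 : v.gcd (3 * (((a : ℤ) - c) * ((b - c) * (a + b)))) = v.natAbs :=
        Int.gcd_eq_natAbs_left hdvd
      rw [← h2]
      have hm : ∀ x y : ℤ, v.gcd (x * y) ∣ v.gcd x * v.gcd y := by
        intro x y
        simp only [Int.gcd, Int.natAbs_mul]
        exact Nat.gcd_mul_right_dvd_mul_gcd _ _ _
      exact (hm _ _).trans (mul_dvd_mul_left _ ((hm _ _).trans (mul_dvd_mul_left _ (hm _ _))))
    have hv0 : 0 < v.natAbs := by omega
    have g3 : v.gcd 3 ≤ 3 := Nat.le_of_dvd (by norm_num)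
      (Int.natCast_dvd_natCast.mp (Int.gcd_dvd_right v 3))
    have hpos : ∀ x, 0 < v.gcd x := fun x => Int.gcd_pos_of_ne_zero_left x (by omega)
    have h2 := Nat.le_of_dvd (mul_pos (hpos _) (mul_pos (hpos _) (mul_pos (hpos _) (hpos _)))) h1
    have h3 : v.gcd 3 * (v.gcd (a - c) * (v.gcd (b - c) * v.gcd (a + b))) ≤
        3 * (G * (G * G)) := by
      gcongr
    have h4 : 3 * (G * (G * G)) = 3 * G ^ 3 := by ring
    omega
  have k1 : S₁.card ≤ 16 * (conicSet (2 * U) U₀ G).card := by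
    have : S₁.card = (S₁.image fun z => ((z.1.1 : ℤ) - z.2.1, (z.2.2 : ℤ) - z.1.2,
        (z.1.1 : ℤ) + z.2.1, (z.1.2 : ℤ) + z.2.2)).card := by
      rw [card_image_of_injOn]
      rintro ⟨⟨a, b⟩, c, d⟩ - ⟨⟨a', b'⟩, c', d'⟩ - h
      simp only [Prod.mk.injEq] at h ⊢
      omega
    rw [this]
    refine card_le_conicSet _ ?_
    intro t ht
    obtain ⟨⟨⟨a, b⟩, c, d⟩, hz, rfl⟩ := mem_image.mp ht
    obtain ⟨hz, hg⟩ := mem_filter.mp hz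
    obtain ⟨h1, h2, h3, h4, e, hlt⟩ := hmem _ _ _ _ hz
    simp only [hu] at hg ⊢
    refine ⟨by omega, by omega, by omega, by omega, ?_, ?_, by linear_combination 4 * e⟩
    · convert hlt using 2; ring
    · rw [← hgcd]; convert hg using 2; ring
  have k2 : S₂.card ≤ 16 * (conicSet (2 * U) U₀ G).card := by
    have : S₂.card = (S₂.image fun z => ((z.1.2 : ℤ) - z.2.1, (z.2.2 : ℤ) - z.1.1,
        (z.1.2 : ℤ) + z.2.1, (z.1.1 : ℤ) + z.2.2)).card := by
      rw [card_image_of_injOn]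
      rintro ⟨⟨a, b⟩, c, d⟩ - ⟨⟨a', b'⟩, c', d'⟩ - h
      simp only [Prod.mk.injEq] at h ⊢
      omega
    rw [this]
    refine card_le_conicSet _ ?_
    intro t ht
    obtain ⟨⟨⟨a, b⟩, c, d⟩, hz, rfl⟩ := mem_image.mp ht
    obtain ⟨hz, hg⟩ := mem_filter.mp hz
    obtain ⟨h1, h2, h3, h4, e, hlt⟩ := hmem _ _ _ _ hz
    simp only [hu] at hg ⊢
    refine ⟨by omega, by omega, by omega, by omega, ?_, ?_, by linear_combination 4 * e⟩
    · convert hlt using 2; ring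
    · rw [← hgcd]; convert hg using 2; ring
  have k3 : S₃.card ≤ 16 * (conicSet (2 * U) U₀ G).card := by
    have : S₃.card = (S₃.image fun z => ((z.1.1 : ℤ) + z.1.2, (z.2.1 : ℤ) + z.2.2,
        (z.1.1 : ℤ) - z.1.2, (z.2.1 : ℤ) - z.2.2)).card := by
      rw [card_image_of_injOn]
      rintro ⟨⟨a, b⟩, c, d⟩ - ⟨⟨a', b'⟩, c', d'⟩ - h
      simp only [Prod.mk.injEq] at h ⊢
      omega
    rw [this]
    refine card_le_conicSet _ ?_
    intro t ht
    obtain ⟨⟨⟨a, b⟩, c, d⟩, hz, rfl⟩ := mem_image.mp ht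
    obtain ⟨hz, hg⟩ := mem_filter.mp hz
    obtain ⟨h1, h2, h3, h4, e, hlt⟩ := hmem _ _ _ _ hz
    simp only [hu] at hg ⊢
    refine ⟨by omega, by omega, by omega, by omega, ?_, ?_, by linear_combination 4 * e⟩
    · convert hlt using 2; ring
    · rw [← hgcd]; convert hg using 2; ring
  have := (card_le_card hcover).trans (card_union_le _ _)
  have := card_union_le S₂ S₃
  omega

lemma card_quad (A : Finset ℕ) : (quad A).card = A.card ^ 4 := by
  simp [quad, card_product]; ring

lemma half_le_floor {y : ℝ} (hy : 1 ≤ y) : y / 2 ≤ (⌊y⌋₊ : ℝ) := by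
  have h1 := Nat.lt_floor_add_one y
  have h2 : (1 : ℝ) ≤ (⌊y⌋₊ : ℝ) := by exact_mod_cast Nat.le_floor (by simpa using hy)
  linarith

lemma exists_nontrivial_card_le : ∃ C : ℝ, 1 ≤ C ∧ ∀ U : ℕ, ∀ x : ℝ, (U : ℝ) = x ^ 100 → 16 < x →
    (((quad (Icc 1 U)).filter fun z => Phi z = 0 ∧
      (z.1.1 : ℤ) + z.1.2 - z.2.1 - z.2.2 ≠ 0).card : ℝ) ≤ C * x ^ 195 := by
  obtain ⟨C₁, hC1, hτ⟩ := tau_le_rpow (1 / 1200) (by norm_num)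
  obtain ⟨C₂, hC2, hlog⟩ := log_pow_le_rpow 4 (1 / 200) (by norm_num)
  refine ⟨30000 * ((9 * C₁ ^ 2) * (2 * C₂)), by nlinarith [one_le_pow₀ hC1 (n := 2)], ?_⟩
  intro U x hU hx
  have hx0 : 0 < x := by linarith
  have hx1 : 1 ≤ x := by linarith
  have hp : ∀ n : ℕ, 1 ≤ x ^ n := fun n => one_le_pow₀ hx1
  have hU1 : (1 : ℝ) ≤ U := hU ▸ hp 100
  have hU1' : 1 ≤ U := by exact_mod_cast hU1
  set U₀ := ⌊x ^ 90⌋₊ with hU0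
  set G := ⌊x ^ 29⌋₊ with hG
  set X := ⌊x ^ 6⌋₊ with hX
  have a1 := half_le_floor (hp 90)
  have a2 := half_le_floor (hp 29)
  have a3 := half_le_floor (hp 6)
  have b1 : (U₀ : ℝ) ≤ x ^ 90 := Nat.floor_le (by positivity)
  have b2 : (G : ℝ) ≤ x ^ 29 := Nat.floor_le (by positivity)
  have b3 : (X : ℝ) ≤ x ^ 6 := Nat.floor_le (by positivity)
  rw [← hU0] at a1
  rw [← hG] at a2
  rw [← hX] at a3
  have hG1 : 1 ≤ G := Nat.le_floor (by simpa using hp 29)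
  have hX1 : 1 ≤ X := Nat.le_floor (by simpa using hp 6)
  have c1 : 3 * G ^ 3 ≤ U₀ := by
    have h1 : (3 * G ^ 3 : ℝ) ≤ U₀ := by
      have h2 : (G : ℝ) ^ 3 ≤ (x ^ 29) ^ 3 := pow_le_pow_left₀ (by positivity) b2 3
      have h3 : (x ^ 90) = x ^ 87 * (x * x * x) := by ring
      have h4 : (6 : ℝ) ≤ x * x * x := by nlinarith
      have h5 : (x ^ 29) ^ 3 = x ^ 87 := by ring
      have h6 : x ^ 87 * 6 ≤ x ^ 87 * (x * x * x) :=
        mul_le_mul_of_nonneg_left h4 (by positivity)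
      linarith
    exact_mod_cast h1
  have c2 : 2 * (2 * U) * X ^ 3 < G * U₀ := by
    have h1 : (2 * (2 * U) * X ^ 3 : ℝ) < G * U₀ := by
      have h2 : (X : ℝ) ^ 3 ≤ (x ^ 6) ^ 3 := pow_le_pow_left₀ (by positivity) b3 3
      have h3 : x ^ 29 / 2 * (x ^ 90 / 2) ≤ G * U₀ :=
        mul_le_mul a2 a1 (by positivity) (by positivity)
      have h4 : x ^ 29 / 2 * (x ^ 90 / 2) = x ^ 118 * x / 4 := by ring
      have h5 : (2 * (2 * U) * X ^ 3 : ℝ) ≤ 2 * (2 * x ^ 100) * (x ^ 6) ^ 3 := by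
        rw [hU]; gcongr
      have h6 : 2 * (2 * x ^ 100) * (x ^ 6) ^ 3 = x ^ 118 * 16 / 4 := by ring
      have h7 : x ^ 118 * 16 < x ^ 118 * x := mul_lt_mul_of_pos_left hx (by positivity)
      linarith
    exact_mod_cast h1
  set T : ℝ := C₁ * ((9 * U ^ 3 : ℕ) : ℝ) ^ (1 / 1200 : ℝ) with hT
  have hT0 : 0 ≤ T := by positivity
  have hτT : ∀ n ∈ Icc 1 (9 * U ^ 3), (tau n : ℝ) ≤ T := by
    intro n hn
    rw [mem_Icc] at hn
    refine (hτ n (by omega)).trans ?_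
    rw [hT]
    have : (n : ℝ) ≤ ((9 * U ^ 3 : ℕ) : ℝ) := by exact_mod_cast hn.2
    gcongr
  have hsq : T ^ 2 ≤ 9 * C₁ ^ 2 * x ^ (1 / 2 : ℝ) := by
    have h1 : ((9 * U ^ 3 : ℕ) : ℝ) = 9 * x ^ 300 := by push_cast; rw [hU]; ring
    rw [hT, h1, mul_pow, ← Real.rpow_mul_natCast (by positivity), Real.mul_rpow (by norm_num)
      (by positivity), ← Real.rpow_natCast x, ← Real.rpow_mul hx0.le]
    have h2 : (9 : ℝ) ^ ((1 : ℝ) / 1200 * (2 : ℕ)) ≤ 9 := by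
      conv_rhs => rw [← Real.rpow_one 9]
      exact Real.rpow_le_rpow_of_exponent_le (by norm_num) (by norm_num)
    have h3 : (300 : ℕ) * ((1 : ℝ) / 1200 * (2 : ℕ)) = 1 / 2 := by norm_num
    rw [h3]
    calc _ ≤ C₁ ^ 2 * (9 * x ^ (1 / 2 : ℝ)) := by gcongr
      _ = _ := by ring
  have hL : (1 + Real.log (2 * U : ℕ)) ^ 4 ≤ 2 * C₂ * x ^ (1 / 2 : ℝ) := by
    refine (hlog _ (by push_cast; linarith)).trans ?_
    have h1 : ((2 * U : ℕ) : ℝ) = 2 * x ^ 100 := by push_cast; rw [hU]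
    rw [h1, Real.mul_rpow (by norm_num) (by positivity), ← Real.rpow_natCast x,
      ← Real.rpow_mul hx0.le]
    have h2 : (2 : ℝ) ^ ((1 : ℝ) / 200) ≤ 2 := by
      conv_rhs => rw [← Real.rpow_one 2]
      exact Real.rpow_le_rpow_of_exponent_le (by norm_num) (by norm_num)
    have h3 : (100 : ℕ) * ((1 : ℝ) / 200) = 1 / 2 := by norm_num
    rw [h3]
    calc _ ≤ C₂ * (2 * x ^ (1 / 2 : ℝ)) := by gcongr
      _ = _ := by ring
  have hL1 : 1 ≤ (1 + Real.log (2 * U : ℕ)) ^ 4 := by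
    refine one_le_pow₀ ?_
    have : 0 ≤ Real.log (2 * U : ℕ) := Real.log_nonneg (by push_cast; linarith)
    linarith
  set D := (9 * C₁ ^ 2) * (2 * C₂) with hD
  have hD0 : 0 < D := by positivity
  have hTL : T ^ 2 * (1 + Real.log (2 * U : ℕ)) ^ 4 ≤ D * x := by
    calc _ ≤ (9 * C₁ ^ 2 * x ^ (1 / 2 : ℝ)) * (2 * C₂ * x ^ (1 / 2 : ℝ)) := by gcongr
      _ = D * (x ^ (1 / 2 : ℝ) * x ^ (1 / 2 : ℝ)) := by rw [hD]; ring
      _ = D * x := by rw [← Real.rpow_add hx0]; norm_num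
  have hTT : T ^ 2 ≤ D * x :=
    (le_mul_of_one_le_right (sq_nonneg T) hL1).trans hTL
  have m1 := card_small_shift_le U U₀ T hτT
  have m2 := card_large_shift_le (U := U) c1
  have m3 := card_conicSet_le hG1 hX1 (by omega) c2 T (fun n hn => hτT n (by
    rw [mem_Icc] at hn ⊢
    have : U ≤ U ^ 3 := Nat.le_self_pow (by norm_num) U
    omega))
  have m2' : (((quad (Icc 1 U)).filter fun z => Phi z = 0 ∧
      U₀ < ((z.1.1 : ℤ) + z.1.2 - z.2.1 - z.2.2).natAbs).card : ℝ) ≤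
      48 * ((conicSet (2 * U) U₀ G).card : ℝ) := by exact_mod_cast m2
  have cover : ((quad (Icc 1 U)).filter fun z => Phi z = 0 ∧
      (z.1.1 : ℤ) + z.1.2 - z.2.1 - z.2.2 ≠ 0) ⊆
      ((quad (Icc 1 U)).filter fun z => Phi z = 0 ∧
        (z.1.1 : ℤ) + z.1.2 - z.2.1 - z.2.2 ≠ 0 ∧
        ((z.1.1 : ℤ) + z.1.2 - z.2.1 - z.2.2).natAbs ≤ U₀) ∪
      ((quad (Icc 1 U)).filter fun z => Phi z = 0 ∧
        U₀ < ((z.1.1 : ℤ) + z.1.2 - z.2.1 - z.2.2).natAbs) := by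
    intro z hz
    simp only [mem_filter, mem_union] at hz ⊢
    rcases le_or_gt ((z.1.1 : ℤ) + z.1.2 - z.2.1 - z.2.2).natAbs U₀ with h | h
    · exact Or.inl ⟨hz.1, hz.2.1, hz.2.2, h⟩
    · exact Or.inr ⟨hz.1, hz.2.1, h⟩
  have hc := Nat.cast_le (α := ℝ) |>.mpr ((card_le_card cover).trans (card_union_le _ _))
  rw [Nat.cast_add] at hc
  have n1 : (2 * (U₀ : ℝ) + 1) * U * (2 * T ^ 2) ≤ 6 * D * x ^ 195 := by
    have h1 := hp 90
    calc _ ≤ (3 * x ^ 90) * x ^ 100 * (2 * (D * x)) := by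
          rw [hU]; gcongr; linarith
      _ = 6 * D * x ^ 191 := by ring
      _ ≤ _ := by gcongr; norm_num
  have n2 : 48 * (32 * T ^ 2 * (1 + Real.log (2 * U : ℕ)) ^ 4 * ((2 * U : ℕ) : ℝ) ^ 2 *
      (1 / X + 1 / G)) ≤ 24576 * D * x ^ 195 := by
    have h1 : (1 / X : ℝ) ≤ 2 / x ^ 6 := by
      rw [div_le_div_iff₀ (by exact_mod_cast hX1) (by positivity)]; linarith
    have h2 : (1 / G : ℝ) ≤ 2 / x ^ 6 := by
      have : x ^ 6 ≤ x ^ 29 := pow_le_pow_right₀ hx1 (by norm_num)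
      rw [div_le_div_iff₀ (by exact_mod_cast hG1) (by positivity)]; linarith
    calc _ = 48 * 32 * (T ^ 2 * (1 + Real.log (2 * U : ℕ)) ^ 4) * (4 * (x ^ 100) ^ 2) *
          (1 / X + 1 / G) := by push_cast; rw [hU]; ring
      _ ≤ 48 * 32 * (D * x) * (4 * (x ^ 100) ^ 2) * (2 / x ^ 6 + 2 / x ^ 6) := by
          gcongr
      _ = _ := by field_simp; ring
  have n3 : 0 ≤ D * x ^ 195 := by positivity
  linarith

/-- The number of solutions of `x₁³ + x₂³ = x₃³ + x₄³` is essentially the trivial one. -/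
lemma exists_fourth_moment_le : ∃ C : ℝ, 1 ≤ C ∧ ∀ U : ℕ, ∀ A ⊆ Icc 1 U,
    (((quad A).filter fun z => Phi z = 0).card : ℝ) ≤
      2 * (A.card : ℝ) ^ 2 + C * (U : ℝ) ^ (1.95 : ℝ) := by
  obtain ⟨C, hC, h⟩ := exists_nontrivial_card_le
  obtain ⟨E, hE1, hE⟩ : ∃ E : ℝ, 1 ≤ E ∧ ∀ x : ℝ, 0 ≤ x → x ≤ 16 → x ^ 400 ≤ E :=
    ⟨16 ^ 400, one_le_pow₀ (by norm_num), fun x h0 h1 => pow_le_pow_left₀ h0 h1 _⟩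
  have hE0 : 0 ≤ E := by linarith
  refine ⟨C + E, by linarith, fun U A hA => ?_⟩
  rcases Nat.eq_zero_or_pos U with rfl | hU
  · have : A = ∅ := by simpa using hA
    subst this
    simp [quad]
    positivity
  set x : ℝ := (U : ℝ) ^ (0.01 : ℝ) with hx
  have hU0 : (0 : ℝ) ≤ U := Nat.cast_nonneg _
  have hU1 : (1 : ℝ) ≤ U := by exact_mod_cast hU
  have hUx : (U : ℝ) = x ^ 100 := by
    rw [hx, ← Real.rpow_mul_natCast hU0]; norm_num
  have hUp : (U : ℝ) ^ (1.95 : ℝ) = x ^ 195 := by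
    rw [hx, ← Real.rpow_mul_natCast hU0]; norm_num
  have hx1 : 1 ≤ x := Real.one_le_rpow hU1 (by norm_num)
  rw [hUp]
  rcases le_or_gt x 16 with hlt | hlt
  · have h1 : (((quad A).filter fun z => Phi z = 0).card : ℝ) ≤ E := by
      have h2 : ((quad A).filter fun z => Phi z = 0).card ≤ U ^ 4 := by
        refine (card_filter_le _ _).trans ?_
        rw [card_quad]
        have := card_le_card hA
        rw [Nat.card_Icc] at this
        exact Nat.pow_le_pow_left (by omega) 4
      have h3 : (((quad A).filter fun z => Phi z = 0).card : ℝ) ≤ (U : ℝ) ^ 4 := by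
        exact_mod_cast h2
      refine h3.trans ?_
      rw [hUx, ← pow_mul]
      exact hE x (by linarith) hlt
    have h2 : E * 1 ≤ E * x ^ 195 := mul_le_mul_of_nonneg_left (one_le_pow₀ hx1) hE0
    have h3 : 0 ≤ C * x ^ 195 := by positivity
    have h4 : 0 ≤ 2 * (A.card : ℝ) ^ 2 := mul_nonneg zero_le_two (sq_nonneg _)
    linarith
  · have h1 := h U x hUx hlt
    have h2 : (((quad A).filter fun z => Phi z = 0 ∧
        (z.1.1 : ℤ) + z.1.2 - z.2.1 - z.2.2 = 0).card : ℝ) ≤ 2 * (A.card : ℝ) ^ 2 := by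
      exact_mod_cast card_trivial_le A
    have h3 : ((quad A).filter fun z => Phi z = 0).card ≤
        ((quad A).filter fun z => Phi z = 0 ∧
          (z.1.1 : ℤ) + z.1.2 - z.2.1 - z.2.2 = 0).card +
        ((quad (Icc 1 U)).filter fun z => Phi z = 0 ∧
          (z.1.1 : ℤ) + z.1.2 - z.2.1 - z.2.2 ≠ 0).card := by
      refine (card_le_card ?_).trans (card_union_le _ _)
      intro z hz
      rw [mem_filter] at hz
      rw [mem_union, mem_filter, mem_filter]
      by_cases h0 : (z.1.1 : ℤ) + z.1.2 - z.2.1 - z.2.2 = 0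
      · exact Or.inl ⟨hz.1, hz.2, h0⟩
      · refine Or.inr ⟨?_, hz.2, h0⟩
        have := hz.1
        rw [mem_quad] at this ⊢
        exact ⟨⟨hA this.1.1, hA this.1.2⟩, hA this.2.1, hA this.2.2⟩
    have h5 := Nat.cast_le (α := ℝ) |>.mpr h3
    rw [Nat.cast_add] at h5
    have h4 : 0 ≤ E * x ^ 195 := by positivity
    linarith

lemma card_eq_pairs {α β γ : Type*} (B : Finset α) (T : Finset β) (g : α → γ) (f : β → γ) :
    ((B ×ˢ T).filter fun x => g x.1 = f x.2).card =
      ∑ n ∈ B.image g, (B.filter fun b => g b = n).card * (T.filter fun t => f t = n).card := by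
  rw [card_eq_sum_card_fiberwise (f := fun x => g x.1) (t := B.image g)]
  · refine sum_congr rfl fun n _ => ?_
    rw [← card_product]
    congr 1
    ext ⟨b, t⟩
    simp only [mem_filter, mem_product]
    constructor
    · rintro ⟨⟨⟨h1, h2⟩, h3⟩, h4⟩
      exact ⟨⟨h1, h4⟩, h2, h3 ▸ h4⟩
    · rintro ⟨⟨h1, h2⟩, h3, h4⟩
      exact ⟨⟨⟨h1, h3⟩, h2.trans h4.symm⟩, h2⟩
  · rintro ⟨b, t⟩ h
    have h := (mem_product.mp (mem_filter.mp h).1).1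
    exact mem_coe.mpr (mem_image_of_mem g h)

lemma sum_card_sq_le {β γ : Type*} (N : Finset γ) (T : Finset β) (f : β → γ) :
    ∑ n ∈ N, (T.filter fun t => f t = n).card ^ 2 ≤
      ((T ×ˢ T).filter fun x => f x.1 = f x.2).card := by
  have h := sum_card_fiberwise_eq_card_filter ((T ×ˢ T).filter fun x => f x.1 = f x.2) N
    (fun x => f x.1)
  calc _ = ∑ n ∈ N, (((T ×ˢ T).filter fun x => f x.1 = f x.2).filter fun x => f x.1 = n).card := by
        refine sum_congr rfl fun n _ => ?_
        rw [sq, ← card_product]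
        congr 1
        ext ⟨b, t⟩
        simp only [mem_filter, mem_product]
        constructor
        · rintro ⟨⟨h1, h2⟩, h3, h4⟩
          exact ⟨⟨⟨h1, h3⟩, h2.trans h4.symm⟩, h2⟩
        · rintro ⟨⟨⟨h1, h2⟩, h3⟩, h4⟩
          exact ⟨⟨h1, h4⟩, h2, h3 ▸ h4⟩
    _ = _ := h
    _ ≤ _ := card_filter_le _ _

/-- A weighted Cauchy–Schwarz inequality for counting coincidences. -/
lemma sq_sum_card_le {α β γ : Type*} (H : ℕ) (B : Finset α) (T : Finset β) (g : α → γ)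
    (f : ℕ → β → γ) :
    (∑ h ∈ Icc 1 H, (((B ×ˢ T).filter fun x => g x.1 = f h x.2).card : ℝ)) ^ 2 ≤
      (((B ×ˢ B).filter fun x => g x.1 = g x.2).card : ℝ) *
        (2 * √H * ∑ h ∈ Icc 1 H, √(h : ℝ) *
          (((T ×ˢ T).filter fun x => f h x.1 = f h x.2).card : ℝ)) := by
  set N := B.image g with hN
  set r : γ → ℝ := fun n => ((B.filter fun b => g b = n).card : ℝ) with hr
  set R : ℕ → γ → ℝ := fun h n => ((T.filter fun t => f h t = n).card : ℝ) with hR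
  have h1 : ∑ h ∈ Icc 1 H, (((B ×ˢ T).filter fun x => g x.1 = f h x.2).card : ℝ) =
      ∑ n ∈ N, r n * ∑ h ∈ Icc 1 H, R h n := by
    simp_rw [mul_sum]
    rw [sum_comm]
    refine sum_congr rfl fun h _ => ?_
    rw [card_eq_pairs]
    push_cast
    rfl
  rw [h1]
  refine (sum_mul_sq_le_sq_mul_sq N r _).trans ?_
  have h2 : ∑ n ∈ N, r n ^ 2 ≤ (((B ×ˢ B).filter fun x => g x.1 = g x.2).card : ℝ) := by
    have h := (Nat.cast_le (α := ℝ)).mpr (sum_card_sq_le N B g)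
    push_cast at h
    exact h
  have h3 : ∀ n ∈ N, (∑ h ∈ Icc 1 H, R h n) ^ 2 ≤
      2 * √H * ∑ h ∈ Icc 1 H, √(h : ℝ) * R h n ^ 2 := by
    intro n _
    refine (sum_sq_le_sum_mul_sum_of_sq_le_mul (Icc 1 H) (f := fun h : ℕ => 1 / √(h : ℝ))
      (g := fun h => √(h : ℝ) * R h n ^ 2) (fun h _ => by positivity) (fun h _ => by positivity)
      fun h hh => ?_).trans ?_
    · have : 0 < √(h : ℝ) := Real.sqrt_pos.mpr (by exact_mod_cast (mem_Icc.mp hh).1)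
      refine le_of_eq ?_
      field_simp
    · exact mul_le_mul_of_nonneg_right (sum_inv_sqrt_le H)
        (sum_nonneg fun h _ => by positivity)
  have h4 : ∑ n ∈ N, (∑ h ∈ Icc 1 H, R h n) ^ 2 ≤ 2 * √H * ∑ h ∈ Icc 1 H, √(h : ℝ) *
      (((T ×ˢ T).filter fun x => f h x.1 = f h x.2).card : ℝ) := by
    refine (sum_le_sum h3).trans ?_
    rw [← mul_sum, sum_comm]
    refine mul_le_mul_of_nonneg_left (sum_le_sum fun h _ => ?_) (by positivity)
    rw [← mul_sum]
    refine mul_le_mul_of_nonneg_left ?_ (by positivity)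
    have h := (Nat.cast_le (α := ℝ)).mpr (sum_card_sq_le N T (f h))
    push_cast at h
    exact h
  exact mul_le_mul h2 h4 (sum_nonneg fun n _ => sq_nonneg _) (Nat.cast_nonneg _)

/-- The number of zeros of `Phi`. -/
noncomputable def fourthMoment (A : Finset ℕ) : ℕ := ((quad A).filter fun z => Phi z = 0).card

/-- Solutions of `x³ - y³ = q Φ(z)` with `x ≡ y` modulo `q`. -/
noncomputable def diffCount (q : ℕ) (X A : Finset ℕ) : ℕ :=
  (((X ×ˢ X) ×ˢ quad A).filter fun w => (q : ℤ) ∣ (w.1.1 : ℤ) - w.1.2 ∧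
    (w.1.1 : ℤ) ^ 3 - (w.1.2 : ℤ) ^ 3 = q * Phi w.2).card

/-- The differenced polynomial together with two cubes. -/
def diffValue (q h : ℕ) (t : ℕ × ℕ × ℕ) : ℤ :=
  h * (3 * (t.1 : ℤ) ^ 2 + 3 * t.1 * (q * h) + (q * h : ℤ) ^ 2) + ((t.2.1 : ℤ) ^ 3 + (t.2.2 : ℤ) ^ 3)

lemma diffCount_le_sum (q P : ℕ) (hq : 0 < q) (X A : Finset ℕ) (hX : X ⊆ Icc 1 P) :
    diffCount q X A ≤ X.card * fourthMoment A + 2 * ∑ h ∈ Icc 1 (P / q),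
      (((A ×ˢ A) ×ˢ (X ×ˢ (A ×ˢ A))).filter
        fun x => (x.1.1 : ℤ) ^ 3 + (x.1.2 : ℤ) ^ 3 = diffValue q h x.2).card := by
  have hqz : (q : ℤ) ≠ 0 := by exact_mod_cast hq.ne'
  set S := ((X ×ˢ X) ×ˢ quad A).filter fun w => (q : ℤ) ∣ (w.1.1 : ℤ) - w.1.2 ∧
    (w.1.1 : ℤ) ^ 3 - (w.1.2 : ℤ) ^ 3 = q * Phi w.2 with hS
  set R := (Icc 1 (P / q)).sigma fun h => ((A ×ˢ A) ×ˢ (X ×ˢ (A ×ˢ A))).filter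
        fun x => (x.1.1 : ℤ) ^ 3 + (x.1.2 : ℤ) ^ 3 = diffValue q h x.2 with hR
  have hRc : R.card = ∑ h ∈ Icc 1 (P / q), (((A ×ˢ A) ×ˢ (X ×ˢ (A ×ˢ A))).filter
        fun x => (x.1.1 : ℤ) ^ 3 + (x.1.2 : ℤ) ^ 3 = diffValue q h x.2).card := card_sigma _ _
  have h1 : (S.filter fun w => w.1.1 = w.1.2).card ≤ X.card * fourthMoment A := by
    unfold fourthMoment
    rw [← card_product]
    refine card_le_card_of_injOn (fun w => (w.1.1, w.2)) ?_ ?_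
    · rintro ⟨⟨x, y⟩, z⟩ hw
      obtain ⟨hw, e⟩ := mem_filter.mp hw
      simp only at e
      subst e
      obtain ⟨hw, -, h⟩ := mem_filter.mp hw
      rw [mem_product, mem_product] at hw
      simp only [coe_product, Set.mem_prod, mem_coe, mem_filter]
      refine ⟨hw.1.1, hw.2, ?_⟩
      rw [sub_self] at h
      exact (mul_eq_zero.mp h.symm).resolve_left hqz
    · rintro ⟨⟨x, y⟩, z⟩ hw ⟨⟨x', y'⟩, z'⟩ hw' h
      have e1 := (mem_filter.mp hw).2
      have e2 := (mem_filter.mp hw').2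
      simp only [Prod.mk.injEq] at h e1 e2 ⊢
      exact ⟨⟨h.1, by omega⟩, h.2⟩
  have hmemR : ∀ x y a b c d : ℕ, x ∈ X → y ∈ X → y < x → a ∈ A → b ∈ A → c ∈ A → d ∈ A →
      (q : ℤ) ∣ (x : ℤ) - y → (x : ℤ) ^ 3 - (y : ℤ) ^ 3 = q * Phi ((a, b), (c, d)) →
      x = y + q * ((x - y) / q) ∧
      (⟨(x - y) / q, ((a, b), (y, (c, d)))⟩ : Σ _ : ℕ, (ℕ × ℕ) × (ℕ × ℕ × ℕ)) ∈ R := by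
    intro x y a b c d hx hy hxy ha hb hc hd hdvd h
    have hdvd' : q ∣ x - y := by
      have : ((x - y : ℕ) : ℤ) = (x : ℤ) - y := by push_cast [hxy.le]; ring
      rw [← this] at hdvd
      exact_mod_cast hdvd
    obtain ⟨k, hk⟩ := hdvd'
    have hk' : (x - y) / q = k := by rw [hk]; exact Nat.mul_div_cancel_left k hq
    have hxk : x = y + q * k := by omega
    rw [hk']
    refine ⟨hxk, ?_⟩
    have hk0 : 0 < k := Nat.pos_of_ne_zero fun h0 => by rw [h0] at hxk; omega
    have hxP := (mem_Icc.mp (hX hx)).2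
    simp only [hR, mem_sigma, mem_Icc, mem_filter, mem_product]
    refine ⟨⟨hk0, (Nat.le_div_iff_mul_le hq).mpr (by rw [mul_comm]; omega)⟩,
      ⟨⟨ha, hb⟩, hy, hc, hd⟩, ?_⟩
    refine mul_left_cancel₀ hqz ?_
    rw [hxk] at h
    simp only [diffValue, Phi] at h ⊢
    push_cast at h
    linear_combination (-1) * h
  have h2 : (S.filter fun w => w.1.2 < w.1.1).card ≤ R.card := by
    refine card_le_card_of_injOn (fun w => ⟨(w.1.1 - w.1.2) / q, (w.2.1, (w.1.2, w.2.2))⟩) ?_ ?_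
    · rintro ⟨⟨x, y⟩, ⟨a, b⟩, c, d⟩ hw
      obtain ⟨hw, hlt⟩ := mem_filter.mp hw
      obtain ⟨hw, h3, h4⟩ := mem_filter.mp hw
      rw [mem_product, mem_product, mem_quad] at hw
      exact (hmemR x y a b c d hw.1.1 hw.1.2 hlt hw.2.1.1 hw.2.1.2 hw.2.2.1 hw.2.2.2 h3 h4).2
    · have key : ∀ w ∈ S.filter fun w => w.1.2 < w.1.1,
          w.1.1 = w.1.2 + q * ((w.1.1 - w.1.2) / q) := by
        rintro ⟨⟨x, y⟩, ⟨a, b⟩, c, d⟩ hw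
        obtain ⟨hw, hlt⟩ := mem_filter.mp hw
        obtain ⟨hw, h3, h4⟩ := mem_filter.mp hw
        rw [mem_product, mem_product, mem_quad] at hw
        exact (hmemR x y a b c d hw.1.1 hw.1.2 hlt hw.2.1.1 hw.2.1.2 hw.2.2.1 hw.2.2.2 h3 h4).1
      intro w hw w' hw' h
      have e1 := key w hw
      have e2 := key w' hw'
      simp only [Sigma.mk.injEq, heq_eq_eq, Prod.mk.injEq] at h
      obtain ⟨f1, f2, f3, f4⟩ := h
      rw [f1, f3, ← e2] at e1
      exact Prod.ext (Prod.ext e1 f3) (Prod.ext f2 f4)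
  have h3 : (S.filter fun w => w.1.1 < w.1.2).card ≤ R.card := by
    have key : ∀ w ∈ S.filter (fun w => w.1.1 < w.1.2),
        w.1.2 = w.1.1 + q * ((w.1.2 - w.1.1) / q) ∧
        (⟨(w.1.2 - w.1.1) / q, (w.2.2, (w.1.1, w.2.1))⟩ : Σ _ : ℕ, (ℕ × ℕ) × (ℕ × ℕ × ℕ)) ∈ R := by
      rintro ⟨⟨x, y⟩, ⟨a, b⟩, c, d⟩ hw
      obtain ⟨hw, hlt⟩ := mem_filter.mp hw
      obtain ⟨hw, h3, h4⟩ := mem_filter.mp hw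
      rw [mem_product, mem_product, mem_quad] at hw
      refine hmemR y x c d a b hw.1.2 hw.1.1 hlt hw.2.2.1 hw.2.2.2 hw.2.1.1 hw.2.1.2 ?_ ?_
      · rw [dvd_sub_comm]; exact h3
      · simp only [Phi] at h4 ⊢
        linear_combination (-1) * h4
    refine card_le_card_of_injOn (fun w => ⟨(w.1.2 - w.1.1) / q, (w.2.2, (w.1.1, w.2.1))⟩)
      (fun w hw => (key w hw).2) ?_
    intro w hw w' hw' h
    have e1 := (key w hw).1
    have e2 := (key w' hw').1
    simp only [Sigma.mk.injEq, heq_eq_eq, Prod.mk.injEq] at h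
    obtain ⟨f1, f2, f3, f4⟩ := h
    rw [f1, f3, ← e2] at e1
    exact Prod.ext (Prod.ext f3 e1) (Prod.ext f4 f2)
  have h4 : S ⊆ (S.filter fun w => w.1.1 = w.1.2) ∪
      ((S.filter fun w => w.1.2 < w.1.1) ∪ (S.filter fun w => w.1.1 < w.1.2)) := by
    intro w hw
    simp only [mem_union, mem_filter, hw, true_and]
    omega
  have h5 := (card_le_card h4).trans (card_union_le _ _)
  have h6 := card_union_le (S.filter fun w => w.1.2 < w.1.1) (S.filter fun w => w.1.1 < w.1.2)
  rw [← hRc]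
  unfold diffCount
  rw [← hS]
  omega

lemma card_diffValue_eq_le (q h : ℕ) (hh : 0 < h) (X A : Finset ℕ) (hX : ∀ x ∈ X, 0 < x) :
    ((((X ×ˢ (A ×ˢ A)) ×ˢ (X ×ˢ (A ×ˢ A))).filter
      fun x => diffValue q h x.1 = diffValue q h x.2).card : ℝ) ≤
      X.card * fourthMoment A + ∑ z ∈ (quad A).filter fun z => Phi z ≠ 0 ∧ (h : ℤ) ∣ Phi z,
        (tau ((Phi z).natAbs / h) : ℝ) := by
  set S := ((X ×ˢ (A ×ˢ A)) ×ˢ (X ×ˢ (A ×ˢ A))).filter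
      fun x => diffValue q h x.1 = diffValue q h x.2 with hS
  have hhz : (h : ℤ) ≠ 0 := by exact_mod_cast hh.ne'
  have hmem : ∀ w ∈ S, (w.1.1 ∈ X ∧ w.2.1 ∈ X) ∧ (w.2.2, w.1.2) ∈ quad A ∧
      Phi (w.2.2, w.1.2) = h * (3 * ((w.1.1 : ℤ) - w.2.1) * (w.1.1 + w.2.1 + q * h)) := by
    rintro ⟨⟨y, c, d⟩, ⟨y', c', d'⟩⟩ hw
    obtain ⟨hw, h3⟩ := mem_filter.mp hw
    simp only [mem_product] at hw
    refine ⟨⟨hw.1.1, hw.2.1⟩, mem_quad.mpr ⟨hw.2.2, hw.1.2⟩, ?_⟩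
    simp only [diffValue, Phi] at h3 ⊢
    linear_combination (-1) * h3
  have h1 : (S.filter fun w => w.1.1 = w.2.1).card ≤ X.card * fourthMoment A := by
    unfold fourthMoment
    rw [← card_product]
    refine card_le_card_of_injOn (fun w => (w.1.1, (w.2.2, w.1.2))) ?_ ?_
    · intro w hw
      obtain ⟨hw, e⟩ := mem_filter.mp hw
      obtain ⟨h3, h4, h5⟩ := hmem w hw
      simp only [coe_product, Set.mem_prod, mem_coe, mem_filter]
      refine ⟨h3.1, h4, ?_⟩
      rw [h5, e]; ring
    · intro w hw w' hw' h
      have e1 := (mem_filter.mp hw).2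
      have e2 := (mem_filter.mp hw').2
      simp only [Prod.mk.injEq] at h
      exact Prod.ext (Prod.ext h.1 h.2.2) (Prod.ext (e1 ▸ e2 ▸ h.1) h.2.1)
  set Z := (quad A).filter fun z => Phi z ≠ 0 ∧ (h : ℤ) ∣ Phi z with hZ
  have hpos : ∀ w ∈ S, 0 < (w.1.1 : ℤ) + w.2.1 + q * h := by
    intro w hw
    have := hX _ (hmem w hw).1.1
    positivity
  have h2 : (S.filter fun w => w.1.1 ≠ w.2.1).card = ∑ z ∈ Z,
      ((S.filter fun w => w.1.1 ≠ w.2.1).filter fun w => (w.2.2, w.1.2) = z).card := by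
    refine card_eq_sum_card_fiberwise ?_
    intro w hw
    obtain ⟨hw, e⟩ := mem_filter.mp hw
    obtain ⟨h3, h4, h5⟩ := hmem w hw
    refine mem_coe.mpr (mem_filter.mpr ⟨h4, ?_, ?_⟩)
    · rw [h5]
      have e' : (w.1.1 : ℤ) - w.2.1 ≠ 0 := sub_ne_zero.mpr (by exact_mod_cast e)
      exact mul_ne_zero hhz (mul_ne_zero (mul_ne_zero (by norm_num) e') (hpos w hw).ne')
    · rw [h5]; exact dvd_mul_right _ _
  have h3 : ∀ z ∈ Z, ((S.filter fun w => w.1.1 ≠ w.2.1).filter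
      fun w => (w.2.2, w.1.2) = z).card ≤ tau ((Phi z).natAbs / h) := by
    intro z hz
    obtain ⟨-, hne, hdvd⟩ := mem_filter.mp hz
    obtain ⟨m, hm⟩ := hdvd
    have hm0 : m ≠ 0 := by rintro rfl; simp at hm; exact hne hm
    have hmn : (Phi z).natAbs / h = m.natAbs := by
      rw [hm, Int.natAbs_mul, Int.natAbs_natCast, Nat.mul_div_cancel_left _ hh]
    rw [hmn]
    have key : ∀ w ∈ (S.filter fun w => w.1.1 ≠ w.2.1).filter (fun w => (w.2.2, w.1.2) = z),
        w ∈ S ∧ (w.2.2, w.1.2) = z ∧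
          m = 3 * ((w.1.1 : ℤ) - w.2.1) * (w.1.1 + w.2.1 + q * h) := by
      intro w hw
      obtain ⟨hw, e⟩ := mem_filter.mp hw
      have hw := (mem_filter.mp hw).1
      refine ⟨hw, e, mul_left_cancel₀ hhz ?_⟩
      rw [← hm, ← (hmem w hw).2.2, e]
    refine card_le_card_of_injOn (fun w => w.1.1 + w.2.1 + q * h) ?_ ?_
    · intro w hw
      obtain ⟨-, -, e⟩ := key w hw
      rw [mem_coe, Nat.mem_divisors]
      refine ⟨?_, Int.natAbs_ne_zero.mpr hm0⟩
      rw [← Int.natCast_dvd, e]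
      push_cast
      exact dvd_mul_left _ _
    · intro w hw w' hw' hww
      obtain ⟨hs, e1, e2⟩ := key w hw
      obtain ⟨hs', e1', e2'⟩ := key w' hw'
      have hww' : (w.1.1 : ℤ) + w.2.1 + q * h = w'.1.1 + w'.2.1 + q * h := by exact_mod_cast hww
      have e3 : 3 * ((w.1.1 : ℤ) - w.2.1) = 3 * ((w'.1.1 : ℤ) - w'.2.1) := by
        refine mul_right_cancel₀ (hpos w' hs').ne' ?_
        rw [← e2', e2, hww']
      have e4 := e1.trans e1'.symm
      rw [Prod.mk.injEq] at e4
      exact Prod.ext (Prod.ext (by omega) e4.2) (Prod.ext (by omega) e4.1)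
  have h4 : S.card = (S.filter fun w => w.1.1 = w.2.1).card +
      (S.filter fun w => w.1.1 ≠ w.2.1).card :=
    (card_filter_add_card_filter_not _).symm
  have h5 : S.card ≤ X.card * fourthMoment A + ∑ z ∈ Z, tau ((Phi z).natAbs / h) := by
    rw [h4, h2]
    exact add_le_add h1 (sum_le_sum h3)
  exact_mod_cast h5

/-- One Weyl differencing step. -/
lemma diffCount_le (q P : ℕ) (hq : 0 < q) (X A : Finset ℕ) (hX : X ⊆ Icc 1 P) :
    (diffCount q X A : ℝ) ≤ X.card * fourthMoment A +
      2 * √(fourthMoment A * (2 * √((P / q : ℕ) : ℝ) *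
        ((P / q : ℕ) * √((P / q : ℕ) : ℝ) * (X.card * fourthMoment A) +
          divisorMean A (P / q)))) := by
  set H := P / q with hH
  have h1 := diffCount_le_sum q P hq X A hX
  rw [← hH] at h1
  have hM : (((A ×ˢ A) ×ˢ (A ×ˢ A)).filter fun x => (x.1.1 : ℤ) ^ 3 + (x.1.2 : ℤ) ^ 3 =
      (x.2.1 : ℤ) ^ 3 + (x.2.2 : ℤ) ^ 3).card = fourthMoment A := by
    unfold fourthMoment quad
    congr 1
    refine filter_congr fun x _ => ?_
    rw [Phi, sub_eq_zero]
  have h2 : (∑ h ∈ Icc 1 H, ((((A ×ˢ A) ×ˢ (X ×ˢ (A ×ˢ A))).filter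
        fun x => (x.1.1 : ℤ) ^ 3 + (x.1.2 : ℤ) ^ 3 = diffValue q h x.2).card : ℝ)) ^ 2 ≤
      (fourthMoment A : ℝ) * (2 * √H * ∑ h ∈ Icc 1 H, √(h : ℝ) *
        ((((X ×ˢ (A ×ˢ A)) ×ˢ (X ×ˢ (A ×ˢ A))).filter
          fun x => diffValue q h x.1 = diffValue q h x.2).card : ℝ)) := by
    rw [← hM]
    convert sq_sum_card_le H (A ×ˢ A) (X ×ˢ (A ×ˢ A))
      (fun b => (b.1 : ℤ) ^ 3 + (b.2 : ℤ) ^ 3) (diffValue q)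
  have h3 : ∑ h ∈ Icc 1 H, √(h : ℝ) * ((((X ×ˢ (A ×ˢ A)) ×ˢ (X ×ˢ (A ×ˢ A))).filter
      fun x => diffValue q h x.1 = diffValue q h x.2).card : ℝ) ≤
      H * √(H : ℝ) * (X.card * fourthMoment A) + divisorMean A H := by
    calc _ ≤ ∑ h ∈ Icc 1 H, (√(H : ℝ) * (X.card * fourthMoment A) + √(h : ℝ) *
          ∑ z ∈ (quad A).filter fun z => Phi z ≠ 0 ∧ (h : ℤ) ∣ Phi z,
            (tau ((Phi z).natAbs / h) : ℝ)) := by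
          refine sum_le_sum fun h hh => ?_
          rw [mem_Icc] at hh
          have h4 := card_diffValue_eq_le q h hh.1 X A fun x hx => (mem_Icc.mp (hX hx)).1
          refine (mul_le_mul_of_nonneg_left h4 (Real.sqrt_nonneg _)).trans ?_
          rw [mul_add]
          refine add_le_add (mul_le_mul_of_nonneg_right ?_ (by positivity)) le_rfl
          exact Real.sqrt_le_sqrt (by exact_mod_cast hh.2)
      _ = _ := by
          rw [sum_add_distrib, sum_const, Nat.card_Icc, nsmul_eq_mul, divisorMean]
          simp only [Nat.add_sub_cancel]
          ring
  have h4 : ∑ h ∈ Icc 1 H, ((((A ×ˢ A) ×ˢ (X ×ˢ (A ×ˢ A))).filter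
        fun x => (x.1.1 : ℤ) ^ 3 + (x.1.2 : ℤ) ^ 3 = diffValue q h x.2).card : ℝ) ≤
      √(fourthMoment A * (2 * √(H : ℝ) *
        (H * √(H : ℝ) * (X.card * fourthMoment A) + divisorMean A H))) := by
    refine Real.le_sqrt_of_sq_le (h2.trans ?_)
    exact mul_le_mul_of_nonneg_left (mul_le_mul_of_nonneg_left h3 (by positivity))
      (Nat.cast_nonneg _)
  have h5 : (diffCount q X A : ℝ) ≤ X.card * fourthMoment A + 2 * ∑ h ∈ Icc 1 H,
      ((((A ×ˢ A) ×ˢ (X ×ˢ (A ×ˢ A))).filter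
        fun x => (x.1.1 : ℤ) ^ 3 + (x.1.2 : ℤ) ^ 3 = diffValue q h x.2).card : ℝ) := by
    exact_mod_cast h1
  linarith

/-- Products of at most `k` distinct elements of `Q`. -/
def brunSupport (Q : Finset ℕ) (k : ℕ) : Finset ℕ :=
  (Q.powerset.filter fun s => s.card ≤ k).image fun s => ∏ p ∈ s, p

/-- The Möbius function on squarefree numbers. -/
def brunCoeff (e : ℕ) : ℝ := (-1) ^ e.primeFactors.card

lemma primeFactors_prod_id {Q s : Finset ℕ} (hQ : ∀ p ∈ Q, p.Prime) (hs : s ∈ Q.powerset) :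
    (∏ p ∈ s, p).primeFactors = s :=
  Nat.primeFactors_prod fun p hp => hQ p (mem_powerset.mp hs hp)

lemma sum_brunSupport {Q : Finset ℕ} (hQ : ∀ p ∈ Q, p.Prime) (k : ℕ) (F : ℕ → ℝ) :
    ∑ e ∈ brunSupport Q k, F e = ∑ s ∈ Q.powerset with s.card ≤ k, F (∏ p ∈ s, p) := by
  unfold brunSupport
  refine sum_image fun s hs t ht h => ?_
  have h1 := primeFactors_prod_id hQ (mem_filter.mp hs).1
  have h2 := primeFactors_prod_id hQ (mem_filter.mp ht).1
  rw [← h1, h, h2]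

lemma sum_alternating_card_le {α : Type*} (S : Finset α) (k : ℕ) :
    ∑ s ∈ S.powerset with s.card ≤ k, (-1 : ℤ) ^ s.card =
      ∑ j ∈ range (k + 1), (-1 : ℤ) ^ j * S.card.choose j := by
  rw [← sum_fiberwise_of_maps_to (g := fun s : Finset α => s.card) (t := range (k + 1))
    (fun s hs => mem_range.mpr (by have := (mem_filter.mp hs).2; omega))]
  refine sum_congr rfl fun j hj => ?_
  have h1 : ((S.powerset.filter fun s => s.card ≤ k).filter fun s => s.card = j) =
      powersetCard j S := by
    ext s
    simp only [mem_filter, mem_powerset, mem_powersetCard]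
    have := mem_range.mp hj
    constructor
    · rintro ⟨⟨h1, -⟩, h2⟩; exact ⟨h1, h2⟩
    · rintro ⟨h1, h2⟩; exact ⟨⟨h1, by omega⟩, h2⟩
  rw [h1, ← card_powersetCard, mul_comm, ← nsmul_eq_mul, ← sum_const]
  exact sum_congr rfl fun s hs => by rw [(mem_powersetCard.mp hs).2]

lemma prod_dvd_iff_subset {Q s : Finset ℕ} (hQ : ∀ p ∈ Q, p.Prime) (hs : s ⊆ Q) (n : ℕ) :
    (∏ p ∈ s, p) ∣ n ↔ s ⊆ Q.filter fun p => p ∣ n := by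
  constructor
  · intro h p hp
    exact mem_filter.mpr ⟨hs hp, (dvd_prod_of_mem _ hp).trans h⟩
  · intro h
    exact prod_primes_dvd n (fun p hp => (hQ p (hs hp)).prime) fun p hp => (mem_filter.mp (h hp)).2

lemma sieveWeight_brun {Q : Finset ℕ} (hQ : ∀ p ∈ Q, p.Prime) (k n : ℕ) :
    sieveWeight (brunSupport Q k) brunCoeff n =
      (∑ j ∈ range (k + 1), (-1 : ℤ) ^ j * (Q.filter fun p => p ∣ n).card.choose j : ℤ) := by
  unfold sieveWeight
  rw [← sum_alternating_card_le, sum_filter, sum_brunSupport hQ, ← sum_filter, filter_filter]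
  push_cast
  refine sum_congr ?_ ?_
  · ext s
    simp only [mem_filter, mem_powerset]
    constructor
    · rintro ⟨h1, h2, h3⟩; exact ⟨(prod_dvd_iff_subset hQ h1 n).mp h3, h2⟩
    · rintro ⟨h1, h2⟩
      have h3 := h1.trans (filter_subset _ _)
      exact ⟨h3, h2, (prod_dvd_iff_subset hQ h3 n).mpr h1⟩
  · intro s hs
    have h3 : s ∈ Q.powerset := mem_powerset.mpr ((mem_powerset.mp (mem_filter.mp hs).1).trans
      (filter_subset _ _))
    rw [brunCoeff, primeFactors_prod_id hQ h3]

lemma sieveWeight_brun_nonneg {Q : Finset ℕ} (hQ : ∀ p ∈ Q, p.Prime) {k : ℕ} (hk : Even k)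
    (n : ℕ) : 0 ≤ sieveWeight (brunSupport Q k) brunCoeff n := by
  rw [sieveWeight_brun hQ]
  refine Int.cast_nonneg ?_
  rcases Nat.eq_zero_or_pos (Q.filter fun p => p ∣ n).card with h | h
  · rw [h, sum_range_succ']
    simp
  · obtain ⟨m, hm⟩ := Nat.exists_eq_succ_of_ne_zero h.ne'
    rw [hm, Nat.succ_eq_add_one, Int.alternating_sum_range_choose_eq_choose, hk.neg_one_pow]
    simp

lemma one_le_sieveWeight_brun {Q : Finset ℕ} (hQ : ∀ p ∈ Q, p.Prime) (k : ℕ) (n : ℕ)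
    (hn : ∀ p ∈ Q, ¬p ∣ n) : 1 ≤ sieveWeight (brunSupport Q k) brunCoeff n := by
  rw [sieveWeight_brun hQ, filter_false_of_mem hn, sum_range_succ']
  simp

lemma abs_sieveDensity_brun_le {Q : Finset ℕ} (hQ : ∀ p ∈ Q, p.Prime) (k : ℕ) :
    |sieveDensity (brunSupport Q k) brunCoeff| ≤ ∏ p ∈ Q, (1 - (p : ℝ)⁻¹) +
      Real.exp (-k) * Real.exp (3 * ∑ p ∈ Q, (1 : ℝ) / p) := by
  have h0 : ∏ p ∈ Q, (1 - (p : ℝ)⁻¹) = ∑ s ∈ Q.powerset, ∏ p ∈ s, (-(p : ℝ)⁻¹) := by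
    rw [← prod_one_add]
    exact prod_congr rfl fun p _ => by ring
  have hterm : ∀ s ∈ Q.powerset, brunCoeff (∏ p ∈ s, p) / ((∏ p ∈ s, p : ℕ) : ℝ) =
      ∏ p ∈ s, (-(p : ℝ)⁻¹) := by
    intro s hs
    rw [brunCoeff, primeFactors_prod_id hQ hs, prod_neg, prod_inv_distrib]
    push_cast
    rw [div_eq_mul_inv]
  have h1 : sieveDensity (brunSupport Q k) brunCoeff =
      ∏ p ∈ Q, (1 - (p : ℝ)⁻¹) - ∑ s ∈ Q.powerset with ¬ s.card ≤ k, ∏ p ∈ s, (-(p : ℝ)⁻¹) := by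
    unfold sieveDensity
    rw [sum_brunSupport hQ, h0, ← sum_filter_add_sum_filter_not Q.powerset fun s => s.card ≤ k,
      add_sub_cancel_right]
    exact sum_congr rfl fun s hs => hterm s (mem_filter.mp hs).1
  have h2 : |∑ s ∈ Q.powerset with ¬ s.card ≤ k, ∏ p ∈ s, (-(p : ℝ)⁻¹)| ≤
      Real.exp (-k) * Real.exp (3 * ∑ p ∈ Q, (1 : ℝ) / p) := by
    calc _ ≤ ∑ s ∈ Q.powerset with ¬ s.card ≤ k, |∏ p ∈ s, (-(p : ℝ)⁻¹)| := abs_sum_le_sum_abs _ _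
      _ ≤ ∑ s ∈ Q.powerset with ¬ s.card ≤ k, Real.exp (-k) * ∏ p ∈ s, (3 * (1 / (p : ℝ))) := by
          refine sum_le_sum fun s hs => ?_
          have hs := (mem_filter.mp hs).2
          rw [abs_prod, prod_mul_distrib, prod_const, ← mul_assoc]
          have e1 : ∏ p ∈ s, |(-(p : ℝ)⁻¹)| = ∏ p ∈ s, (1 / (p : ℝ)) :=
            prod_congr rfl fun p _ => by rw [abs_neg, abs_of_nonneg (by positivity), one_div]
          rw [e1]
          refine le_mul_of_one_le_left (prod_nonneg fun p _ => by positivity) ?_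
          have e2 : Real.exp (k : ℝ) ≤ 3 ^ s.card := by
            calc Real.exp (k : ℝ) ≤ Real.exp (s.card : ℝ) :=
                  Real.exp_le_exp.mpr (by exact_mod_cast (by omega : k ≤ s.card))
              _ = Real.exp 1 ^ s.card := by rw [← Real.exp_nat_mul, mul_one]
              _ ≤ 3 ^ s.card := by
                  have := Real.exp_one_lt_d9
                  have := Real.exp_pos 1
                  gcongr
                  linarith
          rw [Real.exp_neg, ← div_eq_inv_mul, le_div_iff₀ (Real.exp_pos _), one_mul]
          exact e2
      _ ≤ ∑ s ∈ Q.powerset, Real.exp (-k) * ∏ p ∈ s, (3 * (1 / (p : ℝ))) :=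
          sum_le_sum_of_subset_of_nonneg (filter_subset _ _) fun s _ _ =>
            mul_nonneg (Real.exp_pos _).le (prod_nonneg fun p _ => by positivity)
      _ = Real.exp (-k) * ∏ p ∈ Q, (1 + 3 * (1 / (p : ℝ))) := by rw [← mul_sum, ← prod_one_add]
      _ ≤ _ := by
          refine mul_le_mul_of_nonneg_left ?_ (Real.exp_pos _).le
          rw [mul_sum, Real.exp_sum]
          refine prod_le_prod (fun p _ => by positivity) fun p _ => ?_
          rw [add_comm]
          exact Real.add_one_le_exp _
  rw [h1]
  refine (abs_sub _ _).trans (add_le_add ?_ h2)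
  rw [abs_of_nonneg]
  refine prod_nonneg fun p hp => ?_
  have : (1 : ℝ) ≤ p := by exact_mod_cast (hQ p hp).one_le
  have := inv_le_one_of_one_le₀ this
  linarith

lemma isSieve_brun {Q : Finset ℕ} (hQ : ∀ p ∈ Q, p.Prime) (k U : ℕ) {Z : ℝ} (hZ : 1 ≤ Z)
    (hQZ : ∀ p ∈ Q, (p : ℝ) ≤ Z) (hU : Z ^ k ≤ (U : ℝ) ^ (0.01 : ℝ)) :
    IsSieve (brunSupport Q k) brunCoeff U := by
  refine ⟨?_, ?_, ?_⟩
  · intro e he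
    obtain ⟨s, hs, rfl⟩ := mem_image.mp he
    have hs := mem_powerset.mp (mem_filter.mp hs).1
    exact Nat.one_le_iff_ne_zero.mpr (prod_ne_zero_iff.mpr fun p hp => (hQ p (hs hp)).ne_zero)
  · intro e he
    obtain ⟨s, hs, rfl⟩ := mem_image.mp he
    obtain ⟨h1, h2⟩ := mem_filter.mp hs
    have h1 := mem_powerset.mp h1
    refine le_trans ?_ hU
    push_cast
    calc ∏ p ∈ s, (p : ℝ) ≤ ∏ p ∈ s, Z :=
          prod_le_prod (fun p _ => Nat.cast_nonneg p) fun p hp => hQZ p (h1 hp)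
      _ = Z ^ s.card := prod_const _
      _ ≤ Z ^ k := pow_le_pow_right₀ hZ h2
  · intro e _
    rw [brunCoeff, abs_pow, abs_neg, abs_one, one_pow]

lemma coprime_of_mem_brunSupport {Q : Finset ℕ} (hQ : ∀ p ∈ Q, p.Prime) {k : ℕ} {Y : ℝ}
    (hQY : ∀ p ∈ Q, Y ≤ p) : ∀ e ∈ brunSupport Q k, ∀ d : ℕ, 1 ≤ d → (d : ℝ) < Y →
      e.Coprime d := by
  intro e he d hd hdY
  obtain ⟨s, hs, rfl⟩ := mem_image.mp he
  have h1 := mem_powerset.mp (mem_filter.mp hs).1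
  refine Nat.Coprime.prod_left fun p hp => ?_
  rw [(hQ p (h1 hp)).coprime_iff_not_dvd]
  intro h
  have h2 : (p : ℝ) ≤ d := by exact_mod_cast Nat.le_of_dvd hd h
  linarith [hQY p (h1 hp)]

lemma IsSieve.card_le {I : Finset ℕ} {c : ℕ → ℝ} {U : ℕ} (h : IsSieve I c U) :
    (I.card : ℝ) ≤ (U : ℝ) ^ (0.01 : ℝ) := by
  have h1 : I ⊆ Icc 1 ⌊(U : ℝ) ^ (0.01 : ℝ)⌋₊ := fun e he =>
    Finset.mem_Icc.mpr ⟨h.pos e he, Nat.le_floor (h.le e he)⟩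
  have h2 := card_le_card h1
  rw [Nat.card_Icc, Nat.add_sub_cancel] at h2
  exact (Nat.cast_le.mpr h2).trans (Nat.floor_le (by positivity))

lemma IsSieve.card_sifted_le {I : Finset ℕ} {c : ℕ → ℝ} {U : ℕ} (h : IsSieve I c U)
    {A : Finset ℕ} (hA : A ⊆ Icc 1 U) (h0 : ∀ n ∈ Icc 1 U, 0 ≤ sieveWeight I c n)
    (h1 : ∀ n ∈ A, 1 ≤ sieveWeight I c n) :
    (A.card : ℝ) ≤ U * sieveDensity I c + (U : ℝ) ^ (0.01 : ℝ) := by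
  calc (A.card : ℝ) = ∑ n ∈ A, (1 : ℝ) := by simp
    _ ≤ ∑ n ∈ A, sieveWeight I c n := sum_le_sum h1
    _ ≤ ∑ n ∈ Icc 1 U, sieveWeight I c n :=
        sum_le_sum_of_subset_of_nonneg hA fun n hn _ => h0 n hn
    _ = ∑ e ∈ I, c e * ((U / e : ℕ) : ℝ) := by
        unfold sieveWeight
        simp_rw [sum_filter]
        rw [sum_comm]
        refine sum_congr rfl fun e he => ?_
        rw [← sum_filter, sum_const, card_filter_dvd, nsmul_eq_mul, mul_comm]
    _ ≤ ∑ e ∈ I, (U * (c e / e) + 1) := by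
        refine sum_le_sum fun e he => ?_
        have he0 : (0 : ℝ) < e := by exact_mod_cast h.pos e he
        have e1 : ((U / e : ℕ) : ℝ) ≤ U / e := Nat.cast_div_le
        have e2 : (U : ℝ) / e - 1 ≤ ((U / e : ℕ) : ℝ) := by
          rw [sub_le_iff_le_add, div_le_iff₀ he0]
          exact_mod_cast (Nat.lt_succ_iff.mp (Nat.lt_succ_of_lt
            (Nat.lt_mul_of_div_lt (Nat.lt_succ_self (U / e)) (h.pos e he)))).trans
              (by rw [mul_comm])
        have e3 := _root_.abs_le.mp (h.abs_le e he)
        have e4 : (U : ℝ) * (c e / e) = c e * (U / e) := by ring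
        rw [e4]
        nlinarith [mul_nonneg (by linarith [e3.1] : (0:ℝ) ≤ 1 + c e) (sub_nonneg.mpr e1)]
    _ = U * sieveDensity I c + I.card := by
        rw [sum_add_distrib, ← mul_sum, sieveDensity]; simp
    _ ≤ _ := by linarith [h.card_le]

lemma eventually_log_le_rpow (κ c B : ℝ) (hκ : 0 < κ) (hc : 0 < c) : ∃ L₀ : ℝ, 1 ≤ L₀ ∧
    ∀ L : ℝ, L₀ ≤ L → B * Real.log L + B ≤ c * L ^ κ := by
  have h1 : (fun L : ℝ => B * Real.log L + B) =o[Filter.atTop] fun L : ℝ => L ^ κ := by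
    refine ((isLittleO_log_rpow_atTop hκ).const_mul_left B).add ?_
    refine Asymptotics.isLittleO_const_left.mpr (Or.inr ?_)
    exact tendsto_norm_atTop_atTop.comp (tendsto_rpow_atTop hκ)
  have h2 := (h1.bound hc).and (Filter.eventually_ge_atTop 1)
  obtain ⟨L₀, h⟩ := Filter.eventually_atTop.mp h2
  refine ⟨max L₀ 1, le_max_right _ _, fun L hL => ?_⟩
  obtain ⟨h3, h4⟩ := h L ((le_max_left _ _).trans hL)
  rw [Real.norm_eq_abs, Real.norm_of_nonneg (by positivity)] at h3
  exact (le_abs_self _).trans h3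

/-- The primes between `exp ((log P) ^ κ)` and `exp ((log P) ^ (1 - κ))`. -/
noncomputable def sievePrimes (κ : ℝ) (P : ℕ) : Finset ℕ :=
  (primesUpTo ⌊Real.exp (Real.log P ^ (1 - κ))⌋₊).filter fun p => Real.exp (Real.log P ^ κ) ≤ p

lemma mem_sievePrimes {κ : ℝ} {P p : ℕ} : p ∈ sievePrimes κ P ↔ p.Prime ∧
    Real.exp (Real.log P ^ κ) ≤ p ∧ (p : ℝ) ≤ Real.exp (Real.log P ^ (1 - κ)) := by
  unfold sievePrimes
  rw [mem_filter, mem_primesUpTo, Nat.le_floor_iff (Real.exp_pos _).le]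
  tauto

/-- The integers up to `P` without prime factors in `sievePrimes κ P`. -/
noncomputable def sifted (κ : ℝ) (P : ℕ) : Finset ℕ :=
  (Icc 1 P).filter fun n => ∀ p ∈ sievePrimes κ P, ¬p ∣ n

lemma sum_inv_sievePrimes_le (κ : ℝ) (hκ : 0 < κ) (hκ' : κ ≤ 1 / 2) (P : ℕ)
    (hL : 1 ≤ Real.log P) :
    ∑ p ∈ sievePrimes κ P, (1 : ℝ) / p ≤ 13 + 5 * Real.log (2 * Real.log P) := by
  have hL0 : 0 < Real.log P := by linarith
  have h1 : 1 ≤ ⌊Real.exp (Real.log P ^ (1 - κ))⌋₊ :=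
    Nat.le_floor (by simpa using Real.one_le_exp (by positivity))
  refine (sum_le_sum_of_subset_of_nonneg (filter_subset _ _) fun p _ _ => by positivity).trans
    ((sum_inv_primes_le _ h1).trans ?_)
  have h2 : Real.log (⌊Real.exp (Real.log P ^ (1 - κ))⌋₊ : ℝ) ≤ Real.log P := by
    refine (Real.log_le_log (by exact_mod_cast h1) (Nat.floor_le (Real.exp_pos _).le)).trans ?_
    rw [Real.log_exp]
    calc Real.log P ^ (1 - κ) ≤ Real.log P ^ (1 : ℝ) :=
          Real.rpow_le_rpow_of_exponent_le hL (by linarith)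
      _ = _ := Real.rpow_one _
  have h3 : 0 ≤ Real.log (⌊Real.exp (Real.log P ^ (1 - κ))⌋₊ : ℝ) :=
    Real.log_natCast_nonneg _
  have h4 : Real.log (1 + Real.log (⌊Real.exp (Real.log P ^ (1 - κ))⌋₊ : ℝ)) ≤
      Real.log (2 * Real.log P) := Real.log_le_log (by linarith) (by linarith)
  linarith

lemma prod_sievePrimes_le (κ : ℝ) (hκ : 0 < κ) (hκ' : κ ≤ 1 / 2) (P : ℕ)
    (hL : 1 ≤ Real.log P) :
    ∏ p ∈ sievePrimes κ P, (1 - (p : ℝ)⁻¹) ≤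
      Real.exp 26 * 2 ^ 10 * Real.log P ^ (-1 + 11 * κ) := by
  set L := Real.log P with hLdef
  have hL0 : 0 < L := by linarith
  set Y := Real.exp (L ^ κ) with hY
  set N := ⌊Real.exp (L ^ (1 - κ))⌋₊ with hN
  have hYpos : 0 < Y := Real.exp_pos _
  have hfac : ∀ p : ℕ, p.Prime → 0 < 1 - (p : ℝ)⁻¹ := by
    intro p hp
    have : (1 : ℝ) < p := by exact_mod_cast hp.one_lt
    have := inv_lt_one_of_one_lt₀ this
    linarith
  set R : Finset ℕ := (primesUpTo N).filter fun p : ℕ => ¬ Y ≤ (p : ℝ) with hR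
  have h1 : (∏ p ∈ sievePrimes κ P, (1 - (p : ℝ)⁻¹)) * ∏ p ∈ R, (1 - (p : ℝ)⁻¹) =
      ∏ p ∈ primesUpTo N, (1 - (p : ℝ)⁻¹) := prod_filter_mul_prod_filter_not _ _ _
  have h2 : L ^ (1 - κ) ≤ (∏ p ∈ primesUpTo N, (1 - (p : ℝ)⁻¹))⁻¹ := by
    rw [← prod_inv_distrib]
    refine le_trans ?_ (log_le_prod_primes N)
    rw [Real.le_log_iff_exp_le (by positivity)]
    exact (Nat.lt_floor_add_one _).le
  have hRpos : 0 < ∏ p ∈ R, (1 - (p : ℝ)⁻¹) := prod_pos fun p hp =>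
    hfac p (mem_primesUpTo.mp (mem_filter.mp hp).1).1
  have hall : 0 < ∏ p ∈ primesUpTo N, (1 - (p : ℝ)⁻¹) := prod_pos fun p hp =>
    hfac p (mem_primesUpTo.mp hp).1
  have h3 : (∏ p ∈ R, (1 - (p : ℝ)⁻¹))⁻¹ ≤ Real.exp 26 * 2 ^ 10 * L ^ (10 * κ) := by
    have hY1 : 1 ≤ ⌊Y⌋₊ := Nat.le_floor (by
      rw [Nat.cast_one]; exact Real.one_le_exp (by positivity))
    have hRsub : R ⊆ primesUpTo ⌊Y⌋₊ := by
      intro p hp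
      obtain ⟨h, h'⟩ := mem_filter.mp hp
      exact mem_primesUpTo.mpr ⟨(mem_primesUpTo.mp h).1, Nat.le_floor (not_le.mp h').le⟩
    have e1 : ∑ p ∈ R, (1 : ℝ) / p ≤ 13 + 5 * Real.log (2 * L ^ κ) := by
      refine (sum_le_sum_of_subset_of_nonneg hRsub fun p _ _ => by positivity).trans
        ((sum_inv_primes_le _ hY1).trans ?_)
      have f1 : Real.log (⌊Y⌋₊ : ℝ) ≤ L ^ κ := by
        refine (Real.log_le_log (by exact_mod_cast hY1) (Nat.floor_le hYpos.le)).trans ?_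
        rw [hY, Real.log_exp]
      have f2 : 0 ≤ Real.log (⌊Y⌋₊ : ℝ) := Real.log_natCast_nonneg _
      have f3 : 1 ≤ L ^ κ := Real.one_le_rpow hL hκ.le
      have f4 : Real.log (1 + Real.log (⌊Y⌋₊ : ℝ)) ≤ Real.log (2 * L ^ κ) :=
        Real.log_le_log (by linarith) (by linarith)
      linarith
    calc (∏ p ∈ R, (1 - (p : ℝ)⁻¹))⁻¹ = ∏ p ∈ R, (1 - (p : ℝ)⁻¹)⁻¹ := (prod_inv_distrib _).symm
      _ ≤ ∏ p ∈ R, Real.exp (2 * (1 / (p : ℝ))) := by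
          refine prod_le_prod (fun p hp => ?_) fun p hp => ?_
          · exact inv_nonneg.mpr (hfac p (mem_primesUpTo.mp (mem_filter.mp hp).1).1).le
          · have hp2 : (2 : ℝ) ≤ p := by
              exact_mod_cast (mem_primesUpTo.mp (mem_filter.mp hp).1).1.two_le
            have hp0 : (0 : ℝ) < p := by linarith
            refine le_trans ?_ (Real.add_one_le_exp _)
            have hp1 : (0 : ℝ) < 1 - (p : ℝ)⁻¹ :=
              hfac p (mem_primesUpTo.mp (mem_filter.mp hp).1).1
            rw [inv_le_iff_one_le_mul₀ hp1]
            have hi : (p : ℝ)⁻¹ ≤ 1 / 2 := by rw [one_div]; exact inv_anti₀ two_pos hp2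
            have hi0 : 0 < (p : ℝ)⁻¹ := by positivity
            rw [one_div]
            nlinarith
      _ = Real.exp (2 * ∑ p ∈ R, (1 : ℝ) / p) := by rw [← Real.exp_sum, mul_sum]
      _ ≤ Real.exp (26 + 10 * Real.log (2 * L ^ κ)) := Real.exp_le_exp.mpr (by linarith)
      _ = Real.exp 26 * 2 ^ 10 * L ^ (10 * κ) := by
          have g : (0 : ℝ) < 2 * L ^ κ := by positivity
          have g2 : (10 : ℝ) * Real.log (2 * L ^ κ) = ((10 : ℕ) : ℝ) * Real.log (2 * L ^ κ) := by
            norm_num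
          rw [Real.exp_add, g2, Real.exp_nat_mul, Real.exp_log g, mul_pow, ← Real.rpow_mul_natCast hL0.le,
            mul_assoc]
          norm_num [mul_comm]
  have h4 : ∏ p ∈ sievePrimes κ P, (1 - (p : ℝ)⁻¹) =
      (∏ p ∈ primesUpTo N, (1 - (p : ℝ)⁻¹)) * (∏ p ∈ R, (1 - (p : ℝ)⁻¹))⁻¹ := by
    rw [← h1, mul_inv_cancel_right₀ hRpos.ne']
  have h5 : ∏ p ∈ primesUpTo N, (1 - (p : ℝ)⁻¹) ≤ L ^ (-(1 - κ)) := by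
    rw [Real.rpow_neg hL0.le]
    exact (le_inv_comm₀ (by positivity) hall).mp h2
  rw [h4]
  calc _ ≤ L ^ (-(1 - κ)) * (Real.exp 26 * 2 ^ 10 * L ^ (10 * κ)) :=
        mul_le_mul h5 h3 (inv_nonneg.mpr hRpos.le) (by positivity)
    _ = Real.exp 26 * 2 ^ 10 * (L ^ (-(1 - κ)) * L ^ (10 * κ)) := by ring
    _ = _ := by rw [← Real.rpow_add hL0]; congr 2; ring

set_option maxHeartbeats 1000000 in
lemma exists_sifted_le (κ : ℝ) (hκ : 0 < κ) (hκ' : κ ≤ 1 / 2) : ∃ C : ℝ, 1 ≤ C ∧ ∃ P₀ : ℕ,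
    ∀ P : ℕ, P₀ ≤ P → ((sifted κ P).card : ℝ) ≤ C * P * Real.log P ^ (-1 + 11 * κ) ∧
      ClassBound (sifted κ P) P (C * Real.log P ^ (-4 + 44 * κ)) := by
  obtain ⟨C₀, hC₀, hclass⟩ := exists_card_dvd_le
  obtain ⟨L₀, hL₀, hlog⟩ := eventually_log_le_rpow κ 0.01 20 hκ (by norm_num)
  obtain ⟨B, hB⟩ : ∃ B : ℝ, B = Real.exp 26 * 2 ^ 10 + Real.exp 39 * 2 ^ 15 := ⟨_, rfl⟩
  have hB0 : 0 < B := by rw [hB]; positivity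
  refine ⟨C₀ * (B ^ 4 + 2) + B + 1, by nlinarith [pow_pos hB0 4], ⌈Real.exp L₀⌉₊, fun P hP => ?_⟩
  have hP1 : Real.exp L₀ ≤ P := Nat.ceil_le.mp hP
  have hP0 : (0 : ℝ) < P := (Real.exp_pos _).trans_le hP1
  set L := Real.log P with hLdef
  have hLL : L₀ ≤ L := (Real.le_log_iff_exp_le hP0).mpr hP1
  have hL1 : 1 ≤ L := hL₀.trans hLL
  have hL0 : 0 < L := by linarith
  have hPexp : (P : ℝ) = Real.exp L := (Real.exp_log hP0).symm
  have hlogL := hlog L hLL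
  have hlogL0 : 0 ≤ Real.log L := Real.log_nonneg hL1
  have hκL : L ^ κ * L ^ (1 - κ) = L := by rw [← Real.rpow_add hL0]; simp
  have hκle : L ^ κ ≤ L ^ (1 - κ) := Real.rpow_le_rpow_of_exponent_le hL1 (by linarith)
  have hκ1 : 1 ≤ L ^ κ := Real.one_le_rpow hL1 hκ.le
  have hκ2 : 1 ≤ L ^ (1 - κ) := Real.one_le_rpow hL1 (by linarith)
  set Q := sievePrimes κ P with hQdef
  have hQ : ∀ p ∈ Q, p.Prime := fun p hp => (mem_sievePrimes.mp hp).1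
  set m := ⌈10 * Real.log L⌉₊ with hm
  have hm1 : 10 * Real.log L ≤ m := Nat.le_ceil _
  have hm2 : (m : ℝ) ≤ 10 * Real.log L + 1 := (Nat.ceil_lt_add_one (by positivity)).le
  set k := 2 * m with hk
  have hkc : (k : ℝ) = 2 * m := by rw [hk]; push_cast; ring
  set Z := Real.exp (L ^ (1 - κ)) with hZ
  set Y := Real.exp (L ^ κ) with hY
  have hrp : ∀ s : ℝ, (P : ℝ) ^ s = Real.exp (L * s) := fun s => by
    rw [Real.rpow_def_of_pos hP0]
  have hLr : ∀ s : ℝ, L ^ s = Real.exp (Real.log L * s) := fun s => by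
    rw [Real.rpow_def_of_pos hL0]
  have hκbig : 100 * (20 * Real.log L + 20) ≤ L ^ κ := by linarith
  have hLbig : 100 * (20 * Real.log L + 20) ≤ L := by
    refine hκbig.trans ?_
    calc L ^ κ ≤ L ^ κ * L ^ (1 - κ) := le_mul_of_one_le_right (by positivity) hκ2
      _ = L := hκL
  have hZk : Z ^ k ≤ (P : ℝ) ^ (0.01 : ℝ) := by
    rw [hZ, ← Real.exp_nat_mul, hrp]
    refine Real.exp_le_exp.mpr ?_
    have : (k : ℝ) ≤ 0.01 * L ^ κ := by linarith
    calc (k : ℝ) * L ^ (1 - κ) ≤ 0.01 * L ^ κ * L ^ (1 - κ) :=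
          mul_le_mul_of_nonneg_right this (by positivity)
      _ = L * 0.01 := by rw [mul_assoc, hκL, mul_comm]
  have hsieve : IsSieve (brunSupport Q k) brunCoeff P :=
    isSieve_brun hQ k P (Real.one_le_exp (by positivity))
      (fun p hp => (mem_sievePrimes.mp hp).2.2) hZk
  have hw0 := sieveWeight_brun_nonneg hQ (even_two_mul m)
  have hw1 : ∀ n ∈ sifted κ P, 1 ≤ sieveWeight (brunSupport Q k) brunCoeff n := fun n hn =>
    one_le_sieveWeight_brun hQ k n (mem_filter.mp hn).2
  have hsub : sifted κ P ⊆ Icc 1 P := filter_subset _ _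
  have hD : |sieveDensity (brunSupport Q k) brunCoeff| ≤ B * L ^ (-1 + 11 * κ) := by
    refine (abs_sieveDensity_brun_le hQ k).trans ?_
    have e1 := prod_sievePrimes_le κ hκ hκ' P hL1
    have e2 : Real.exp (-k) * Real.exp (3 * ∑ p ∈ Q, (1 : ℝ) / p) ≤
        Real.exp 39 * 2 ^ 15 * L ^ (-1 + 11 * κ) := by
      have f1 := sum_inv_sievePrimes_le κ hκ hκ' P hL1
      have f2 : Real.exp (-k) ≤ Real.exp (Real.log L * (-20)) := Real.exp_le_exp.mpr (by linarith)
      have f3 : Real.exp (3 * ∑ p ∈ Q, (1 : ℝ) / p) ≤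
          Real.exp 39 * 2 ^ 15 * L ^ (15 : ℝ) := by
        calc _ ≤ Real.exp (39 + (15 : ℕ) * Real.log (2 * L)) :=
              Real.exp_le_exp.mpr (by push_cast; linarith)
          _ = _ := by
              rw [Real.exp_add, Real.exp_nat_mul, Real.exp_log (by positivity), mul_pow,
                ← mul_assoc]
              norm_cast
      calc _ ≤ Real.exp (Real.log L * (-20)) * (Real.exp 39 * 2 ^ 15 * L ^ (15 : ℝ)) :=
            mul_le_mul f2 f3 (Real.exp_pos _).le (Real.exp_pos _).le
        _ = Real.exp 39 * 2 ^ 15 * (L ^ (-20 : ℝ) * L ^ (15 : ℝ)) := by rw [← hLr]; ring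
        _ ≤ _ := by
            refine mul_le_mul_of_nonneg_left ?_ (by positivity)
            rw [← Real.rpow_add hL0]
            exact Real.rpow_le_rpow_of_exponent_le hL1 (by linarith)
    calc _ ≤ Real.exp 26 * 2 ^ 10 * L ^ (-1 + 11 * κ) + Real.exp 39 * 2 ^ 15 * L ^ (-1 + 11 * κ) :=
          add_le_add e1 e2
      _ = _ := by rw [hB]; ring
  have hP1' : 1 ≤ P := by exact_mod_cast hP0
  constructor
  · have h1 := hsieve.card_sifted_le hsub (fun n _ => hw0 n) hw1
    have h2 : (P : ℝ) ^ (0.01 : ℝ) ≤ P * L ^ (-1 + 11 * κ) := by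
      rw [hrp, hLr]
      nth_rewrite 1 [hPexp]
      rw [← Real.exp_add]
      refine Real.exp_le_exp.mpr ?_
      nlinarith [mul_nonneg hlogL0 hκ.le]
    have h3 : 0 ≤ C₀ * (B ^ 4 + 2) := by positivity
    have h4 : (P : ℝ) * sieveDensity (brunSupport Q k) brunCoeff ≤
        P * (B * L ^ (-1 + 11 * κ)) :=
      mul_le_mul_of_nonneg_left ((le_abs_self _).trans hD) hP0.le
    have h5 : 0 ≤ (P : ℝ) * L ^ (-1 + 11 * κ) := by positivity
    nlinarith [mul_nonneg h3 h5]
  · intro r hr hrP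
    have hYP : Y ≤ (P : ℝ) ^ (0.01 : ℝ) := by
      rw [hrp]
      refine Real.exp_le_exp.mpr ?_
      have : (1 : ℝ) ≤ 0.01 * L ^ κ := by linarith
      calc L ^ κ ≤ L ^ (1 - κ) := hκle
        _ ≤ 0.01 * L ^ κ * L ^ (1 - κ) := le_mul_of_one_le_left (by positivity) this
        _ = L * 0.01 := by rw [mul_assoc, hκL, mul_comm]
    have h1 := hclass (brunSupport Q k) brunCoeff P Y (sifted κ P) hsieve hP1'
      (Real.one_le_exp (by positivity)) hYP
      (coprime_of_mem_brunSupport hQ fun p hp => (mem_sievePrimes.mp hp).2.1) hsub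
      (fun n _ => hw0 n) hw1 r hr hrP
    refine h1.trans (mul_le_mul_of_nonneg_right ?_
      (mul_nonneg (by positivity) (localSum_nonneg r)))
    have h2 : sieveDensity (brunSupport Q k) brunCoeff ^ 4 ≤ B ^ 4 * L ^ (-4 + 44 * κ) := by
      calc sieveDensity (brunSupport Q k) brunCoeff ^ 4
          = |sieveDensity (brunSupport Q k) brunCoeff| ^ 4 := by
            exact ((by decide : Even 4).pow_abs _).symm
        _ ≤ (B * L ^ (-1 + 11 * κ)) ^ 4 := pow_le_pow_left₀ (abs_nonneg _) hD 4
        _ = _ := by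
            rw [mul_pow, ← Real.rpow_mul_natCast hL0.le]
            congr 2
            push_cast
            ring
    have h3 : (P : ℝ) ^ (-3.8 : ℝ) ≤ L ^ (-4 + 44 * κ) := by
      rw [hrp, hLr]
      refine Real.exp_le_exp.mpr ?_
      nlinarith [mul_nonneg hlogL0 hκ.le]
    have h4 : (1 + L) ^ 4 * Y ^ (-0.05 : ℝ) ≤ L ^ (-4 + 44 * κ) := by
      have e1 : (1 + L) ^ 4 ≤ Real.exp (4 + 4 * Real.log L) := by
        calc (1 + L) ^ 4 ≤ (2 * L) ^ 4 := by gcongr; linarith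
          _ ≤ (Real.exp 1 * L) ^ 4 := by
              have := Real.add_one_le_exp (1 : ℝ)
              gcongr
              linarith
          _ = Real.exp (4 + 4 * Real.log L) := by
              rw [mul_pow, ← Real.exp_nat_mul, Real.exp_add, mul_comm (4 : ℝ) (Real.log L),
                ← hLr]
              norm_num
      rw [hY, ← Real.exp_mul, hLr (-4 + 44 * κ)]
      refine (mul_le_mul_of_nonneg_right e1 (Real.exp_pos _).le).trans ?_
      rw [← Real.exp_add]
      refine Real.exp_le_exp.mpr ?_
      nlinarith [mul_nonneg hlogL0 hκ.le]
    have h5 : 0 < L ^ (-4 + 44 * κ) := by positivity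
    calc _ ≤ C₀ * (B ^ 4 * L ^ (-4 + 44 * κ) + L ^ (-4 + 44 * κ) + L ^ (-4 + 44 * κ)) :=
          mul_le_mul_of_nonneg_left (add_le_add (add_le_add h2 h3) h4) (by linarith)
      _ = C₀ * (B ^ 4 + 2) * L ^ (-4 + 44 * κ) := by ring
      _ ≤ _ := by nlinarith [mul_pos hB0 h5]

lemma exists_classBound_Icc : ∃ C : ℝ, 1 ≤ C ∧ ∀ U : ℕ, 1 ≤ U →
    ClassBound (Icc 1 U) U (C * (1 + Real.log U) ^ 4) := by
  obtain ⟨C₀, hC₀, hclass⟩ := exists_card_dvd_le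
  refine ⟨3 * C₀, by linarith, fun U hU r hr hrU => ?_⟩
  have hU' : (1 : ℝ) ≤ U := by exact_mod_cast hU
  have hL : 0 ≤ Real.log U := Real.log_nonneg hU'
  have hw : ∀ n, sieveWeight {1} (fun _ => 1) n = 1 := by
    intro n
    unfold sieveWeight
    rw [filter_true_of_mem (by simp)]
    simp
  have h1 := hclass {1} (fun _ => 1) U 1 (Icc 1 U) ⟨by simp, by
      simpa using Real.one_le_rpow hU' (by norm_num), by simp⟩ hU le_rfl
    (Real.one_le_rpow hU' (by norm_num)) (by simp) subset_rfl (fun n _ => by rw [hw]; norm_num)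
    (fun n _ => by rw [hw]) r hr hrU
  refine h1.trans (mul_le_mul_of_nonneg_right ?_
    (mul_nonneg (by positivity) (localSum_nonneg r)))
  have h2 : sieveDensity {1} (fun _ => 1) = 1 := by simp [sieveDensity]
  have h3 : (U : ℝ) ^ (-3.8 : ℝ) ≤ 1 := Real.rpow_le_one_of_one_le_of_nonpos hU' (by norm_num)
  have h4 : (1 : ℝ) ≤ (1 + Real.log U) ^ 4 := one_le_pow₀ (by linarith)
  rw [h2, Real.one_rpow]
  nlinarith

lemma sqrt_add_le (a b : ℝ) (ha : 0 ≤ a) (hb : 0 ≤ b) : √(a + b) ≤ √a + √b := by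
  rw [Real.sqrt_le_left (by positivity), add_sq, Real.sq_sqrt ha, Real.sq_sqrt hb]
  nlinarith [Real.sqrt_nonneg a, Real.sqrt_nonneg b,
    mul_nonneg (Real.sqrt_nonneg a) (Real.sqrt_nonneg b)]

lemma exists_diffCount_le (ε : ℝ) (hε : 0 < ε) : ∃ C : ℝ, 1 ≤ C ∧ ∃ U₀ : ℕ, ∀ U : ℕ, U₀ ≤ U →
    ∀ (K M : ℝ) (q P : ℕ) (X A : Finset ℕ), 0 ≤ K → 0 < q → P / q ≤ U → X ⊆ Icc 1 P →
    A ⊆ Icc 1 U → ClassBound A U K → (fourthMoment A : ℝ) ≤ M →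
    (diffCount q X A : ℝ) ≤ X.card * M + 4 * (M * (P / q : ℕ) * √(X.card : ℝ)) +
      C * √(M * K * U ^ 4 * (P / q : ℕ) * Real.log U ^ (1 + ε)) := by
  obtain ⟨C, hC, U₀, h⟩ := exists_divisorMean_le ε hε
  refine ⟨4 * C, by linarith, U₀, fun U hU K M q P X A hK hq hPU hX hA hcl hM => ?_⟩
  have h1 := diffCount_le q P hq X A hX
  have h2 := h U hU K A hK hA hcl (P / q) hPU
  set H : ℝ := ((P / q : ℕ) : ℝ) with hH
  have hH0 : 0 ≤ H := Nat.cast_nonneg _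
  set F : ℝ := (fourthMoment A : ℝ) with hF
  have hF0 : 0 ≤ F := Nat.cast_nonneg _
  have hM0 : 0 ≤ M := hF0.trans hM
  set x : ℝ := (X.card : ℝ) with hx
  have hx0 : 0 ≤ x := Nat.cast_nonneg _
  set W : ℝ := Real.log U ^ (1 + ε) with hW
  have hW0 : 0 ≤ W := Real.rpow_nonneg (Real.log_natCast_nonneg U) _
  have hs : √H * √H = H := Real.mul_self_sqrt hH0
  have hdiv : 0 ≤ divisorMean A (P / q) :=
    sum_nonneg fun h _ => mul_nonneg (Real.sqrt_nonneg _)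
      (sum_nonneg fun _ _ => Nat.cast_nonneg _)
  have h3 : F * (2 * √H * (H * √H * (x * F) + divisorMean A (P / q))) ≤
      (2 * (M * H * √x)) ^ 2 + 4 * C * (M * K * U ^ 4 * H * W) := by
    have e1 : F * (2 * √H * (H * √H * (x * F) + divisorMean A (P / q))) ≤
        M * (2 * √H * (H * √H * (x * M) + C * K * U ^ 4 * √H * W)) := by
      gcongr
    refine e1.trans ?_
    have e2 : M * (2 * √H * (H * √H * (x * M) + C * K * U ^ 4 * √H * W)) =
        2 * (M ^ 2 * (√H * √H) * H * x) + 2 * C * (M * K * U ^ 4 * (√H * √H) * W) := by ring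
    have e3 : (2 * (M * H * √x)) ^ 2 = 4 * (M ^ 2 * H * H * x) := by
      rw [mul_pow, mul_pow, Real.sq_sqrt hx0]; ring
    rw [e2, hs, e3]
    have e4 : 0 ≤ M ^ 2 * H * H * x := by positivity
    have e5 : 0 ≤ C * (M * K * U ^ 4 * H * W) := mul_nonneg (by linarith) (by positivity)
    linarith
  have h4 : √(F * (2 * √H * (H * √H * (x * F) + divisorMean A (P / q)))) ≤
      2 * (M * H * √x) + 2 * C * √(M * K * U ^ 4 * H * W) := by
    refine (Real.sqrt_le_sqrt h3).trans ((sqrt_add_le _ _ (sq_nonneg _)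
      (mul_nonneg (by linarith) (by positivity))).trans ?_)
    rw [Real.sqrt_sq (by positivity), Real.sqrt_mul (by linarith)]
    refine add_le_add le_rfl (mul_le_mul_of_nonneg_right ?_ (Real.sqrt_nonneg _))
    rw [Real.sqrt_le_left (by linarith)]
    nlinarith
  have h5 : x * F ≤ x * M := mul_le_mul_of_nonneg_left hM hx0
  linarith

lemma exists_fourthMoment_le : ∃ C : ℝ, 1 ≤ C ∧ ∀ U, ∀ A ⊆ Icc 1 U,
    (fourthMoment A : ℝ) ≤ 2 * (A.card : ℝ) ^ 2 + C * (U : ℝ) ^ (1.95 : ℝ) := by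
  obtain ⟨C, hC, h⟩ := exists_fourth_moment_le
  exact ⟨C, hC, fun U A hA => h U A hA⟩

lemma exists_diffCount_sifted_le (κ : ℝ) (hκ : 0 < κ) (hκ' : κ ≤ 1 / 2) : ∃ C : ℝ, 1 ≤ C ∧
    ∃ P₀ : ℕ, ∀ P : ℕ, P₀ ≤ P → (diffCount 1 (sifted κ P) (sifted κ P) : ℝ) ≤
      C * (P : ℝ) ^ (3.5 : ℝ) * Real.log P ^ (-(5 / 2) + 34 * κ) := by
  obtain ⟨C₁, hC₁, P₁, h1⟩ := exists_sifted_le κ hκ hκ'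
  obtain ⟨C₂, hC₂, P₂, h2⟩ := exists_diffCount_le κ hκ
  obtain ⟨C₃, hC₃, h3⟩ := exists_fourthMoment_le
  obtain ⟨C₄, hC₄, h4⟩ := log_pow_le_rpow 2 0.05 (by norm_num)
  obtain ⟨B, hB⟩ : ∃ B : ℝ, B = 2 * C₁ ^ 2 + C₃ * C₄ := ⟨_, rfl⟩
  have hB0 : 0 < B := by rw [hB]; positivity
  refine ⟨5 * (B * √C₁) + C₂ * √(B * C₁) + 1, by
    have : 0 ≤ B * √C₁ := by positivity
    have : 0 ≤ C₂ * √(B * C₁) := by positivity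
    linarith, max (max P₁ P₂) 3, fun P hP => ?_⟩
  have hP₁ : P₁ ≤ P := (le_max_left _ _).trans ((le_max_left _ _).trans hP)
  have hP₂ : P₂ ≤ P := (le_max_right _ _).trans ((le_max_left _ _).trans hP)
  have hP3 : 3 ≤ P := (le_max_right _ _).trans hP
  have hP3' : (3 : ℝ) ≤ P := by exact_mod_cast hP3
  have hP0 : (0 : ℝ) < P := by linarith
  obtain ⟨hcard, hcl⟩ := h1 P hP₁
  set L := Real.log P with hL
  have hL1 : 1 ≤ L := by
    rw [hL, Real.le_log_iff_exp_le hP0]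
    linarith [Real.exp_one_lt_d9]
  have hL0 : 0 < L := by linarith
  set E := sifted κ P with hE
  have hsub : E ⊆ Icc 1 P := filter_subset _ _
  have hM : (fourthMoment E : ℝ) ≤ B * (P ^ 2 * L ^ (-2 + 22 * κ)) := by
    refine (h3 P E hsub).trans ?_
    have e1 : (E.card : ℝ) ^ 2 ≤ C₁ ^ 2 * (P ^ 2 * L ^ (-2 + 22 * κ)) := by
      calc (E.card : ℝ) ^ 2 ≤ (C₁ * P * L ^ (-1 + 11 * κ)) ^ 2 :=
            pow_le_pow_left₀ (Nat.cast_nonneg _) hcard 2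
        _ = _ := by
            rw [mul_pow, mul_pow, ← Real.rpow_mul_natCast hL0.le, mul_assoc]
            congr 3
            push_cast
            ring
    have e2 : (P : ℝ) ^ (1.95 : ℝ) ≤ C₄ * (P ^ 2 * L ^ (-2 + 22 * κ)) := by
      have f1 := h4 P (by linarith)
      rw [← hL] at f1
      have f2 : L ^ 2 ≤ C₄ * (P : ℝ) ^ (0.05 : ℝ) := (by gcongr; linarith : L ^ 2 ≤ (1 + L) ^ 2).trans f1
      have f3 : (P : ℝ) ^ 2 = (P : ℝ) ^ (1.95 : ℝ) * (P : ℝ) ^ (0.05 : ℝ) := by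
        rw [← Real.rpow_add hP0, ← Real.rpow_natCast]; norm_num
      have f4 : L ^ (-2 : ℝ) ≤ L ^ (-2 + 22 * κ) :=
        Real.rpow_le_rpow_of_exponent_le hL1 (by linarith)
      have f5 : L ^ (-2 : ℝ) * L ^ 2 = 1 := by
        rw [← Real.rpow_natCast, ← Real.rpow_add hL0]; norm_num
      calc (P : ℝ) ^ (1.95 : ℝ) = (P : ℝ) ^ (1.95 : ℝ) * (L ^ (-2 : ℝ) * L ^ 2) := by
            rw [f5, mul_one]
        _ ≤ (P : ℝ) ^ (1.95 : ℝ) * (L ^ (-2 + 22 * κ) * (C₄ * (P : ℝ) ^ (0.05 : ℝ))) := by gcongr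
        _ = _ := by rw [f3]; ring
    calc _ ≤ 2 * (C₁ ^ 2 * (P ^ 2 * L ^ (-2 + 22 * κ))) +
          C₃ * (C₄ * (P ^ 2 * L ^ (-2 + 22 * κ))) := by gcongr
      _ = _ := by rw [hB]; ring
  set M := B * (P ^ 2 * L ^ (-2 + 22 * κ)) with hMdef
  have hM0 : 0 ≤ M := by positivity
  have key := h2 P hP₂ (C₁ * L ^ (-4 + 44 * κ)) M 1 P E E (by positivity) one_pos
    (by simp) hsub hsub hcl hM
  rw [Nat.div_one, ← hL] at key
  have hx : √(E.card : ℝ) ≤ √C₁ * ((P : ℝ) ^ (0.5 : ℝ) * L ^ (-(1 / 2) + 11 / 2 * κ)) := by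
    calc √(E.card : ℝ) ≤ √(C₁ * P * L ^ (-1 + 11 * κ)) := Real.sqrt_le_sqrt hcard
      _ = √C₁ * (√(P : ℝ) * √(L ^ (-1 + 11 * κ))) := by
          rw [mul_assoc, Real.sqrt_mul (by linarith), Real.sqrt_mul hP0.le]
      _ = _ := by
          rw [Real.sqrt_eq_rpow (P : ℝ), Real.sqrt_eq_rpow (L ^ (-1 + 11 * κ)),
            ← Real.rpow_mul hL0.le]
          congr 3
          · norm_num
          · ring
  have hxx : (E.card : ℝ) ≤ P * √(E.card : ℝ) := by
    have f1 : √(E.card : ℝ) ≤ P := by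
      rw [Real.sqrt_le_left hP0.le]
      have := card_le_card hsub
      rw [Nat.card_Icc, Nat.add_sub_cancel] at this
      have : (E.card : ℝ) ≤ P := by exact_mod_cast this
      nlinarith
    calc (E.card : ℝ) = √(E.card : ℝ) * √(E.card : ℝ) :=
          (Real.mul_self_sqrt (Nat.cast_nonneg _)).symm
      _ ≤ P * √(E.card : ℝ) := mul_le_mul_of_nonneg_right f1 (Real.sqrt_nonneg _)
  set T := (P : ℝ) ^ (3.5 : ℝ) * L ^ (-(5 / 2) + 34 * κ) with hT
  have hT0 : 0 ≤ T := by positivity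
  have ha : M * P * √(E.card : ℝ) ≤ B * √C₁ * T := by
    calc M * P * √(E.card : ℝ) ≤
          M * P * (√C₁ * ((P : ℝ) ^ (0.5 : ℝ) * L ^ (-(1 / 2) + 11 / 2 * κ))) := by gcongr
      _ = B * √C₁ * ((P ^ 2 * P * (P : ℝ) ^ (0.5 : ℝ)) *
          (L ^ (-2 + 22 * κ) * L ^ (-(1 / 2) + 11 / 2 * κ))) := by rw [hMdef]; ring
      _ ≤ _ := by
          refine mul_le_mul_of_nonneg_left ?_ (by positivity)
          rw [← pow_succ, ← Real.rpow_natCast, ← Real.rpow_add hP0, ← Real.rpow_add hL0, hT]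
          refine mul_le_mul (le_of_eq (by norm_num)) (Real.rpow_le_rpow_of_exponent_le hL1 ?_)
            (by positivity) (by positivity)
          linarith
  have hb : √(M * (C₁ * L ^ (-4 + 44 * κ)) * P ^ 4 * P * L ^ (1 + κ)) ≤ √(B * C₁) * T := by
    rw [← Real.sqrt_sq hT0, ← Real.sqrt_mul (by positivity)]
    refine Real.sqrt_le_sqrt ?_
    calc M * (C₁ * L ^ (-4 + 44 * κ)) * P ^ 4 * P * L ^ (1 + κ) =
          B * C₁ * (P ^ 7 * (L ^ (-2 + 22 * κ) * L ^ (-4 + 44 * κ) * L ^ (1 + κ))) := by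
          rw [hMdef]; ring
      _ ≤ _ := by
          refine mul_le_mul_of_nonneg_left ?_ (by positivity)
          rw [hT, mul_pow, ← Real.rpow_mul_natCast hP0.le, ← Real.rpow_mul_natCast hL0.le,
            ← Real.rpow_add hL0, ← Real.rpow_add hL0]
          refine mul_le_mul (le_of_eq ?_) (Real.rpow_le_rpow_of_exponent_le hL1 ?_)
            (by positivity) (by positivity)
          · rw [← Real.rpow_natCast]; norm_num
          · push_cast; linarith
  have hc : E.card * M ≤ M * P * √(E.card : ℝ) := by
    calc (E.card : ℝ) * M ≤ P * √(E.card : ℝ) * M := mul_le_mul_of_nonneg_right hxx hM0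
      _ = _ := by ring
  calc _ ≤ _ := key
    _ ≤ B * √C₁ * T + 4 * (B * √C₁ * T) + C₂ * (√(B * C₁) * T) := by
        refine add_le_add (add_le_add (hc.trans ha) (by linarith)) ?_
        exact mul_le_mul_of_nonneg_left hb (by linarith)
    _ ≤ _ := by rw [mul_assoc _ ((P : ℝ) ^ (3.5 : ℝ)), ← hT]; linarith

lemma exists_diffCount_Icc_le : ∃ C : ℝ, 1 ≤ C ∧ ∃ U₀ : ℕ, ∀ U : ℕ, U₀ ≤ U → ∀ q P : ℕ,
    0 < q → P / q ≤ U → (diffCount q (Icc 1 P) (Icc 1 U) : ℝ) ≤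
      C * (P * U ^ 2 + U ^ 2 * (P / q : ℕ) * √(P : ℝ) +
        U ^ 3 * √((P / q : ℕ) : ℝ) * (1 + Real.log U) ^ 3) := by
  obtain ⟨C₁, hC₁, h1⟩ := exists_classBound_Icc
  obtain ⟨C₂, hC₂, U₂, h2⟩ := exists_diffCount_le 1 one_pos
  obtain ⟨C₃, hC₃, h3⟩ := exists_fourthMoment_le
  obtain ⟨B, hB⟩ : ∃ B : ℝ, B = 2 + C₃ := ⟨_, rfl⟩
  have hB0 : 2 ≤ B := by linarith
  have hs : 0 ≤ C₂ * √(B * C₁) := by positivity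
  refine ⟨4 * B + C₂ * √(B * C₁), by linarith, max U₂ 1, fun U hU q P hq hPU => ?_⟩
  have hU₂ : U₂ ≤ U := (le_max_left _ _).trans hU
  have hU1 : 1 ≤ U := (le_max_right _ _).trans hU
  have hU1' : (1 : ℝ) ≤ U := by exact_mod_cast hU1
  set L := Real.log U with hL
  have hL0 : 0 ≤ L := Real.log_nonneg hU1'
  have hM : (fourthMoment (Icc 1 U) : ℝ) ≤ B * U ^ 2 := by
    refine (h3 U _ subset_rfl).trans ?_
    rw [Nat.card_Icc, Nat.add_sub_cancel]
    have : (U : ℝ) ^ (1.95 : ℝ) ≤ U ^ 2 := by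
      rw [← Real.rpow_natCast]
      exact Real.rpow_le_rpow_of_exponent_le hU1' (by norm_num)
    rw [hB]
    nlinarith
  have key := h2 U hU₂ (C₁ * (1 + L) ^ 4) (B * U ^ 2) q P (Icc 1 P) (Icc 1 U) (by positivity) hq
    hPU subset_rfl subset_rfl (h1 U hU1) hM
  rw [Nat.card_Icc, Nat.add_sub_cancel, ← hL] at key
  set H : ℝ := ((P / q : ℕ) : ℝ) with hH
  have hH0 : 0 ≤ H := Nat.cast_nonneg _
  have hb : √(B * U ^ 2 * (C₁ * (1 + L) ^ 4) * U ^ 4 * H * L ^ (1 + 1 : ℝ)) ≤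
      √(B * C₁) * (U ^ 3 * √H * (1 + L) ^ 3) := by
    have e : U ^ 3 * √H * (1 + L) ^ 3 = √((U ^ 3 * √H * (1 + L) ^ 3) ^ 2) :=
      (Real.sqrt_sq (by positivity)).symm
    rw [e, ← Real.sqrt_mul (by positivity)]
    refine Real.sqrt_le_sqrt ?_
    have e1 : L ^ (1 + 1 : ℝ) ≤ (1 + L) ^ 2 := by
      rw [← Real.rpow_natCast]
      norm_num
      nlinarith
    calc B * U ^ 2 * (C₁ * (1 + L) ^ 4) * U ^ 4 * H * L ^ (1 + 1 : ℝ) ≤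
          B * U ^ 2 * (C₁ * (1 + L) ^ 4) * U ^ 4 * H * (1 + L) ^ 2 :=
          mul_le_mul_of_nonneg_left e1 (by positivity)
      _ = _ := by
        rw [mul_pow, mul_pow, Real.sq_sqrt hH0]; ring
  have g1 : 0 ≤ (P : ℝ) * U ^ 2 := by positivity
  have g2 : 0 ≤ (U : ℝ) ^ 2 * H * √(P : ℝ) := by positivity
  have g3 : 0 ≤ (U : ℝ) ^ 3 * √H * (1 + L) ^ 3 := by positivity
  have hb' := mul_le_mul_of_nonneg_left hb (by linarith : (0 : ℝ) ≤ C₂)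
  nlinarith [mul_nonneg hs g1, mul_nonneg hs g2, mul_nonneg (by linarith : 0 ≤ B) g1,
    mul_nonneg (by linarith : 0 ≤ B) g2, mul_nonneg (by linarith : 0 ≤ B) g3]

/-- The exponential sum over the cubes of the elements of `S`. -/
noncomputable def cubeExp (S : Finset ℕ) (t : ℝ) : ℂ :=
  esum S (fun _ => 1) (fun s : ℕ => (s : ℤ) ^ 3) t

/-- The sum of the cubes of three integers. -/
def cubes (t : ℕ × ℕ × ℕ) : ℕ := t.1 ^ 3 + (t.2.1 ^ 3 + t.2.2 ^ 3)

/-- Coincidences between sums of three cubes from `S` and from `T`. -/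
def coincidences (S T : Finset (ℕ × ℕ × ℕ)) : Finset ((ℕ × ℕ × ℕ) × ℕ × ℕ × ℕ) :=
  (S ×ˢ T).filter fun w => cubes w.1 = cubes w.2

/-- The number of solutions of `x³ + a³ + b³ = y³ + c³ + d³` with `x, y ∈ X` and
`a, b, c, d ∈ A`. -/
def pairCount (X A : Finset ℕ) : ℕ := (coincidences (X ×ˢ (A ×ˢ A)) (X ×ˢ (A ×ˢ A))).card

lemma mem_coincidences {S T : Finset (ℕ × ℕ × ℕ)} {w : (ℕ × ℕ × ℕ) × ℕ × ℕ × ℕ} :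
    w ∈ coincidences S T ↔ (w.1 ∈ S ∧ w.2 ∈ T) ∧ cubes w.1 = cubes w.2 := by
  unfold coincidences
  rw [mem_filter, mem_product]

lemma pairCount_mono {X X' A A' : Finset ℕ} (hX : X ⊆ X') (hA : A ⊆ A') :
    pairCount X A ≤ pairCount X' A' := by
  refine card_le_card (filter_subset_filter _ ?_)
  have h := product_subset_product hX (product_subset_product hA hA)
  exact product_subset_product h h

lemma cubeExp_mul_mul (X A B : Finset ℕ) (t : ℝ) :
    cubeExp X t * (cubeExp A t * cubeExp B t) =
      esum (X ×ˢ (A ×ˢ B)) (fun _ => 1) (fun s => (cubes s : ℤ)) t := by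
  unfold cubeExp
  rw [esum_mul, esum_mul]
  unfold esum
  refine sum_congr rfl fun s _ => ?_
  simp [cubes]

lemma mul_card_coincidences_le (X A B Y C D : Finset ℕ) (N : ℕ) (hN : 0 < N) :
    (N : ℝ) * (coincidences (X ×ˢ (A ×ˢ B)) (Y ×ˢ (C ×ˢ D))).card ≤
      ∑ b ∈ range N, (‖cubeExp X ((b : ℝ) / N)‖ * (‖cubeExp A ((b : ℝ) / N)‖ *
        ‖cubeExp B ((b : ℝ) / N)‖)) * (‖cubeExp Y ((b : ℝ) / N)‖ *
        (‖cubeExp C ((b : ℝ) / N)‖ * ‖cubeExp D ((b : ℝ) / N)‖)) := by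
  set S := X ×ˢ (A ×ˢ B)
  set T := Y ×ˢ (C ×ˢ D)
  have h1 := sum_esum_range (S ×ˢ T) (fun _ => 1)
    (fun w => (cubes w.1 : ℤ) + -(cubes w.2 : ℤ)) N hN
  have h2 : ∀ t : ℝ, esum (S ×ˢ T) (fun _ => 1) (fun w => (cubes w.1 : ℤ) + -(cubes w.2 : ℤ)) t =
      (cubeExp X t * (cubeExp A t * cubeExp B t)) *
        (starRingEnd ℂ) (cubeExp Y t * (cubeExp C t * cubeExp D t)) := by
    intro t
    rw [cubeExp_mul_mul, cubeExp_mul_mul, esum_conj, esum_mul]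
    simp only [mul_one]
    rfl
  simp_rw [h2] at h1
  have h3 : ((coincidences S T).card : ℝ) ≤
      ∑ w ∈ S ×ˢ T with (N : ℤ) ∣ (cubes w.1 : ℤ) + -(cubes w.2 : ℤ), (1 : ℝ) := by
    rw [sum_const, nsmul_eq_mul, mul_one]
    refine Nat.cast_le.mpr (card_le_card fun w hw => ?_)
    obtain ⟨h, e⟩ := mem_filter.mp hw
    refine mem_filter.mpr ⟨h, ?_⟩
    rw [e, add_neg_cancel]
    exact dvd_zero _
  have h4 := congrArg norm h1
  rw [Complex.norm_real, Real.norm_of_nonneg (mul_nonneg (Nat.cast_nonneg _)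
    (sum_nonneg fun _ _ => zero_le_one))] at h4
  refine (mul_le_mul_of_nonneg_left h3 (Nat.cast_nonneg _)).trans ?_
  rw [← h4]
  refine (norm_sum_le _ _).trans (le_of_eq (sum_congr rfl fun b _ => ?_))
  simp only [norm_mul, RCLike.norm_conj]

lemma sum_norm_cubeExp_eq {P : ℕ} {X A : Finset ℕ} (hX : X ⊆ Icc 1 P) (hA : A ⊆ Icc 1 P)
    (N : ℕ) (hN : 3 * P ^ 3 < N) :
    ∑ b ∈ range N, ‖cubeExp X ((b : ℝ) / N)‖ ^ 2 * ‖cubeExp A ((b : ℝ) / N)‖ ^ 4 =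
      N * (pairCount X A : ℝ) := by
  have h := sum_norm_esum_sq (X ×ˢ (A ×ˢ A)) (fun _ => 1) (fun s => (cubes s : ℤ)) N (by omega)
  simp_rw [← cubeExp_mul_mul, norm_mul, mul_one, sum_const, nsmul_eq_mul, mul_one] at h
  have h2 : ((((X ×ˢ (A ×ˢ A)) ×ˢ (X ×ˢ (A ×ˢ A))).filter
      fun w => (N : ℤ) ∣ (cubes w.1 : ℤ) - cubes w.2)) =
      coincidences (X ×ˢ (A ×ˢ A)) (X ×ˢ (A ×ˢ A)) := by
    refine filter_congr fun w hw => ?_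
    have hb : ∀ t ∈ X ×ˢ (A ×ˢ A), cubes t < N := by
      intro t ht
      rw [mem_product, mem_product] at ht
      have e1 := Nat.pow_le_pow_left (mem_Icc.mp (hX ht.1)).2 3
      have e2 := Nat.pow_le_pow_left (mem_Icc.mp (hA ht.2.1)).2 3
      have e3 := Nat.pow_le_pow_left (mem_Icc.mp (hA ht.2.2)).2 3
      unfold cubes
      omega
    obtain ⟨h1, h2⟩ := mem_product.mp hw
    have f1 := hb _ h1
    have f2 := hb _ h2
    constructor
    · intro hd
      have : (cubes w.1 : ℤ) - cubes w.2 = 0 :=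
        Int.eq_zero_of_abs_lt_dvd hd (by rw [abs_lt]; constructor <;> omega)
      omega
    · intro e
      rw [e, sub_self]
      exact dvd_zero _
  rw [h2] at h
  unfold pairCount
  rw [← h]
  exact sum_congr rfl fun b _ => by ring

lemma pairCount_le_diffCount (X A : Finset ℕ) : pairCount X A ≤ diffCount 1 X A := by
  refine card_le_card_of_injOn (fun w => ((w.1.1, w.2.1), (w.2.2, w.1.2))) ?_ ?_
  · rintro ⟨⟨x, a, b⟩, y, c, d⟩ hw
    obtain ⟨⟨h1, h2⟩, h3⟩ := mem_coincidences.mp hw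
    simp only [mem_product] at h1 h2
    simp only [cubes] at h3
    refine mem_coe.mpr (mem_filter.mpr ⟨mem_product.mpr ⟨mem_product.mpr ⟨h1.1, h2.1⟩,
      mem_quad.mpr ⟨h2.2, h1.2⟩⟩, by simp, ?_⟩)
    zify at h3
    simp only [Phi, Nat.cast_one, one_mul]
    linear_combination h3
  · rintro w - w' - h
    simp only [Prod.mk.injEq] at h
    exact Prod.ext (Prod.ext h.1.1 h.2.2) (Prod.ext h.1.2 h.2.1)

lemma pairCount_union_le {P : ℕ} {D E : Finset ℕ} (h : Disjoint E D) (hE : E ⊆ Icc 1 P)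
    (hD : D ⊆ Icc 1 P) :
    (pairCount (E ∪ D) (E ∪ D) : ℝ) ≤ 32 * (pairCount E E + pairCount D D) := by
  obtain ⟨N, hN⟩ : ∃ N, N = 3 * P ^ 3 + 1 := ⟨_, rfl⟩
  have hN0 : (0 : ℝ) < N := by rw [hN]; positivity
  have h1 := sum_norm_cubeExp_eq (union_subset hE hD) (union_subset hE hD) N (by omega)
  have h2 := sum_norm_cubeExp_eq hE hE N (by omega)
  have h3 := sum_norm_cubeExp_eq hD hD N (by omega)
  have h4 : (N : ℝ) * pairCount (E ∪ D) (E ∪ D) ≤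
      32 * (N * pairCount E E + N * pairCount D D) := by
    rw [← h1, ← h2, ← h3, ← sum_add_distrib, mul_sum]
    refine sum_le_sum fun b _ => ?_
    simp only [← pow_add]
    have e : cubeExp (E ∪ D) ((b : ℝ) / N) = cubeExp E ((b : ℝ) / N) + cubeExp D ((b : ℝ) / N) :=
      sum_union h
    rw [e]
    refine (pow_le_pow_left₀ (norm_nonneg _) (norm_add_le _ _) _).trans ?_
    refine (add_pow_le (norm_nonneg _) (norm_nonneg _) _).trans (le_of_eq ?_)
    norm_num
  refine le_of_mul_le_mul_left ?_ hN0
  linarith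

/-- Positive multiples of `p` up to `P`. -/
def multiples (P p : ℕ) : Finset ℕ := (Icc 1 P).filter fun n => p ∣ n

/-- Integers up to `P` that are not multiples of `p`. -/
def nonmultiples (P p : ℕ) : Finset ℕ := (Icc 1 P).filter fun n => ¬p ∣ n

lemma pairCount_multiples_le (P p : ℕ) (hp : 0 < p) :
    pairCount (multiples P p) (multiples P p) ≤
      pairCount (Icc 1 (P / p)) (Icc 1 (P / p)) := by
  have hm : ∀ n ∈ multiples P p, n / p ∈ Icc 1 (P / p) ∧ n = p * (n / p) := by
    intro n hn
    obtain ⟨h, k, rfl⟩ := mem_filter.mp hn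
    rw [mem_Icc] at h
    rw [Nat.mul_div_cancel_left k hp, mem_Icc]
    refine ⟨⟨Nat.pos_of_ne_zero fun h0 => by rw [h0] at h; omega, ?_⟩, rfl⟩
    exact (Nat.le_div_iff_mul_le hp).mpr (by rw [mul_comm]; exact h.2)
  refine card_le_card_of_injOn (fun w => ((w.1.1 / p, w.1.2.1 / p, w.1.2.2 / p),
    (w.2.1 / p, w.2.2.1 / p, w.2.2.2 / p))) ?_ ?_
  · rintro ⟨⟨x, a, b⟩, y, c, d⟩ hw
    obtain ⟨⟨h1, h2⟩, h3⟩ := mem_coincidences.mp hw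
    simp only [mem_product] at h1 h2
    simp only [cubes] at h3
    obtain ⟨x1, x2⟩ := hm _ h1.1
    obtain ⟨a1, a2⟩ := hm _ h1.2.1
    obtain ⟨b1, b2⟩ := hm _ h1.2.2
    obtain ⟨y1, y2⟩ := hm _ h2.1
    obtain ⟨c1, c2⟩ := hm _ h2.2.1
    obtain ⟨d1, d2⟩ := hm _ h2.2.2
    refine mem_coe.mpr (mem_coincidences.mpr ⟨⟨?_, ?_⟩, ?_⟩)
    · simp only [mem_product]; exact ⟨x1, a1, b1⟩
    · simp only [mem_product]; exact ⟨y1, c1, d1⟩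
    · rw [x2, a2, b2, y2, c2, d2] at h3
      simp only [cubes]
      have : p ^ 3 ≠ 0 := by positivity
      refine mul_left_cancel₀ this ?_
      linarith
  · rintro ⟨⟨x, a, b⟩, y, c, d⟩ hw ⟨⟨x', a', b'⟩, y', c', d'⟩ hw' h
    obtain ⟨⟨h1, h2⟩, -⟩ := mem_coincidences.mp hw
    obtain ⟨⟨h1', h2'⟩, -⟩ := mem_coincidences.mp hw'
    simp only [mem_product] at h1 h2 h1' h2'
    simp only [Prod.mk.injEq] at h
    have hinj : ∀ m ∈ multiples P p, ∀ n ∈ multiples P p, m / p = n / p → m = n :=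
      fun m h1 n h2 e => by rw [(hm m h1).2, (hm n h2).2, e]
    rw [hinj _ h1.1 _ h1'.1 h.1.1, hinj _ h1.2.1 _ h1'.2.1 h.1.2.1,
      hinj _ h1.2.2 _ h1'.2.2 h.1.2.2, hinj _ h2.1 _ h2'.1 h.2.1,
      hinj _ h2.2.1 _ h2'.2.1 h.2.2.1, hinj _ h2.2.2 _ h2'.2.2 h.2.2.2]

/-- Coincidences are controlled by coincidences inside classes when each fibre meets few classes. -/
lemma card_coincidence_le_mul {α β γ : Type*} [DecidableEq β] [DecidableEq γ] (T : Finset α) (g : α → β) (h : α → γ) (k : ℕ)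
    (hk : ∀ m, ((T.filter fun t => g t = m).image h).card ≤ k) :
    ((T ×ˢ T).filter fun w => g w.1 = g w.2).card ≤
      k * ((T ×ˢ T).filter fun w => g w.1 = g w.2 ∧ h w.1 = h w.2).card := by
  have h1 : ((T ×ˢ T).filter fun w => g w.1 = g w.2).card =
      ∑ m ∈ T.image g, (T.filter fun t => g t = m).card ^ 2 := by
    simp_rw [sq]
    convert card_eq_pairs T T g g
  have h2 : ((T ×ˢ T).filter fun w => g w.1 = g w.2 ∧ h w.1 = h w.2).card =
      ∑ x ∈ T.image (fun t => (g t, h t)), (T.filter fun t => (g t, h t) = x).card ^ 2 := by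
    simp_rw [sq, ← Prod.mk.injEq]
    convert card_eq_pairs T T (fun t => (g t, h t)) (fun t => (g t, h t))
  rw [h1, h2, mul_sum]
  have h3 : ∀ m ∈ T.image g, (T.filter fun t => g t = m).card ^ 2 ≤
      ∑ c ∈ (T.filter fun t => g t = m).image h,
        k * (T.filter fun t => (g t, h t) = (m, c)).card ^ 2 := by
    intro m _
    rw [card_eq_sum_card_image h (T.filter fun t => g t = m), ← mul_sum]
    refine sq_sum_le_card_mul_sum_sq.trans (Nat.mul_le_mul (hk m) (le_of_eq ?_))
    refine sum_congr rfl fun c _ => ?_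
    rw [filter_filter]
    congr 2
    refine filter_congr fun t _ => ?_
    rw [Prod.mk.injEq]
  refine (sum_le_sum h3).trans (le_of_eq ?_)
  rw [sum_sigma' (T.image g) (fun m => (T.filter fun t => g t = m).image h)
    (fun m c => k * (T.filter fun t => (g t, h t) = (m, c)).card ^ 2)]
  refine sum_nbij' (fun x => (x.1, x.2)) (fun x => ⟨x.1, x.2⟩) ?_ ?_ ?_ ?_ ?_
  · rintro ⟨m, c⟩ hx
    obtain ⟨-, h2⟩ := mem_sigma.mp hx
    obtain ⟨t, ht, e⟩ := mem_image.mp h2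
    obtain ⟨ht, e'⟩ := mem_filter.mp ht
    exact mem_image.mpr ⟨t, ht, by rw [e, e']⟩
  · rintro ⟨m, c⟩ hx
    obtain ⟨t, ht, e⟩ := mem_image.mp hx
    rw [Prod.mk.injEq] at e
    exact mem_sigma.mpr ⟨mem_image.mpr ⟨t, ht, e.1⟩,
      mem_image.mpr ⟨t, mem_filter.mpr ⟨ht, e.1⟩, e.2⟩⟩
  · intro _ _; rfl
  · intro _ _; rfl
  · intro _ _; rfl

lemma card_unit_cube_roots_le (p : ℕ) (hp : p.Prime) (h2 : p ≠ 2) (S : Finset (ZMod (p ^ 3)))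
    (hS : ∀ c ∈ S, IsUnit c) (a : ZMod (p ^ 3)) (ha : ∀ c ∈ S, c ^ 3 = a) : S.card ≤ 3 := by
  have : Fact p.Prime := ⟨hp⟩
  have : NeZero (p ^ 3) := ⟨pow_ne_zero _ hp.ne_zero⟩
  have hcyc : IsCyclic (ZMod (p ^ 3))ˣ := ZMod.isCyclic_units_of_prime_pow p hp h2 3
  rcases S.eq_empty_or_nonempty with rfl | ⟨c₀, hc₀⟩
  · simp
  obtain ⟨u₀, rfl⟩ := hS c₀ hc₀
  have h := IsCyclic.card_pow_eq_one_le (α := (ZMod (p ^ 3))ˣ) (n := 3) (by norm_num)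
  refine le_trans ?_ h
  refine card_le_card_of_injOn (fun c => if hc : IsUnit c then hc.unit * u₀⁻¹ else 1) ?_ ?_
  · intro c hc
    have hu := hS c hc
    simp only [hu, dif_pos, coe_filter, mem_univ, true_and, Set.mem_ofPred_eq]
    rw [mul_pow, inv_pow, mul_inv_eq_one]
    ext
    push_cast
    rw [IsUnit.unit_spec, ha c hc, ha _ hc₀]
  · intro c hc c' hc' e
    have hu := hS c hc
    have hu' := hS c' hc'
    simp only [hu, hu', dif_pos] at e
    have e := mul_right_cancel e
    rw [← hu.unit_spec, ← hu'.unit_spec, e]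

lemma pairCount_nonmultiples_le (P p : ℕ) (hp : p.Prime) (h2 : p ≠ 2) :
    pairCount (nonmultiples P p) (multiples P p) ≤
      3 * diffCount (p ^ 3) (Icc 1 P) (Icc 1 (P / p)) := by
  have hp3 : (p : ℤ) ^ 3 ≠ 0 := pow_ne_zero _ (by exact_mod_cast hp.ne_zero)
  set T := nonmultiples P p ×ˢ (multiples P p ×ˢ multiples P p) with hT
  have hm : ∀ n ∈ multiples P p, n / p ∈ Icc 1 (P / p) ∧ n = p * (n / p) := by
    intro n hn
    obtain ⟨h, k, rfl⟩ := mem_filter.mp hn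
    rw [mem_Icc] at h
    rw [Nat.mul_div_cancel_left k hp.pos, mem_Icc]
    refine ⟨⟨Nat.pos_of_ne_zero fun h0 => by rw [h0] at h; omega, ?_⟩, rfl⟩
    exact (Nat.le_div_iff_mul_le hp.pos).mpr (by rw [mul_comm]; exact h.2)
  have h1 := card_coincidence_le_mul T cubes (fun t => (t.1 : ZMod (p ^ 3))) 3 (by
    intro m
    refine card_unit_cube_roots_le p hp h2 _ ?_ (m : ZMod (p ^ 3)) ?_
    · intro c hc
      obtain ⟨t, ht, rfl⟩ := mem_image.mp hc
      have ht := (mem_filter.mp (mem_product.mp (mem_filter.mp ht).1).1).2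
      rw [ZMod.isUnit_iff_coprime]
      exact Nat.Coprime.pow_right 3 ((hp.coprime_iff_not_dvd.mpr ht).symm)
    · intro c hc
      obtain ⟨⟨x, a, b⟩, ht, rfl⟩ := mem_image.mp hc
      obtain ⟨ht, e⟩ := mem_filter.mp ht
      simp only [hT, mem_product] at ht
      rw [← e]
      have ea := (hm a ht.2.1).2
      have eb := (hm b ht.2.2).2
      simp only [cubes]
      rw [ea, eb, mul_pow, mul_pow, ← mul_add]
      push_cast
      have : ((p : ZMod (p ^ 3)) ^ 3) = 0 := by
        rw [← Nat.cast_pow]; exact ZMod.natCast_self _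
      rw [this, zero_mul, add_zero])
  refine h1.trans (Nat.mul_le_mul_left 3 ?_)
  refine card_le_card_of_injOn (fun w => ((w.1.1, w.2.1),
    ((w.2.2.1 / p, w.2.2.2 / p), (w.1.2.1 / p, w.1.2.2 / p)))) ?_ ?_
  · rintro ⟨⟨x, a, b⟩, y, c, d⟩ hw
    obtain ⟨hw, h3, h4⟩ := mem_filter.mp hw
    simp only [hT, mem_product] at hw
    simp only [cubes] at h3
    simp only at h4
    obtain ⟨⟨hx, ha, hb⟩, hy, hc, hd⟩ := hw
    obtain ⟨a1, a2⟩ := hm _ ha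
    obtain ⟨b1, b2⟩ := hm _ hb
    obtain ⟨c1, c2⟩ := hm _ hc
    obtain ⟨d1, d2⟩ := hm _ hd
    refine mem_coe.mpr (mem_filter.mpr ⟨mem_product.mpr ⟨mem_product.mpr
      ⟨(mem_filter.mp hx).1, (mem_filter.mp hy).1⟩, mem_quad.mpr ⟨⟨c1, d1⟩, a1, b1⟩⟩, ?_, ?_⟩)
    · have h5 := (ZMod.intCast_eq_intCast_iff_dvd_sub (y : ℤ) (x : ℤ) (p ^ 3)).mp (by
        push_cast; exact h4.symm)
      exact h5
    · rw [a2, b2, c2, d2] at h3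
      zify at h3
      simp only [Phi]
      push_cast
      linear_combination h3
  · rintro ⟨⟨x, a, b⟩, y, c, d⟩ hw ⟨⟨x', a', b'⟩, y', c', d'⟩ hw' h
    have hw := (mem_filter.mp hw).1
    have hw' := (mem_filter.mp hw').1
    simp only [hT, mem_product] at hw hw'
    simp only [Prod.mk.injEq] at h
    have hinj : ∀ m ∈ multiples P p, ∀ n ∈ multiples P p, m / p = n / p → m = n :=
      fun m h1 n h2 e => by rw [(hm m h1).2, (hm n h2).2, e]
    rw [h.1.1, h.1.2, hinj _ hw.1.2.1 _ hw'.1.2.1 h.2.2.1, hinj _ hw.1.2.2 _ hw'.1.2.2 h.2.2.2,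
      hinj _ hw.2.2.1 _ hw'.2.2.1 h.2.1.1, hinj _ hw.2.2.2 _ hw'.2.2.2 h.2.1.2]

lemma sq_mul_pow_four_le {a b r : ℝ} (hr : 0 < r) :
    a ^ 2 * b ^ 4 ≤ 1 / 3 * (r ^ 6 * a ^ 6 + 2 * b ^ 6 / r ^ 3) := by
  have h1 : 0 ≤ (r ^ 2 * a ^ 2 - b ^ 2 / r) ^ 2 * (r ^ 2 * a ^ 2 + 2 * (b ^ 2 / r)) := by positivity
  have h2 : (r ^ 2 * a ^ 2 - b ^ 2 / r) ^ 2 * (r ^ 2 * a ^ 2 + 2 * (b ^ 2 / r)) =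
      r ^ 6 * a ^ 6 + 2 * b ^ 6 / r ^ 3 - 3 * (a ^ 2 * b ^ 4) := by
    field_simp
    ring
  linarith

lemma sum_sq_mul_pow_four_le (P p : ℕ) (r : ℝ) (hr : 0 < r) (N : ℕ) (hN : 3 * P ^ 3 < N) :
    ∑ b ∈ range N, ‖cubeExp (multiples P p) ((b : ℝ) / N)‖ ^ 2 *
      ‖cubeExp (Icc 1 P) ((b : ℝ) / N)‖ ^ 4 ≤
      N * (1 / 3 * (r ^ 6 * pairCount (multiples P p) (multiples P p) +
        2 * pairCount (Icc 1 P) (Icc 1 P) / r ^ 3)) := by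
  have hs : multiples P p ⊆ Icc 1 P := filter_subset _ _
  have h1 := sum_norm_cubeExp_eq hs hs N hN
  have h2 := sum_norm_cubeExp_eq (Subset.refl (Icc 1 P)) (Subset.refl (Icc 1 P)) N hN
  simp only [← pow_add] at h1 h2
  norm_num only at h1 h2
  refine (sum_le_sum fun b _ => sq_mul_pow_four_le hr).trans
    (le_of_eq ?_)
  rw [← mul_sum, sum_add_distrib, ← mul_sum, ← sum_div, ← mul_sum, h1, h2]
  ring

lemma prod_four_le {a b c d : ℝ} :
    a * b * c * d ≤ 1 / 4 * (a ^ 4 + b ^ 4 + c ^ 4 + d ^ 4) := by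
  nlinarith [sq_nonneg (a * b - c * d), sq_nonneg (a ^ 2 - b ^ 2), sq_nonneg (c ^ 2 - d ^ 2)]

/-- Integers up to `P` divisible by none of the four components of `q`. -/
def avoidFour (P : ℕ) (q : (ℕ × ℕ) × ℕ × ℕ) : Finset ℕ :=
  (Icc 1 P).filter fun n => (¬q.1.1 ∣ n ∧ ¬q.1.2 ∣ n) ∧ ¬q.2.1 ∣ n ∧ ¬q.2.2 ∣ n

lemma card_coincidences_avoidFour_le (P : ℕ) (q : (ℕ × ℕ) × ℕ × ℕ)
    (h1 : 0 < q.1.1) (h2 : 0 < q.1.2) (h3 : 0 < q.2.1) (h4 : 0 < q.2.2) (I : ℕ → ℝ)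
    (hI : ∀ p, I p = p ^ 3 * (pairCount (nonmultiples P p) (multiples P p) : ℝ)) :
    ((coincidences (avoidFour P q ×ˢ (multiples P q.1.1 ×ˢ multiples P q.1.2))
      (avoidFour P q ×ˢ (multiples P q.2.1 ×ˢ multiples P q.2.2))).card : ℝ) ≤
      1 / 4 * (I q.1.1 * (1 / q.1.2) * (1 / q.2.1) * (1 / q.2.2) +
        (1 / q.1.1) * I q.1.2 * (1 / q.2.1) * (1 / q.2.2) +
        (1 / q.1.1) * (1 / q.1.2) * I q.2.1 * (1 / q.2.2) +
        (1 / q.1.1) * (1 / q.1.2) * (1 / q.2.1) * I q.2.2) := by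
  obtain ⟨⟨p₁, p₂⟩, p₃, p₄⟩ := q
  simp only at h1 h2 h3 h4 ⊢
  set X := avoidFour P ((p₁, p₂), p₃, p₄) with hX
  obtain ⟨N, hN⟩ : ∃ N, N = 3 * P ^ 3 + 1 := ⟨_, rfl⟩
  have hN0 : (0 : ℝ) < N := by rw [hN]; positivity
  have e1 : (0 : ℝ) < p₁ := Nat.cast_pos.mpr h1
  have e2 : (0 : ℝ) < p₂ := Nat.cast_pos.mpr h2
  have e3 : (0 : ℝ) < p₃ := Nat.cast_pos.mpr h3
  have e4 : (0 : ℝ) < p₄ := Nat.cast_pos.mpr h4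
  have hsub : ∀ p, multiples P p ⊆ Icc 1 P := fun p => filter_subset _ _
  have hXs : X ⊆ Icc 1 P := filter_subset _ _
  have hsum : ∀ p, 0 < p → X ⊆ nonmultiples P p →
      (p : ℝ) ^ 4 * ∑ b ∈ range N, ‖cubeExp X ((b : ℝ) / N)‖ ^ 2 *
        ‖cubeExp (multiples P p) ((b : ℝ) / N)‖ ^ 4 ≤ N * (p * I p) := by
    intro p hp hs
    rw [sum_norm_cubeExp_eq hXs (hsub p) N (by omega), hI]
    have := Nat.cast_le (α := ℝ).mpr (pairCount_mono hs (Subset.refl (multiples P p)))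
    have h5 : (0 : ℝ) ≤ p ^ 4 * N := by positivity
    have h6 := mul_le_mul_of_nonneg_left this h5
    calc _ = (p : ℝ) ^ 4 * N * (pairCount X (multiples P p) : ℝ) := by ring
      _ ≤ _ := h6
      _ = _ := by ring
  have s1 := hsum p₁ h1 fun n hn => by
    obtain ⟨h, h'⟩ := mem_filter.mp hn
    exact mem_filter.mpr ⟨h, h'.1.1⟩
  have s2 := hsum p₂ h2 fun n hn => by
    obtain ⟨h, h'⟩ := mem_filter.mp hn
    exact mem_filter.mpr ⟨h, h'.1.2⟩
  have s3 := hsum p₃ h3 fun n hn => by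
    obtain ⟨h, h'⟩ := mem_filter.mp hn
    exact mem_filter.mpr ⟨h, h'.2.1⟩
  have s4 := hsum p₄ h4 fun n hn => by
    obtain ⟨h, h'⟩ := mem_filter.mp hn
    exact mem_filter.mpr ⟨h, h'.2.2⟩
  have h := mul_card_coincidences_le X (multiples P p₁) (multiples P p₂) X (multiples P p₃)
    (multiples P p₄) N (by omega)
  have hpt : ∀ K a b c d : ℝ, (K * (a * b)) * (K * (c * d)) ≤ 1 / (4 * (p₁ * p₂ * p₃ * p₄)) *
      ((p₁ : ℝ) ^ 4 * (K ^ 2 * a ^ 4) + (p₂ : ℝ) ^ 4 * (K ^ 2 * b ^ 4) +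
        (p₃ : ℝ) ^ 4 * (K ^ 2 * c ^ 4) + (p₄ : ℝ) ^ 4 * (K ^ 2 * d ^ 4)) := by
    intro K a b c d
    have h5 := mul_le_mul_of_nonneg_left
      (prod_four_le (a := p₁ * a) (b := p₂ * b) (c := p₃ * c) (d := p₄ * d)) (sq_nonneg K)
    have h6 : 0 < (p₁ : ℝ) * p₂ * p₃ * p₄ := by positivity
    have h7 := mul_le_mul_of_nonneg_left h5 (one_div_pos.mpr h6).le
    refine le_trans (le_of_eq ?_) (h7.trans (le_of_eq ?_))
    · field_simp
    · field_simp
  refine le_of_mul_le_mul_left ((h.trans (sum_le_sum fun b _ => hpt _ _ _ _ _)).trans ?_) hN0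
  rw [← mul_sum, sum_add_distrib, sum_add_distrib, sum_add_distrib, ← mul_sum, ← mul_sum,
    ← mul_sum, ← mul_sum]
  refine (mul_le_mul_of_nonneg_left (add_le_add (add_le_add (add_le_add s1 s2) s3) s4)
    (by positivity)).trans (le_of_eq ?_)
  field_simp

/-- The eight families of coincidences in which `p` divides one of the outer and one of the inner
variables. -/
def mixedCoincidences (P p : ℕ) : Finset ((ℕ × ℕ × ℕ) × ℕ × ℕ × ℕ) :=
  (coincidences (multiples P p ×ˢ (multiples P p ×ˢ Icc 1 P)) (Icc 1 P ×ˢ (Icc 1 P ×ˢ Icc 1 P)) ∪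
    coincidences (multiples P p ×ˢ (Icc 1 P ×ˢ multiples P p))
      (Icc 1 P ×ˢ (Icc 1 P ×ˢ Icc 1 P))) ∪
  (coincidences (multiples P p ×ˢ (Icc 1 P ×ˢ Icc 1 P)) (Icc 1 P ×ˢ (multiples P p ×ˢ Icc 1 P)) ∪
    coincidences (multiples P p ×ˢ (Icc 1 P ×ˢ Icc 1 P))
      (Icc 1 P ×ˢ (Icc 1 P ×ˢ multiples P p))) ∪
  ((coincidences (Icc 1 P ×ˢ (multiples P p ×ˢ Icc 1 P)) (multiples P p ×ˢ (Icc 1 P ×ˢ Icc 1 P)) ∪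
    coincidences (Icc 1 P ×ˢ (Icc 1 P ×ˢ multiples P p))
      (multiples P p ×ˢ (Icc 1 P ×ˢ Icc 1 P))) ∪
  (coincidences (Icc 1 P ×ˢ (Icc 1 P ×ˢ Icc 1 P)) (multiples P p ×ˢ (multiples P p ×ˢ Icc 1 P)) ∪
    coincidences (Icc 1 P ×ˢ (Icc 1 P ×ˢ Icc 1 P))
      (multiples P p ×ˢ (Icc 1 P ×ˢ multiples P p))))

lemma card_mixedCoincidences_le (P p : ℕ) (r : ℝ) (hr : 0 < r) :
    ((mixedCoincidences P p).card : ℝ) ≤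
      8 / 3 * (r ^ 6 * pairCount (multiples P p) (multiples P p) +
        2 * pairCount (Icc 1 P) (Icc 1 P) / r ^ 3) := by
  obtain ⟨N, hN⟩ : ∃ N, N = 3 * P ^ 3 + 1 := ⟨_, rfl⟩
  have hN0 : (0 : ℝ) < N := by rw [hN]; positivity
  have h := sum_sq_mul_pow_four_le P p r hr N (by omega)
  set B := 1 / 3 * (r ^ 6 * (pairCount (multiples P p) (multiples P p) : ℝ) +
        2 * pairCount (Icc 1 P) (Icc 1 P) / r ^ 3) with hB
  set M := multiples P p with hM
  set J := Icc 1 P with hJ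
  have key : ∀ X A B' Y C D : Finset ℕ,
      (∀ t : ℝ, (‖cubeExp X t‖ * (‖cubeExp A t‖ * ‖cubeExp B' t‖)) *
        (‖cubeExp Y t‖ * (‖cubeExp C t‖ * ‖cubeExp D t‖)) = ‖cubeExp M t‖ ^ 2 * ‖cubeExp J t‖ ^ 4) →
      ((coincidences (X ×ˢ (A ×ˢ B')) (Y ×ˢ (C ×ˢ D))).card : ℝ) ≤ B := by
    intro X A B' Y C D hh
    refine le_of_mul_le_mul_left (((mul_card_coincidences_le X A B' Y C D N (by omega)).trans
      (le_of_eq ?_)).trans h) hN0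
    exact sum_congr rfl fun b _ => hh _
  have k1 := key M M J J J J fun t => by ring
  have k2 := key M J M J J J fun t => by ring
  have k3 := key M J J J M J fun t => by ring
  have k4 := key M J J J J M fun t => by ring
  have k5 := key J M J M J J fun t => by ring
  have k6 := key J J M M J J fun t => by ring
  have k7 := key J J J M M J fun t => by ring
  have k8 := key J J J M J M fun t => by ring
  have hu : ∀ (s t : Finset ((ℕ × ℕ × ℕ) × ℕ × ℕ × ℕ)) (a b : ℝ), (s.card : ℝ) ≤ a →
      (t.card : ℝ) ≤ b → ((s ∪ t).card : ℝ) ≤ a + b := by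
    intro s t a b h1 h2
    have h3 := (Nat.cast_le (α := ℝ)).mpr (card_union_le s t)
    push_cast at h3
    linarith
  have hfin := hu _ _ _ _ (hu _ _ _ _ (hu _ _ _ _ k1 k2) (hu _ _ _ _ k3 k4))
    (hu _ _ _ _ (hu _ _ _ _ k5 k6) (hu _ _ _ _ k7 k8))
  refine hfin.trans (le_of_eq ?_)
  rw [hB]
  ring

lemma coincidences_subset (P : ℕ) (s : Finset ℕ) (D : Finset ℕ) (hDP : D ⊆ Icc 1 P)
    (hD : ∀ n ∈ D, ∃ p ∈ s, p ∣ n) :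
    coincidences (D ×ˢ (D ×ˢ D)) (D ×ˢ (D ×ˢ D)) ⊆ (s.biUnion (mixedCoincidences P)) ∪
      ((s ×ˢ s) ×ˢ (s ×ˢ s)).biUnion fun q =>
        coincidences (avoidFour P q ×ˢ (multiples P q.1.1 ×ˢ multiples P q.1.2))
          (avoidFour P q ×ˢ (multiples P q.2.1 ×ˢ multiples P q.2.2)) := by
  rintro ⟨⟨x, a, b⟩, y, c, d⟩ hw
  rw [mem_coincidences] at hw
  obtain ⟨⟨h1, h2⟩, h3⟩ := hw
  simp only [mem_product] at h1 h2
  obtain ⟨hx, ha, hb⟩ := h1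
  obtain ⟨hy, hc, hd⟩ := h2
  obtain ⟨p₁, m₁, d₁⟩ := hD a ha
  obtain ⟨p₂, m₂, d₂⟩ := hD b hb
  obtain ⟨p₃, m₃, d₃⟩ := hD c hc
  obtain ⟨p₄, m₄, d₄⟩ := hD d hd
  have hx := hDP hx
  have hy := hDP hy
  have ha := hDP ha
  have hb := hDP hb
  have hc := hDP hc
  have hd := hDP hd
  have hmul : ∀ n p, n ∈ Icc 1 P → p ∣ n → n ∈ multiples P p :=
    fun n p h h' => mem_filter.mpr ⟨h, h'⟩
  rw [mem_union]
  by_cases hB : ∃ p ∈ s, (p ∣ x ∨ p ∣ y) ∧ ((p ∣ a ∨ p ∣ b) ∨ p ∣ c ∨ p ∣ d)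
  · left
    obtain ⟨p, hp, h4, h5⟩ := hB
    refine mem_biUnion.mpr ⟨p, hp, ?_⟩
    have hiff : ∀ n, n ∈ Icc 1 P → (n ∈ multiples P p ↔ p ∣ n) :=
      fun n hn => ⟨fun h => (mem_filter.mp h).2, hmul n p hn⟩
    simp only [mixedCoincidences, mem_union, mem_coincidences, mem_product, h3, and_true, hx, hy,
      ha, hb, hc, hd, true_and, hiff]
    rcases h4 with h4 | h4 <;> rcases h5 with (h5 | h5) | h5 | h5 <;>
      simp only [h4, h5, and_self, true_or, or_true]
  · right
    push Not at hB
    have hav : ∀ p ∈ s, ((p ∣ a ∨ p ∣ b) ∨ p ∣ c ∨ p ∣ d) → ¬p ∣ x ∧ ¬p ∣ y := by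
      intro p hp hh
      by_contra hcon
      have := hB p hp (by tauto)
      tauto
    have a1 := hav p₁ m₁ (by tauto)
    have a2 := hav p₂ m₂ (by tauto)
    have a3 := hav p₃ m₃ (by tauto)
    have a4 := hav p₄ m₄ (by tauto)
    refine mem_biUnion.mpr ⟨((p₁, p₂), p₃, p₄), ?_, ?_⟩
    · simp only [mem_product]; exact ⟨⟨m₁, m₂⟩, m₃, m₄⟩
    · refine mem_coincidences.mpr ⟨⟨?_, ?_⟩, h3⟩
      · simp only [mem_product]
        exact ⟨mem_filter.mpr ⟨hx, ⟨a1.1, a2.1⟩, a3.1, a4.1⟩, hmul _ _ ha d₁, hmul _ _ hb d₂⟩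
      · simp only [mem_product]
        exact ⟨mem_filter.mpr ⟨hy, ⟨a1.2, a2.2⟩, a3.2, a4.2⟩, hmul _ _ hc d₃, hmul _ _ hd d₄⟩

/-- Sextuples all of whose entries have a divisor in `s` are bounded by coincidences with
divisibility constraints. -/
lemma pairCount_le_sum (P : ℕ) (s : Finset ℕ) (hs : ∀ p ∈ s, 0 < p) (D : Finset ℕ)
    (hDP : D ⊆ Icc 1 P) (hD : ∀ n ∈ D, ∃ p ∈ s, p ∣ n) (r : ℕ → ℝ) (hr : ∀ p ∈ s, 0 < r p) :
    (pairCount D D : ℝ) ≤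
      8 / 3 * ∑ p ∈ s, (r p ^ 6 * pairCount (multiples P p) (multiples P p) +
        2 * pairCount (Icc 1 P) (Icc 1 P) / r p ^ 3) +
      (∑ p ∈ s, 1 / (p : ℝ)) ^ 3 *
        ∑ p ∈ s, (p : ℝ) ^ 3 * pairCount (nonmultiples P p) (multiples P p) := by
  have h := (card_le_card (coincidences_subset P s D hDP hD)).trans (card_union_le _ _)
  have h1 := h.trans (add_le_add card_biUnion_le card_biUnion_le)
  have h2 := (Nat.cast_le (α := ℝ)).mpr h1
  push_cast at h2
  refine h2.trans (add_le_add ?_ ?_)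
  · rw [mul_sum]
    exact sum_le_sum fun p hp => card_mixedCoincidences_le P p (r p) (hr p hp)
  · set I : ℕ → ℝ := fun p => p ^ 3 * (pairCount (nonmultiples P p) (multiples P p) : ℝ) with hI
    have h3 : ∀ q ∈ (s ×ˢ s) ×ˢ (s ×ˢ s), _ := fun q hq => by
      simp only [mem_product] at hq
      exact card_coincidences_avoidFour_le P q (hs _ hq.1.1) (hs _ hq.1.2) (hs _ hq.2.1)
        (hs _ hq.2.2) I fun p => rfl
    refine (sum_le_sum h3).trans (le_of_eq ?_)
    simp only [sum_product]
    simp only [← mul_sum, ← sum_mul, sum_add_distrib]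
    ring

lemma rpow_seven_halves {x : ℝ} (hx : 0 ≤ x) : x ^ (3.5 : ℝ) = x ^ 3 * √x := by
  rw [Real.sqrt_eq_rpow, ← Real.rpow_natCast, ← Real.rpow_add' hx (by norm_num)]
  norm_num

lemma exists_pairCount_Icc_le_log : ∃ C : ℝ, 1 ≤ C ∧ ∃ U₀ : ℕ, ∀ U ≥ U₀,
    (pairCount (Icc 1 U) (Icc 1 U) : ℝ) ≤ C * ((U : ℝ) ^ 3 * √U * (1 + Real.log U) ^ 3) := by
  obtain ⟨C, hC, U₀, h⟩ := exists_diffCount_Icc_le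
  refine ⟨3 * C, by linarith, max U₀ 1, fun U hU => ?_⟩
  have h1 := h U ((le_max_left _ _).trans hU) 1 U one_pos (by simp)
  rw [Nat.div_one] at h1
  have hU1 : (1 : ℝ) ≤ U := by exact_mod_cast (le_max_right _ _).trans hU
  have hs : 1 ≤ √(U : ℝ) := Real.one_le_sqrt.mpr hU1
  have hl : (1 : ℝ) ≤ (1 + Real.log U) ^ 3 := one_le_pow₀ (by linarith [Real.log_nonneg hU1])
  have h2 := (Nat.cast_le (α := ℝ)).mpr (pairCount_le_diffCount (Icc 1 U) (Icc 1 U))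
  refine (h2.trans h1).trans ?_
  have hU3 : (0 : ℝ) ≤ (U : ℝ) ^ 3 := by positivity
  have e1 : (U : ℝ) ^ 3 ≤ (U : ℝ) ^ 3 * √U := le_mul_of_one_le_right hU3 hs
  have e2 : (U : ℝ) ^ 3 * √U ≤ (U : ℝ) ^ 3 * √U * (1 + Real.log U) ^ 3 :=
    le_mul_of_one_le_right (by positivity) hl
  have e3 : (U : ℝ) * U ^ 2 + U ^ 2 * U * √U + U ^ 3 * √U * (1 + Real.log U) ^ 3 ≤
      3 * ((U : ℝ) ^ 3 * √U * (1 + Real.log U) ^ 3) := by nlinarith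
  have := mul_le_mul_of_nonneg_left e3 (zero_le_one.trans hC)
  linarith

lemma pairCount_multiples_le_of_rpow {C : ℝ} {P p : ℕ} {w V : ℝ} (hC : 1 ≤ C) (hp : 0 < p)
    (hw : 1 ≤ w) (hwp : w ^ 8 = p) (hP : 1 ≤ P) (hU : 1 ≤ P / p)
    (hV : V = (P : ℝ) ^ 3 * √P * (1 + Real.log P) ^ 3)
    (h : (pairCount (Icc 1 (P / p)) (Icc 1 (P / p)) : ℝ) ≤
      C * (((P / p : ℕ) : ℝ) ^ 3 * √((P / p : ℕ) : ℝ) * (1 + Real.log (P / p : ℕ)) ^ 3)) :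
    w ^ 18 * (pairCount (multiples P p) (multiples P p) : ℝ) ≤ C * V / w ^ 9 := by
  have hw0 : 0 < w := by linarith
  have hP1 : (1 : ℝ) ≤ P := by exact_mod_cast hP
  have hU1 : (1 : ℝ) ≤ ((P / p : ℕ) : ℝ) := by exact_mod_cast hU
  have h1 := ((Nat.cast_le (α := ℝ)).mpr (pairCount_multiples_le P p hp)).trans h
  have hUle : ((P / p : ℕ) : ℝ) ≤ P / w ^ 8 := by rw [hwp]; exact Nat.cast_div_le
  have hUP : ((P / p : ℕ) : ℝ) ≤ P := by exact_mod_cast Nat.div_le_self P p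
  have hl0 : 0 ≤ Real.log ((P / p : ℕ) : ℝ) := Real.log_nonneg hU1
  have hl : (1 + Real.log ((P / p : ℕ) : ℝ)) ^ 3 ≤ (1 + Real.log P) ^ 3 :=
    pow_le_pow_left₀ (by linarith) (by linarith [Real.log_le_log (by linarith) hUP]) 3
  have hs : √((P / p : ℕ) : ℝ) ≤ √P / w ^ 4 := by
    refine Real.sqrt_le_iff.mpr ⟨by positivity, hUle.trans (le_of_eq ?_)⟩
    rw [div_pow, Real.sq_sqrt (by linarith), ← pow_mul]
  have h3 : ((P / p : ℕ) : ℝ) ^ 3 ≤ (P / w ^ 8) ^ 3 := pow_le_pow_left₀ (by linarith) hUle 3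
  have h4 : ((P / p : ℕ) : ℝ) ^ 3 * √((P / p : ℕ) : ℝ) * (1 + Real.log (P / p : ℕ)) ^ 3 ≤
      (P / w ^ 8) ^ 3 * (√P / w ^ 4) * (1 + Real.log P) ^ 3 :=
    mul_le_mul (mul_le_mul h3 hs (Real.sqrt_nonneg _) (by positivity)) hl (by positivity)
      (by positivity)
  have h5 : (P / w ^ 8) ^ 3 * (√P / w ^ 4) * (1 + Real.log P) ^ 3 = V / w ^ 28 := by
    rw [hV]; field_simp
  rw [h5] at h4
  have h6 := mul_le_mul_of_nonneg_left (h1.trans (mul_le_mul_of_nonneg_left h4 (by linarith)))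
    (by positivity : 0 ≤ w ^ 18)
  refine h6.trans ?_
  have hlP : 0 ≤ Real.log (P : ℝ) := Real.log_nonneg hP1
  have hV0 : 0 ≤ V := by rw [hV]; positivity
  have h7 : w ^ 18 * (C * (V / w ^ 28)) = C * V / w ^ 10 := by field_simp
  rw [h7]
  exact div_le_div_of_nonneg_left (mul_nonneg (by linarith) hV0) (by positivity)
    (pow_le_pow_right₀ hw (by norm_num))

lemma pairCount_nonmultiples_le_of_rpow {C : ℝ} {P p : ℕ} {w V : ℝ} (hC : 1 ≤ C)
    (hp : p.Prime) (hp2 : p ≠ 2)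
    (hw : 1 ≤ w) (hwp : w ^ 8 = p) (hP : 1 ≤ P) (hU : 1 ≤ P / p) (hpP : p ^ 6 ≤ P)
    (hV : V = (P : ℝ) ^ 3 * √P * (1 + Real.log P) ^ 3)
    (h : (diffCount (p ^ 3) (Icc 1 P) (Icc 1 (P / p)) : ℝ) ≤
      C * (P * ((P / p : ℕ) : ℝ) ^ 2 + ((P / p : ℕ) : ℝ) ^ 2 * (P / p ^ 3 : ℕ) * √P +
        ((P / p : ℕ) : ℝ) ^ 3 * √((P / p ^ 3 : ℕ) : ℝ) * (1 + Real.log (P / p : ℕ)) ^ 3)) :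
    (p : ℝ) ^ 3 * (pairCount (nonmultiples P p) (multiples P p) : ℝ) ≤ 9 * C * V / w ^ 9 := by
  have hw0 : 0 < w := by linarith
  have hP1 : (1 : ℝ) ≤ P := by exact_mod_cast hP
  have hU1 : (1 : ℝ) ≤ ((P / p : ℕ) : ℝ) := by exact_mod_cast hU
  have h1 := (Nat.cast_le (α := ℝ)).mpr (pairCount_nonmultiples_le P p hp hp2)
  push_cast at h1
  have hUle : ((P / p : ℕ) : ℝ) ≤ P / w ^ 8 := by rw [hwp]; exact Nat.cast_div_le
  have hHle : ((P / p ^ 3 : ℕ) : ℝ) ≤ P / w ^ 24 := by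
    refine Nat.cast_div_le.trans (le_of_eq ?_)
    push_cast
    rw [← hwp, ← pow_mul]
  have hUP : ((P / p : ℕ) : ℝ) ≤ P := by exact_mod_cast Nat.div_le_self P p
  have hl0 : 0 ≤ Real.log ((P / p : ℕ) : ℝ) := Real.log_nonneg hU1
  have hlP : 0 ≤ Real.log (P : ℝ) := Real.log_nonneg hP1
  have hl : (1 + Real.log ((P / p : ℕ) : ℝ)) ^ 3 ≤ (1 + Real.log P) ^ 3 :=
    pow_le_pow_left₀ (by linarith) (by linarith [Real.log_le_log (by linarith) hUP]) 3
  have hl1 : (1 : ℝ) ≤ (1 + Real.log P) ^ 3 := one_le_pow₀ (by linarith)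
  have hs : √((P / p ^ 3 : ℕ) : ℝ) ≤ √P / w ^ 12 := by
    refine Real.sqrt_le_iff.mpr ⟨by positivity, hHle.trans (le_of_eq ?_)⟩
    rw [div_pow, Real.sq_sqrt (by linarith), ← pow_mul]
  have h2 : ((P / p : ℕ) : ℝ) ^ 2 ≤ (P / w ^ 8) ^ 2 := pow_le_pow_left₀ (by linarith) hUle 2
  have h3 : ((P / p : ℕ) : ℝ) ^ 3 ≤ (P / w ^ 8) ^ 3 := pow_le_pow_left₀ (by linarith) hUle 3
  have hsP : w ^ 24 ≤ √(P : ℝ) := by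
    refine Real.le_sqrt_of_sq_le ?_
    have := (Nat.cast_le (α := ℝ)).mpr hpP
    push_cast at this
    rw [← hwp, ← pow_mul] at this
    rwa [← pow_mul]
  have hW : 0 ≤ (P : ℝ) ^ 3 * √P := by positivity
  have hWV : (P : ℝ) ^ 3 * √P ≤ V := by rw [hV]; exact le_mul_of_one_le_right hW hl1
  have hV0 : 0 ≤ V := hW.trans hWV
  have hdiv : ∀ k, 9 ≤ k → V / w ^ k ≤ V / w ^ 9 := fun k hk =>
    div_le_div_of_nonneg_left hV0 (by positivity) (pow_le_pow_right₀ hw hk)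
  have t1 : (p : ℝ) ^ 3 * (P * ((P / p : ℕ) : ℝ) ^ 2) ≤ V / w ^ 9 := by
    have e1 : (p : ℝ) ^ 3 * (P * ((P / p : ℕ) : ℝ) ^ 2) ≤ (p : ℝ) ^ 3 * (P * (P / w ^ 8) ^ 2) :=
      mul_le_mul_of_nonneg_left (mul_le_mul_of_nonneg_left h2 (by linarith)) (by positivity)
    have e2 : (p : ℝ) ^ 3 * (P * (P / w ^ 8) ^ 2) = (P : ℝ) ^ 3 * w ^ 8 := by
      rw [← hwp]; field_simp
    rw [e2] at e1
    refine e1.trans ?_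
    rw [le_div_iff₀ (by positivity)]
    have e3 : w ^ 17 ≤ √(P : ℝ) := (pow_le_pow_right₀ hw (by norm_num)).trans hsP
    have e4 := mul_le_mul_of_nonneg_left e3 (by positivity : (0 : ℝ) ≤ (P : ℝ) ^ 3)
    calc _ = (P : ℝ) ^ 3 * w ^ 17 := by ring
      _ ≤ _ := e4.trans hWV
  have t2 : (p : ℝ) ^ 3 * (((P / p : ℕ) : ℝ) ^ 2 * (P / p ^ 3 : ℕ) * √P) ≤ V / w ^ 9 := by
    have e1 : (p : ℝ) ^ 3 * (((P / p : ℕ) : ℝ) ^ 2 * (P / p ^ 3 : ℕ) * √P) ≤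
        (p : ℝ) ^ 3 * ((P / w ^ 8) ^ 2 * (P / w ^ 24) * √P) := by
      refine mul_le_mul_of_nonneg_left (mul_le_mul_of_nonneg_right
        (mul_le_mul h2 hHle (Nat.cast_nonneg _) (by positivity)) (Real.sqrt_nonneg _))
        (by positivity)
    have e2 : (p : ℝ) ^ 3 * ((P / w ^ 8) ^ 2 * (P / w ^ 24) * √P) = (P : ℝ) ^ 3 * √P / w ^ 16 := by
      rw [← hwp]; field_simp
    rw [e2] at e1
    exact e1.trans ((div_le_div_of_nonneg_right hWV (by positivity)).trans (hdiv 16 (by norm_num)))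
  have t3 : (p : ℝ) ^ 3 * (((P / p : ℕ) : ℝ) ^ 3 * √((P / p ^ 3 : ℕ) : ℝ) *
      (1 + Real.log (P / p : ℕ)) ^ 3) ≤ V / w ^ 9 := by
    have e1 : (p : ℝ) ^ 3 * (((P / p : ℕ) : ℝ) ^ 3 * √((P / p ^ 3 : ℕ) : ℝ) *
        (1 + Real.log (P / p : ℕ)) ^ 3) ≤
        (p : ℝ) ^ 3 * ((P / w ^ 8) ^ 3 * (√P / w ^ 12) * (1 + Real.log P) ^ 3) :=
      mul_le_mul_of_nonneg_left (mul_le_mul (mul_le_mul h3 hs (Real.sqrt_nonneg _)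
        (by positivity)) hl (by positivity) (by positivity)) (by positivity)
    have e2 : (p : ℝ) ^ 3 * ((P / w ^ 8) ^ 3 * (√P / w ^ 12) * (1 + Real.log P) ^ 3) =
        V / w ^ 12 := by
      rw [hV, ← hwp]; field_simp
    rw [e2] at e1
    exact e1.trans (hdiv 12 (by norm_num))
  have hp0 : (0 : ℝ) ≤ (p : ℝ) ^ 3 := by positivity
  have h4 := mul_le_mul_of_nonneg_left h1 hp0
  have h5 := mul_le_mul_of_nonneg_left h hp0
  have h6 := mul_le_mul_of_nonneg_left (add_le_add (add_le_add t1 t2) t3)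
    (by linarith : (0 : ℝ) ≤ C)
  calc _ ≤ _ := h4
    _ = 3 * ((p : ℝ) ^ 3 * (diffCount (p ^ 3) (Icc 1 P) (Icc 1 (P / p)) : ℝ)) := by ring
    _ ≤ 3 * (C * (V / w ^ 9 + V / w ^ 9 + V / w ^ 9)) := by
      refine mul_le_mul_of_nonneg_left (h5.trans (le_trans (le_of_eq ?_) h6)) (by norm_num)
      ring
    _ = _ := by ring

/-- Integers up to `P` divisible by a sieving prime. -/
noncomputable def divisibles (κ : ℝ) (P : ℕ) : Finset ℕ :=
  (Icc 1 P).filter fun n => ∃ p ∈ sievePrimes κ P, p ∣ n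

lemma exists_pairCount_divisibles_le (κ : ℝ) (hκ : 0 < κ) (hκ' : κ ≤ 1 / 2) :
    ∃ C : ℝ, 1 ≤ C ∧ ∃ P₀ : ℕ, ∀ P ≥ P₀,
      (pairCount (divisibles κ P) (divisibles κ P) : ℝ) ≤
        C * ((P : ℝ) ^ 3 * √P * ((1 + Real.log P) ^ 3 * Real.log P ^ 4 *
          Real.exp (-(Real.log P ^ κ) / 8))) := by
  obtain ⟨C₁, hC₁, U₁, h₁⟩ := exists_pairCount_Icc_le_log
  obtain ⟨C₂, hC₂, U₂, h₂⟩ := exists_diffCount_Icc_le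
  obtain ⟨U, hU1, hUU1, hUU2⟩ : ∃ U : ℕ, 1 ≤ U ∧ U₁ ≤ U ∧ U₂ ≤ U :=
    ⟨max 1 (max U₁ U₂), by simp, by simp, by simp⟩
  refine ⟨33 * 23 ^ 4 * (C₁ + C₂), by linarith, ?_⟩
  have hlim : Filter.Tendsto (fun P : ℕ => Real.log P) Filter.atTop Filter.atTop :=
    Real.tendsto_log_atTop.comp tendsto_natCast_atTop_atTop
  have hev := hlim.eventually (Filter.eventually_ge_atTop
    (max (max 1 ((8 : ℝ) ^ (1 / κ))) (2 * Real.log U)))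
  obtain ⟨P₁, hP₁⟩ := Filter.eventually_atTop.mp hev
  refine ⟨max (max P₁ U) 1, fun P hP => ?_⟩
  have hLb := hP₁ P (((le_max_left _ _).trans (le_max_left _ _)).trans hP)
  have hPU : U ≤ P := ((le_max_right _ _).trans (le_max_left _ _)).trans hP
  have hP1 : 1 ≤ P := (le_max_right _ _).trans hP
  have hPr : (1 : ℝ) ≤ P := by exact_mod_cast hP1
  obtain ⟨L, hL⟩ : ∃ L, L = Real.log P := ⟨_, rfl⟩
  rw [← hL] at hLb ⊢
  have hL1 : 1 ≤ L := ((le_max_left _ _).trans (le_max_left _ _)).trans hLb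
  have hL8 : (8 : ℝ) ^ (1 / κ) ≤ L := ((le_max_right _ _).trans (le_max_left _ _)).trans hLb
  have hLU : 2 * Real.log U ≤ L := (le_max_right _ _).trans hLb
  have hexpL : Real.exp L = P := by rw [hL, Real.exp_log (by linarith)]
  have hκ1 : 1 ≤ L ^ κ := Real.one_le_rpow hL1 hκ.le
  have hκ8 : 8 ≤ L ^ κ := by
    have := Real.rpow_le_rpow (by positivity) hL8 hκ.le
    rwa [← Real.rpow_mul (by norm_num), one_div, inv_mul_cancel₀ hκ.ne', Real.rpow_one] at this
  have hκL : L ^ (1 - κ) ≤ L / 8 := by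
    rw [Real.rpow_sub (by linarith), Real.rpow_one]
    exact div_le_div_of_nonneg_left (by linarith) (by norm_num) hκ8
  obtain ⟨V, hV⟩ : ∃ V, V = (P : ℝ) ^ 3 * √P * (1 + Real.log P) ^ 3 := ⟨_, rfl⟩
  have hV0 : 0 ≤ V := by rw [hV, ← hL]; positivity
  set s := sievePrimes κ P with hs
  obtain ⟨w, hwdef⟩ : ∃ w : ℕ → ℝ, ∀ p, w p = (p : ℝ) ^ (1 / 8 : ℝ) := ⟨_, fun _ => rfl⟩
  have hwp : ∀ p, w p ^ 8 = p := by
    intro p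
    rw [hwdef, ← Real.rpow_natCast, ← Real.rpow_mul (Nat.cast_nonneg _)]
    norm_num
  have hmem : ∀ p ∈ s, p.Prime ∧ p ≠ 2 ∧ 1 ≤ w p ∧ U ≤ P / p ∧ p ^ 6 ≤ P ∧
      1 / w p ≤ Real.exp (-(L ^ κ) / 8) := by
    intro p hp
    obtain ⟨hpp, hY, hZ⟩ := mem_sievePrimes.mp hp
    rw [← hL] at hY hZ
    have hp1 : (1 : ℝ) ≤ p := by exact_mod_cast hpp.one_le
    have hw1 : 1 ≤ w p := by rw [hwdef]; exact Real.one_le_rpow hp1 (by norm_num)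
    have hZ8 : (p : ℝ) ≤ Real.exp (L / 8) := hZ.trans (Real.exp_le_exp.mpr hκL)
    refine ⟨hpp, ?_, hw1, ?_, ?_, ?_⟩
    · rintro rfl
      have : Real.exp 1 ≤ ((2 : ℕ) : ℝ) := (Real.exp_le_exp.mpr hκ1).trans hY
      push_cast at this
      linarith [Real.exp_one_gt_d9]
    · rw [Nat.le_div_iff_mul_le hpp.pos]
      have hUe : (U : ℝ) ≤ Real.exp (L / 2) := by
        rw [← Real.log_le_iff_le_exp (by exact_mod_cast hU1)]
        linarith
      have : ((U * p : ℕ) : ℝ) ≤ P := by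
        push_cast
        calc (U : ℝ) * p ≤ Real.exp (L / 2) * Real.exp (L / 8) :=
              mul_le_mul hUe hZ8 (by linarith) (Real.exp_pos _).le
          _ = Real.exp (L / 2 + L / 8) := (Real.exp_add _ _).symm
          _ ≤ Real.exp L := Real.exp_le_exp.mpr (by linarith)
          _ = P := hexpL
      exact_mod_cast this
    · have : ((p ^ 6 : ℕ) : ℝ) ≤ P := by
        push_cast
        calc (p : ℝ) ^ 6 ≤ Real.exp (L / 8) ^ 6 := pow_le_pow_left₀ (by linarith) hZ8 6
          _ = Real.exp (6 * (L / 8)) := by rw [← Real.exp_nat_mul]; norm_num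
          _ ≤ Real.exp L := Real.exp_le_exp.mpr (by linarith)
          _ = P := hexpL
      exact_mod_cast this
    · rw [neg_div, Real.exp_neg, one_div]
      refine inv_anti₀ (Real.exp_pos _) ?_
      have := Real.rpow_le_rpow (Real.exp_pos _).le hY (by norm_num : (0 : ℝ) ≤ 1 / 8)
      rw [← Real.exp_mul] at this
      rw [hwdef]
      refine le_trans (le_of_eq ?_) this
      ring_nf
  have hw0 : ∀ p ∈ s, 0 < w p := fun p hp => by linarith [(hmem p hp).2.2.1]
  have hmain := pairCount_le_sum P s (fun p hp => (hmem p hp).1.pos) (divisibles κ P)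
    (filter_subset _ _) (fun n hn => (mem_filter.mp hn).2) (fun p => w p ^ 3)
    (fun p hp => pow_pos (hw0 p hp) 3)
  have hC0 : 0 ≤ C₁ + C₂ := by linarith
  have b1 : ∀ p ∈ s, ((w p ^ 3) ^ 6 * (pairCount (multiples P p) (multiples P p) : ℝ) +
      2 * pairCount (Icc 1 P) (Icc 1 P) / (w p ^ 3) ^ 3) ≤ 3 * (C₁ + C₂) * V * (1 / w p ^ 9) := by
    intro p hp
    obtain ⟨hpp, hp2, hw1, hUp, hp6, -⟩ := hmem p hp
    have e1 := pairCount_multiples_le_of_rpow hC₁ hpp.pos hw1 (hwp p) hP1 (hU1.trans hUp) hV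
      (h₁ (P / p) (hUU1.trans hUp))
    have e2 := h₁ P (hUU1.trans hPU)
    rw [← hV] at e2
    have hpos : 0 < w p ^ 9 := pow_pos (hw0 p hp) 9
    have e3 := div_le_div_of_nonneg_right e2 hpos.le
    have e4 : 0 ≤ C₂ * V / w p ^ 9 := div_nonneg (mul_nonneg (by linarith) hV0) hpos.le
    rw [← pow_mul, ← pow_mul]
    norm_num only
    have e5 : 3 * (C₁ + C₂) * V * (1 / w p ^ 9) =
      3 * (C₁ * V / w p ^ 9) + 3 * (C₂ * V / w p ^ 9) := by ring
    have e6 : 2 * (pairCount (Icc 1 P) (Icc 1 P) : ℝ) / w p ^ 9 =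
      2 * ((pairCount (Icc 1 P) (Icc 1 P) : ℝ) / w p ^ 9) := by ring
    rw [e5, e6]
    linarith
  have b2 : ∀ p ∈ s, (p : ℝ) ^ 3 * (pairCount (nonmultiples P p) (multiples P p) : ℝ) ≤
      9 * (C₁ + C₂) * V * (1 / w p ^ 9) := by
    intro p hp
    obtain ⟨hpp, hp2, hw1, hUp, hp6, -⟩ := hmem p hp
    have e1 := pairCount_nonmultiples_le_of_rpow hC₂ hpp hp2 hw1 (hwp p) hP1 (hU1.trans hUp) hp6 hV
      (h₂ (P / p) (hUU2.trans hUp) (p ^ 3) P (pow_pos hpp.pos 3)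
        (Nat.div_le_div_left (Nat.le_self_pow (by norm_num) p) hpp.pos))
    refine e1.trans ?_
    have hpos : 0 < w p ^ 9 := pow_pos (hw0 p hp) 9
    have e4 : 0 ≤ C₁ * V / w p ^ 9 := div_nonneg (mul_nonneg (by linarith) hV0) hpos.le
    have e5 : 9 * (C₁ + C₂) * V * (1 / w p ^ 9) =
      9 * C₂ * V / w p ^ 9 + 9 * (C₁ * V / w p ^ 9) := by ring
    rw [e5]
    linarith
  obtain ⟨S, hS⟩ : ∃ S, S = ∑ p ∈ s, 1 / (p : ℝ) := ⟨_, rfl⟩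
  obtain ⟨e, he⟩ : ∃ e, e = Real.exp (-(L ^ κ) / 8) := ⟨_, rfl⟩
  have he0 : 0 < e := by rw [he]; exact Real.exp_pos _
  have hS0 : 0 ≤ S := by rw [hS]; positivity
  have hSL : S ≤ 23 * L := by
    have h := sum_inv_sievePrimes_le κ hκ hκ' P (by rw [← hL]; exact hL1)
    rw [← hs, ← hS, ← hL] at h
    linarith [Real.log_le_sub_one_of_pos (by linarith : 0 < 2 * L)]
  have hW : ∑ p ∈ s, 1 / w p ^ 9 ≤ S * e := by
    rw [hS, sum_mul]
    refine sum_le_sum fun p hp => ?_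
    have h1 := (hmem p hp).2.2.2.2.2
    have h2 : 1 / w p ^ 9 = 1 / (p : ℝ) * (1 / w p) := by
      rw [← hwp p]
      have := hw0 p hp
      field_simp
    rw [h2, he]
    exact mul_le_mul_of_nonneg_left h1 (by positivity)
  have f1 := sum_le_sum b1
  have f2 := sum_le_sum b2
  rw [← mul_sum] at f1 f2
  have g1 := f1.trans (mul_le_mul_of_nonneg_left hW (by positivity))
  have g2 := f2.trans (mul_le_mul_of_nonneg_left hW (by positivity))
  rw [← hS] at hmain
  have g3 := hmain.trans (add_le_add (mul_le_mul_of_nonneg_left g1 (by norm_num))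
    (mul_le_mul_of_nonneg_left g2 (pow_nonneg hS0 3)))
  refine g3.trans ?_
  have hT1 : 1 ≤ 23 * L := by linarith
  have hS3 : S ^ 3 ≤ (23 * L) ^ 3 := pow_le_pow_left₀ hS0 hSL 3
  have hk0 : 0 ≤ (C₁ + C₂) * V * e := by positivity
  have h8 : S * (8 + 9 * S ^ 3) ≤ 23 * L * (17 * (23 * L) ^ 3) := by
    refine mul_le_mul hSL ?_ (by positivity) (by linarith)
    have : 1 ≤ (23 * L) ^ 3 := one_le_pow₀ hT1
    linarith
  have h9 := mul_le_mul_of_nonneg_left h8 hk0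
  rw [← he]
  have hL4 : 0 ≤ L ^ 4 * ((C₁ + C₂) * V * e) := by positivity
  calc _ = (C₁ + C₂) * V * e * (S * (8 + 9 * S ^ 3)) := by ring
    _ ≤ _ := h9
    _ = 17 * 23 ^ 4 * (L ^ 4 * ((C₁ + C₂) * V * e)) := by ring
    _ ≤ 33 * 23 ^ 4 * (L ^ 4 * ((C₁ + C₂) * V * e)) :=
      mul_le_mul_of_nonneg_right (by norm_num) hL4
    _ = _ := by rw [hV, ← hL]; ring

lemma sifted_union_divisibles (κ : ℝ) (P : ℕ) :
    sifted κ P ∪ divisibles κ P = Icc 1 P ∧ Disjoint (sifted κ P) (divisibles κ P) := by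
  have h : divisibles κ P = (Icc 1 P).filter fun n => ¬∀ p ∈ sievePrimes κ P, ¬p ∣ n := by
    unfold divisibles
    refine filter_congr fun n _ => ?_
    push Not
    rfl
  rw [h]
  unfold sifted
  exact ⟨filter_union_filter_not_eq _ _, disjoint_filter_filter_not _ _ _⟩

/-- The number of solutions of `x³ + a³ + b³ = y³ + c³ + d³` up to `P`. -/
lemma exists_pairCount_Icc_le (κ : ℝ) (hκ : 0 < κ) (hκ' : κ ≤ 1 / 2) :
    ∃ C : ℝ, 1 ≤ C ∧ ∃ P₀ : ℕ, ∀ P ≥ P₀, (pairCount (Icc 1 P) (Icc 1 P) : ℝ) ≤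
      C * ((P : ℝ) ^ 3 * √P) * Real.log P ^ (-(5 / 2) + 34 * κ) := by
  obtain ⟨C₁, hC₁, P₁, h₁⟩ := exists_diffCount_sifted_le κ hκ hκ'
  obtain ⟨C₂, hC₂, P₂, h₂⟩ := exists_pairCount_divisibles_le κ hκ hκ'
  obtain ⟨L₀, hL₀, hlog⟩ := eventually_log_le_rpow κ (1 / 8) 10 hκ (by norm_num)
  have hlim : Filter.Tendsto (fun P : ℕ => Real.log P) Filter.atTop Filter.atTop :=
    Real.tendsto_log_atTop.comp tendsto_natCast_atTop_atTop
  obtain ⟨P₃, hP₃⟩ := Filter.eventually_atTop.mp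
    (hlim.eventually (Filter.eventually_ge_atTop L₀))
  refine ⟨32 * (C₁ + 8 * C₂), by linarith, max (max P₁ P₂) P₃, fun P hP => ?_⟩
  have hE := h₁ P (((le_max_left _ _).trans (le_max_left _ _)).trans hP)
  have hD := h₂ P (((le_max_right _ _).trans (le_max_left _ _)).trans hP)
  have hL := hP₃ P ((le_max_right _ _).trans hP)
  obtain ⟨L, hLdef⟩ : ∃ L, L = Real.log P := ⟨_, rfl⟩
  rw [← hLdef] at hE hD hL ⊢
  have hL1 : 1 ≤ L := hL₀.trans hL
  rw [rpow_seven_halves (Nat.cast_nonneg _)] at hE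
  have hW : 0 ≤ (P : ℝ) ^ 3 * √P := by positivity
  have hu := pairCount_union_le (sifted_union_divisibles κ P).2 (filter_subset _ _ : sifted κ P ⊆ _)
    (filter_subset _ _ : divisibles κ P ⊆ _)
  rw [(sifted_union_divisibles κ P).1] at hu
  have hE2 := ((Nat.cast_le (α := ℝ)).mpr (pairCount_le_diffCount _ _)).trans hE
  have hkey : (1 + L) ^ 3 * L ^ 4 * Real.exp (-(L ^ κ) / 8) ≤ 8 * L ^ (-(5 / 2) + 34 * κ) := by
    have e1 : (1 + L) ^ 3 ≤ (2 * L) ^ 3 := pow_le_pow_left₀ (by linarith) (by linarith) 3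
    have e2 : Real.exp (-(L ^ κ) / 8) ≤ L ^ (-10 : ℝ) := by
      rw [Real.rpow_def_of_pos (by linarith : 0 < L) (-10)]
      refine Real.exp_le_exp.mpr ?_
      have := hlog L hL
      linarith
    have e3 : (1 + L) ^ 3 * L ^ 4 ≤ 8 * L ^ (7 : ℝ) := by
      rw [show (7 : ℝ) = ((7 : ℕ) : ℝ) by norm_num, Real.rpow_natCast]
      calc (1 + L) ^ 3 * L ^ 4 ≤ (2 * L) ^ 3 * L ^ 4 :=
            mul_le_mul_of_nonneg_right e1 (by positivity)
        _ = _ := by ring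
    calc _ ≤ 8 * L ^ (7 : ℝ) * L ^ (-10 : ℝ) :=
          mul_le_mul e3 e2 (Real.exp_pos _).le (by positivity)
      _ = 8 * L ^ (-3 : ℝ) := by
          rw [mul_assoc, ← Real.rpow_add (by linarith)]; norm_num
      _ ≤ _ := mul_le_mul_of_nonneg_left
          (Real.rpow_le_rpow_of_exponent_le hL1 (by linarith)) (by norm_num)
  have hD2 := hD.trans (mul_le_mul_of_nonneg_left (mul_le_mul_of_nonneg_left hkey hW)
    (by linarith))
  calc _ ≤ _ := hu
    _ ≤ _ := mul_le_mul_of_nonneg_left (add_le_add hE2 hD2) (by norm_num)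
    _ = _ := by ring

/-- Triples of positive integers up to `R`. -/
def box (R : ℕ) : Finset (ℕ × ℕ × ℕ) := Icc 1 R ×ˢ (Icc 1 R ×ˢ Icc 1 R)

lemma rthree_eq_card (R n : ℕ) (h : n < (R + 1) ^ 3) :
    rthree n = ((box R).filter fun t => cubes t = n).card := by
  unfold rthree
  refine Nat.subtype_card _ fun t => ?_
  rw [mem_filter]
  unfold box cubes
  simp only [mem_product, Finset.mem_Icc]
  constructor
  · rintro ⟨⟨⟨h1, -⟩, ⟨h2, -⟩, h3, -⟩, h4⟩
    exact ⟨h1, h2, h3, by omega⟩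
  · rintro ⟨h1, h2, h3, h4⟩
    have key : ∀ a, a ^ 3 ≤ n → a ≤ R := fun a ha => by
      by_contra hcon
      have := Nat.pow_le_pow_left (Nat.succ_le_of_lt (Nat.lt_of_not_le hcon)) 3
      rw [Nat.succ_eq_add_one] at this
      omega
    exact ⟨⟨⟨h1, key _ (by omega)⟩, ⟨h2, key _ (by omega)⟩, h3, key _ (by omega)⟩, by omega⟩

lemma sum_rthree_sq_le (R N : ℕ) (h : N < (R + 1) ^ 3) :
    ∑ n ∈ Icc 1 N, rthree n ^ 2 ≤ pairCount (Icc 1 R) (Icc 1 R) := by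
  have h1 : pairCount (Icc 1 R) (Icc 1 R) =
      ∑ n ∈ (box R).image cubes, ((box R).filter fun t => cubes t = n).card ^ 2 := by
    simp_rw [sq]
    unfold pairCount coincidences
    convert card_eq_pairs (box R) (box R) cubes cubes <;> rfl
  rw [h1, sum_congr rfl fun n hn => by
    rw [rthree_eq_card R n ((Finset.mem_Icc.mp hn).2.trans_lt h)]]
  refine sum_le_sum_of_ne_zero fun n _ h0 => ?_
  have h2 : ((box R).filter fun t => cubes t = n).card ≠ 0 := fun e => h0 (by rw [e]; rfl)
  obtain ⟨t, ht⟩ := card_ne_zero.mp h2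
  exact mem_image.mpr ⟨t, mem_filter.mp ht⟩

lemma pow_three_le_sum_rthree_sq (M N : ℕ) (h : 3 * M ^ 3 ≤ N) :
    M ^ 3 ≤ ∑ n ∈ Icc 1 N, rthree n ^ 2 := by
  have h1 : (box M).card = M ^ 3 := by
    simp only [box, card_product, Nat.card_Icc, Nat.add_sub_cancel]
    ring
  have h2 : ∀ t ∈ box M, cubes t ∈ Icc 1 N := by
    intro t ht
    simp only [box, mem_product, Finset.mem_Icc] at ht
    have e1 := Nat.pow_le_pow_left ht.1.2 3
    have e2 := Nat.pow_le_pow_left ht.2.1.2 3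
    have e3 := Nat.pow_le_pow_left ht.2.2.2 3
    have e4 := Nat.pow_le_pow_left ht.1.1 3
    simp only [cubes, Finset.mem_Icc]
    omega
  rw [← h1, card_eq_sum_card_fiberwise h2]
  refine sum_le_sum fun n hn => ?_
  obtain ⟨R, hMR, hR⟩ : ∃ R, M ≤ R ∧ n < (R + 1) ^ 3 := by
    refine ⟨max M n, le_max_left _ _, ?_⟩
    calc n < max M n + 1 := Nat.lt_succ_of_le (le_max_right _ _)
      _ ≤ _ := Nat.le_self_pow (by norm_num) _
  rw [rthree_eq_card R n hR]
  have hs : Icc 1 M ⊆ Icc 1 R := Icc_subset_Icc_right hMR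
  refine le_trans (card_le_card (filter_subset_filter _ (product_subset_product hs
    (product_subset_product hs hs)))) ?_
  exact Nat.le_self_pow (by norm_num) _

lemma log_floor_rpow_le {x y η : ℝ} {R : ℕ} (hx : 64 ≤ x) (hy : 0 ≤ y) (hyx : y ^ 3 = x)
    (hR : y / 2 ≤ R) (hη : -3 ≤ η) (hη' : η ≤ 0) :
    Real.log R ^ η ≤ 216 * Real.log x ^ η := by
  have hy4 : 4 ≤ y := by
    by_contra hcon
    have := pow_lt_pow_left₀ (not_le.mp hcon) hy (by norm_num : 3 ≠ 0)
    linarith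
  have hlx : 1 ≤ Real.log x := by
    rw [Real.le_log_iff_exp_le (by linarith)]
    linarith [Real.exp_one_lt_d9]
  have hlog : Real.log x / 6 ≤ Real.log R := by
    have h1 : Real.log x = 3 * Real.log y := by rw [← hyx, Real.log_pow]; norm_num
    have h2 : √y ≤ R := by
      refine le_trans ?_ hR
      rw [Real.sqrt_le_iff]
      exact ⟨by linarith, by nlinarith⟩
    have h3 := Real.log_le_log (Real.sqrt_pos.mpr (by linarith)) h2
    rw [Real.log_sqrt hy] at h3
    linarith
  have h4 := Real.rpow_le_rpow_of_nonpos (by linarith) hlog hη'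
  refine h4.trans ?_
  rw [Real.div_rpow (by linarith) (by norm_num), div_eq_mul_inv, ← Real.rpow_neg (by norm_num),
    mul_comm]
  refine mul_le_mul_of_nonneg_right ?_ (Real.rpow_nonneg (by linarith) _)
  calc (6 : ℝ) ^ (-η) ≤ 6 ^ (3 : ℝ) := Real.rpow_le_rpow_of_exponent_le (by norm_num) (by linarith)
    _ = 216 := by norm_num

end ThreeCubes

/-- Vaughan (2021): `x ≪ Σ_{n ≤ x} r₃(n)² ≪ x^{7/6}(log x)^{ε−5/2}`. -/
theorem rthree_mean_square (ε : ℝ) (hε : 0 < ε) :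
    ∃ c₁ C₂ x₀ : ℝ, 0 < c₁ ∧ 0 < C₂ ∧ ∀ x : ℝ, x₀ ≤ x →
      c₁ * x ≤ (∑ n ∈ Finset.Icc 1 ⌊x⌋₊, (rthree n : ℝ) ^ 2) ∧
      (∑ n ∈ Finset.Icc 1 ⌊x⌋₊, (rthree n : ℝ) ^ 2) ≤
        C₂ * x ^ ((7 : ℝ) / 6) * Real.log x ^ (ε - 5 / 2) := by
  obtain ⟨κ, hκ, hκ1, hκ2⟩ : ∃ κ : ℝ, 0 < κ ∧ κ ≤ 1 / 34 ∧ 34 * κ ≤ ε :=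
    ⟨min (1 / 34) (ε / 34), lt_min (by norm_num) (by linarith), min_le_left _ _, by
      linarith [min_le_right (1 / 34) (ε / 34)]⟩
  obtain ⟨C, hC, P₀, hP⟩ := ThreeCubes.exists_pairCount_Icc_le κ hκ (by linarith)
  refine ⟨1 / 64, C * 216, max 64 ((P₀ + 1 : ℝ) ^ 3), by norm_num, by linarith, fun x hx => ?_⟩
  have hx64 : 64 ≤ x := (le_max_left _ _).trans hx
  obtain ⟨y, hy⟩ : ∃ y, y = x ^ (1 / 3 : ℝ) := ⟨_, rfl⟩
  have hy0 : 0 ≤ y := by rw [hy]; positivity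
  have hyx : y ^ 3 = x := by
    rw [hy, ← Real.rpow_natCast, ← Real.rpow_mul (by linarith)]
    norm_num
  have hyP : (P₀ + 1 : ℝ) ≤ y := by
    refine le_of_pow_le_pow_left₀ (by norm_num : 3 ≠ 0) hy0 ?_
    rw [hyx]
    exact (le_max_right _ _).trans hx
  have hy4 : 4 ≤ y := by
    refine le_of_pow_le_pow_left₀ (by norm_num : 3 ≠ 0) hy0 ?_
    rw [hyx]
    linarith
  obtain ⟨R, hR⟩ : ∃ R, R = ⌊y⌋₊ := ⟨_, rfl⟩
  have hRy : (R : ℝ) ≤ y := by rw [hR]; exact Nat.floor_le hy0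
  have hyR : y < R + 1 := by rw [hR]; exact Nat.lt_floor_add_one y
  have hRP : P₀ ≤ R := by rw [hR]; exact Nat.le_floor (by linarith)
  constructor
  · have h1 : 3 * (R / 2) ^ 3 ≤ ⌊x⌋₊ := by
      refine Nat.le_floor ?_
      push_cast
      have h2 : ((R / 2 : ℕ) : ℝ) ≤ y / 2 := Nat.cast_div_le.trans (by push_cast; linarith)
      have h3 := pow_le_pow_left₀ (Nat.cast_nonneg _) h2 3
      have h4 : (y / 2) ^ 3 = x / 8 := by rw [div_pow, hyx]; norm_num
      linarith
    have h2 := (Nat.cast_le (α := ℝ)).mpr (ThreeCubes.pow_three_le_sum_rthree_sq _ _ h1)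
    push_cast at h2
    refine le_trans ?_ h2
    have h3 : y / 4 ≤ ((R / 2 : ℕ) : ℝ) := by
      have h5 : R ≤ 2 * (R / 2) + 1 := by omega
      have h6 := (Nat.cast_le (α := ℝ)).mpr h5
      push_cast at h6
      have h7 : ((R / 2 : ℕ) : ℝ) * 2 + 2 > y := by linarith
      linarith
    have h4 := pow_le_pow_left₀ (by linarith) h3 3
    have h5 : (y / 4) ^ 3 = 1 / 64 * x := by rw [div_pow, hyx]; ring
    rwa [h5] at h4
  · have h1 : ⌊x⌋₊ < (R + 1) ^ 3 := by
      rw [Nat.floor_lt (by linarith)]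
      push_cast
      rw [← hyx]
      exact pow_lt_pow_left₀ hyR hy0 (by norm_num)
    have h2 := (Nat.cast_le (α := ℝ)).mpr (ThreeCubes.sum_rthree_sq_le R _ h1)
    push_cast at h2
    refine (h2.trans (hP R hRP)).trans ?_
    have h3 : (R : ℝ) ^ 3 * √R ≤ x ^ ((7 : ℝ) / 6) := by
      rw [← ThreeCubes.rpow_seven_halves (Nat.cast_nonneg _)]
      refine (Real.rpow_le_rpow (Nat.cast_nonneg _) hRy (by norm_num)).trans (le_of_eq ?_)
      rw [hy, ← Real.rpow_mul (by linarith)]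
      norm_num
    have hlx : 1 ≤ Real.log x := by
      rw [Real.le_log_iff_exp_le (by linarith)]
      linarith [Real.exp_one_lt_d9]
    have h4 : Real.log R ^ (-(5 / 2) + 34 * κ) ≤ 216 * Real.log x ^ (ε - 5 / 2) := by
      refine (ThreeCubes.log_floor_rpow_le hx64 hy0 hyx ?_ (by linarith) (by linarith)).trans ?_
      · rw [hR]
        exact ThreeCubes.half_le_floor (by linarith)
      · exact mul_le_mul_of_nonneg_left (Real.rpow_le_rpow_of_exponent_le hlx (by linarith))
          (by norm_num)
    have h5 : 0 ≤ x ^ ((7 : ℝ) / 6) := by positivity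
    have hR0 : 0 ≤ Real.log (R : ℝ) := Real.log_natCast_nonneg R
    calc _ ≤ C * x ^ ((7 : ℝ) / 6) * (216 * Real.log x ^ (ε - 5 / 2)) :=
          mul_le_mul (mul_le_mul_of_nonneg_left h3 (by linarith)) h4 (Real.rpow_nonneg hR0 _)
            (mul_nonneg (by linarith) h5)
      _ = _ := by ring
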